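/- Assume Hypotheses (H) with condition (i) replaced by the weaker condition: the coefficients q_{ij}, b_j, c and their spatial derivatives up to order 3 belong to C^{0,δ}([0,T]×B(0,R)) for some δ∈(0,1) and every R>0 (i.e. they are continuous on [0,T]×B(0,R), δ-Hölder continuous in x on B(0,R) for each fixed t, with Hölder norms bounded uniformly in t; no Hölder regularity in t is assumed). Fix θ ∈ (0,1), f ∈ C^{2+θ}_b(ℝ^N) and g ∈ C^{0,θ}([0,T]×ℝ^N). Then the Cauchy problem D_t u = 𝒜u + g on [0,T]×ℝ^N, u(0,·)=f, admits a unique bounded classical solution u; moreover u(t,·) ∈ C^{2+θ}_b(ℝ^N) for every t and there exists C > 0, independent of f and g, with sup_{t∈[0,T]} ‖u(t,·)‖_{C^{2+θ}_b(ℝ^N)} ≤ C ( ‖f‖_{C^{2+θ}_b(ℝ^N)} + sup_{t∈[0,T]} ‖g(t,·)‖_{C^θ_b(ℝ^N)} ). -/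

import Mathlib

open Set Filter MeasureTheory Metric
open scoped Topology ENNReal RealInnerProductSpace Classical

noncomputable section

/-- `ℝ^N` with the Euclidean norm. -/
abbrev ES (N : ℕ) := EuclideanSpace ℝ (Fin N)

/-- First-order partial derivative `D_i f` in the `i`-th coordinate direction. -/
def pd1 {N : ℕ} (f : ES N → ℝ) (i : Fin N) : ES N → ℝ :=
  fun x => fderiv ℝ f x (EuclideanSpace.single i 1)

/-- Second-order partial derivative `D_{ij} f`. -/
def pd2 {N : ℕ} (f : ES N → ℝ) (i j : Fin N) : ES N → ℝ := pd1 (pd1 f j) i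

/-- Third-order partial derivative `D_{ijk} f`. -/
def pd3 {N : ℕ} (f : ES N → ℝ) (i j k : Fin N) : ES N → ℝ := pd1 (pd2 f j k) i

/-- The nonautonomous elliptic operator
`(𝒜 φ)(t,x) = ∑ᵢⱼ qᵢⱼ(t,x) Dᵢⱼφ(x) + ∑ⱼ bⱼ(t,x) Dⱼφ(x) + c(t,x) φ(x)`. -/
def Aop {N : ℕ} (q : ℝ → ES N → Fin N → Fin N → ℝ) (b : ℝ → ES N → Fin N → ℝ)
    (c : ℝ → ES N → ℝ) (φ : ES N → ℝ) (t : ℝ) (x : ES N) : ℝ :=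
  (∑ i, ∑ j, q t x i j * pd2 φ i j x) + (∑ j, b t x j * pd1 φ j x) + c t x * φ x

/-- Membership in `C^{0,δ}([0,T] × B(0,R))`: `h` is (jointly) continuous on
`[0,T] × B(0,R)` and `δ`-Hölder continuous in `x` on `B(0,R)`, uniformly with respect to
`t ∈ [0,T]`; no Hölder regularity in `t` is required. -/
def SpaceHolderUnif {N : ℕ} (T δ R : ℝ) (h : ℝ → ES N → ℝ) : Prop :=
  ContinuousOn (fun p : ℝ × ES N => h p.1 p.2) (Icc (0:ℝ) T ×ˢ closedBall (0 : ES N) R) ∧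
  ∃ K : ℝ, ∀ t ∈ Icc (0:ℝ) T, ∀ x ∈ closedBall (0 : ES N) R,
    |h t x| ≤ K ∧ ∀ y ∈ closedBall (0 : ES N) R, |h t x - h t y| ≤ K * ‖x - y‖ ^ δ

/-- Hypotheses (H) with condition (i) weakened: the coefficients and their spatial
derivatives up to order 3 belong to `C^{0,δ}([0,T] × B(0,R))` for some `δ ∈ (0,1)` and every
`R > 0` (Theorem `thm-schauder-cont-2` of the paper). -/
structure Hyp2 (N : ℕ) (T : ℝ) (q : ℝ → ES N → Fin N → Fin N → ℝ)
    (b : ℝ → ES N → Fin N → ℝ) (c : ℝ → ES N → ℝ) where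
  T_pos : 0 < T
  N_pos : 1 ≤ N
  /- (i) smoothness in space and parabolic Hölder regularity up to third-order
     spatial derivatives on `[0,T] × B(0,R)` for every `R`. -/
  δ : ℝ
  δ_mem : δ ∈ Ioo (0:ℝ) 1
  smooth_q : ∀ t ∈ Icc (0:ℝ) T, ∀ i j, ContDiff ℝ 3 fun x => q t x i j
  smooth_b : ∀ t ∈ Icc (0:ℝ) T, ∀ j, ContDiff ℝ 3 fun x => b t x j
  smooth_c : ∀ t ∈ Icc (0:ℝ) T, ContDiff ℝ 3 fun x => c t x
  holder_q : ∀ R > 0, ∀ i j, SpaceHolderUnif T δ R fun t x => q t x i j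
  holder_q1 : ∀ R > 0, ∀ i j k, SpaceHolderUnif T δ R fun t x => pd1 (fun y => q t y i j) k x
  holder_q2 : ∀ R > 0, ∀ i j k l, SpaceHolderUnif T δ R fun t x => pd2 (fun y => q t y i j) k l x
  holder_q3 : ∀ R > 0, ∀ i j k l m, SpaceHolderUnif T δ R fun t x => pd3 (fun y => q t y i j) k l m x
  holder_b : ∀ R > 0, ∀ j, SpaceHolderUnif T δ R fun t x => b t x j
  holder_b1 : ∀ R > 0, ∀ j k, SpaceHolderUnif T δ R fun t x => pd1 (fun y => b t y j) k x
  holder_b2 : ∀ R > 0, ∀ j k l, SpaceHolderUnif T δ R fun t x => pd2 (fun y => b t y j) k l x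
  holder_b3 : ∀ R > 0, ∀ j k l m, SpaceHolderUnif T δ R fun t x => pd3 (fun y => b t y j) k l m x
  holder_c : ∀ R > 0, SpaceHolderUnif T δ R c
  holder_c1 : ∀ R > 0, ∀ k, SpaceHolderUnif T δ R fun t x => pd1 (c t) k x
  holder_c2 : ∀ R > 0, ∀ k l, SpaceHolderUnif T δ R fun t x => pd2 (c t) k l x
  holder_c3 : ∀ R > 0, ∀ k l m, SpaceHolderUnif T δ R fun t x => pd3 (c t) k l m x
  /- (ii) symmetry and (uniform) ellipticity. -/
  q_symm : ∀ t ∈ Icc (0:ℝ) T, ∀ x i j, q t x i j = q t x j i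
  ν : ℝ → ES N → ℝ
  ν₀ : ℝ
  ν₀_pos : 0 < ν₀
  ν_lb : ∀ t ∈ Icc (0:ℝ) T, ∀ x, ν₀ ≤ ν t x
  ellip : ∀ t ∈ Icc (0:ℝ) T, ∀ x, ∀ ξ : ES N, ν t x * ‖ξ‖ ^ 2 ≤ ∑ i, ∑ j, q t x i j * ξ i * ξ j
  /- (iii) growth conditions. -/
  C₁ : ℝ
  C₂ : ℝ
  C₃ : ℝ
  C₁_pos : 0 < C₁
  C₂_pos : 0 < C₂
  C₃_pos : 0 < C₃
  growth_Q : ∀ t ∈ Icc (0:ℝ) T, ∀ x,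
    ‖(EuclideanSpace.equiv (Fin N) ℝ).symm fun i => ∑ j, q t x i j * x j‖
      ≤ C₁ * (1 + ‖x‖ ^ 2) * ν t x
  growth_tr : ∀ t ∈ Icc (0:ℝ) T, ∀ x, (∑ i, q t x i i) ≤ C₂ * (1 + ‖x‖ ^ 2) * ν t x
  growth_b : ∀ t ∈ Icc (0:ℝ) T, ∀ x, (∑ j, b t x j * x j) ≤ C₃ * (1 + ‖x‖ ^ 2) * ν t x
  /- (iv) `c` is bounded from above. -/
  c₀ : ℝ
  c_ub : ∀ t ∈ Icc (0:ℝ) T, ∀ x, c t x ≤ c₀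
  /- (v) bounds on the derivatives of the diffusion coefficients. -/
  K₁ : ℝ
  K₂ : ℝ
  K₃ : ℝ
  K₁_pos : 0 < K₁
  K₂_pos : 0 < K₂
  K₃_pos : 0 < K₃
  dq1_bound : ∀ t ∈ Icc (0:ℝ) T, ∀ x i j k, |pd1 (fun y => q t y i j) k x| ≤ K₁ * ν t x
  dq3_bound : ∀ t ∈ Icc (0:ℝ) T, ∀ x i j k l m, |pd3 (fun y => q t y i j) k l m x| ≤ K₃ * ν t x
  dq2_quad : ∀ t ∈ Icc (0:ℝ) T, ∀ x, ∀ Ξ : Fin N → Fin N → ℝ, (∀ h k, Ξ h k = Ξ k h) →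
    (∑ h, ∑ k, ∑ l, ∑ m, pd2 (fun y => q t y h k) l m x * Ξ h k * Ξ l m)
      ≤ K₂ * ν t x * ∑ h, ∑ k, Ξ h k ^ 2
  /- (vi) dissipativity and bounds on the derivatives of the drift and of `c`. -/
  d : ℝ → ES N → ℝ
  r : ℝ → ES N → ℝ
  ϱ : ℝ → ES N → ℝ
  ϱ₀ : ℝ
  ϱ₀_pos : 0 < ϱ₀
  ϱ_lb : ∀ t ∈ Icc (0:ℝ) T, ∀ x, ϱ₀ ≤ ϱ t x
  L₁ : ℝ
  L₂ : ℝ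
  L₃ : ℝ
  L₁_pos : 0 < L₁
  L₂_pos : 0 < L₂
  L₃_pos : 0 < L₃
  dissip : ∀ t ∈ Icc (0:ℝ) T, ∀ x, ∀ ξ : ES N,
    (∑ i, ∑ j, pd1 (fun y => b t y i) j x * ξ j * ξ i) ≤ d t x * ‖ξ‖ ^ 2
  db2_bound : ∀ t ∈ Icc (0:ℝ) T, ∀ x j k l, |pd2 (fun y => b t y j) k l x| ≤ r t x
  db3_bound : ∀ t ∈ Icc (0:ℝ) T, ∀ x j k l m, |pd3 (fun y => b t y j) k l m x| ≤ r t x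
  dc1_bound : ∀ t ∈ Icc (0:ℝ) T, ∀ x k, |pd1 (c t) k x| ≤ ϱ t x
  dc2_bound : ∀ t ∈ Icc (0:ℝ) T, ∀ x k l, |pd2 (c t) k l x| ≤ ϱ t x
  dc3_bound : ∀ t ∈ Icc (0:ℝ) T, ∀ x k l m, |pd3 (c t) k l m x| ≤ ϱ t x
  funz : ∀ t ∈ Icc (0:ℝ) T, ∀ x, d t x + L₁ * r t x + L₂ * ϱ t x ^ 2 ≤ L₃ * ν t x
  /- (vii) existence of a Lyapunov function. -/
  liap : ∃ φ : ES N → ℝ, ∃ lam : ℝ, 0 < lam ∧ (∀ x, 0 < φ x) ∧ ContDiff ℝ 2 φ ∧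
    Tendsto φ (cocompact (ES N)) atTop ∧
    ∃ M : ℝ, ∀ t ∈ Icc (0:ℝ) T, ∀ x, Aop q b c φ t x - lam * φ x ≤ M

/-- `u` is a bounded classical solution on `[s,τ] × ℝ^N` of the homogeneous Cauchy problem
`D_t u = 𝒜 u`, `u(s,·) = f`: it is bounded and continuous on `[s,τ] × ℝ^N`, continuously
differentiable once in time and twice in space on `(s,τ] × ℝ^N`, satisfies the equation there
and attains the initial datum `f` at time `s`. -/
def IsBCSol {N : ℕ} (q : ℝ → ES N → Fin N → Fin N → ℝ) (b : ℝ → ES N → Fin N → ℝ)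
    (c : ℝ → ES N → ℝ) (s τ : ℝ) (f : ES N → ℝ) (u : ℝ → ES N → ℝ) : Prop :=
  (∃ M, ∀ t ∈ Icc s τ, ∀ x, |u t x| ≤ M) ∧
  ContinuousOn (fun p : ℝ × ES N => u p.1 p.2) (Icc s τ ×ˢ univ) ∧
  (∀ t ∈ Ioc s τ, ContDiff ℝ 2 (u t)) ∧
  (∀ x, ∀ t ∈ Ioc s τ, DifferentiableAt ℝ (fun t' => u t' x) t) ∧
  ContinuousOn (fun p : ℝ × ES N => deriv (fun t' => u t' p.2) p.1) (Ioc s τ ×ˢ univ) ∧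
  (∀ i, ContinuousOn (fun p : ℝ × ES N => pd1 (u p.1) i p.2) (Ioc s τ ×ˢ univ)) ∧
  (∀ i j, ContinuousOn (fun p : ℝ × ES N => pd2 (u p.1) i j p.2) (Ioc s τ ×ˢ univ)) ∧
  (∀ t ∈ Ioc s τ, ∀ x, deriv (fun t' => u t' x) t = Aop q b c (u t) t x) ∧
  (∀ x, u s x = f x)

/-- `u` is a bounded classical solution on `[0,T] × ℝ^N` of the nonhomogeneous Cauchy problem
`D_t u = 𝒜 u + g`, `u(0,·) = f`, continuously differentiable once in time and twice in space
on all of `[0,T] × ℝ^N`. -/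
def IsBCSolInhom {N : ℕ} (q : ℝ → ES N → Fin N → Fin N → ℝ) (b : ℝ → ES N → Fin N → ℝ)
    (c : ℝ → ES N → ℝ) (T : ℝ) (f : ES N → ℝ) (g : ℝ → ES N → ℝ) (u : ℝ → ES N → ℝ) : Prop :=
  (∃ M, ∀ t ∈ Icc (0:ℝ) T, ∀ x, |u t x| ≤ M) ∧
  (∀ t ∈ Icc (0:ℝ) T, ContDiff ℝ 2 (u t)) ∧
  (∀ x, ∀ t ∈ Icc (0:ℝ) T, DifferentiableWithinAt ℝ (fun t' => u t' x) (Icc (0:ℝ) T) t) ∧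
  ContinuousOn (fun p : ℝ × ES N => derivWithin (fun t' => u t' p.2) (Icc (0:ℝ) T) p.1)
    (Icc (0:ℝ) T ×ˢ univ) ∧
  (∀ i, ContinuousOn (fun p : ℝ × ES N => pd1 (u p.1) i p.2) (Icc (0:ℝ) T ×ˢ univ)) ∧
  (∀ i j, ContinuousOn (fun p : ℝ × ES N => pd2 (u p.1) i j p.2) (Icc (0:ℝ) T ×ˢ univ)) ∧
  (∀ t ∈ Icc (0:ℝ) T, ∀ x,
    derivWithin (fun t' => u t' x) (Icc (0:ℝ) T) t = Aop q b c (u t) t x + g t x) ∧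
  (∀ x, u 0 x = f x)

/-- Extended-real sup norm of the `k`-th derivative. -/
def supNormE {N : ℕ} (k : ℕ) (f : ES N → ℝ) : ℝ≥0∞ :=
  ⨆ x : ES N, ENNReal.ofReal ‖iteratedFDeriv ℝ k f x‖

/-- Extended-real `γ`-Hölder seminorm of the `k`-th derivative. -/
def holderSemiE {N : ℕ} (k : ℕ) (γ : ℝ) (f : ES N → ℝ) : ℝ≥0∞ :=
  ⨆ (x : ES N) (y : ES N) (_ : x ≠ y),
    ENNReal.ofReal (‖iteratedFDeriv ℝ k f x - iteratedFDeriv ℝ k f y‖ / ‖x - y‖ ^ γ)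

/-- The `C^α_b(ℝ^N)` norm (valued in `[0,∞]`): sup norms of the derivatives up to order `⌊α⌋`
plus, when `α ∉ ℕ`, the `(α-⌊α⌋)`-Hölder seminorm of the `⌊α⌋`-th order derivatives. -/
def CbNorm {N : ℕ} (α : ℝ) (f : ES N → ℝ) : ℝ≥0∞ :=
  (∑ k ∈ Finset.range (⌊α⌋₊ + 1), supNormE k f) +
    (if (⌊α⌋₊ : ℝ) = α then 0 else holderSemiE ⌊α⌋₊ (α - ⌊α⌋₊) f)

/-- Membership in `C^α_b(ℝ^N)`. -/
def MemCb {N : ℕ} (α : ℝ) (f : ES N → ℝ) : Prop :=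
  ContDiff ℝ (⌊α⌋₊ : ℕ) f ∧ CbNorm α f ≠ ⊤

open scoped ContDiff
open Finset (sum_congr mul_sum sum_add_distrib sum_le_sum sum_nonneg sum_comm sum_sub_distrib
  single_le_sum abs_sum_le_sum_abs sum_mul sum_singleton sum_insert sum_div sum_const
  sum_range_succ sum_le_card_nsmul sum_const_zero sum_range_zero sum_mul_sum)
open Real (exp exp_pos exp_add norm_eq_abs rpow_le_rpow)

namespace Schauder

/-- Real functions on `ℝ^N`. -/
abbrev Fn (N : ℕ) := ES N → ℝ

/-- Vector fields on `ℝ^N`. -/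
abbrev VF (N : ℕ) := Fin N → Fn N

local notation "Smooth" => ContDiff ℝ ∞

variable {N : ℕ} {f : Fn N}

/-! ### Coordinate derivatives -/

lemma smooth_le (n : ℕ) : (n : WithTop ℕ∞) ≤ (∞ : WithTop ℕ∞) := by
  exact_mod_cast (le_top : (n : ℕ∞) ≤ ⊤)

lemma contDiff_pd1 {n m : WithTop ℕ∞} (hf : ContDiff ℝ n f) (h : m + 1 ≤ n)
    (i : Fin N) : ContDiff ℝ m (pd1 f i) :=
  (hf.fderiv_right h).clm_apply contDiff_const

lemma smooth_pd1 (hf : Smooth f) (i : Fin N) : Smooth (pd1 f i) :=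
  contDiff_pd1 hf (by simp) i

lemma smooth_diff (hf : Smooth f) : Differentiable ℝ f :=
  hf.differentiable (by simp)

lemma pd1_add {f g : Fn N} (hf : Differentiable ℝ f) (hg : Differentiable ℝ g) (i : Fin N) :
    pd1 (fun x => f x + g x) i = fun x => pd1 f i x + pd1 g i x := by
  ext x; simp only [pd1]; rw [fderiv_fun_add (hf x) (hg x)]; rfl

lemma pd1_sub {f g : Fn N} (hf : Differentiable ℝ f) (hg : Differentiable ℝ g) (i : Fin N) :
    pd1 (fun x => f x - g x) i = fun x => pd1 f i x - pd1 g i x := by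
  ext x; simp only [pd1]; rw [fderiv_fun_sub (hf x) (hg x)]; rfl

lemma pd1_mul {f g : Fn N} (hf : Differentiable ℝ f) (hg : Differentiable ℝ g) (i : Fin N) :
    pd1 (fun x => f x * g x) i = fun x => pd1 f i x * g x + f x * pd1 g i x := by
  ext x; simp only [pd1]; rw [fderiv_fun_mul (hf x) (hg x)]
  simp [mul_comm]; ring

lemma pd1_const (a : ℝ) (i : Fin N) : pd1 (fun _ : ES N => a) i = fun _ => 0 := by
  ext x; simp [pd1]

lemma pd1_const_mul (a : ℝ) (hf : Differentiable ℝ f) (i : Fin N) :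
    pd1 (fun x => a * f x) i = fun x => a * pd1 f i x := by
  rw [pd1_mul (differentiable_const a) hf, pd1_const]; simp

lemma pd1_sum {ι : Type*} (s : Finset ι) {f : ι → Fn N} (hf : ∀ k, Differentiable ℝ (f k))
    (i : Fin N) : pd1 (fun x => ∑ k ∈ s, f k x) i = fun x => ∑ k ∈ s, pd1 (f k) i x := by
  ext x; simp only [pd1]
  rw [fderiv_fun_sum (fun k _ => hf k x)]; simp

lemma pd1_comm (hf : ContDiff ℝ 2 f) (i j : Fin N) :
    pd1 (pd1 f i) j = pd1 (pd1 f j) i := by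
  ext x
  have hs := (hf.contDiffAt (x := x)).isSymmSndFDerivAt (by simp)
  have hd : DifferentiableAt ℝ (fderiv ℝ f) x :=
    ((hf.fderiv_right (m := 1) (by norm_num)).differentiable (by simp)) x
  change fderiv ℝ (fun y => fderiv ℝ f y _) x _ = fderiv ℝ (fun y => fderiv ℝ f y _) x _
  rw [fderiv_clm_apply hd (by fun_prop), fderiv_clm_apply hd (by fun_prop)]
  simpa using hs _ _

/-- A vector is the combination of the coordinate directions. -/
lemma sum_single (v : ES N) : ∑ j, v j • EuclideanSpace.single j (1 : ℝ) = v := by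
  ext i
  simp [Pi.single_apply]

lemma fderiv_apply_eq (f : Fn N) (x v : ES N) :
    fderiv ℝ f x v = ∑ j, pd1 f j x * v j := by
  conv_lhs => rw [← sum_single v]
  simp [pd1, mul_comm]

lemma pd1_comp {Φ : ES N → ES N} (hf : Differentiable ℝ f)
    (hΦ : ∀ j, Differentiable ℝ fun x => Φ x j) (i : Fin N) (x : ES N) :
    pd1 (fun x => f (Φ x)) i x = ∑ j, pd1 f j (Φ x) * pd1 (fun x => Φ x j) i x := by
  have hd : Differentiable ℝ Φ := differentiable_euclidean.2 hΦ
  have h1 : fderiv ℝ (fun x => f (Φ x)) x = (fderiv ℝ f (Φ x)).comp (fderiv ℝ Φ x) :=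
    fderiv_comp x (hf _) (hd x)
  simp only [pd1]
  rw [h1, ContinuousLinearMap.comp_apply, fderiv_apply_eq]
  refine sum_congr rfl fun j _ => ?_
  have h2 : HasFDerivAt (fun x => Φ x j)
      ((EuclideanSpace.proj j : ES N →L[ℝ] ℝ).comp (fderiv ℝ Φ x)) x :=
    (EuclideanSpace.proj j : ES N →L[ℝ] ℝ).hasFDerivAt.comp x (hd x).hasFDerivAt
  rw [h2.fderiv]; simp [pd1]

/-! ### Boundedness of derivatives -/

/-- All coordinate derivatives of order at most `m` are bounded by `K`. -/
def Bd : ℕ → Fn N → ℝ → Prop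
  | 0, f, K => ∀ x, |f x| ≤ K
  | m + 1, f, K => Bd m f K ∧ ∀ i, Bd m (pd1 f i) K

lemma Bd.zero {m : ℕ} {K : ℝ} (h : Bd m f K) : ∀ x, |f x| ≤ K := by
  induction m generalizing f with
  | zero => exact h
  | succ m ih => exact ih h.1

lemma Bd.nonneg {m : ℕ} {K : ℝ} (h : Bd m f K) : 0 ≤ K :=
  (abs_nonneg _).trans (h.zero 0)

lemma Bd.mono {m : ℕ} {K L : ℝ} (h : Bd m f K) (hKL : K ≤ L) : Bd m f L := by
  induction m generalizing f with
  | zero => exact fun x => (h x).trans hKL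
  | succ m ih => exact ⟨ih h.1, fun i => ih (h.2 i)⟩

lemma Bd.of_le {m k : ℕ} {K : ℝ} (h : Bd m f K) (hk : k ≤ m) : Bd k f K := by
  induction m generalizing f k with
  | zero => obtain rfl : k = 0 := by omega
            exact h
  | succ m ih =>
    cases k with
    | zero => exact h.zero
    | succ k => exact ⟨ih h.1 (by omega), fun i => ih (h.2 i) (by omega)⟩

lemma Bd.const (m : ℕ) {a K : ℝ} (h : |a| ≤ K) : Bd m (fun _ : ES N => a) K := by
  induction m generalizing a with
  | zero => exact fun _ => h
  | succ m ih =>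
    refine ⟨ih h, fun i => ?_⟩
    rw [pd1_const]; exact ih (by simpa using (abs_nonneg a).trans h)

lemma Bd.add {m : ℕ} {f g : Fn N} {K L : ℝ} (hf : Smooth f) (hg : Smooth g)
    (h : Bd m f K) (h' : Bd m g L) : Bd m (fun x => f x + g x) (K + L) := by
  induction m generalizing f g with
  | zero => exact fun x => (abs_add_le _ _).trans (add_le_add (h x) (h' x))
  | succ m ih =>
    refine ⟨ih hf hg h.1 h'.1, fun i => ?_⟩
    rw [pd1_add (smooth_diff hf) (smooth_diff hg)]
    exact ih (smooth_pd1 hf i) (smooth_pd1 hg i) (h.2 i) (h'.2 i)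

lemma Bd.mul {m : ℕ} {f g : Fn N} {K L : ℝ} (hf : Smooth f) (hg : Smooth g)
    (h : Bd m f K) (h' : Bd m g L) : Bd m (fun x => f x * g x) (2 ^ m * (K * L)) := by
  induction m generalizing f g with
  | zero =>
    intro x
    rw [abs_mul]; simpa using mul_le_mul (h x) (h' x) (abs_nonneg _) h.nonneg
  | succ m ih =>
    have hKL : 0 ≤ 2 ^ m * (K * L) := by have := h.nonneg; have := h'.nonneg; positivity
    refine ⟨(ih hf hg h.1 h'.1).mono (by rw [pow_succ]; linarith), fun i => ?_⟩
    rw [pd1_mul (smooth_diff hf) (smooth_diff hg)]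
    exact (Bd.add ((smooth_pd1 hf i).mul hg) (hf.mul (smooth_pd1 hg i))
      (ih (smooth_pd1 hf i) hg (h.2 i) h'.1) (ih hf (smooth_pd1 hg i) h.1 (h'.2 i))).mono
      (by rw [pow_succ]; linarith)

lemma Bd.const_mul {m : ℕ} {K : ℝ} (a : ℝ) (hf : Smooth f)
    (h : Bd m f K) : Bd m (fun x => a * f x) (|a| * K) := by
  induction m generalizing f with
  | zero => intro x; rw [abs_mul]; exact mul_le_mul_of_nonneg_left (h x) (abs_nonneg _)
  | succ m ih =>
    refine ⟨ih hf h.1, fun i => ?_⟩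
    rw [pd1_const_mul a (smooth_diff hf)]
    exact ih (smooth_pd1 hf i) (h.2 i)

lemma Bd.sub {m : ℕ} {f g : Fn N} {K L : ℝ} (hf : Smooth f) (hg : Smooth g)
    (h : Bd m f K) (h' : Bd m g L) : Bd m (fun x => f x - g x) (K + L) := by
  have := Bd.add hf (contDiff_const.mul hg) h (h'.const_mul (-1) hg)
  simpa [sub_eq_add_neg] using this

lemma Bd.sum {m : ℕ} {ι : Type*} (s : Finset ι) {f : ι → Fn N} {K : ι → ℝ}
    (hf : ∀ k, Smooth (f k)) (h : ∀ k ∈ s, Bd m (f k) (K k)) :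
    Bd m (fun x => ∑ k ∈ s, f k x) (∑ k ∈ s, K k) := by
  induction s using Finset.induction_on with
  | empty => simpa using Bd.const m (by simp)
  | insert a s ha ih =>
    simp only [sum_insert ha]
    exact Bd.add (hf a) (ContDiff.sum fun k _ => hf k) (h a (by simp))
      (ih fun k hk => h k (by simp [hk]))

/-- Smooth functions all of whose derivatives are bounded. -/
def Sm (f : Fn N) : Prop := Smooth f ∧ ∀ m, ∃ K, Bd m f K

lemma Sm.pd1 (h : Sm f) (i : Fin N) : Sm (pd1 f i) :=
  ⟨smooth_pd1 h.1 i, fun m => (h.2 (m + 1)).imp fun _ hK => hK.2 i⟩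

lemma Sm.const (a : ℝ) : Sm (fun _ : ES N => a) :=
  ⟨contDiff_const, fun m => ⟨|a|, Bd.const m le_rfl⟩⟩

lemma Sm.add {f g : Fn N} (h : Sm f) (h' : Sm g) : Sm (fun x => f x + g x) :=
  ⟨h.1.add h'.1, fun m => by
    obtain ⟨K, hK⟩ := h.2 m
    obtain ⟨L, hL⟩ := h'.2 m
    exact ⟨_, Bd.add h.1 h'.1 hK hL⟩⟩

lemma Sm.mul {f g : Fn N} (h : Sm f) (h' : Sm g) : Sm (fun x => f x * g x) :=
  ⟨h.1.mul h'.1, fun m => by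
    obtain ⟨K, hK⟩ := h.2 m
    obtain ⟨L, hL⟩ := h'.2 m
    exact ⟨_, Bd.mul h.1 h'.1 hK hL⟩⟩

lemma Sm.const_mul (a : ℝ) (h : Sm f) : Sm (fun x => a * f x) :=
  (Sm.const a).mul h

lemma Sm.sum {ι : Type*} (s : Finset ι) {f : ι → Fn N} (h : ∀ k, Sm (f k)) :
    Sm (fun x => ∑ k ∈ s, f k x) := by
  induction s using Finset.induction_on with
  | empty => simpa using Sm.const 0
  | insert a s ha ih => simp only [sum_insert ha]; exact (h a).add ih

/-- A common bound for finitely many functions in the class `Sm`. -/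
lemma exists_Bd_of_finite {ι : Type*} [Finite ι] {f : ι → Fn N} (h : ∀ k, Sm (f k)) (m : ℕ) :
    ∃ K, ∀ k, Bd m (f k) K := by
  have := Fintype.ofFinite ι
  choose K hK using fun k => (h k).2 m
  refine ⟨∑ k, K k, fun k => (hK k).mono ?_⟩
  exact single_le_sum (f := K) (fun k _ => (hK k).nonneg) (Finset.mem_univ k)

/-! ### Second order operators -/

/-- The operator `∑ qᵢⱼ Dᵢⱼ + ∑ bⱼ Dⱼ + c`. -/
def Lop (q : Fin N → VF N) (b : VF N) (c : Fn N) (f : Fn N)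
    (x : ES N) : ℝ :=
  (∑ i, ∑ j, q i j x * pd2 f i j x) + (∑ j, b j x * pd1 f j x) + c x * f x

lemma smooth_Lop {q : Fin N → VF N} {b : VF N} {c f : Fn N}
    (hq : ∀ i j, Smooth (q i j)) (hb : ∀ j, Smooth (b j)) (hc : Smooth c)
    (hf : Smooth f) : Smooth (Lop q b c f) :=
  ((ContDiff.sum fun i _ => ContDiff.sum fun j _ =>
    (hq i j).mul (smooth_pd1 (smooth_pd1 hf j) i)).add
    (ContDiff.sum fun j _ => (hb j).mul (smooth_pd1 hf j))).add (hc.mul hf)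

lemma pd1_Lop {q : Fin N → VF N} {b : VF N} {c f : Fn N}
    (hq : ∀ i j, Smooth (q i j)) (hb : ∀ j, Smooth (b j)) (hc : Smooth c)
    (hf : Smooth f) (l : Fin N) :
    pd1 (Lop q b c f) l = fun x => Lop q b c (pd1 f l) x +
      Lop (fun i j => pd1 (q i j) l) (fun j => pd1 (b j) l) (pd1 c l) f x := by
  have h1 : ∀ i, Smooth (pd1 f i) := smooth_pd1 hf
  have h2 : ∀ i j, Smooth (pd2 f i j) := fun i j => smooth_pd1 (h1 j) i
  have hc2 : ∀ i, pd1 (pd1 f i) l = pd1 (pd1 f l) i := fun i => pd1_comm (hf.of_le (smooth_le 2)) i l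
  have hc3 : ∀ i j, pd1 (pd2 f i j) l = pd2 (pd1 f l) i j := fun i j => by
    rw [pd2, pd1_comm ((h1 j).of_le (smooth_le 2)) i l, hc2 j]; rfl
  have e1 : pd1 (fun x => ∑ i, ∑ j, q i j x * pd2 f i j x) l = fun x => ∑ i, ∑ j,
      (pd1 (q i j) l x * pd2 f i j x + q i j x * pd2 (pd1 f l) i j x) := by
    rw [pd1_sum _ fun i => smooth_diff (ContDiff.sum fun j _ => (hq i j).mul (h2 i j))]
    ext x
    refine sum_congr rfl fun i _ => ?_
    rw [pd1_sum _ fun j => smooth_diff ((hq i j).mul (h2 i j))]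
    refine sum_congr rfl fun j _ => ?_
    rw [pd1_mul (smooth_diff (hq i j)) (smooth_diff (h2 i j)), hc3]
  have e2 : pd1 (fun x => ∑ j, b j x * pd1 f j x) l = fun x => ∑ j,
      (pd1 (b j) l x * pd1 f j x + b j x * pd1 (pd1 f l) j x) := by
    rw [pd1_sum _ fun j => smooth_diff ((hb j).mul (h1 j))]
    ext x
    refine sum_congr rfl fun j _ => ?_
    rw [pd1_mul (smooth_diff (hb j)) (smooth_diff (h1 j)), hc2]
  have s1 : Smooth (fun x => ∑ i, ∑ j, q i j x * pd2 f i j x) :=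
    ContDiff.sum fun i _ => ContDiff.sum fun j _ => (hq i j).mul (h2 i j)
  have s2 : Smooth (fun x => ∑ j, b j x * pd1 f j x) :=
    ContDiff.sum fun j _ => (hb j).mul (h1 j)
  have : pd1 (Lop q b c f) l = fun x => pd1 (fun x => ∑ i, ∑ j, q i j x * pd2 f i j x) l x
      + pd1 (fun x => ∑ j, b j x * pd1 f j x) l x + pd1 (fun x => c x * f x) l x := by
    unfold Lop
    rw [pd1_add (smooth_diff (s1.add s2)) (smooth_diff (hc.mul hf)),
      pd1_add (smooth_diff s1) (smooth_diff s2)]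
  rw [this, e1, e2, pd1_mul (smooth_diff hc) (smooth_diff hf)]
  ext x
  simp only [Lop, sum_add_distrib]
  ring

/-! ### The averaging scheme and its stability -/

/-- The displacement `x + z s(x) + z² b(x)`. -/
def flow (s b : VF N) (z : ℝ) (x : ES N) : ES N :=
  WithLp.toLp 2 fun i => x i + z * s i x + z ^ 2 * b i x

lemma flow_apply (s b : VF N) (z : ℝ) (x : ES N) (i : Fin N) :
    flow s b z x i = x i + z * s i x + z ^ 2 * b i x := rfl

lemma smooth_coord (i : Fin N) : Smooth fun x : ES N => x i :=
  (EuclideanSpace.proj i : ES N →L[ℝ] ℝ).contDiff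

lemma pd1_coord (i j : Fin N) : pd1 (fun x : ES N => x j) i = fun _ => if j = i then 1 else 0 := by
  ext x
  have : fderiv ℝ (fun x : ES N => x j) x = (EuclideanSpace.proj j : ES N →L[ℝ] ℝ) :=
    (EuclideanSpace.proj j : ES N →L[ℝ] ℝ).hasFDerivAt.fderiv
  simp [pd1, this]

lemma smooth_flow_apply {s b : VF N} (hs : ∀ i, Smooth (s i))
    (hb : ∀ i, Smooth (b i)) (z : ℝ) (i : Fin N) :
    Smooth fun x => flow s b z x i :=
  ((smooth_coord i).add (contDiff_const.mul (hs i))).add (contDiff_const.mul (hb i))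

lemma smooth_flow {s b : VF N} (hs : ∀ i, Smooth (s i))
    (hb : ∀ i, Smooth (b i)) (z : ℝ) : Smooth (flow s b z) :=
  contDiff_euclidean.2 (smooth_flow_apply hs hb z)

lemma pd1_flow {s b : VF N} (hs : ∀ i, Smooth (s i))
    (hb : ∀ i, Smooth (b i)) (z : ℝ) (i j : Fin N) :
    pd1 (fun x => flow s b z x j) i = fun x =>
      (if j = i then 1 else 0) + z * pd1 (s j) i x + z ^ 2 * pd1 (b j) i x := by
  simp only [flow_apply]
  rw [pd1_add (smooth_diff ((smooth_coord j).add (contDiff_const.mul (hs j))))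
    (smooth_diff (contDiff_const.mul (hb j))),
    pd1_add (smooth_diff (smooth_coord j)) (smooth_diff (contDiff_const.mul (hs j))), pd1_coord,
    pd1_const_mul _ (smooth_diff (hs j)), pd1_const_mul _ (smooth_diff (hb j))]

/-- Amplitudes: polynomials in `z` with coefficients in the class `Sm`. -/
inductive Amp : (ℝ → Fn N) → Prop
  | of {f : Fn N} (hf : Sm f) : Amp fun _ x => f x
  | var : Amp fun z _ => z
  | add {M M' : ℝ → Fn N} : Amp M → Amp M' → Amp fun z x => M z x + M' z x
  | mul {M M' : ℝ → Fn N} : Amp M → Amp M' → Amp fun z x => M z x * M' z x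

lemma Amp.smooth {M : ℝ → Fn N} (h : Amp M) (z : ℝ) : Smooth (M z) := by
  induction h with
  | of hf => exact hf.1
  | var => exact contDiff_const
  | add _ _ h1 h2 => exact h1.add h2
  | mul _ _ h1 h2 => exact h1.mul h2

lemma Amp.pd1 {M : ℝ → Fn N} (h : Amp M) (i : Fin N) : Amp fun z => pd1 (M z) i := by
  induction h with
  | of hf => exact .of (hf.pd1 i)
  | var => simp only [pd1_const]; exact .of (Sm.const 0)
  | add a b h1 h2 =>
    convert h1.add h2 using 2 with z
    exact pd1_add (smooth_diff (a.smooth z)) (smooth_diff (b.smooth z)) i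
  | mul a b h1 h2 =>
    convert (h1.mul b).add (a.mul h2) using 2 with z
    exact pd1_mul (smooth_diff (a.smooth z)) (smooth_diff (b.smooth z)) i

lemma Amp.bounds {M : ℝ → Fn N} (h : Amp M) : ∃ C, 0 ≤ C ∧ ∀ z x, |z| ≤ 1 →
    |M z x| ≤ C ∧ |M z x - M (-z) x| ≤ C * |z| ∧ |(M z x + M (-z) x) / 2 - M 0 x| ≤ C * z ^ 2 := by
  induction h with
  | @of f hf =>
    obtain ⟨K, hK⟩ := hf.2 0
    refine ⟨K, hK.nonneg, fun z x _ => ⟨hK x, ?_, ?_⟩⟩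
    · simpa using mul_nonneg hK.nonneg (abs_nonneg z)
    · simpa using mul_nonneg hK.nonneg (sq_nonneg z)
  | var =>
    refine ⟨2, by norm_num, fun z x hz => ⟨by linarith, ?_, ?_⟩⟩
    · rw [sub_neg_eq_add, ← two_mul, abs_mul]; simp
    · simp; positivity
  | @add M M' _ _ h1 h2 =>
    obtain ⟨C, hC, h1⟩ := h1
    obtain ⟨D, hD, h2⟩ := h2
    refine ⟨C + D, by positivity, fun z x hz => ?_⟩
    obtain ⟨a, b, c⟩ := h1 z x hz
    obtain ⟨a', b', c'⟩ := h2 z x hz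
    refine ⟨(abs_add_le _ _).trans (add_le_add a a'), ?_, ?_⟩
    · rw [show M z x + M' z x - (M (-z) x + M' (-z) x)
        = (M z x - M (-z) x) + (M' z x - M' (-z) x) by ring, add_mul]
      exact (abs_add_le _ _).trans (add_le_add b b')
    · rw [show (M z x + M' z x + (M (-z) x + M' (-z) x)) / 2 - (M 0 x + M' 0 x)
        = ((M z x + M (-z) x) / 2 - M 0 x) + ((M' z x + M' (-z) x) / 2 - M' 0 x) by ring, add_mul]
      exact (abs_add_le _ _).trans (add_le_add c c')
  | @mul M M' _ _ h1 h2 =>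
    obtain ⟨C, hC, h1⟩ := h1
    obtain ⟨D, hD, h2⟩ := h2
    refine ⟨3 * (C * D), by positivity, fun z x hz => ?_⟩
    obtain ⟨a, b, c⟩ := h1 z x hz
    obtain ⟨a', b', c'⟩ := h2 z x hz
    have an := (h1 (-z) x (by simpa)).1
    have an' := (h2 (-z) x (by simpa)).1
    have a0 := (h1 0 x (by simp)).1
    have hz0 := abs_nonneg z
    have hCD : 0 ≤ C * D := by positivity
    refine ⟨?_, ?_, ?_⟩
    · rw [abs_mul]
      exact (mul_le_mul a a' (abs_nonneg _) hC).trans (by linarith)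
    · rw [show M z x * M' z x - M (-z) x * M' (-z) x
        = (M z x - M (-z) x) * M' z x + M (-z) x * (M' z x - M' (-z) x) by ring]
      refine (abs_add_le _ _).trans ?_
      rw [abs_mul, abs_mul]
      have e1 := mul_le_mul b a' (abs_nonneg _) (by positivity)
      have e2 := mul_le_mul an b' (abs_nonneg _) hC
      nlinarith
    · rw [show (M z x * M' z x + M (-z) x * M' (-z) x) / 2 - M 0 x * M' 0 x
        = ((M z x + M (-z) x) / 2 - M 0 x) * ((M' z x + M' (-z) x) / 2)
          + M 0 x * ((M' z x + M' (-z) x) / 2 - M' 0 x)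
          + (M z x - M (-z) x) * (M' z x - M' (-z) x) / 4 by ring]
      refine (abs_add_three _ _ _).trans ?_
      rw [abs_mul, abs_mul, abs_div ((M z x - M (-z) x) * _), abs_mul (M z x - M (-z) x)]
      have e0 : |(M' z x + M' (-z) x) / 2| ≤ D := by
        rw [abs_le] at *; constructor <;> linarith [a'.1, a'.2, an'.1, an'.2]
      have e1 := mul_le_mul c e0 (abs_nonneg _) (by positivity)
      have e2 := mul_le_mul a0 c' (abs_nonneg _) hC
      have e3 := mul_le_mul b b' (abs_nonneg _) (by positivity)
      have e4 : C * |z| * (D * |z|) = C * D * z ^ 2 := by rw [← sq_abs z]; ring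
      rw [show |(4 : ℝ)| = 4 by norm_num]
      have : 0 ≤ C * D * z ^ 2 := by positivity
      linarith

/-- The vector of all derivatives of order at most one. -/
def prol {ι : Type} (F : ι → Fn N) : ι × Option (Fin N) → Fn N
  | (a, none) => F a
  | (a, some i) => pd1 (F a) i

/-- The amplitude matrix acting on the prolonged vectors. -/
def prolAmp {ι : Type} (s b : VF N) (M : ι → ι → ℝ → Fn N) :
    ι × Option (Fin N) → ι × Option (Fin N) → ℝ → Fn N
  | (a, none), (a', none) => M a a'
  | (_, none), (_, some _) => fun _ _ => 0
  | (a, some i), (a', none) => fun z => pd1 (M a a' z) i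
  | (a, some i), (a', some j) => fun z x => M a a' z x *
      ((if j = i then 1 else 0) + z * pd1 (s j) i x + z * z * pd1 (b j) i x)

/-- One branch of the averaging scheme acting on vector valued functions. -/
def branch {ι : Type} [Fintype ι] (s b : VF N) (M : ι → ι → ℝ → Fn N) (z : ℝ)
    (F : ι → Fn N) (a : ι) (x : ES N) : ℝ :=
  ∑ a', M a a' z x * F a' (flow s b z x)

/-- The averaging scheme acting on vector valued functions. -/
def schemeV {ι : Type} [Fintype ι] (s : Fin N → VF N) (b : VF N)
    (M : Fin N → ι → ι → ℝ → Fn N) (z : ℝ) (F : ι → Fn N) (a : ι) (x : ES N) : ℝ :=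
  (∑ k, (branch (s k) b (M k) z F a x + branch (s k) b (M k) (-z) F a x) / 2) / N

lemma prolAmp_amp {ι : Type} {s b : VF N} (hs : ∀ i, Sm (s i)) (hb : ∀ i, Sm (b i))
    {M : ι → ι → ℝ → Fn N} (hM : ∀ a a', Amp (M a a')) (p p') : Amp (prolAmp s b M p p') := by
  obtain ⟨a, i⟩ := p
  obtain ⟨a', j⟩ := p'
  cases i <;> cases j
  · exact hM a a'
  · exact .of (Sm.const 0)
  · exact (hM a a').pd1 _
  · exact (hM a a').mul (((Amp.of (Sm.const _)).add (Amp.var.mul (.of ((hs _).pd1 _)))).add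
      ((Amp.var.mul .var).mul (.of ((hb _).pd1 _))))

lemma prolAmp_zero {ι : Type} {s b : VF N}
    {M : ι → ι → ℝ → Fn N} (hM : ∀ a a' x, M a a' 0 x = if a = a' then 1 else 0) (p p' x) :
    prolAmp s b M p p' 0 x = if p = p' then 1 else 0 := by
  obtain ⟨a, i⟩ := p
  obtain ⟨a', j⟩ := p'
  cases i <;> cases j
  · simp [prolAmp, hM]
  · simp [prolAmp]
  · have : M a a' 0 = fun _ => if a = a' then 1 else 0 := funext fun x => hM a a' x
    simp only [prolAmp]
    rw [this, pd1_const]; simp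
  · simp only [prolAmp, hM, Prod.mk.injEq, Option.some.injEq]
    split_ifs <;> simp_all

lemma smooth_branch {ι : Type} [Fintype ι] {s b : VF N} (hs : ∀ i, Sm (s i))
    (hb : ∀ i, Sm (b i)) {M : ι → ι → ℝ → Fn N} (hM : ∀ a a', Amp (M a a')) (z : ℝ)
    {F : ι → Fn N} (hF : ∀ a, Smooth (F a)) (a : ι) :
    Smooth (branch s b M z F a) :=
  ContDiff.sum fun a' _ => ((hM a a').smooth z).mul
    ((hF a').comp (smooth_flow (fun i => (hs i).1) (fun i => (hb i).1) z))

lemma prol_branch {ι : Type} [Fintype ι] {s b : VF N} (hs : ∀ i, Sm (s i))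
    (hb : ∀ i, Sm (b i)) {M : ι → ι → ℝ → Fn N} (hM : ∀ a a', Amp (M a a')) (z : ℝ)
    {F : ι → Fn N} (hF : ∀ a, Smooth (F a)) :
    prol (branch s b M z F) = branch s b (prolAmp s b M) z (prol F) := by
  have hs' := fun i => (hs i).1
  have hb' := fun i => (hb i).1
  have hc : ∀ a, Smooth fun x => F a (flow s b z x) := fun a =>
    (hF a).comp (smooth_flow hs' hb' z)
  ext ⟨a, i⟩ x
  cases i with
  | none => simp [prol, branch, Fintype.sum_prod_type, prolAmp]
  | some i =>
    have h1 : pd1 (branch s b M z F a) i x = ∑ a', (pd1 (M a a' z) i x * F a' (flow s b z x)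
        + M a a' z x * ∑ j, pd1 (F a') j (flow s b z x) * pd1 (fun x => flow s b z x j) i x) := by
      unfold branch
      rw [pd1_sum _ fun a' => smooth_diff (((hM a a').smooth z).mul (hc a'))]
      refine sum_congr rfl fun a' _ => ?_
      rw [pd1_mul (smooth_diff ((hM a a').smooth z)) (smooth_diff (hc a'))]
      simp only
      rw [pd1_comp (smooth_diff (hF a')) (fun j => smooth_diff (smooth_flow_apply hs' hb' z j))]
    simp only [prol]
    rw [h1]
    simp only [branch, Fintype.sum_prod_type, Fintype.sum_option, prolAmp, prol]
    refine sum_congr rfl fun a' _ => ?_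
    congr 1
    rw [mul_sum]
    refine sum_congr rfl fun j _ => ?_
    rw [pd1_flow hs' hb']
    ring

lemma prol_schemeV {ι : Type} [Fintype ι] {s : Fin N → VF N} {b : VF N}
    (hs : ∀ k i, Sm (s k i)) (hb : ∀ i, Sm (b i)) {M : Fin N → ι → ι → ℝ → Fn N}
    (hM : ∀ k a a', Amp (M k a a')) (z : ℝ) {F : ι → Fn N} (hF : ∀ a, Smooth (F a)) :
    prol (schemeV s b M z F) = schemeV s b (fun k => prolAmp (s k) b (M k)) z (prol F) := by
  have hsm := fun k z a => smooth_branch (hs k) hb (hM k) z hF a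
  have key := fun k z => prol_branch (hs k) hb (hM k) z hF
  ext ⟨a, i⟩ x
  cases i with
  | none =>
    simp only [prol, schemeV, ← key]
  | some i =>
    simp only [schemeV, ← key]
    simp only [prol]
    have : schemeV s b M z F a = fun x => (1 / (2 * N : ℝ)) * ∑ k, (branch (s k) b (M k) z F a x
        + branch (s k) b (M k) (-z) F a x) := by
      ext x; simp only [schemeV, ← sum_div]; field_simp
    rw [this, pd1_const_mul _ (smooth_diff (ContDiff.sum fun k _ => (hsm k z a).add (hsm k (-z) a))),
      pd1_sum _ fun k => smooth_diff ((hsm k z a).add (hsm k (-z) a))]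
    simp only [pd1_add (smooth_diff (hsm _ z a)) (smooth_diff (hsm _ (-z) a)), ← sum_div]
    field_simp

/-- Sup bound for the Euclidean norm of the vector of iterated prolongations. -/
def JB : (m : ℕ) → (ι : Type) → [Fintype ι] → (ι → Fn N) → ℝ → Prop
  | 0, _, _, F, K => ∀ x, ∑ a, F a x ^ 2 ≤ K ^ 2
  | m + 1, ι, _, F, K => JB m (ι × Option (Fin N)) (prol F) K

lemma JB.bd {m : ℕ} : ∀ {ι : Type} [Fintype ι] {F : ι → Fn N} {K : ℝ}, 0 ≤ K → JB m ι F K →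
    ∀ a, Bd m (F a) K := by
  induction m with
  | zero =>
    intro ι _ F K hK h a x
    refine abs_le_of_sq_le_sq ?_ hK
    exact (single_le_sum (f := fun a => F a x ^ 2) (fun a _ => sq_nonneg _)
      (Finset.mem_univ a)).trans (h x)
  | succ m ih =>
    intro ι _ F K hK h a
    exact ⟨ih hK h (a, none), fun i => ih hK h (a, some i)⟩

lemma exists_JB (m : ℕ) : ∀ (ι : Type) [Fintype ι], ∃ C : ℝ, 0 ≤ C ∧ ∀ (F : ι → Fn N) (K : ℝ),
    (∀ a, Bd m (F a) K) → 0 ≤ K → JB m ι F (C * K) := by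
  induction m with
  | zero =>
    intro ι _
    refine ⟨Fintype.card ι, by positivity, fun F K h hK x => ?_⟩
    have h1 : ∑ a, F a x ^ 2 ≤ ∑ _a : ι, K ^ 2 :=
      sum_le_sum fun a _ => sq_le_sq' (abs_le.1 (h a x)).1 (abs_le.1 (h a x)).2
    refine h1.trans ?_
    rw [sum_const, Finset.card_univ, nsmul_eq_mul, mul_pow]
    have h2 : (Fintype.card ι : ℝ) ≤ (Fintype.card ι : ℝ) ^ 2 := by
      exact_mod_cast Nat.le_self_pow (by norm_num) _
    exact mul_le_mul_of_nonneg_right h2 (sq_nonneg _)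
  | succ m ih =>
    intro ι _
    obtain ⟨C, hC, h⟩ := ih (ι × Option (Fin N))
    refine ⟨C, hC, fun F K hF hK => h _ K ?_ hK⟩
    rintro ⟨a, i⟩
    cases i
    · exact (hF a).1
    · exact (hF a).2 _

/-- The averaged Euclidean length of the two transported covectors. -/
lemma avg_norm_le {ι : Type} [Fintype ι] {M : ι → ι → ℝ → Fn N} {C : ℝ} (hC : 0 ≤ C)
    (h0 : ∀ a a' x, M a a' 0 x = if a = a' then 1 else 0)
    (hM : ∀ a a' z x, |z| ≤ 1 → |M a a' z x - M a a' (-z) x| ≤ C * |z| ∧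
      |(M a a' z x + M a a' (-z) x) / 2 - M a a' 0 x| ≤ C * z ^ 2)
    {z : ℝ} (hz : |z| ≤ 1) (x : ES N) (ξ : ι → ℝ) :
    (√(∑ a', (∑ a, ξ a * M a a' z x) ^ 2) + √(∑ a', (∑ a, ξ a * M a a' (-z) x) ^ 2)) / 2
      ≤ (1 + (C * Fintype.card ι + (C * Fintype.card ι) ^ 2) * z ^ 2) * √(∑ a, ξ a ^ 2) := by
  set n : ℝ := (Fintype.card ι : ℝ) with hn_def
  set L := √(∑ a, ξ a ^ 2) with hL
  have hL0 : 0 ≤ L := Real.sqrt_nonneg _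
  have hn : 0 ≤ n := Nat.cast_nonneg _
  set p : EuclideanSpace ℝ ι := WithLp.toLp 2 fun a' => ∑ a, ξ a * M a a' z x with hp
  set m : EuclideanSpace ℝ ι := WithLp.toLp 2 fun a' => ∑ a, ξ a * M a a' (-z) x with hm
  set X : EuclideanSpace ℝ ι := WithLp.toLp 2 ξ with hX
  have eX : ‖X‖ = L := by rw [EuclideanSpace.norm_eq]; simp [hX, hL]
  have ep : ‖p‖ = √(∑ a', (∑ a, ξ a * M a a' z x) ^ 2) := by
    rw [EuclideanSpace.norm_eq]; simp [hp]
  have em : ‖m‖ = √(∑ a', (∑ a, ξ a * M a a' (-z) x) ^ 2) := by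
    rw [EuclideanSpace.norm_eq]; simp [hm]
  rw [← ep, ← em]
  -- entrywise small matrices act with small norm
  have small : ∀ (B : ι → ι → ℝ) (δ : ℝ), 0 ≤ δ → (∀ a a', |B a a'| ≤ δ) →
      ‖(WithLp.toLp 2 fun a' => ∑ a, ξ a * B a a' : EuclideanSpace ℝ ι)‖ ≤ n * δ * L := by
    intro B δ hδ hB
    rw [EuclideanSpace.norm_eq]
    refine Real.sqrt_le_iff.2 ⟨by positivity, ?_⟩
    have h1 : ∀ a', ‖∑ a, ξ a * B a a'‖ ^ 2 ≤ n * δ ^ 2 * L ^ 2 := by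
      intro a'
      rw [norm_eq_abs, sq_abs]
      refine (Finset.sum_mul_sq_le_sq_mul_sq _ _ _).trans ?_
      rw [hL, Real.sq_sqrt (sum_nonneg fun _ _ => sq_nonneg _), mul_comm]
      refine mul_le_mul_of_nonneg_right ?_ (sum_nonneg fun _ _ => sq_nonneg _)
      refine (sum_le_card_nsmul _ _ (δ ^ 2) fun a _ => ?_).trans (by simp [n])
      exact sq_le_sq' (abs_le.1 (hB a a')).1 (abs_le.1 (hB a a')).2
    refine (sum_le_card_nsmul _ _ _ fun a' _ => h1 a').trans (le_of_eq ?_)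
    simp only [Finset.card_univ, nsmul_eq_mul, n]; ring
  have hs : ‖(1 / 2 : ℝ) • (p + m) - X‖ ≤ n * (C * z ^ 2) * L := by
    have : (1 / 2 : ℝ) • (p + m) - X = WithLp.toLp 2 fun a' => ∑ a, ξ a *
        ((M a a' z x + M a a' (-z) x) / 2 - M a a' 0 x) := by
      ext a'
      simp only [hp, hm, hX, PiLp.sub_apply, PiLp.smul_apply, PiLp.add_apply, smul_eq_mul, h0,
        mul_sub, sum_sub_distrib, mul_ite, mul_one, mul_zero, Finset.sum_ite_eq',
        Finset.mem_univ, if_true, ← sum_add_distrib, mul_sum]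
      congr 1
      exact sum_congr rfl fun a _ => by ring
    rw [this]
    exact small _ _ (by positivity) fun a a' => (hM a a' z x hz).2
  have hd : ‖(1 / 2 : ℝ) • (p - m)‖ ≤ n * (C * |z|) * L := by
    have : p - m = WithLp.toLp 2 fun a' => ∑ a, ξ a * (M a a' z x - M a a' (-z) x) := by
      ext a'
      simp [hp, hm, mul_sub, sum_sub_distrib]
    rw [this, norm_smul]
    have h2 := small _ _ (by positivity) fun a a' => (hM a a' z x hz).1
    norm_num at h2 ⊢
    linarith [norm_nonneg (WithLp.toLp 2 fun a' => ∑ a, ξ a * (M a a' z x - M a a' (-z) x) :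
      EuclideanSpace ℝ ι)]
  set u := (1 / 2 : ℝ) • (p + m) with hu
  set w := (1 / 2 : ℝ) • (p - m) with hw
  have hpu : p = u + w := by rw [hu, hw, ← smul_add]; ext; simp; ring
  have hmu : m = u - w := by rw [hu, hw, ← smul_sub]; ext; simp; ring
  have par : ‖p‖ ^ 2 + ‖m‖ ^ 2 = 2 * (‖u‖ ^ 2 + ‖w‖ ^ 2) := by
    have := parallelogram_law_with_norm ℝ u w
    rw [hpu, hmu]; linarith
  have hub : ‖u‖ ≤ (1 + n * C * z ^ 2) * L := by
    calc ‖u‖ = ‖X + (u - X)‖ := by congr 1; abel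
      _ ≤ ‖X‖ + ‖u - X‖ := norm_add_le _ _
      _ ≤ _ := by rw [eX]; linarith
  set A := n * C * z ^ 2
  set B := n * C * |z|
  have hB2 : B ^ 2 = (n * C) ^ 2 * z ^ 2 := by rw [← sq_abs z]; simp only [B]; ring
  have hA : 0 ≤ A := by positivity
  have hgoal : (1 + (C * n + (C * n) ^ 2) * z ^ 2) * L = (1 + A + B ^ 2) * L := by
    rw [hB2]; simp only [A]; ring
  rw [hgoal]
  have hw' : ‖w‖ ≤ B * L := by simpa [B, mul_assoc] using hd
  have h3 : ‖u‖ ^ 2 ≤ ((1 + A) * L) ^ 2 := pow_le_pow_left₀ (norm_nonneg _) hub 2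
  have h4 : ‖w‖ ^ 2 ≤ (B * L) ^ 2 := pow_le_pow_left₀ (norm_nonneg _) hw' 2
  refine abs_le_of_sq_le_sq' ?_ (by positivity) |>.2
  have h5 : ((‖p‖ + ‖m‖) / 2) ^ 2 ≤ ‖u‖ ^ 2 + ‖w‖ ^ 2 := by
    nlinarith [sq_nonneg (‖p‖ - ‖m‖)]
  have h6 : (0 : ℝ) ≤ (B ^ 2 + 2 * A * B ^ 2 + B ^ 2 * B ^ 2) * L ^ 2 := by positivity
  nlinarith

lemma schemeV_step {ι : Type} [Fintype ι] (hN : 1 ≤ N) {s : Fin N → VF N}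
    {b : VF N} {M : Fin N → ι → ι → ℝ → Fn N}
    (hM : ∀ k a a', Amp (M k a a')) (h0 : ∀ k a a' x, M k a a' 0 x = if a = a' then 1 else 0) :
    ∃ C, 0 ≤ C ∧ ∀ (z : ℝ) (F : ι → Fn N) (K : ℝ), |z| ≤ 1 → 0 ≤ K → JB 0 ι F K →
      JB 0 ι (schemeV s b M z F) ((1 + C * z ^ 2) * K) := by
  choose D hD hb using fun k a a' => (hM k a a').bounds
  set C := ∑ k, ∑ a, ∑ a', D k a a'
  have hDC : ∀ k a a', D k a a' ≤ C := fun k a a' =>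
    (single_le_sum (f := fun a' => D k a a') (fun _ _ => hD _ _ _) (Finset.mem_univ a')).trans
    ((single_le_sum (f := fun a => ∑ a', D k a a')
      (fun _ _ => sum_nonneg fun _ _ => hD _ _ _) (Finset.mem_univ a)).trans
    (single_le_sum (f := fun k => ∑ a, ∑ a', D k a a')
      (fun _ _ => sum_nonneg fun _ _ => sum_nonneg fun _ _ => hD _ _ _)
      (Finset.mem_univ k)))
  have hC : 0 ≤ C := sum_nonneg fun _ _ => sum_nonneg fun _ _ =>
    sum_nonneg fun _ _ => hD _ _ _
  refine ⟨C * Fintype.card ι + (C * Fintype.card ι) ^ 2, by positivity, fun z F K hz hK hF x => ?_⟩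
  set Q := C * Fintype.card ι + (C * Fintype.card ι) ^ 2
  have hQ : 0 ≤ Q := by positivity
  set ξ : ι → ℝ := fun a => schemeV s b M z F a x with hξ
  set L := √(∑ a, ξ a ^ 2) with hL
  have hL2 : L ^ 2 = ∑ a, ξ a ^ 2 := Real.sq_sqrt (sum_nonneg fun _ _ => sq_nonneg _)
  have hL0 : 0 ≤ L := Real.sqrt_nonneg _
  have hbr : ∀ k z', ∑ a, ξ a * branch (s k) b (M k) z' F a x
      ≤ √(∑ a', (∑ a, ξ a * M k a a' z' x) ^ 2) * K := by
    intro k z'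
    have : ∑ a, ξ a * branch (s k) b (M k) z' F a x
        = ∑ a', (∑ a, ξ a * M k a a' z' x) * F a' (flow (s k) b z' x) := by
      simp only [branch, mul_sum, sum_mul]
      rw [sum_comm]
      exact sum_congr rfl fun _ _ => sum_congr rfl fun _ _ => by ring
    rw [this]
    refine (Real.sum_mul_le_sqrt_mul_sqrt _ _ _).trans ?_
    refine mul_le_mul_of_nonneg_left ?_ (Real.sqrt_nonneg _)
    exact Real.sqrt_le_iff.2 ⟨hK, hF _⟩
  have hN0 : (0 : ℝ) < N := by exact_mod_cast hN
  have key : L ^ 2 ≤ (1 + Q * z ^ 2) * K * L := by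
    have e : L ^ 2 = (∑ k : Fin N, ((∑ a, ξ a * branch (s k) b (M k) z F a x)
        + ∑ a, ξ a * branch (s k) b (M k) (-z) F a x) / 2) / N := by
      rw [hL2]
      have : ∀ a, ξ a ^ 2 = (∑ k : Fin N, (ξ a * branch (s k) b (M k) z F a x
        + ξ a * branch (s k) b (M k) (-z) F a x) / 2) / N := fun a => by
        have : ξ a ^ 2 = ξ a * ((∑ k, (branch (s k) b (M k) z F a x
          + branch (s k) b (M k) (-z) F a x) / 2) / N) := by rw [sq]; rfl
        rw [this, mul_div_assoc', mul_sum]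
        congr 1
        exact sum_congr rfl fun _ _ => by ring
      simp only [this]
      rw [← sum_div, sum_comm]
      congr 1
      refine sum_congr rfl fun k _ => ?_
      rw [← sum_div, sum_add_distrib]
    rw [e, div_le_iff₀ hN0]
    refine (sum_le_card_nsmul _ _ ((1 + Q * z ^ 2) * K * L) fun k _ => ?_).trans
      (le_of_eq (by simp; ring))
    have h1 := avg_norm_le hC (h0 k) (fun a a' z x hz => ⟨?_, ?_⟩) hz x ξ
    · have h2 := hbr k z
      have h3 := hbr k (-z)
      have h4 := mul_le_mul_of_nonneg_right h1 hK
      rw [← hL] at h4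
      linarith
    · exact (hb k a a' z x hz).2.1.trans (mul_le_mul_of_nonneg_right (hDC k a a') (abs_nonneg _))
    · exact (hb k a a' z x hz).2.2.trans (mul_le_mul_of_nonneg_right (hDC k a a') (sq_nonneg _))
  change ∑ a, ξ a ^ 2 ≤ _
  rw [← hL2]
  refine pow_le_pow_left₀ hL0 ?_ 2
  rcases hL0.eq_or_lt with h | h
  · rw [← h]; positivity
  · rw [sq] at key; exact le_of_mul_le_mul_right key h

lemma schemeV_stable (hN : 1 ≤ N) {s : Fin N → VF N}
    {b : VF N} (hs : ∀ k i, Sm (s k i)) (hb : ∀ i, Sm (b i)) (m : ℕ) :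
    ∀ (ι : Type) [Fintype ι] (M : Fin N → ι → ι → ℝ → Fn N), (∀ k a a', Amp (M k a a')) →
    (∀ k a a' x, M k a a' 0 x = if a = a' then 1 else 0) →
    ∃ C, 0 ≤ C ∧ ∀ (z : ℝ) (F : ι → Fn N) (K : ℝ), |z| ≤ 1 → 0 ≤ K →
      (∀ a, Smooth (F a)) → JB m ι F K →
      JB m ι (schemeV s b M z F) ((1 + C * z ^ 2) * K) := by
  induction m with
  | zero =>
    intro ι _ M hM h0
    obtain ⟨C, hC, h⟩ := schemeV_step (s := s) (b := b) hN hM h0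
    exact ⟨C, hC, fun z F K hz hK _ => h z F K hz hK⟩
  | succ m ih =>
    intro ι _ M hM h0
    obtain ⟨C, hC, h⟩ := ih _ (fun k => prolAmp (s k) b (M k))
      (fun k => prolAmp_amp (hs k) hb (hM k)) (fun k p p' x => by
        rw [prolAmp_zero (h0 k)]; congr)
    refine ⟨C, hC, fun z F K hz hK hF hJ => ?_⟩
    change JB m _ (prol _) _
    rw [prol_schemeV hs hb hM z hF]
    refine h z _ K hz hK ?_ hJ
    rintro ⟨a, i⟩
    cases i
    · exact hF a
    · exact smooth_pd1 (hF a) _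

/-! ### Consistency of the averaging scheme -/

lemma Amp.jointly_smooth {M : ℝ → Fn N} (h : Amp M) :
    Smooth fun p : ℝ × ES N => M p.1 p.2 := by
  induction h with
  | of hf => exact hf.1.comp contDiff_snd
  | var => exact contDiff_fst
  | add _ _ h1 h2 => exact h1.add h2
  | mul _ _ h1 h2 => exact h1.mul h2

lemma Amp.exists_deriv {M : ℝ → Fn N} (h : Amp M) :
    ∃ M', Amp M' ∧ ∀ z x, HasDerivAt (fun z => M z x) (M' z x) z := by
  induction h with
  | of hf => exact ⟨fun _ _ => 0, .of (Sm.const 0), fun z x => hasDerivAt_const _ _⟩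
  | var => exact ⟨fun _ _ => 1, .of (Sm.const 1), fun z x => hasDerivAt_id z⟩
  | add _ _ h1 h2 =>
    obtain ⟨A, hA, h1⟩ := h1
    obtain ⟨B, hB, h2⟩ := h2
    exact ⟨_, hA.add hB, fun z x => (h1 z x).add (h2 z x)⟩
  | mul a b h1 h2 =>
    obtain ⟨A, hA, h1⟩ := h1
    obtain ⟨B, hB, h2⟩ := h2
    exact ⟨_, (hA.mul b).add (a.mul hB), fun z x => (h1 z x).mul (h2 z x)⟩

lemma hasDerivAt_comp_flow (s b : VF N) (hf : Smooth f) (z : ℝ)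
    (x : ES N) : HasDerivAt (fun z => f (flow s b z x))
    (∑ j, (s j x + 2 * z * b j x) * pd1 f j (flow s b z x)) z := by
  have h0 : HasDerivAt (fun z i => x i + z * s i x + z ^ 2 * b i x)
      (fun i => s i x + 2 * z * b i x) z := by
    refine hasDerivAt_pi.2 fun i => ?_
    have h1 : HasDerivAt (fun z : ℝ => z ^ 2) (2 * z) z := by simpa using hasDerivAt_pow 2 z
    simpa using ((((hasDerivAt_id' z).mul_const (s i x)).const_add (x i)).fun_add
      (h1.mul_const (b i x)))
  have h1 : HasDerivAt (fun z => flow s b z x)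
      (WithLp.toLp 2 fun i => s i x + 2 * z * b i x : ES N) z :=
    (EuclideanSpace.equiv (Fin N) ℝ).symm.toContinuousLinearMap.hasFDerivAt.comp_hasDerivAt z h0
  refine (HasFDerivAt.comp_hasDerivAt (l := f) (f := fun z => flow s b z x) z
    ((smooth_diff hf) (flow s b z x)).hasFDerivAt h1).congr_deriv ?_
  rw [fderiv_apply_eq]
  exact sum_congr rfl fun j _ => mul_comm _ _

/-- Operators built from amplitudes and derivatives of order at most `k` transported by the
flow. -/
inductive Br (s b : VF N) : ℕ → (Fn N → ℝ → Fn N) → Prop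
  | base {M : ℝ → Fn N} (hM : Amp M) : Br s b 0 fun f z x => M z x * f (flow s b z x)
  | der {k : ℕ} {G : Fn N → ℝ → Fn N} (i : Fin N) :
      Br s b k G → Br s b (k + 1) fun f => G (pd1 f i)
  | lift {k : ℕ} {G : Fn N → ℝ → Fn N} : Br s b k G → Br s b (k + 1) G
  | add {k : ℕ} {G H : Fn N → ℝ → Fn N} :
      Br s b k G → Br s b k H → Br s b k fun f z x => G f z x + H f z x

lemma Br.zero {s b : VF N} (k : ℕ) : Br s b k fun _ _ _ => 0 := by
  induction k with
  | zero => simpa using Br.base (s := s) (b := b) (.of (Sm.const 0))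
  | succ k ih => exact ih.lift

lemma Br.sum {s b : VF N} {k : ℕ} {ι : Type*} (t : Finset ι)
    {G : ι → Fn N → ℝ → Fn N} (h : ∀ i, Br s b k (G i)) :
    Br s b k fun f z x => ∑ i ∈ t, G i f z x := by
  induction t using Finset.induction_on with
  | empty => simpa using Br.zero k
  | insert a t ha ih => simp only [sum_insert ha]; exact (h a).add ih

lemma Br.bound {s b : VF N} {k : ℕ} {G : Fn N → ℝ → Fn N}
    (h : Br s b k G) : ∃ C, 0 ≤ C ∧ ∀ f K, Bd k f K → ∀ z x, |z| ≤ 1 → |G f z x| ≤ C * K := by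
  induction h with
  | base hM =>
    obtain ⟨C, hC, h⟩ := hM.bounds
    refine ⟨C, hC, fun f K hf z x hz => ?_⟩
    rw [abs_mul]
    exact mul_le_mul (h z x hz).1 (hf _) (abs_nonneg _) hC
  | der i _ ih =>
    obtain ⟨C, hC, h⟩ := ih
    exact ⟨C, hC, fun f K hf => h _ K (hf.2 i)⟩
  | lift _ ih =>
    obtain ⟨C, hC, h⟩ := ih
    exact ⟨C, hC, fun f K hf => h _ K hf.1⟩
  | add _ _ h1 h2 =>
    obtain ⟨C, hC, h1⟩ := h1
    obtain ⟨D, hD, h2⟩ := h2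
    refine ⟨C + D, by positivity, fun f K hf z x hz => ?_⟩
    rw [add_mul]
    exact (abs_add_le _ _).trans (add_le_add (h1 f K hf z x hz) (h2 f K hf z x hz))

section

variable {s b : VF N} (hs : ∀ i, Sm (s i)) (hb : ∀ i, Sm (b i))
include hs hb

lemma smooth_joint_flow : Smooth fun p : ℝ × ES N => flow s b p.1 p.2 := by
  refine contDiff_euclidean.2 fun i => ?_
  exact (((smooth_coord i).comp contDiff_snd).add (contDiff_fst.mul
    ((hs i).1.comp contDiff_snd))).add ((contDiff_fst.pow 2).mul ((hb i).1.comp contDiff_snd))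

lemma Br.jointly_smooth {k : ℕ} {G : Fn N → ℝ → Fn N} (h : Br s b k G) :
    ∀ {f : Fn N}, Smooth f → Smooth fun p : ℝ × ES N => G f p.1 p.2 := by
  induction h with
  | base hM => exact fun hf => hM.jointly_smooth.mul (hf.comp (smooth_joint_flow hs hb))
  | der i _ ih => exact fun hf => ih (smooth_pd1 hf i)
  | lift _ ih => exact fun hf => ih hf
  | add _ _ h1 h2 => exact fun hf => (h1 hf).add (h2 hf)

lemma Br.smooth {k : ℕ} {G : Fn N → ℝ → Fn N} (h : Br s b k G)
    (hf : Smooth f) (z : ℝ) : Smooth (G f z) :=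
  (h.jointly_smooth hs hb hf).comp (contDiff_prodMk_right z)

lemma Br.exists_pd1 {k : ℕ} {G : Fn N → ℝ → Fn N} (h : Br s b k G) (i : Fin N) :
    ∃ G', Br s b (k + 1) G' ∧ ∀ f, Smooth f → ∀ z, pd1 (G f z) i = G' f z := by
  have hs' := fun i => (hs i).1
  have hb' := fun i => (hb i).1
  induction h with
  | @base M hM =>
    refine ⟨fun f z x => pd1 (M z) i x * f (flow s b z x) + ∑ j, (M z x *
      ((if j = i then 1 else 0) + z * pd1 (s j) i x + z * z * pd1 (b j) i x)) *
        pd1 f j (flow s b z x),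
      (Br.base (hM.pd1 i)).lift.add (Br.sum _ fun j => ?_), fun f hf z => ?_⟩
    · exact Br.der j (Br.base (hM.mul (((Amp.of (Sm.const _)).add
        (Amp.var.mul (.of ((hs _).pd1 _)))).add ((Amp.var.mul .var).mul (.of ((hb _).pd1 _))))))
    · have hc : Smooth fun x => f (flow s b z x) := hf.comp (smooth_flow hs' hb' z)
      simp only
      rw [pd1_mul (smooth_diff (hM.smooth z)) (smooth_diff hc)]
      ext x
      rw [pd1_comp (smooth_diff hf) (fun j => smooth_diff (smooth_flow_apply hs' hb' z j)),
        mul_sum]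
      congr 1
      refine sum_congr rfl fun j _ => ?_
      rw [pd1_flow hs' hb']
      ring
  | der j _ ih =>
    obtain ⟨G', hG', h⟩ := ih
    exact ⟨fun f => G' (pd1 f j), hG'.der j, fun f hf z => h _ (smooth_pd1 hf j) z⟩
  | lift _ ih =>
    obtain ⟨G', hG', h⟩ := ih
    exact ⟨G', hG'.lift, h⟩
  | add a b' h1 h2 =>
    obtain ⟨A, hA, h1⟩ := h1
    obtain ⟨B, hB, h2⟩ := h2
    refine ⟨_, hA.add hB, fun f hf z => ?_⟩
    rw [pd1_add (smooth_diff (a.smooth hs hb hf z)) (smooth_diff (b'.smooth hs hb hf z)),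
      h1 f hf, h2 f hf]

lemma Br.exists_deriv {k : ℕ} {G : Fn N → ℝ → Fn N} (h : Br s b k G) :
    ∃ G', Br s b (k + 1) G' ∧ ∀ f, Smooth f → ∀ z x,
      HasDerivAt (fun z => G f z x) (G' f z x) z := by
  induction h with
  | @base M hM =>
    obtain ⟨M', hM', hd⟩ := hM.exists_deriv
    refine ⟨fun f z x => M' z x * f (flow s b z x) + ∑ j, (M z x * (s j x + 2 * z * b j x)) *
        pd1 f j (flow s b z x),
      (Br.base hM').lift.add (Br.sum _ fun j => ?_), fun f hf z x => ?_⟩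
    · exact Br.der j (Br.base (hM.mul ((Amp.of (hs j)).add
        (((Amp.of (Sm.const 2)).mul .var).mul (.of (hb j))))))
    · refine ((hd z x).mul (hasDerivAt_comp_flow s b hf z x)).congr_deriv ?_
      rw [mul_sum]
      congr 1
      exact sum_congr rfl fun j _ => by ring
  | der j _ ih =>
    obtain ⟨G', hG', h⟩ := ih
    exact ⟨fun f => G' (pd1 f j), hG'.der j, fun f hf z => h _ (smooth_pd1 hf j) z⟩
  | lift _ ih =>
    obtain ⟨G', hG', h⟩ := ih
    exact ⟨G', hG'.lift, h⟩
  | add a b' h1 h2 =>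
    obtain ⟨A, hA, h1⟩ := h1
    obtain ⟨B, hB, h2⟩ := h2
    exact ⟨_, hA.add hB, fun f hf z x => (h1 f hf z x).add (h2 f hf z x)⟩

end

/-- The derivative with respect to the parameter commutes with the spatial derivatives. -/
lemma hasDerivAt_pd1 {g g' : ℝ → Fn N} (hg : Smooth fun p : ℝ × ES N => g p.1 p.2)
    (hd : ∀ z x, HasDerivAt (fun z => g z x) (g' z x) z) (i : Fin N) (z : ℝ) (x : ES N) :
    HasDerivAt (fun z => pd1 (g z) i x) (pd1 (g' z) i x) z := by
  set Γ : ℝ × ES N → ℝ := fun p => g p.1 p.2 with hΓ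
  set e : ES N := EuclideanSpace.single i 1
  have hdiff : Differentiable ℝ Γ := hg.differentiable (by simp)
  have hx : ∀ z x, pd1 (g z) i x = fderiv ℝ Γ (z, x) (0, e) := fun z x => by
    have h1 : HasFDerivAt (fun y : ES N => (z, y)) (ContinuousLinearMap.inr ℝ ℝ (ES N)) x :=
      hasFDerivAt_prodMk_right z x
    have h2 := (hdiff (z, x)).hasFDerivAt.comp x h1
    have h3 : fderiv ℝ (g z) x = (fderiv ℝ Γ (z, x)).comp (ContinuousLinearMap.inr ℝ ℝ (ES N)) :=
      h2.fderiv
    simp [pd1, h3, e]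
  have hz : ∀ z x, g' z x = fderiv ℝ Γ (z, x) (1, 0) := fun z x => by
    have h1 : HasDerivAt (fun y : ℝ => (y, x)) ((1 : ℝ), (0 : ES N)) z :=
      (hasDerivAt_id z).prodMk (hasDerivAt_const z x)
    have h2 : HasDerivAt (fun z => g z x) (fderiv ℝ Γ (z, x) (1, 0)) z :=
      HasFDerivAt.comp_hasDerivAt (l := Γ) (f := fun y => (y, x)) z (hdiff (z, x)).hasFDerivAt h1
    exact (hd z x).unique h2
  have hd2 : Differentiable ℝ (fderiv ℝ Γ) :=
    (hg.fderiv_right (m := ∞) (by simp)).differentiable (by simp)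
  have h1 : HasDerivAt (fun y : ℝ => (y, x)) ((1 : ℝ), (0 : ES N)) z :=
    (hasDerivAt_id z).prodMk (hasDerivAt_const z x)
  have h2 : HasDerivAt (fun z => fderiv ℝ Γ (z, x) (0, e))
      (fderiv ℝ (fderiv ℝ Γ) (z, x) (1, 0) (0, e)) z := by
    have h3 : HasDerivAt (fun z => fderiv ℝ Γ (z, x)) (fderiv ℝ (fderiv ℝ Γ) (z, x) (1, 0)) z :=
      (hd2 (z, x)).hasFDerivAt.comp_hasDerivAt z h1
    simpa using h3.clm_apply (hasDerivAt_const z ((0 : ℝ), e))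
  simp only [hx]
  refine h2.congr_deriv ?_
  have h6 : pd1 (g' z) i x = fderiv ℝ (fderiv ℝ Γ) (z, x) (0, e) (1, 0) := by
    have h3 : HasFDerivAt (fun y : ES N => (z, y)) (ContinuousLinearMap.inr ℝ ℝ (ES N)) x :=
      hasFDerivAt_prodMk_right z x
    have h4 : HasFDerivAt (fun y => fderiv ℝ Γ (z, y)) ((fderiv ℝ (fderiv ℝ Γ) (z, x)).comp
        (ContinuousLinearMap.inr ℝ ℝ (ES N))) x := (hd2 (z, x)).hasFDerivAt.comp x h3
    have h5 : g' z = fun y => fderiv ℝ Γ (z, y) (1, 0) := funext fun y => hz z y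
    have h7 := h4.clm_apply (hasFDerivAt_const ((1 : ℝ), (0 : ES N)) x)
    rw [← h5] at h7
    simp only [pd1]
    rw [h7.fderiv]
    simp [e]
  rw [h6]
  have hs := (hg.contDiffAt (x := (z, x))).isSymmSndFDerivAt (by simpa using smooth_le 2)
  simpa using hs _ _

/-- Third order Taylor estimate for a symmetric average. -/
lemma symm_taylor {w w1 w2 w3 : ℝ → ℝ} (h1 : ∀ z, HasDerivAt w (w1 z) z)
    (h2 : ∀ z, HasDerivAt w1 (w2 z) z) (h3 : ∀ z, HasDerivAt w2 (w3 z) z) {C : ℝ}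
    (hC : ∀ z, |z| ≤ 1 → |w3 z| ≤ C) {z : ℝ} (hz : |z| ≤ 1) :
    |(w z + w (-z)) / 2 - w 0 - z ^ 2 / 2 * w2 0| ≤ C * |z| ^ 3 := by
  have hC0 : 0 ≤ C := (abs_nonneg _).trans (hC 0 (by simp))
  -- estimate on `w2`, then on the two integrals
  have key : ∀ {p p' : ℝ → ℝ} {K : ℝ} {m : ℕ}, 0 ≤ K → p 0 = 0 → (∀ y, HasDerivAt p (p' y) y) →
      (∀ y, |y| ≤ 1 → |p' y| ≤ K * |y| ^ m) → ∀ y, |y| ≤ 1 → |p y| ≤ K * |y| ^ (m + 1) := by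
    intro p p' K m hK h0 hp hb y hy
    have := (convex_closedBall (0 : ℝ) |y|).norm_image_sub_le_of_norm_hasDerivWithin_le
      (f := p) (f' := p') (C := K * |y| ^ m) (x := 0) (y := y)
      (fun t _ => (hp t).hasDerivWithinAt) (fun t ht => ?_) (by simp) (by simp)
    · simpa [h0, pow_succ, mul_assoc] using this
    · have ht : |t| ≤ |y| := by simpa using ht
      exact (hb t (ht.trans hy)).trans
        (mul_le_mul_of_nonneg_left (pow_le_pow_left₀ (abs_nonneg _) ht m) hK)
  have e2 := key (p := fun y => w2 y - w2 0) (p' := w3) (K := C) (m := 0) hC0 (by simp)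
    (fun y => (h3 y).sub_const _) (by simpa using hC)
  have e1 := key (p := fun y => w1 y - w1 0 - y * w2 0) (p' := fun y => w2 y - w2 0)
    (K := C) hC0 (by simp) (fun y => (((h2 y).sub_const _).sub
      ((hasDerivAt_id y).mul_const (w2 0))).congr_deriv (by simp)) e2
  have e0 := key (p := fun y => w y - w 0 - y * w1 0 - y ^ 2 / 2 * w2 0)
    (p' := fun y => w1 y - w1 0 - y * w2 0)
    (K := C) hC0 (by simp) (fun y => ((((h1 y).sub_const _).sub
      ((hasDerivAt_id y).mul_const (w1 0))).sub
      ((((hasDerivAt_id y).pow 2).div_const 2).mul_const (w2 0))).congr_deriv (by simp)) e1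
  have a1 := abs_le.1 (e0 z hz)
  have a2 := abs_le.1 (e0 (-z) (by simpa using hz))
  simp only [abs_neg] at a2
  norm_num at a1 a2
  rw [abs_le]
  constructor <;> linarith

lemma Br.consistent {s b : VF N} (hs : ∀ i, Sm (s i)) (hb : ∀ i, Sm (b i)) (m : ℕ) :
    ∀ {k : ℕ} {G G1 G2 G3 : Fn N → ℝ → Fn N}, Br s b k G → Br s b (k + 1) G1 →
    Br s b (k + 2) G2 → Br s b (k + 3) G3 →
    (∀ f, Smooth f → ∀ z x, HasDerivAt (fun z => G f z x) (G1 f z x) z) →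
    (∀ f, Smooth f → ∀ z x, HasDerivAt (fun z => G1 f z x) (G2 f z x) z) →
    (∀ f, Smooth f → ∀ z x, HasDerivAt (fun z => G2 f z x) (G3 f z x) z) →
    ∃ C, 0 ≤ C ∧ ∀ f K z, Smooth f → Bd (k + 3 + m) f K → |z| ≤ 1 →
      Bd m (fun x => (G f z x + G f (-z) x) / 2 - G f 0 x - z ^ 2 / 2 * G2 f 0 x)
        (C * K * |z| ^ 3) := by
  induction m with
  | zero =>
    intro k G G1 G2 G3 hG hG1 hG2 hG3 h1 h2 h3
    obtain ⟨C, hC, hbd⟩ := hG3.bound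
    exact ⟨C, hC, fun f K z hf hK hz x => symm_taylor (w := fun z => G f z x)
      (fun z => h1 f hf z x) (fun z => h2 f hf z x) (fun z => h3 f hf z x)
      (fun z hz => hbd f K hK z x hz) hz⟩
  | succ m ih =>
    intro k G G1 G2 G3 hG hG1 hG2 hG3 h1 h2 h3
    obtain ⟨C, hC, hbd⟩ := ih hG hG1 hG2 hG3 h1 h2 h3
    have : ∀ i : Fin N, ∃ D, 0 ≤ D ∧ ∀ f K z, Smooth f → Bd (k + 3 + (m + 1)) f K →
        |z| ≤ 1 → Bd m (pd1 (fun x => (G f z x + G f (-z) x) / 2 - G f 0 x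
          - z ^ 2 / 2 * G2 f 0 x) i) (D * K * |z| ^ 3) := by
      intro i
      obtain ⟨F, hF, f0⟩ := hG.exists_pd1 hs hb i
      obtain ⟨F1, hF1, f1⟩ := hG1.exists_pd1 hs hb i
      obtain ⟨F2, hF2, f2⟩ := hG2.exists_pd1 hs hb i
      obtain ⟨F3, hF3, f3⟩ := hG3.exists_pd1 hs hb i
      obtain ⟨D, hD, hbd'⟩ := ih hF hF1 hF2 hF3
        (fun f hf z x => by
          simp only [← f0 f hf, ← f1 f hf]
          exact hasDerivAt_pd1 (hG.jointly_smooth hs hb hf) (h1 f hf) i z x)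
        (fun f hf z x => by
          simp only [← f1 f hf, ← f2 f hf]
          exact hasDerivAt_pd1 (hG1.jointly_smooth hs hb hf) (h2 f hf) i z x)
        (fun f hf z x => by
          simp only [← f2 f hf, ← f3 f hf]
          exact hasDerivAt_pd1 (hG2.jointly_smooth hs hb hf) (h3 f hf) i z x)
      refine ⟨D, hD, fun f K z hf hK hz => ?_⟩
      convert hbd' f K z hf (by rwa [show k + 1 + 3 + m = k + 3 + (m + 1) by ring]) hz using 1
      have sm := fun z => hG.smooth hs hb hf z
      have sm2 := hG2.smooth hs hb hf 0
      have ea : (fun x => (G f z x + G f (-z) x) / 2 - G f 0 x - z ^ 2 / 2 * G2 f 0 x)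
          = fun x => (1 / 2) * (G f z x + G f (-z) x) - G f 0 x - z ^ 2 / 2 * G2 f 0 x := by
        ext x; ring
      rw [ea, pd1_sub (smooth_diff ((contDiff_const.mul ((sm z).add (sm (-z)))).sub (sm 0)))
        (smooth_diff (contDiff_const.mul sm2)),
        pd1_sub (smooth_diff (contDiff_const.mul ((sm z).add (sm (-z))))) (smooth_diff (sm 0)),
        pd1_const_mul _ (smooth_diff ((sm z).add (sm (-z)))), pd1_const_mul _ (smooth_diff sm2),
        pd1_add (smooth_diff (sm z)) (smooth_diff (sm (-z))), f0 f hf, f0 f hf, f0 f hf, f2 f hf]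
      ext x; ring
    choose D hD hbd' using this
    refine ⟨C + ∑ i, D i, add_nonneg hC (sum_nonneg fun i _ => hD i),
      fun f K z hf hK hz => ⟨(hbd f K z hf (hK.of_le (by omega)) hz).mono ?_, fun i =>
        (hbd' i f K z hf hK hz).mono ?_⟩⟩
    all_goals
      have hK0 := hK.nonneg
      refine mul_le_mul_of_nonneg_right (mul_le_mul_of_nonneg_right ?_ hK0) (by positivity)
    · linarith [sum_nonneg fun i (_ : i ∈ Finset.univ) => hD i]
    · linarith [single_le_sum (fun i _ => hD i) (Finset.mem_univ i)]

/-- Data of the scheme: the generator is `1/(2N) ∑ₖ sₖ sₖᵀ D² + b D + c`. -/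
structure Gen (N : ℕ) where
  s : Fin N → VF N
  b : VF N
  c : Fn N
  hs : ∀ k i, Sm (s k i)
  hb : ∀ i, Sm (b i)
  hc : Sm c

namespace Gen

variable (G : Gen N)

/-- The diffusion matrix of the generator. -/
def q (i j : Fin N) (x : ES N) : ℝ := (1 / (2 * N)) * ∑ k, G.s k i x * G.s k j x

/-- One step of the scheme without potential. -/
def P0 (z : ℝ) (f : Fn N) (x : ES N) : ℝ :=
  (∑ k, (f (flow (G.s k) G.b z x) + f (flow (G.s k) G.b (-z) x)) / 2) / N

/-- One step of the scheme. -/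
def P (z : ℝ) (f : Fn N) (x : ES N) : ℝ := (1 + z ^ 2 * G.c x) * G.P0 z f x

/-- The generator. -/
def A (f : Fn N) : Fn N := Lop G.q G.b G.c f

/-- The generator without potential. -/
def A0 (f : Fn N) : Fn N := Lop G.q G.b (fun _ => 0) f

lemma q_Sm (i j : Fin N) : Sm (G.q i j) :=
  (Sm.sum _ fun k => (G.hs k i).mul (G.hs k j)).const_mul _

lemma q_symm (i j : Fin N) : G.q i j = G.q j i := by
  ext x; simp only [q]; congr 1; exact sum_congr rfl fun _ _ => mul_comm _ _

/-- The generator with zero potential. -/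
def drop : Gen N := ⟨G.s, G.b, fun _ => 0, G.hs, G.hb, Sm.const 0⟩

lemma P_drop (z : ℝ) (f : Fn N) : G.drop.P z f = G.P0 z f := by
  ext x; simp [P, drop, P0]

lemma A_drop (f : Fn N) : G.drop.A f = G.A0 f := rfl

lemma flow_zero (s b : VF N) (x : ES N) : flow s b 0 x = x := by
  ext i; simp [flow_apply]

lemma smooth_comp_flow (hf : Smooth f) (k : Fin N) (z : ℝ) :
    Smooth fun x => f (flow (G.s k) G.b z x) :=
  hf.comp (smooth_flow (fun i => (G.hs k i).1) (fun i => (G.hb i).1) z)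

lemma smooth_P0 (hf : Smooth f) (z : ℝ) : Smooth (G.P0 z f) :=
  (ContDiff.sum fun k _ => ((G.smooth_comp_flow hf k z).add
    (G.smooth_comp_flow hf k (-z))).div_const 2).div_const _

lemma smooth_P (hf : Smooth f) (z : ℝ) : Smooth (G.P z f) :=
  (contDiff_const.add (contDiff_const.mul G.hc.1)).mul (G.smooth_P0 hf z)

lemma smooth_A (hf : Smooth f) : Smooth (G.A f) :=
  smooth_Lop (fun i j => (G.q_Sm i j).1) (fun j => (G.hb j).1) G.hc.1 hf

/-- The scheme is consistent with the generator. -/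
lemma consistent (hN : 1 ≤ N) (m : ℕ) : ∃ C, 0 ≤ C ∧ ∀ f K z, Smooth f → Bd (m + 3) f K →
    |z| ≤ 1 → Bd m (fun x => G.P z f x - f x - z ^ 2 * G.A f x) (C * K * |z| ^ 3) := by
  have : ∀ k, ∃ C, 0 ≤ C ∧ ∀ f K z, Smooth f → Bd (m + 3) f K → |z| ≤ 1 →
      Smooth (fun x => ((1 + z ^ 2 * G.c x) * f (flow (G.s k) G.b z x)
        + (1 + z ^ 2 * G.c x) * f (flow (G.s k) G.b (-z) x)) / 2 - f x
        - z ^ 2 / 2 * (2 * G.c x * f x + 2 * ∑ j, G.b j x * pd1 f j x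
          + ∑ i, ∑ j, G.s k i x * G.s k j x * pd2 f i j x)) ∧
      Bd m (fun x => ((1 + z ^ 2 * G.c x) * f (flow (G.s k) G.b z x)
        + (1 + z ^ 2 * G.c x) * f (flow (G.s k) G.b (-z) x)) / 2 - f x
        - z ^ 2 / 2 * (2 * G.c x * f x + 2 * ∑ j, G.b j x * pd1 f j x
          + ∑ i, ∑ j, G.s k i x * G.s k j x * pd2 f i j x)) (C * K * |z| ^ 3) := by
    intro k
    have hM : Amp fun z x => 1 + z * z * G.c x :=
      (Amp.of (Sm.const 1)).add ((Amp.var.mul .var).mul (.of G.hc))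
    have h0 := Br.base (s := G.s k) (b := G.b) hM
    obtain ⟨G1, h1, d1⟩ := h0.exists_deriv (G.hs k) G.hb
    obtain ⟨G2, h2, d2⟩ := h1.exists_deriv (G.hs k) G.hb
    obtain ⟨G3, h3, d3⟩ := h2.exists_deriv (G.hs k) G.hb
    obtain ⟨C, hC, h⟩ := Br.consistent (G.hs k) G.hb m h0 h1 h2 h3 d1 d2 d3
    have e2 : ∀ f, Smooth f → ∀ x, G2 f 0 x = 2 * G.c x * f x
        + 2 * ∑ j, G.b j x * pd1 f j x + ∑ i, ∑ j, G.s k i x * G.s k j x * pd2 f i j x := by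
      intro f hf x
      have hm : ∀ z : ℝ, HasDerivAt (fun z : ℝ => 1 + z * z * G.c x) (2 * z * G.c x) z := fun z => by
        have := (((hasDerivAt_id' z).mul (hasDerivAt_id' z)).mul_const (G.c x)).const_add 1
        refine this.congr_deriv ?_
        ring
      have hl : ∀ (a : ℝ) (z : ℝ), HasDerivAt (fun z : ℝ => 2 * z * a) (2 * a) z := fun a z => by
        have := ((hasDerivAt_id' z).const_mul 2).mul_const a
        simpa using this
      have e1 : ∀ z, G1 f z x = 2 * z * G.c x * f (flow (G.s k) G.b z x) + (1 + z * z * G.c x) *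
          ∑ j, (G.s k j x + 2 * z * G.b j x) * pd1 f j (flow (G.s k) G.b z x) := fun z =>
        (d1 f hf z x).unique ((hm z).mul (hasDerivAt_comp_flow (G.s k) G.b hf z x))
      have h5 := d2 f hf 0 x
      simp only [e1] at h5
      have h6 := ((hl (G.c x) 0).mul (hasDerivAt_comp_flow (G.s k) G.b hf 0 x)).add
        ((hm 0).mul (HasDerivAt.fun_sum (u := Finset.univ) fun j _ =>
          (((hl (G.b j x) 0).const_add (G.s k j x)).mul
          (hasDerivAt_comp_flow (G.s k) G.b (smooth_pd1 hf j) 0 x))))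
      rw [h5.unique h6]
      simp only [flow_zero, mul_zero, zero_mul, add_zero, zero_add, one_mul]
      rw [sum_add_distrib, ← add_assoc, mul_sum]
      congr 1
      · congr 1
        exact sum_congr rfl fun j _ => by ring
      · simp only [mul_sum, pd2]
        rw [sum_comm]
        exact sum_congr rfl fun i _ => sum_congr rfl fun j _ => by ring
    refine ⟨C, hC, fun f K z hf hK hz => ?_⟩
    have hb := h f K z hf (hK.of_le (by omega)) hz
    have ee : (fun x => ((1 + z ^ 2 * G.c x) * f (flow (G.s k) G.b z x)
        + (1 + z ^ 2 * G.c x) * f (flow (G.s k) G.b (-z) x)) / 2 - f x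
        - z ^ 2 / 2 * (2 * G.c x * f x + 2 * ∑ j, G.b j x * pd1 f j x
          + ∑ i, ∑ j, G.s k i x * G.s k j x * pd2 f i j x)) = _ :=
      funext fun x => show _ = ((1 + z * z * G.c x) * f (flow (G.s k) G.b z x)
        + (1 + -z * -z * G.c x) * f (flow (G.s k) G.b (-z) x)) / 2
        - (1 + 0 * 0 * G.c x) * f (flow (G.s k) G.b 0 x) - z ^ 2 / 2 * G2 f 0 x by
        rw [e2 f hf, flow_zero]; ring
    rw [ee]
    refine ⟨?_, hb⟩
    exact ((((h0.smooth (G.hs k) G.hb hf z).add (h0.smooth (G.hs k) G.hb hf (-z))).div_const 2).sub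
      (h0.smooth (G.hs k) G.hb hf 0)).sub (contDiff_const.mul (h2.smooth (G.hs k) G.hb hf 0))
  choose C hC h using this
  have hN0 : (N : ℝ) ≠ 0 := by exact_mod_cast (by omega : N ≠ 0)
  refine ⟨|(1 / N : ℝ)| * ∑ k, C k, mul_nonneg (abs_nonneg _) (sum_nonneg fun k _ => hC k),
    fun f K z hf hK hz => ?_⟩
  have h1 := Bd.sum Finset.univ (fun k => (h k f K z hf hK hz).1) fun k _ => (h k f K z hf hK hz).2
  have h2 := h1.const_mul (1 / N : ℝ) (ContDiff.sum fun k _ => (h k f K z hf hK hz).1)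
  convert h2 using 1
  · ext x
    have e1 : ∑ i, ∑ j, G.q i j x * pd2 f i j x
        = (1 / (2 * N)) * ∑ k, ∑ i, ∑ j, G.s k i x * G.s k j x * pd2 f i j x := by
      simp only [q, mul_sum, sum_mul]
      rw [sum_congr rfl fun i _ => sum_comm, sum_comm]
      exact sum_congr rfl fun k _ => sum_congr rfl fun i _ =>
        sum_congr rfl fun j _ => by ring
    simp only [P, P0, A, Lop]
    rw [e1, sum_sub_distrib, sum_sub_distrib, ← mul_sum,
      sum_add_distrib, sum_const, sum_const, Finset.card_univ,
      Fintype.card_fin, nsmul_eq_mul, nsmul_eq_mul]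
    have e2 : ∑ k, ((1 + z ^ 2 * G.c x) * f (flow (G.s k) G.b z x)
        + (1 + z ^ 2 * G.c x) * f (flow (G.s k) G.b (-z) x)) / 2 = (1 + z ^ 2 * G.c x) *
        ∑ k, (f (flow (G.s k) G.b z x) + f (flow (G.s k) G.b (-z) x)) / 2 := by
      rw [mul_sum]
      exact sum_congr rfl fun k _ => by ring
    rw [e2]
    field_simp
    ring
  · rw [← sum_mul, ← sum_mul]; ring

end Gen

/-! ### Bernstein's method -/

/-- The contraction of the derivatives of order `k` of two functions. -/
def TT : ℕ → Fn N → Fn N → Fn N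
  | 0, f, g, x => f x * g x
  | k + 1, f, g, x => ∑ i, TT k (pd1 f i) (pd1 g i) x

/-- The sum of the squares of the derivatives of order `k`. -/
def SS : ℕ → Fn N → Fn N
  | 0, f, x => f x ^ 2
  | k + 1, f, x => ∑ i, SS k (pd1 f i) x

lemma SS_eq_TT (k : ℕ) (f : Fn N) (x : ES N) : SS k f x = TT k f f x := by
  induction k generalizing f with
  | zero => simp [SS, TT, sq]
  | succ k ih => simp [SS, TT, ih]

lemma SS_nonneg (k : ℕ) (f : Fn N) (x : ES N) : 0 ≤ SS k f x := by
  induction k generalizing f with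
  | zero => exact sq_nonneg _
  | succ k ih => exact sum_nonneg fun i _ => ih _

lemma smooth_SS (k : ℕ) (hf : Smooth f) : Smooth (SS k f) := by
  induction k generalizing f with
  | zero => exact hf.pow 2
  | succ k ih => exact ContDiff.sum fun i _ => ih (smooth_pd1 hf i)

/-- Young's inequality for bilinear expressions with bounded entries. -/
lemma young_sum {α β : Type*} [Fintype α] [Fintype β] {A : α → β → ℝ} {K X Y W : ℝ}
    (hK : 0 ≤ K)
    (hA : ∀ i j, |W * A i j| ≤ K * (X * Y)) (g : α → ℝ) (f : β → ℝ) :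
    W * ∑ i, g i * ∑ j, A i j * f j ≤ K * (Fintype.card α + Fintype.card β) *
      (X ^ 2 * ∑ i, g i ^ 2 + Y ^ 2 * ∑ j, f j ^ 2) := by
  have key : ∀ i j, W * (g i * (A i j * f j)) ≤ K * (X ^ 2 * g i ^ 2 + Y ^ 2 * f j ^ 2) := by
    intro i j
    have h2 : X * Y * |g i * f j| ≤ X ^ 2 * g i ^ 2 + Y ^ 2 * f j ^ 2 := by
      rw [abs_mul, ← sq_abs (g i), ← sq_abs (f j)]
      nlinarith [sq_nonneg (X * |g i| - Y * |f j|), sq_nonneg (X * |g i|), sq_nonneg (Y * |f j|)]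
    calc W * (g i * (A i j * f j)) = W * A i j * (g i * f j) := by ring
      _ ≤ |W * A i j * (g i * f j)| := le_abs_self _
      _ = |W * A i j| * |g i * f j| := abs_mul _ _
      _ ≤ K * (X * Y) * |g i * f j| := by gcongr; exact hA i j
      _ = K * (X * Y * |g i * f j|) := by ring
      _ ≤ _ := by gcongr
  simp only [mul_sum]
  refine (sum_le_sum fun i _ => sum_le_sum fun j _ => key i j).trans ?_
  simp only [← mul_sum, sum_add_distrib, sum_const, Finset.card_univ,
    nsmul_eq_mul]
  have h1 : 0 ≤ X ^ 2 * ∑ i, g i ^ 2 :=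
    mul_nonneg (sq_nonneg _) (sum_nonneg fun i _ => sq_nonneg _)
  have h2 : 0 ≤ Y ^ 2 * ∑ j, f j ^ 2 :=
    mul_nonneg (sq_nonneg _) (sum_nonneg fun i _ => sq_nonneg _)
  rw [mul_assoc]
  refine mul_le_mul_of_nonneg_left ?_ hK
  nlinarith [mul_nonneg (Nat.cast_nonneg (Fintype.card α) : (0:ℝ) ≤ _) h1,
    mul_nonneg (Nat.cast_nonneg (Fintype.card β) : (0:ℝ) ≤ _) h2]

lemma TT_add (k : ℕ) {f g h : Fn N} (hg : Smooth g) (hh : Smooth h) (x : ES N) :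
    TT k f (fun x => g x + h x) x = TT k f g x + TT k f h x := by
  induction k generalizing f g h with
  | zero => simp [TT, mul_add]
  | succ k ih =>
    simp only [TT, pd1_add (smooth_diff hg) (smooth_diff hh)]
    rw [← sum_add_distrib]
    exact sum_congr rfl fun i _ => ih (smooth_pd1 hg i) (smooth_pd1 hh i)

section Commutators

variable (q : Fin N → VF N) (b : VF N) (c : Fn N)

/-- The sum of the products of the derivatives of order `k` with the operator applied to them. -/
def EE : ℕ → Fn N → Fn N
  | 0, u, x => u x * Lop q b c u x
  | k + 1, u, x => ∑ i, EE k (pd1 u i) x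

/-- The first order commutator term. -/
def C1 (u : Fn N) (x : ES N) : ℝ := ∑ l, pd1 u l x *
  Lop (fun i j => pd1 (q i j) l) (fun j => pd1 (b j) l) (pd1 c l) u x

/-- The second order commutator term. -/
def C2 (u : Fn N) (x : ES N) : ℝ := ∑ k, ∑ l, pd1 (pd1 u k) l x *
  Lop (fun i j => pd1 (pd1 (q i j) k) l) (fun j => pd1 (pd1 (b j) k) l) (pd1 (pd1 c k) l) u x

/-- The third order commutator term. -/
def C3 (u : Fn N) (x : ES N) : ℝ := ∑ m, ∑ k, ∑ l, pd1 (pd1 (pd1 u m) k) l x *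
  Lop (fun i j => pd1 (pd1 (pd1 (q i j) m) k) l) (fun j => pd1 (pd1 (pd1 (b j) m) k) l)
    (pd1 (pd1 (pd1 c m) k) l) u x

lemma EE_eq (k : ℕ) (u : Fn N) (x : ES N) :
    EE q b c k u x = EE q b (fun _ => 0) k u x + c x * SS k u x := by
  induction k generalizing u with
  | zero => simp only [EE, SS, Lop]; ring
  | succ k ih => simp only [EE, SS, ih, sum_add_distrib, mul_sum]

variable {q b c} (hq : ∀ i j, Smooth (q i j)) (hb : ∀ j, Smooth (b j))
  (hc : Smooth c)

include hq hb hc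

lemma TT_one {u : Fn N} (hu : Smooth u) (x : ES N) :
    TT 1 u (Lop q b c u) x = EE q b c 1 u x + C1 q b c u x := by
  simp only [TT, EE, C1, pd1_Lop hq hb hc hu, mul_add, sum_add_distrib]

lemma TT_two {u : Fn N} (hu : Smooth u) (x : ES N) :
    TT 2 u (Lop q b c u) x = EE q b c 2 u x + 2 * ∑ i, C1 q b c (pd1 u i) x + C2 q b c u x := by
  have hq1 : ∀ l i j, Smooth (pd1 (q i j) l) := fun l i j => smooth_pd1 (hq i j) l
  have hb1 : ∀ l j, Smooth (pd1 (b j) l) := fun l j => smooth_pd1 (hb j) l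
  have hc1 : ∀ l, Smooth (pd1 c l) := fun l => smooth_pd1 hc l
  have e : TT 2 u (Lop q b c u) x = ∑ i, TT 1 (pd1 u i) (pd1 (Lop q b c u) i) x := rfl
  have e2 : ∀ i, TT 1 (pd1 u i) (pd1 (Lop q b c u) i) x = EE q b c 1 (pd1 u i) x
      + C1 q b c (pd1 u i) x + TT 1 (pd1 u i) (Lop (fun k j => pd1 (q k j) i)
        (fun j => pd1 (b j) i) (pd1 c i) u) x := fun i => by
    rw [pd1_Lop hq hb hc hu, TT_add 1 (smooth_Lop hq hb hc (smooth_pd1 hu i))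
      (smooth_Lop (hq1 i) (hb1 i) (hc1 i) hu), TT_one hq hb hc (smooth_pd1 hu i)]
  have e3 : ∑ i, TT 1 (pd1 u i) (Lop (fun k j => pd1 (q k j) i)
      (fun j => pd1 (b j) i) (pd1 c i) u) x = ∑ i, C1 q b c (pd1 u i) x + C2 q b c u x := by
    simp only [TT, pd1_Lop (hq1 _) (hb1 _) (hc1 _) hu, mul_add, sum_add_distrib, C1, C2]
    congr 1
    rw [sum_comm]
    refine sum_congr rfl fun i _ => sum_congr rfl fun j _ => ?_
    rw [pd1_comm (hu.of_le (smooth_le 2))]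
  rw [e, sum_congr rfl fun i _ => e2 i, sum_add_distrib, e3,
    sum_add_distrib]
  simp only [EE]
  ring

lemma TT_three {u : Fn N} (hu : Smooth u) (x : ES N) :
    TT 3 u (Lop q b c u) x = EE q b c 3 u x + 3 * ∑ i, ∑ j, C1 q b c (pd1 (pd1 u i) j) x
      + 3 * ∑ i, C2 q b c (pd1 u i) x + C3 q b c u x := by
  have hq1 : ∀ l i j, Smooth (pd1 (q i j) l) := fun l i j => smooth_pd1 (hq i j) l
  have hb1 : ∀ l j, Smooth (pd1 (b j) l) := fun l j => smooth_pd1 (hb j) l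
  have hc1 : ∀ l, Smooth (pd1 c l) := fun l => smooth_pd1 hc l
  have hq2 : ∀ k l i j, Smooth (pd1 (pd1 (q i j) k) l) :=
    fun k l i j => smooth_pd1 (hq1 k i j) l
  have hb2 : ∀ k l j, Smooth (pd1 (pd1 (b j) k) l) := fun k l j => smooth_pd1 (hb1 k j) l
  have hc2 : ∀ k l, Smooth (pd1 (pd1 c k) l) := fun k l => smooth_pd1 (hc1 k) l
  have hu1 : ∀ i, Smooth (pd1 u i) := smooth_pd1 hu
  have hcm : ∀ i j, pd1 (pd1 u i) j = pd1 (pd1 u j) i :=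
    fun i j => pd1_comm (hu.of_le (smooth_le 2)) i j
  have hcm1 : ∀ i j k, pd1 (pd1 (pd1 u i) j) k = pd1 (pd1 (pd1 u i) k) j :=
    fun i j k => pd1_comm ((hu1 i).of_le (smooth_le 2)) j k
  have e : TT 3 u (Lop q b c u) x = ∑ i, TT 2 (pd1 u i) (pd1 (Lop q b c u) i) x := rfl
  have e2 : ∀ i, TT 2 (pd1 u i) (pd1 (Lop q b c u) i) x = EE q b c 2 (pd1 u i) x
      + 2 * ∑ j, C1 q b c (pd1 (pd1 u i) j) x + C2 q b c (pd1 u i) x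
      + TT 2 (pd1 u i) (Lop (fun k j => pd1 (q k j) i)
        (fun j => pd1 (b j) i) (pd1 c i) u) x := fun i => by
    rw [pd1_Lop hq hb hc hu, TT_add 2 (smooth_Lop hq hb hc (hu1 i))
      (smooth_Lop (hq1 i) (hb1 i) (hc1 i) hu), TT_two hq hb hc (hu1 i)]
  have e4 : ∀ i j, pd1 (fun x => Lop (fun k l => pd1 (q k l) i) (fun l => pd1 (b l) i) (pd1 c i)
      (pd1 u j) x + Lop (fun k l => pd1 (pd1 (q k l) i) j) (fun l => pd1 (pd1 (b l) i) j)
        (pd1 (pd1 c i) j) u x) = fun m x =>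
      (Lop (fun k l => pd1 (q k l) i) (fun l => pd1 (b l) i) (pd1 c i) (pd1 (pd1 u j) m) x
      + Lop (fun k l => pd1 (pd1 (q k l) i) m) (fun l => pd1 (pd1 (b l) i) m) (pd1 (pd1 c i) m)
        (pd1 u j) x) + (Lop (fun k l => pd1 (pd1 (q k l) i) j) (fun l => pd1 (pd1 (b l) i) j)
        (pd1 (pd1 c i) j) (pd1 u m) x + Lop (fun k l => pd1 (pd1 (pd1 (q k l) i) j) m)
          (fun l => pd1 (pd1 (pd1 (b l) i) j) m) (pd1 (pd1 (pd1 c i) j) m) u x) := by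
    intro i j
    funext m
    rw [pd1_add (smooth_diff (smooth_Lop (hq1 i) (hb1 i) (hc1 i) (hu1 j)))
      (smooth_diff (smooth_Lop (hq2 i j) (hb2 i j) (hc2 i j) hu)),
      pd1_Lop (hq1 i) (hb1 i) (hc1 i) (hu1 j), pd1_Lop (hq2 i j) (hb2 i j) (hc2 i j) hu]
  have e3 : ∑ i, TT 2 (pd1 u i) (Lop (fun k j => pd1 (q k j) i)
      (fun j => pd1 (b j) i) (pd1 c i) u) x = ∑ i, ∑ j, C1 q b c (pd1 (pd1 u i) j) x
      + 2 * ∑ i, C2 q b c (pd1 u i) x + C3 q b c u x := by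
    have a1 : ∀ F : Fin N → Fin N → Fin N → ℝ,
        ∑ i, ∑ j, ∑ m, F i j m = ∑ j, ∑ m, ∑ i, F i j m := fun F => by
      rw [sum_comm]
      exact sum_congr rfl fun j _ => sum_comm
    have a2 : ∀ F : Fin N → Fin N → Fin N → ℝ,
        ∑ i, ∑ j, ∑ m, F i j m = ∑ j, ∑ i, ∑ m, F i j m := fun F => sum_comm
    have b1 : ∀ i j m, pd1 (pd1 (pd1 u i) j) m x = pd1 (pd1 (pd1 u j) m) i x := fun i j m => by
      rw [hcm i j, hcm1 j i m]
    have b2 : ∀ i j m, pd1 (pd1 (pd1 u i) j) m x = pd1 (pd1 (pd1 u j) i) m x := fun i j m => by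
      rw [hcm i j]
    have b3 : ∀ i j m, pd1 (pd1 (pd1 u i) j) m x = pd1 (pd1 (pd1 u m) i) j x := fun i j m => by
      rw [b1, b1]
    have f1 : ∑ i, ∑ j, ∑ m, pd1 (pd1 (pd1 u i) j) m x * Lop (fun k j => pd1 (q k j) i)
        (fun l => pd1 (b l) i) (pd1 c i) (pd1 (pd1 u j) m) x
        = ∑ i, ∑ j, C1 q b c (pd1 (pd1 u i) j) x := by
      refine (a1 _).trans (sum_congr rfl fun j _ => sum_congr rfl fun m _ =>
        sum_congr rfl fun i _ => ?_)
      rw [b1 i j m]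
    have f2 : ∑ i, ∑ j, ∑ m, pd1 (pd1 (pd1 u i) j) m x * Lop (fun k l => pd1 (pd1 (q k l) i) m)
        (fun l => pd1 (pd1 (b l) i) m) (pd1 (pd1 c i) m) (pd1 u j) x
        = ∑ i, C2 q b c (pd1 u i) x := by
      refine (a2 _).trans (sum_congr rfl fun j _ => sum_congr rfl fun i _ =>
        sum_congr rfl fun m _ => ?_)
      rw [b2 i j m]
    have f3 : ∑ i, ∑ j, ∑ m, pd1 (pd1 (pd1 u i) j) m x * Lop (fun k l => pd1 (pd1 (q k l) i) j)
        (fun l => pd1 (pd1 (b l) i) j) (pd1 (pd1 c i) j) (pd1 u m) x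
        = ∑ i, C2 q b c (pd1 u i) x := by
      refine (a1 fun m i j => _).symm.trans (sum_congr rfl fun m _ =>
        sum_congr rfl fun i _ => sum_congr rfl fun j _ => ?_)
      rw [b3 i j m]
    simp only [TT, pd1_Lop (hq1 _) (hb1 _) (hc1 _) hu, e4, mul_add, sum_add_distrib]
    rw [f1, f2, f3]
    simp only [C3]
    ring
  rw [e, sum_congr rfl fun i _ => e2 i, sum_add_distrib, e3,
    sum_add_distrib, sum_add_distrib, ← mul_sum]
  simp only [EE]
  ring

end Commutators

/-- The structural conditions on the coefficients at the point `x`. -/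
structure Pt (q : Fin N → VF N) (b : VF N) (c : Fn N)
    (B ν d r ϱ : ℝ) (x : ES N) : Prop where
  B_nonneg : 0 ≤ B
  ν_nonneg : 0 ≤ ν
  q1 : ∀ i j l, |pd1 (q i j) l x| ≤ B * ν
  q2 : ∀ Ξ : Fin N → Fin N → ℝ, (∀ i j, Ξ i j = Ξ j i) →
    ∑ k, ∑ l, ∑ i, ∑ j, pd1 (pd1 (q i j) k) l x * Ξ i j * Ξ k l ≤ B * ν * ∑ i, ∑ j, Ξ i j ^ 2
  q3 : ∀ i j m k l, |pd1 (pd1 (pd1 (q i j) m) k) l x| ≤ B * ν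
  b1 : ∀ ξ : Fin N → ℝ, ∑ i, ∑ j, pd1 (b i) j x * ξ j * ξ i ≤ d * ∑ i, ξ i ^ 2
  b2 : ∀ j k l, |pd1 (pd1 (b j) k) l x| ≤ r
  b3 : ∀ j m k l, |pd1 (pd1 (pd1 (b j) m) k) l x| ≤ r
  c1 : ∀ k, |pd1 c k x| ≤ ϱ
  c2 : ∀ k l, |pd1 (pd1 c k) l x| ≤ ϱ
  c3 : ∀ m k l, |pd1 (pd1 (pd1 c m) k) l x| ≤ ϱ

/-- The constant in the commutator estimates. -/
def comC (N : ℕ) (B : ℝ) : ℝ := (B + 1) * ((N : ℝ) ^ 3 + N ^ 2 + N + 1)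

section

variable {q : Fin N → VF N} {b : VF N} {c : Fn N}
  {B ν d r ϱ : ℝ} {x : ES N}

lemma SS_one (u : Fn N) (x : ES N) : SS 1 u x = ∑ i, pd1 u i x ^ 2 := rfl

lemma SS_two (u : Fn N) (x : ES N) : SS 2 u x = ∑ i, ∑ j, pd1 (pd1 u i) j x ^ 2 := rfl

lemma SS_three (u : Fn N) (x : ES N) :
    SS 3 u x = ∑ i, ∑ j, ∑ k, pd1 (pd1 (pd1 u i) j) k x ^ 2 := rfl

lemma comC_aux {B a s t : ℝ} (hB : 0 ≤ B) (ha : 0 ≤ a) (hs : 0 ≤ s) (ht : t ≤ (N : ℝ) ^ 3 + N ^ 2 + N + 1) :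
    B * a * t * s ≤ comC N B * (a * s) := by
  have h1 : 0 ≤ B * (a * s) := by positivity
  have h2 : 0 ≤ (a * s) * ((N : ℝ) ^ 3 + N ^ 2 + N + 1) := by positivity
  unfold comC
  nlinarith [mul_le_mul_of_nonneg_left ht h1]

lemma comC_aux' {B a s t : ℝ} (hB : 0 ≤ B) (ha : 0 ≤ a) (hs : 0 ≤ s) (ht : t ≤ (N : ℝ) ^ 3 + N ^ 2 + N + 1) :
    a * t * s ≤ comC N B * (a * s) := by
  have h1 : 0 ≤ (a * s) := by positivity
  have h2 : 0 ≤ B * (a * s) * ((N : ℝ) ^ 3 + N ^ 2 + N + 1) := by positivity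
  unfold comC
  nlinarith [mul_le_mul_of_nonneg_left ht h1]

lemma Pt.C1_le (H : Pt q b c B ν d r ϱ x) (u : Fn N) {y : ℝ} (hy : 0 ≤ y) :
    y ^ 2 * C1 q b c u x ≤ d * (y ^ 2 * SS 1 u x) + comC N B *
      (ν * y * (SS 1 u x + y ^ 2 * SS 2 u x) + (y ^ 4 * ϱ ^ 2 * SS 1 u x + SS 0 u x)) := by
  have hn : (0 : ℝ) ≤ N := Nat.cast_nonneg N
  have s1 := SS_nonneg 1 u x
  have s2 := SS_nonneg 2 u x
  have s0 := SS_nonneg 0 u x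
  have hB := H.B_nonneg
  have hν := H.ν_nonneg
  have e : y ^ 2 * C1 q b c u x
      = y ^ 2 * ∑ l, pd1 u l x * ∑ p : Fin N × Fin N, pd1 (q p.2 p.1) l x * pd1 (pd1 u p.1) p.2 x
      + y ^ 2 * ∑ i, ∑ j, pd1 (b i) j x * pd1 u j x * pd1 u i x
      + y ^ 2 * ∑ l, pd1 u l x * ∑ _p : Unit, pd1 c l x * u x := by
    simp only [C1, Lop, Fintype.sum_prod_type, mul_add, sum_add_distrib, Finset.univ_unique,
      sum_singleton]
    congr 3
    · refine sum_congr rfl fun l _ => congrArg _ ?_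
      rw [sum_comm]; rfl
    · rw [sum_comm]
      simp only [mul_sum]
      exact sum_congr rfl fun l _ => sum_congr rfl fun j _ => by ring
  have t1 := young_sum (A := fun (l : Fin N) (p : Fin N × Fin N) => pd1 (q p.2 p.1) l x)
    (K := B * (ν * y)) (X := 1) (Y := y) (W := y ^ 2) (by positivity)
    (fun l p => by
      rw [abs_mul, abs_of_nonneg (by positivity : 0 ≤ y ^ 2)]
      nlinarith [mul_le_mul_of_nonneg_left (H.q1 p.2 p.1 l) (by positivity : 0 ≤ y ^ 2)])
    (fun l => pd1 u l x) (fun p => pd1 (pd1 u p.1) p.2 x)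
  have t2 := mul_le_mul_of_nonneg_left (H.b1 fun i => pd1 u i x) (by positivity : 0 ≤ y ^ 2)
  have t3 := young_sum (A := fun (l : Fin N) (_ : Unit) => pd1 c l x)
    (K := 1) (X := y ^ 2 * ϱ) (Y := 1) (W := y ^ 2) (by positivity)
    (fun l p => by
      rw [abs_mul, abs_of_nonneg (by positivity : 0 ≤ y ^ 2)]
      nlinarith [mul_le_mul_of_nonneg_left (H.c1 l) (by positivity : 0 ≤ y ^ 2)])
    (fun l => pd1 u l x) (fun _ => u x)
  simp only [Fintype.card_prod, Fintype.card_fin, Fintype.sum_prod_type, Fintype.card_unit,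
    Finset.univ_unique, sum_singleton, one_pow, one_mul, Nat.cast_mul, Nat.cast_one]
    at t1 t2 t3
  simp only [← SS_two] at t1
  simp only [← SS_one] at t1 t2 t3
  have u1 := comC_aux (N := N) (t := N + N * N) (s := SS 1 u x + y ^ 2 * SS 2 u x) hB
    (mul_nonneg hν hy) (by positivity) (by nlinarith [pow_nonneg hn 3])
  have u3 := comC_aux' (N := N) (a := 1) (t := N + 1)
    (s := (y ^ 2 * ϱ) ^ 2 * SS 1 u x + SS 0 u x) hB
    (by norm_num) (by positivity) (by nlinarith [pow_nonneg hn 3])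
  have u4 : SS 0 u x = u x ^ 2 := rfl
  rw [← u4] at t3
  rw [e]
  simp only [Fintype.sum_prod_type, Finset.univ_unique, sum_singleton]
  linarith

lemma Pt.C2_le (H : Pt q b c B ν d r ϱ x) {u : Fn N} (hu : Smooth u) {y : ℝ}
    (hy : 0 ≤ y) (hr : 0 ≤ r) :
    y ^ 4 * C2 q b c u x ≤ comC N B * (ν * y ^ 4 * SS 2 u x +
      r * y * (y ^ 4 * SS 2 u x + y ^ 2 * SS 1 u x) + (y ^ 8 * ϱ ^ 2 * SS 2 u x + SS 0 u x)) := by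
  have hn : (0 : ℝ) ≤ N := Nat.cast_nonneg N
  have s1 := SS_nonneg 1 u x
  have s2 := SS_nonneg 2 u x
  have s0 := SS_nonneg 0 u x
  have hB := H.B_nonneg
  have hν := H.ν_nonneg
  have hcm : ∀ i j, pd1 (pd1 u i) j = pd1 (pd1 u j) i :=
    fun i j => pd1_comm (hu.of_le (smooth_le 2)) i j
  have e : y ^ 4 * C2 q b c u x
      = y ^ 4 * ∑ k, ∑ l, ∑ i, ∑ j, pd1 (pd1 (q i j) k) l x * pd1 (pd1 u i) j x
          * pd1 (pd1 u k) l x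
      + y ^ 4 * ∑ p : Fin N × Fin N, pd1 (pd1 u p.1) p.2 x *
          ∑ j, pd1 (pd1 (b j) p.1) p.2 x * pd1 u j x
      + y ^ 4 * ∑ p : Fin N × Fin N, pd1 (pd1 u p.1) p.2 x *
          ∑ _p : Unit, pd1 (pd1 c p.1) p.2 x * u x := by
    simp only [C2, Lop, Fintype.sum_prod_type, mul_add, sum_add_distrib, Finset.univ_unique,
      sum_singleton, pd2]
    congr 3
    refine sum_congr rfl fun k _ => sum_congr rfl fun l _ => ?_
    simp only [mul_sum]
    exact sum_congr rfl fun i _ => sum_congr rfl fun j _ => by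
      rw [hcm i j]; ring
  have t1 := mul_le_mul_of_nonneg_left (H.q2 (fun i j => pd1 (pd1 u i) j x)
    fun i j => by rw [hcm]) (by positivity : 0 ≤ y ^ 4)
  have t2 := young_sum (A := fun (p : Fin N × Fin N) (j : Fin N) => pd1 (pd1 (b j) p.1) p.2 x)
    (K := r * y) (X := y ^ 2) (Y := y) (W := y ^ 4) (by positivity)
    (fun p j => by
      rw [abs_mul, abs_of_nonneg (by positivity : 0 ≤ y ^ 4)]
      nlinarith [mul_le_mul_of_nonneg_left (H.b2 j p.1 p.2) (by positivity : 0 ≤ y ^ 4)])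
    (fun p => pd1 (pd1 u p.1) p.2 x) (fun j => pd1 u j x)
  have t3 := young_sum (A := fun (p : Fin N × Fin N) (_ : Unit) => pd1 (pd1 c p.1) p.2 x)
    (K := 1) (X := y ^ 4 * ϱ) (Y := 1) (W := y ^ 4) (by positivity)
    (fun p _ => by
      rw [abs_mul, abs_of_nonneg (by positivity : 0 ≤ y ^ 4)]
      nlinarith [mul_le_mul_of_nonneg_left (H.c2 p.1 p.2) (by positivity : 0 ≤ y ^ 4)])
    (fun p => pd1 (pd1 u p.1) p.2 x) (fun _ => u x)
  simp only [Fintype.card_prod, Fintype.card_fin, Fintype.sum_prod_type, Fintype.card_unit,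
    Finset.univ_unique, sum_singleton, one_pow, one_mul, Nat.cast_mul, Nat.cast_one]
    at t1 t2 t3
  simp only [← SS_two] at t1 t2 t3
  simp only [← SS_one] at t2
  have u1 := comC_aux (N := N) (t := 1) (s := SS 2 u x) hB
    (mul_nonneg hν (pow_nonneg hy 4)) (by positivity) (by nlinarith [pow_nonneg hn 3, pow_nonneg hn 2])
  have u2 := comC_aux' (N := N) (a := r * y) (t := N * N + N)
    (s := (y ^ 2) ^ 2 * SS 2 u x + y ^ 2 * SS 1 u x) hB
    (by positivity) (by positivity) (by nlinarith [pow_nonneg hn 3])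
  have u3 := comC_aux' (N := N) (a := 1) (t := N * N + 1)
    (s := (y ^ 4 * ϱ) ^ 2 * SS 2 u x + SS 0 u x) hB
    (by norm_num) (by positivity) (by nlinarith [pow_nonneg hn 3])
  have u4 : SS 0 u x = u x ^ 2 := rfl
  rw [← u4] at t3
  rw [e]
  simp only [Fintype.sum_prod_type, Finset.univ_unique, sum_singleton]
  linarith

lemma Pt.C3_le (H : Pt q b c B ν d r ϱ x) (u : Fn N) {y : ℝ}
    (hy : 0 ≤ y) (hr : 0 ≤ r) :
    y ^ 6 * C3 q b c u x ≤ comC N B * (ν * y ^ 3 * (y ^ 4 * SS 3 u x + y ^ 2 * SS 2 u x) +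
      r * y ^ 2 * (y ^ 6 * SS 3 u x + y ^ 2 * SS 1 u x)
        + (y ^ 12 * ϱ ^ 2 * SS 3 u x + SS 0 u x)) := by
  have hn : (0 : ℝ) ≤ N := Nat.cast_nonneg N
  have s1 := SS_nonneg 1 u x
  have s2 := SS_nonneg 2 u x
  have s3 := SS_nonneg 3 u x
  have s0 := SS_nonneg 0 u x
  have hB := H.B_nonneg
  have hν := H.ν_nonneg
  have e : y ^ 6 * C3 q b c u x
      = y ^ 6 * ∑ p : Fin N × Fin N × Fin N, pd1 (pd1 (pd1 u p.1) p.2.1) p.2.2 x *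
        ∑ t : Fin N × Fin N, pd1 (pd1 (pd1 (q t.2 t.1) p.1) p.2.1) p.2.2 x * pd1 (pd1 u t.1) t.2 x
      + y ^ 6 * ∑ p : Fin N × Fin N × Fin N, pd1 (pd1 (pd1 u p.1) p.2.1) p.2.2 x *
          ∑ j, pd1 (pd1 (pd1 (b j) p.1) p.2.1) p.2.2 x * pd1 u j x
      + y ^ 6 * ∑ p : Fin N × Fin N × Fin N, pd1 (pd1 (pd1 u p.1) p.2.1) p.2.2 x *
          ∑ _p : Unit, pd1 (pd1 (pd1 c p.1) p.2.1) p.2.2 x * u x := by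
    simp only [C3, Lop, Fintype.sum_prod_type, mul_add, sum_add_distrib, Finset.univ_unique,
      sum_singleton, pd2]
    congr 3
    refine sum_congr rfl fun m _ => sum_congr rfl fun k _ =>
      sum_congr rfl fun l _ => congrArg _ ?_
    rw [sum_comm]
  have t1 := young_sum (A := fun (p : Fin N × Fin N × Fin N) (t : Fin N × Fin N) =>
      pd1 (pd1 (pd1 (q t.2 t.1) p.1) p.2.1) p.2.2 x)
    (K := B * (ν * y ^ 3)) (X := y ^ 2) (Y := y) (W := y ^ 6) (by positivity)
    (fun p t => by
      rw [abs_mul, abs_of_nonneg (by positivity : 0 ≤ y ^ 6)]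
      nlinarith [mul_le_mul_of_nonneg_left (H.q3 t.2 t.1 p.1 p.2.1 p.2.2)
        (by positivity : 0 ≤ y ^ 6)])
    (fun p => pd1 (pd1 (pd1 u p.1) p.2.1) p.2.2 x) (fun t => pd1 (pd1 u t.1) t.2 x)
  have t2 := young_sum (A := fun (p : Fin N × Fin N × Fin N) (j : Fin N) =>
      pd1 (pd1 (pd1 (b j) p.1) p.2.1) p.2.2 x)
    (K := r * y ^ 2) (X := y ^ 3) (Y := y) (W := y ^ 6) (by positivity)
    (fun p j => by
      rw [abs_mul, abs_of_nonneg (by positivity : 0 ≤ y ^ 6)]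
      nlinarith [mul_le_mul_of_nonneg_left (H.b3 j p.1 p.2.1 p.2.2) (by positivity : 0 ≤ y ^ 6)])
    (fun p => pd1 (pd1 (pd1 u p.1) p.2.1) p.2.2 x) (fun j => pd1 u j x)
  have t3 := young_sum (A := fun (p : Fin N × Fin N × Fin N) (_ : Unit) =>
      pd1 (pd1 (pd1 c p.1) p.2.1) p.2.2 x)
    (K := 1) (X := y ^ 6 * ϱ) (Y := 1) (W := y ^ 6) (by positivity)
    (fun p _ => by
      rw [abs_mul, abs_of_nonneg (by positivity : 0 ≤ y ^ 6)]
      nlinarith [mul_le_mul_of_nonneg_left (H.c3 p.1 p.2.1 p.2.2) (by positivity : 0 ≤ y ^ 6)])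
    (fun p => pd1 (pd1 (pd1 u p.1) p.2.1) p.2.2 x) (fun _ => u x)
  simp only [Fintype.card_prod, Fintype.card_fin, Fintype.sum_prod_type, Fintype.card_unit,
    Finset.univ_unique, sum_singleton, one_pow, one_mul, Nat.cast_mul, Nat.cast_one]
    at t1 t2 t3
  simp only [← SS_three] at t1 t2 t3
  simp only [← SS_two] at t1
  simp only [← SS_one] at t2
  have u1 := comC_aux (N := N) (t := N * (N * N) + N * N)
    (s := (y ^ 2) ^ 2 * SS 3 u x + y ^ 2 * SS 2 u x) hB
    (mul_nonneg hν (pow_nonneg hy 3)) (by positivity) (by nlinarith)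
  have u2 := comC_aux' (N := N) (a := r * y ^ 2) (t := N * (N * N) + N)
    (s := (y ^ 3) ^ 2 * SS 3 u x + y ^ 2 * SS 1 u x) hB
    (by positivity) (by positivity) (by nlinarith)
  have u3 := comC_aux' (N := N) (a := 1) (t := N * (N * N) + 1)
    (s := (y ^ 6 * ϱ) ^ 2 * SS 3 u x + SS 0 u x) hB
    (by norm_num) (by positivity) (by nlinarith)
  have u4 : SS 0 u x = u x ^ 2 := rfl
  rw [← u4] at t3
  rw [e]
  simp only [Fintype.sum_prod_type, Finset.univ_unique, sum_singleton]
  linarith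

lemma Lop_add (q : Fin N → VF N) (b : VF N) (c : Fn N)
    {f g : Fn N} (hf : Smooth f) (hg : Smooth g) (x : ES N) :
    Lop q b c (fun x => f x + g x) x = Lop q b c f x + Lop q b c g x := by
  have h1 : ∀ i, pd1 (fun x => f x + g x) i = fun x => pd1 f i x + pd1 g i x :=
    fun i => pd1_add (smooth_diff hf) (smooth_diff hg) i
  have h2 : ∀ i j, pd2 (fun x => f x + g x) i j = fun x => pd2 f i j x + pd2 g i j x := fun i j => by
    simp only [pd2]
    rw [h1, pd1_add (smooth_diff (smooth_pd1 hf j)) (smooth_diff (smooth_pd1 hg j))]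
  simp only [Lop, h1, h2, mul_add, sum_add_distrib]
  ring

lemma Lop_zero (q : Fin N → VF N) (b : VF N) (c : Fn N) (x : ES N) :
    Lop q b c (fun _ => 0) x = 0 := by
  simp [Lop, pd2, pd1_const]

lemma Lop_sum (q : Fin N → VF N) (b : VF N) (c : Fn N) {ι : Type*}
    (s : Finset ι) {f : ι → Fn N} (hf : ∀ k, Smooth (f k)) (x : ES N) :
    Lop q b c (fun x => ∑ k ∈ s, f k x) x = ∑ k ∈ s, Lop q b c (f k) x := by
  induction s using Finset.induction_on with
  | empty => simpa using Lop_zero q b c x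
  | insert a s ha ih =>
    simp only [sum_insert ha]
    rw [Lop_add q b c (hf a) (ContDiff.sum fun k _ => hf k), ih]

/-- The carré du champ operator. -/
def Gam (q : Fin N → VF N) (f g : Fn N) (x : ES N) : ℝ :=
  ∑ i, ∑ j, q i j x * pd1 f i x * pd1 g j x

lemma Lop_mul (hq : ∀ i j, q i j = q j i) (b : VF N)
    {f g : Fn N} (hf : Smooth f) (hg : Smooth g) (x : ES N) :
    Lop q b (fun _ => 0) (fun x => f x * g x) x = f x * Lop q b (fun _ => 0) g x
      + g x * Lop q b (fun _ => 0) f x + 2 * Gam q f g x := by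
  have h1 : ∀ i, pd1 (fun x => f x * g x) i = fun x => pd1 f i x * g x + f x * pd1 g i x :=
    fun i => pd1_mul (smooth_diff hf) (smooth_diff hg) i
  have h2 : ∀ i j, pd2 (fun x => f x * g x) i j = fun x => (pd2 f i j x * g x
      + pd1 f j x * pd1 g i x) + (pd1 f i x * pd1 g j x + f x * pd2 g i j x) := fun i j => by
    have hf' := smooth_pd1 hf j
    have hg' := smooth_pd1 hg j
    simp only [pd2]
    rw [h1, pd1_add (smooth_diff (hf'.mul hg)) (smooth_diff (hf.mul hg')),
      pd1_mul (smooth_diff hf') (smooth_diff hg), pd1_mul (smooth_diff hf) (smooth_diff hg')]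
  have e : ∑ i, ∑ j, q i j x * (pd1 f j x * pd1 g i x) = Gam q f g x := by
    rw [Gam, sum_comm]
    exact sum_congr rfl fun i _ => sum_congr rfl fun j _ => by rw [hq]; ring
  have e' : ∑ i, ∑ j, q i j x * (pd1 f i x * pd1 g j x) = Gam q f g x :=
    sum_congr rfl fun i _ => sum_congr rfl fun j _ => by ring
  have e1 : ∑ i, ∑ j, q i j x * (pd2 f i j x * g x) = g x * ∑ i, ∑ j, q i j x * pd2 f i j x := by
    simp only [mul_sum]
    exact sum_congr rfl fun i _ => sum_congr rfl fun j _ => by ring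
  have e2 : ∑ i, ∑ j, q i j x * (f x * pd2 g i j x) = f x * ∑ i, ∑ j, q i j x * pd2 g i j x := by
    simp only [mul_sum]
    exact sum_congr rfl fun i _ => sum_congr rfl fun j _ => by ring
  have e3 : ∑ j, b j x * (pd1 f j x * g x) = g x * ∑ j, b j x * pd1 f j x := by
    simp only [mul_sum]
    exact sum_congr rfl fun i _ => by ring
  have e4 : ∑ j, b j x * (f x * pd1 g j x) = f x * ∑ j, b j x * pd1 g j x := by
    simp only [mul_sum]
    exact sum_congr rfl fun i _ => by ring
  simp only [Lop, h1, h2, mul_add, sum_add_distrib, e, e', e1, e2, e3, e4]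
  ring

lemma pd1_pow (hf : Smooth f) (m : ℕ) (i : Fin N) :
    pd1 (fun x => f x ^ (m + 1)) i = fun x => (m + 1) * f x ^ m * pd1 f i x := by
  induction m with
  | zero => simp
  | succ m ih =>
    have : (fun x => f x ^ (m + 1 + 1)) = fun x => f x ^ (m + 1) * f x := funext fun x => pow_succ _ _
    rw [this, pd1_mul (smooth_diff (hf.pow _)) (smooth_diff hf), ih]
    ext x
    push_cast
    ring

lemma Gam_pow (f : Fn N) {g : Fn N} (hg : Smooth g) (m : ℕ) (x : ES N) :
    Gam q f (fun x => g x ^ (m + 1)) x = (m + 1) * g x ^ m * Gam q f g x := by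
  simp only [Gam, pd1_pow hg, mul_sum]
  exact sum_congr rfl fun i _ => sum_congr rfl fun j _ => by ring

lemma Gam_pow_left (g : Fn N) (hf : Smooth f) (m : ℕ) (x : ES N) :
    Gam q (fun x => f x ^ (m + 1)) g x = (m + 1) * f x ^ m * Gam q f g x := by
  simp only [Gam, pd1_pow hf, mul_sum]
  exact sum_congr rfl fun i _ => sum_congr rfl fun j _ => by ring

variable (hq : ∀ i j, q i j = q j i)
  (hpos : ∀ x (ξ : Fin N → ℝ), 0 ≤ ∑ i, ∑ j, q i j x * ξ i * ξ j)

include hq hpos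

lemma Lop_pow_ge {η : Fn N} (hη : Smooth η) (m : ℕ) {x : ES N} (h0 : 0 ≤ η x) :
    (m + 1) * η x ^ m * Lop q b (fun _ => 0) η x
      ≤ Lop q b (fun _ => 0) (fun x => η x ^ (m + 1)) x := by
  induction m with
  | zero => simp
  | succ m ih =>
    have : (fun x => η x ^ (m + 1 + 1)) = fun x => η x * η x ^ (m + 1) := funext fun x => pow_succ' _ _
    rw [this, Lop_mul hq b hη (hη.pow (m + 1)), Gam_pow η hη]
    have h2 : 0 ≤ Gam q η η x := hpos x _
    have h3 : 0 ≤ (m + 1 : ℝ) * η x ^ m * Gam q η η x := by positivity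
    have h4 := mul_le_mul_of_nonneg_left ih h0
    push_cast
    have h5 : η x * ((m + 1) * η x ^ m * Lop q b (fun _ => 0) η x)
      = (m + 1) * η x ^ (m + 1) * Lop q b (fun _ => 0) η x := by ring
    nlinarith

lemma energy_ge {η g : Fn N} (hη : Smooth η) (hg : Smooth g) (m : ℕ) {x : ES N}
    (h0 : 0 ≤ η x) :
    2 * η x ^ (m + 1) * (g x * Lop q b (fun _ => 0) g x) + 2 * η x ^ (m + 1) * Gam q g g x
      + (m + 1) * η x ^ m * g x ^ 2 * Lop q b (fun _ => 0) η x
      + 4 * (m + 1) * η x ^ m * (g x * Gam q η g x)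
      ≤ Lop q b (fun _ => 0) (fun x => η x ^ (m + 1) * g x ^ 2) x := by
  rw [Lop_mul hq b (hη.pow (m + 1)) (hg.pow 2), Gam_pow_left _ hη, Gam_pow (m := 1) _ hg]
  have h1 : Lop q b (fun _ => 0) (fun x => g x ^ 2) x
      = 2 * (g x * Lop q b (fun _ => 0) g x) + 2 * Gam q g g x := by
    have : (fun x => g x ^ 2) = fun x => g x * g x := funext fun x => sq _
    rw [this, Lop_mul hq b hg hg]; ring
  have h2 := mul_le_mul_of_nonneg_left (Lop_pow_ge (b := b) hq hpos hη m h0) (sq_nonneg (g x))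
  rw [h1]
  push_cast
  linarith

/-- Weighted energy inequality where the weight vanishes. -/
lemma energy_SS_of_zero {η u : Fn N} (hη : Smooth η) (hu : Smooth u) (k m : ℕ)
    {x : ES N} (h0 : η x = 0) :
    0 ≤ Lop q b (fun _ => 0) (fun x => η x ^ (m + 2) * SS k u x) x := by
  induction k generalizing u with
  | zero =>
    have := energy_ge (b := b) hq hpos hη hu (m + 1) h0.ge
    simpa [h0, SS] using this
  | succ k ih =>
    simp only [SS, mul_sum]
    rw [Lop_sum _ _ _ _ fun i => (hη.pow _).mul (smooth_SS k (smooth_pd1 hu i))]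
    exact sum_nonneg fun i _ => ih (smooth_pd1 hu i)

/-- Weighted energy inequality. -/
lemma energy_SS {η u : Fn N} (hη : Smooth η) (hu : Smooth u) (k m : ℕ) {x : ES N}
    {B ν s : ℝ} (hB : 0 ≤ B) (hν : 0 ≤ ν) (hs : 0 ≤ s) (hs1 : s ≤ 1) (h0 : 0 ≤ η x) (h1 : η x ≤ 1)
    (hell : ∀ ξ : Fin N → ℝ, ν * ∑ i, ξ i ^ 2 ≤ ∑ i, ∑ j, q i j x * ξ i * ξ j)
    (hL : -(B * ν) ≤ Lop q b (fun _ => 0) η x)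
    (hΓ : ∀ (t : ℝ) (ξ : Fin N → ℝ), -(B * ν * (t ^ 2 + ∑ i, ξ i ^ 2))
      ≤ t * ∑ i, ∑ j, q i j x * pd1 η i x * ξ j) :
    2 * (s * η x) ^ (m + 2) * EE q b (fun _ => 0) k u x
      + 2 * ν * (s * η x) ^ (m + 2) * SS (k + 1) u x
      - 5 * (m + 2) * (s * (B * ν)) * (s * η x) ^ m * (SS k u x + (s * η x) ^ 2 * SS (k + 1) u x)
      ≤ s ^ (m + 2) * Lop q b (fun _ => 0) (fun x => η x ^ (m + 2) * SS k u x) x := by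
  induction k generalizing u with
  | zero =>
    have h := energy_ge (b := b) hq hpos hη hu (m + 1) h0
    set y := s * η x with hy
    have hy0 : 0 ≤ y := mul_nonneg hs h0
    have hy1 : y ≤ 1 := mul_le_one₀ hs1 h0 h1
    have g1 := mul_le_mul_of_nonneg_left (hell fun i => pd1 u i x)
      (by positivity : 0 ≤ 2 * y ^ (m + 2))
    have g2 := mul_le_mul_of_nonneg_left hL
      (by positivity : 0 ≤ (m + 2 : ℝ) * s * y ^ (m + 1) * u x ^ 2)
    have g3 := mul_le_mul_of_nonneg_left (hΓ (u x) fun i => y * pd1 u i x)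
      (by positivity : 0 ≤ 4 * (m + 2 : ℝ) * s * y ^ m)
    have e1 : ∑ i, (y * pd1 u i x) ^ 2 = y ^ 2 * ∑ i, pd1 u i x ^ 2 := by
      simp only [mul_pow, mul_sum]
    have e2 : ∑ i, ∑ j, q i j x * pd1 η i x * (y * pd1 u j x) = y * Gam q η u x := by
      simp only [Gam, mul_sum]
      exact sum_congr rfl fun i _ => sum_congr rfl fun j _ => by ring
    have g4 : (m + 2 : ℝ) * s * y ^ (m + 1) * u x ^ 2 * (B * ν)
        ≤ (m + 2 : ℝ) * s * y ^ m * u x ^ 2 * (B * ν) := by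
      rw [pow_succ]
      have : y ^ m * y ≤ y ^ m := mul_le_of_le_one_right (by positivity) hy1
      gcongr
    rw [e1, e2] at g3
    have h' := mul_le_mul_of_nonneg_left h (pow_nonneg hs (m + 2))
    simp only [SS, EE]
    have hG : ν * ∑ i, pd1 u i x ^ 2 ≤ Gam q u u x := hell _
    have e5 : s ^ (m + 2) * (2 * η x ^ (m + 1 + 1) * (u x * Lop q b (fun _ => 0) u x)
      + 2 * η x ^ (m + 1 + 1) * Gam q u u x
      + (((m + 1 : ℕ) : ℝ) + 1) * η x ^ (m + 1) * u x ^ 2 * Lop q b (fun _ => 0) η x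
      + 4 * (((m + 1 : ℕ) : ℝ) + 1) * η x ^ (m + 1) * (u x * Gam q η u x))
      = 2 * y ^ (m + 2) * (u x * Lop q b (fun _ => 0) u x) + 2 * y ^ (m + 2) * Gam q u u x
      + (m + 2) * s * y ^ (m + 1) * u x ^ 2 * Lop q b (fun _ => 0) η x
      + 4 * (m + 2) * s * y ^ m * (u x * (y * Gam q η u x)) := by
      rw [hy]; push_cast; simp only [mul_pow]; ring
    rw [e5] at h'
    have g5 : 0 ≤ (m + 2 : ℝ) * s * y ^ m * (B * ν) * (y ^ 2 * ∑ i, pd1 u i x ^ 2) := by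
      have : 0 ≤ ∑ i, pd1 u i x ^ 2 := sum_nonneg fun _ _ => sq_nonneg _
      positivity
    have g1' : 2 * y ^ (m + 2) * (ν * ∑ i, pd1 u i x ^ 2) ≤ 2 * y ^ (m + 2) * Gam q u u x := g1
    refine le_trans ?_ h'
    linarith
  | succ k ih =>
    simp only [SS, EE, mul_sum]
    rw [Lop_sum _ _ _ _ fun i => (hη.pow _).mul (smooth_SS k (smooth_pd1 hu i)), mul_sum,
      ← sum_add_distrib, ← sum_add_distrib, mul_sum, ← sum_sub_distrib]
    refine sum_le_sum fun i _ => ?_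
    have := ih (smooth_pd1 hu i)
    simpa only [SS, mul_sum] using this

end

/-- The hypotheses on a cut-off function `η` at a point `x` used in the Bernstein estimate. -/
structure CutPt (q : Fin N → VF N) (b : VF N) (η : Fn N)
    (B ν : ℝ) (x : ES N) : Prop where
  ell : ∀ ξ : Fin N → ℝ, ν * ∑ i, ξ i ^ 2 ≤ ∑ i, ∑ j, q i j x * ξ i * ξ j
  L : -(B * ν) ≤ Lop q b (fun _ => 0) η x
  Γ : ∀ (t : ℝ) (ξ : Fin N → ℝ), -(B * ν * (t ^ 2 + ∑ i, ξ i ^ 2))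
    ≤ t * ∑ i, ∑ j, q i j x * pd1 η i x * ξ j

/-- The constant collecting the commutator and cut-off terms. -/
def berD (N : ℕ) (B : ℝ) : ℝ := 24 * comC N B + 30 * B

lemma comC_nonneg (N : ℕ) {B : ℝ} (hB : 0 ≤ B) : 0 ≤ comC N B := by
  unfold comC; positivity

section

variable {q : Fin N → VF N} {b : VF N} {c : Fn N}
  {B ν d r ϱ s : ℝ} {x : ES N} {η u : Fn N}
  (hq : ∀ i j, Smooth (q i j)) (hb : ∀ j, Smooth (b j)) (hc : Smooth c)
  (hsym : ∀ i j, q i j = q j i)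
  (hpos : ∀ x (ξ : Fin N → ℝ), 0 ≤ ∑ i, ∑ j, q i j x * ξ i * ξ j)
  (hη : Smooth η) (h0 : 0 ≤ η x) (h1 : η x ≤ 1) (hu : Smooth u)
  (hs : 0 ≤ s) (hs1 : s ≤ 1) (H : Pt q b c B ν d r ϱ x) (hr : 0 ≤ r) (Hc : CutPt q b η B ν x)

include hsym hu in
lemma energy_zero (x : ES N) :
    2 * EE q b (fun _ => 0) 0 u x ≤ Lop q b (fun _ => 0) (SS 0 u) x
      - 2 * ∑ i, ∑ j, q i j x * pd1 u i x * pd1 u j x := by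
  have : SS 0 u = fun x => u x * u x := funext fun x => sq _
  rw [this, Lop_mul hsym b hu hu]
  simp only [EE, Gam]
  linarith

include hq hb hc hsym hpos hη h0 h1 hu hs hs1 H Hc

lemma energy_one (y : ℝ) (hy : y = s * η x) :
    2 * (y ^ 2 * TT 1 u (Lop q b c u) x) ≤
      s ^ 2 * Lop q b (fun _ => 0) (fun x => η x ^ 2 * SS 1 u x) x
      + 2 * c x * (y ^ 2 * SS 1 u x) - 2 * ν * (y ^ 2 * SS 2 u x)
      + berD N B * (s * ν) * (SS 1 u x + y ^ 2 * SS 2 u x)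
      + 2 * d * (y ^ 2 * SS 1 u x)
      + berD N B * (s ^ 2 * ϱ ^ 2 * (y ^ 2 * SS 1 u x) + SS 0 u x) := by
  have e := energy_SS (b := b) hsym hpos hη hu 1 0 H.B_nonneg H.ν_nonneg hs hs1 h0 h1
    Hc.ell Hc.L Hc.Γ
  have hy0 : 0 ≤ y := hy ▸ mul_nonneg hs h0
  have hys : y ≤ s := hy ▸ mul_le_of_le_one_right hs h1
  have k1 := H.C1_le u hy0
  have hB := H.B_nonneg
  have hν := H.ν_nonneg
  have hK := comC_nonneg N hB
  rw [TT_one hq hb hc hu, EE_eq]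
  rw [← hy] at e
  have s0 := SS_nonneg 0 u x
  have s1 := SS_nonneg 1 u x
  have s2 := SS_nonneg 2 u x
  simp only [zero_add, pow_zero, mul_one, Nat.cast_zero] at e
  unfold berD
  generalize SS 0 u x = S0 at *
  generalize SS 1 u x = S1 at *
  generalize SS 2 u x = S2 at *
  generalize Lop q b (fun _ => 0) (fun x => η x ^ 2 * SS 1 u x) x = LL at *
  generalize C1 q b c u x = cc at *
  generalize EE q b (fun _ => 0) 1 u x = ee at *
  generalize comC N B = K at *
  have j1 : ν * y * (S1 + y ^ 2 * S2) ≤ s * ν * (S1 + y ^ 2 * S2) := by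
    rw [mul_comm s]; gcongr
  have j2 : y ^ 4 * ϱ ^ 2 * S1 ≤ s ^ 2 * ϱ ^ 2 * (y ^ 2 * S1) := by
    have : y ^ 4 * ϱ ^ 2 * S1 = y ^ 2 * ϱ ^ 2 * (y ^ 2 * S1) := by ring
    rw [this]; gcongr
  have j3 := mul_le_mul_of_nonneg_left j1 hK
  have j4 := mul_le_mul_of_nonneg_left j2 hK
  have j5 : 0 ≤ K * (s * ν * (S1 + y ^ 2 * S2)) := by positivity
  have j6 : 0 ≤ K * (s ^ 2 * ϱ ^ 2 * (y ^ 2 * S1)) := by positivity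
  have j7 : 0 ≤ B * (s ^ 2 * ϱ ^ 2 * (y ^ 2 * S1)) := by positivity
  have j8 : 0 ≤ B * (s * ν * (S1 + y ^ 2 * S2)) := by positivity
  have j9 : 0 ≤ K * S0 := by positivity
  have j10 : 0 ≤ B * S0 := by positivity
  linarith

include hr

lemma energy_two (y : ℝ) (hy : y = s * η x) :
    2 * (y ^ 4 * TT 2 u (Lop q b c u) x) ≤
      s ^ 4 * Lop q b (fun _ => 0) (fun x => η x ^ 4 * SS 2 u x) x
      + 2 * c x * (y ^ 4 * SS 2 u x) - 2 * ν * (y ^ 4 * SS 3 u x)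
      + berD N B * (s * ν) * (y ^ 2 * SS 2 u x + y ^ 4 * SS 3 u x)
      + 4 * d * (y ^ 4 * SS 2 u x)
      + berD N B * ((s * r + s ^ 2 * ϱ ^ 2) * (y ^ 2 * SS 1 u x + y ^ 4 * SS 2 u x)
        + (SS 0 u x + y ^ 2 * SS 1 u x)) := by
  have e := energy_SS (b := b) hsym hpos hη hu 2 2 H.B_nonneg H.ν_nonneg hs hs1 h0 h1
    Hc.ell Hc.L Hc.Γ
  have hy0 : 0 ≤ y := hy ▸ mul_nonneg hs h0
  have hys : y ≤ s := hy ▸ mul_le_of_le_one_right hs h1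
  have k1 : y ^ 2 * ∑ i, C1 q b c (pd1 u i) x ≤ d * (y ^ 2 * SS 2 u x) + comC N B *
      (ν * y * (SS 2 u x + y ^ 2 * SS 3 u x) + (y ^ 4 * ϱ ^ 2 * SS 2 u x + SS 1 u x)) := by
    have := sum_le_sum fun i (_ : i ∈ Finset.univ) => H.C1_le (pd1 u i) hy0
    rw [← mul_sum] at this
    refine this.trans_eq ?_
    have e1 : SS 1 u x = ∑ i, SS 0 (pd1 u i) x := rfl
    have e2 : SS 2 u x = ∑ i, SS 1 (pd1 u i) x := rfl
    have e3 : SS 3 u x = ∑ i, SS 2 (pd1 u i) x := rfl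
    rw [e1, e2, e3]
    simp only [mul_sum, sum_add_distrib, mul_add]
  have k2 := H.C2_le hu hy0 hr
  have hB := H.B_nonneg
  have hν := H.ν_nonneg
  have hK := comC_nonneg N hB
  rw [TT_two hq hb hc hu, EE_eq]
  rw [← hy] at e
  have s0 := SS_nonneg 0 u x
  have s1 := SS_nonneg 1 u x
  have s2 := SS_nonneg 2 u x
  have s3 := SS_nonneg 3 u x
  norm_num at e
  unfold berD
  generalize SS 0 u x = S0 at *
  generalize SS 1 u x = S1 at *
  generalize SS 2 u x = S2 at *
  generalize SS 3 u x = S3 at *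
  generalize Lop q b (fun _ => 0) (fun x => η x ^ 4 * SS 2 u x) x = LL at *
  generalize ∑ i, C1 q b c (pd1 u i) x = cc at *
  generalize C2 q b c u x = cd at *
  generalize EE q b (fun _ => 0) 2 u x = ee at *
  generalize comC N B = K at *
  have k1' := mul_le_mul_of_nonneg_left k1 (sq_nonneg y)
  have i1 : ν * y * (y ^ 2 * (S2 + y ^ 2 * S3)) ≤ s * ν * (y ^ 2 * (S2 + y ^ 2 * S3)) := by
    rw [mul_comm s]; gcongr
  have i2 : y ^ 4 * ϱ ^ 2 * (y ^ 2 * S2) ≤ s ^ 2 * ϱ ^ 2 * (y ^ 4 * S2) := by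
    have : y ^ 4 * ϱ ^ 2 * (y ^ 2 * S2) = y ^ 2 * ϱ ^ 2 * (y ^ 4 * S2) := by ring
    rw [this]; gcongr
  have i3 : ν * y ^ 4 * S2 ≤ s * ν * (y ^ 2 * S2) := by
    have : y ^ 4 ≤ s * y ^ 2 := by
      calc y ^ 4 = (y * y) * y ^ 2 := by ring
        _ ≤ (s * 1) * y ^ 2 := by gcongr; exact hys.trans hs1
        _ = _ := by ring
    have := mul_le_mul_of_nonneg_left this (mul_nonneg hν s2)
    linarith
  have i4 : r * y * (y ^ 4 * S2 + y ^ 2 * S1) ≤ s * r * (y ^ 4 * S2 + y ^ 2 * S1) := by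
    rw [mul_comm s]; gcongr
  have i5 : y ^ 8 * ϱ ^ 2 * S2 ≤ s ^ 2 * ϱ ^ 2 * (y ^ 4 * S2) := by
    have : y ^ 8 * ϱ ^ 2 * S2 = (y * y) ^ 2 * ϱ ^ 2 * (y ^ 4 * S2) := by ring
    rw [this]
    have : y * y ≤ s := by nlinarith
    gcongr
  have j1 := mul_le_mul_of_nonneg_left i1 hK
  have j2 := mul_le_mul_of_nonneg_left i2 hK
  have j3 := mul_le_mul_of_nonneg_left i3 hK
  have j4 := mul_le_mul_of_nonneg_left i4 hK
  have j5 := mul_le_mul_of_nonneg_left i5 hK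
  have z1 : 0 ≤ K * (s * ν * (y ^ 2 * S2)) := by positivity
  have z2 : 0 ≤ K * (s * ν * (y ^ 4 * S3)) := by positivity
  have z3 : 0 ≤ B * (s * ν * (y ^ 2 * S2)) := by positivity
  have z4 : 0 ≤ B * (s * ν * (y ^ 4 * S3)) := by positivity
  have z5 : 0 ≤ K * (s * r * (y ^ 2 * S1)) := by positivity
  have z6 : 0 ≤ K * (s * r * (y ^ 4 * S2)) := by positivity
  have z7 : 0 ≤ B * (s * r * (y ^ 2 * S1)) := by positivity
  have z8 : 0 ≤ B * (s * r * (y ^ 4 * S2)) := by positivity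
  have z9 : 0 ≤ K * (s ^ 2 * ϱ ^ 2 * (y ^ 2 * S1)) := by positivity
  have z10 : 0 ≤ K * (s ^ 2 * ϱ ^ 2 * (y ^ 4 * S2)) := by positivity
  have z11 : 0 ≤ B * (s ^ 2 * ϱ ^ 2 * (y ^ 2 * S1)) := by positivity
  have z12 : 0 ≤ B * (s ^ 2 * ϱ ^ 2 * (y ^ 4 * S2)) := by positivity
  have z13 : 0 ≤ K * S0 := by positivity
  have z14 : 0 ≤ B * S0 := by positivity
  have z15 : 0 ≤ K * (y ^ 2 * S1) := by positivity
  have z16 : 0 ≤ B * (y ^ 2 * S1) := by positivity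
  linarith

lemma energy_three (y : ℝ) (hy : y = s * η x) :
    2 * (y ^ 6 * TT 3 u (Lop q b c u) x) ≤
      s ^ 6 * Lop q b (fun _ => 0) (fun x => η x ^ 6 * SS 3 u x) x
      + 2 * c x * (y ^ 6 * SS 3 u x) - 2 * ν * (y ^ 6 * SS 4 u x)
      + berD N B * (s * ν) * (y ^ 2 * SS 2 u x + y ^ 4 * SS 3 u x + y ^ 6 * SS 4 u x)
      + 6 * d * (y ^ 6 * SS 3 u x)
      + berD N B * ((s * r + s ^ 2 * ϱ ^ 2) * (y ^ 2 * SS 1 u x + y ^ 4 * SS 2 u x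
        + y ^ 6 * SS 3 u x) + (SS 0 u x + y ^ 2 * SS 1 u x + y ^ 4 * SS 2 u x)) := by
  have e := energy_SS (b := b) hsym hpos hη hu 3 4 H.B_nonneg H.ν_nonneg hs hs1 h0 h1
    Hc.ell Hc.L Hc.Γ
  have hy0 : 0 ≤ y := hy ▸ mul_nonneg hs h0
  have hys : y ≤ s := hy ▸ mul_le_of_le_one_right hs h1
  have e1 : SS 1 u x = ∑ i, SS 0 (pd1 u i) x := rfl
  have e2 : SS 2 u x = ∑ i, SS 1 (pd1 u i) x := rfl
  have e2' : SS 2 u x = ∑ i, ∑ j, SS 0 (pd1 (pd1 u i) j) x := rfl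
  have e3 : SS 3 u x = ∑ i, SS 2 (pd1 u i) x := rfl
  have e3' : SS 3 u x = ∑ i, ∑ j, SS 1 (pd1 (pd1 u i) j) x := rfl
  have e4 : SS 4 u x = ∑ i, ∑ j, SS 2 (pd1 (pd1 u i) j) x := rfl
  have k1 : y ^ 2 * ∑ i, ∑ j, C1 q b c (pd1 (pd1 u i) j) x ≤ d * (y ^ 2 * SS 3 u x) + comC N B *
      (ν * y * (SS 3 u x + y ^ 2 * SS 4 u x) + (y ^ 4 * ϱ ^ 2 * SS 3 u x + SS 2 u x)) := by
    have := sum_le_sum fun i (_ : i ∈ Finset.univ) => sum_le_sum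
      fun j (_ : j ∈ Finset.univ) => H.C1_le (pd1 (pd1 u i) j) hy0
    rw [e2', e3', e4]
    simp only [mul_sum, sum_add_distrib, mul_add] at this ⊢
    exact this
  have k2 : y ^ 4 * ∑ i, C2 q b c (pd1 u i) x ≤ comC N B * (ν * y ^ 4 * SS 3 u x +
      r * y * (y ^ 4 * SS 3 u x + y ^ 2 * SS 2 u x) + (y ^ 8 * ϱ ^ 2 * SS 3 u x + SS 1 u x)) := by
    have := sum_le_sum fun i (_ : i ∈ Finset.univ) =>
      H.C2_le (smooth_pd1 hu i) hy0 hr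
    rw [e1, e2, e3]
    simp only [mul_sum, sum_add_distrib, mul_add] at this ⊢
    exact this
  have k3 := H.C3_le u hy0 hr
  have hB := H.B_nonneg
  have hν := H.ν_nonneg
  have hK := comC_nonneg N hB
  rw [TT_three hq hb hc hu, EE_eq]
  rw [← hy] at e
  have s0 := SS_nonneg 0 u x
  have s1 := SS_nonneg 1 u x
  have s2 := SS_nonneg 2 u x
  have s3 := SS_nonneg 3 u x
  have s4 := SS_nonneg 4 u x
  norm_num at e
  clear e1 e2 e2' e3 e3' e4
  unfold berD
  generalize SS 0 u x = S0 at *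
  generalize SS 1 u x = S1 at *
  generalize SS 2 u x = S2 at *
  generalize SS 3 u x = S3 at *
  generalize SS 4 u x = S4 at *
  generalize Lop q b (fun _ => 0) (fun x => η x ^ 6 * SS 3 u x) x = LL at *
  generalize ∑ i, ∑ j, C1 q b c (pd1 (pd1 u i) j) x = cc at *
  generalize ∑ i, C2 q b c (pd1 u i) x = cd at *
  generalize C3 q b c u x = ce at *
  generalize EE q b (fun _ => 0) 3 u x = ee at *
  generalize comC N B = K at *
  have hy1 : y ≤ 1 := hys.trans hs1
  have hyy : y * y ≤ s := by nlinarith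
  have k1' := mul_le_mul_of_nonneg_left k1 (pow_nonneg hy0 4)
  have k2' := mul_le_mul_of_nonneg_left k2 (pow_nonneg hy0 2)
  have i1 : ν * y * (y ^ 4 * (S3 + y ^ 2 * S4)) ≤ s * ν * (y ^ 4 * (S3 + y ^ 2 * S4)) := by
    rw [mul_comm s]; gcongr
  have i2 : y ^ 8 * ϱ ^ 2 * S3 ≤ s ^ 2 * ϱ ^ 2 * (y ^ 6 * S3) := by
    have : y ^ 8 * ϱ ^ 2 * S3 = y ^ 2 * ϱ ^ 2 * (y ^ 6 * S3) := by ring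
    rw [this]; gcongr
  have i3 : ν * (y * y) * (y ^ 4 * S3) ≤ s * ν * (y ^ 4 * S3) := by
    rw [mul_comm s]; gcongr
  have i4 : r * y * (y ^ 6 * S3 + y ^ 4 * S2) ≤ s * r * (y ^ 6 * S3 + y ^ 4 * S2) := by
    rw [mul_comm s]; gcongr
  have i5 : (y * y) ^ 2 * ϱ ^ 2 * (y ^ 6 * S3) ≤ s ^ 2 * ϱ ^ 2 * (y ^ 6 * S3) := by
    gcongr
  have i6 : y * y * ν * (y * (y ^ 4 * S3)) ≤ s * ν * (1 * (y ^ 4 * S3)) := by gcongr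
  have i6' : y * y * ν * (y * (y ^ 2 * S2)) ≤ s * ν * (1 * (y ^ 2 * S2)) := by gcongr
  have i7 : r * (y * y) * (y ^ 6 * S3 + y ^ 2 * S1) ≤ s * r * (y ^ 6 * S3 + y ^ 2 * S1) := by
    rw [mul_comm s]; gcongr
  have i8 : (y * y * y) ^ 2 * ϱ ^ 2 * (y ^ 6 * S3) ≤ s ^ 2 * ϱ ^ 2 * (y ^ 6 * S3) := by
    have : y * y * y ≤ s := by
      calc y * y * y ≤ s * 1 := by gcongr
        _ = s := mul_one s
    gcongr
  have j1 := mul_le_mul_of_nonneg_left i1 hK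
  have j2 := mul_le_mul_of_nonneg_left i2 hK
  have j3 := mul_le_mul_of_nonneg_left i3 hK
  have j4 := mul_le_mul_of_nonneg_left i4 hK
  have j5 := mul_le_mul_of_nonneg_left i5 hK
  have j6 := mul_le_mul_of_nonneg_left i6 hK
  have j6' := mul_le_mul_of_nonneg_left i6' hK
  have j7 := mul_le_mul_of_nonneg_left i7 hK
  have j8 := mul_le_mul_of_nonneg_left i8 hK
  have z1 : 0 ≤ K * (s * ν * (y ^ 2 * S2)) := by positivity
  have z2 : 0 ≤ K * (s * ν * (y ^ 4 * S3)) := by positivity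
  have z2' : 0 ≤ K * (s * ν * (y ^ 6 * S4)) := by positivity
  have z3 : 0 ≤ B * (s * ν * (y ^ 2 * S2)) := by positivity
  have z4 : 0 ≤ B * (s * ν * (y ^ 4 * S3)) := by positivity
  have z4' : 0 ≤ B * (s * ν * (y ^ 6 * S4)) := by positivity
  have z5 : 0 ≤ K * (s * r * (y ^ 2 * S1)) := by positivity
  have z6 : 0 ≤ K * (s * r * (y ^ 4 * S2)) := by positivity
  have z6' : 0 ≤ K * (s * r * (y ^ 6 * S3)) := by positivity
  have z7 : 0 ≤ B * (s * r * (y ^ 2 * S1)) := by positivity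
  have z8 : 0 ≤ B * (s * r * (y ^ 4 * S2)) := by positivity
  have z8' : 0 ≤ B * (s * r * (y ^ 6 * S3)) := by positivity
  have z9 : 0 ≤ K * (s ^ 2 * ϱ ^ 2 * (y ^ 2 * S1)) := by positivity
  have z10 : 0 ≤ K * (s ^ 2 * ϱ ^ 2 * (y ^ 4 * S2)) := by positivity
  have z10' : 0 ≤ K * (s ^ 2 * ϱ ^ 2 * (y ^ 6 * S3)) := by positivity
  have z11 : 0 ≤ B * (s ^ 2 * ϱ ^ 2 * (y ^ 2 * S1)) := by positivity
  have z12 : 0 ≤ B * (s ^ 2 * ϱ ^ 2 * (y ^ 4 * S2)) := by positivity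
  have z12' : 0 ≤ B * (s ^ 2 * ϱ ^ 2 * (y ^ 6 * S3)) := by positivity
  have z13 : 0 ≤ K * S0 := by positivity
  have z14 : 0 ≤ B * S0 := by positivity
  have z15 : 0 ≤ K * (y ^ 2 * S1) := by positivity
  have z16 : 0 ≤ B * (y ^ 2 * S1) := by positivity
  have z17 : 0 ≤ K * (y ^ 4 * S2) := by positivity
  have z18 : 0 ≤ B * (y ^ 4 * S2) := by positivity
  linarith

end

/-- The function to which the maximum principle is applied in the Bernstein method. -/
def bV (n : ℕ) (a w : ℝ) (η u : Fn N) (x : ES N) : ℝ :=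
  ∑ k ∈ Finset.range (n + 1), (a * w) ^ k * (η x ^ (2 * k) * SS k u x)

/-- The derivative of `bV` along the evolution `D_w u = f`. -/
def bE (n : ℕ) (a w : ℝ) (η u f : Fn N) (x : ES N) : ℝ :=
  2 * ∑ k ∈ Finset.range (n + 1), (a * w) ^ k * (η x ^ (2 * k) * TT k u f x)
  + ∑ k ∈ Finset.range (n + 1), k * a * (a * w) ^ (k - 1) * (η x ^ (2 * k) * SS k u x)

lemma bern_num {ν D s r Q d a L₁ L₂ L₃ c c₀ p m : ℝ}
    (hν : 0 ≤ ν) (hD : 0 ≤ D) (hs : 0 ≤ s) (hr : 0 ≤ r) (hQ : 0 ≤ Q) (ha : 0 ≤ a)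
    (hL₁ : 0 ≤ L₁) (hL₂ : 0 ≤ L₂) (hL₃ : 0 ≤ L₃) (hp : 0 ≤ p) (hm : 0 ≤ m) (hmp : m ≤ s ^ 2 * p)
    (h1 : 3 * a ≤ ν) (h2 : 3 * D * s ≤ 1 / 2) (h3 : 6 * L₃ * s ^ 2 ≤ 1 / 2)
    (h4 : 3 * D * s ≤ 2 * L₁) (h5 : 3 * D * s ^ 2 ≤ 2 * L₂) (hc : c ≤ c₀)
    (hd : d + L₁ * r + L₂ * Q ≤ L₃ * ν) {j i : ℝ} (hj : 1 ≤ j) (hj' : j ≤ 3)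
    (hi' : i ≤ 3) :
    j * a * p + i * (D * s * ν * p) + 2 * c * m + 2 * j * d * m
      + i * (D * ((s * r + s ^ 2 * Q) * m))
      + i * (D * m) ≤ 2 * (ν * p) + (2 * |c₀| + 3 * D) * m := by
  have e1 : j * a * p ≤ ν * p := by
    have : j * a ≤ ν := by nlinarith
    gcongr
  have e2 : i * (D * s * ν * p) ≤ 1 / 2 * (ν * p) := by
    have h : i * (D * s) ≤ 3 * (D * s) := by gcongr
    have : i * (D * s) ≤ 1 / 2 := by linarith
    have := mul_le_mul_of_nonneg_right this (mul_nonneg hν hp)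
    linarith
  have e3 : 2 * c * m ≤ 2 * |c₀| * m := by
    have := hc.trans (le_abs_self c₀)
    gcongr
  have e4 : 2 * j * d * m ≤ 1 / 2 * (ν * p) - 2 * (L₁ * r + L₂ * Q) * m := by
    have a1 : 2 * j * m * d ≤ 2 * j * m * (L₃ * ν - (L₁ * r + L₂ * Q)) := by
      have : d ≤ L₃ * ν - (L₁ * r + L₂ * Q) := by linarith
      gcongr
    have a2 : 2 * 1 * m * (L₁ * r + L₂ * Q) ≤ 2 * j * m * (L₁ * r + L₂ * Q) := by gcongr
    have a3 : 2 * j * m * (L₃ * ν) ≤ 2 * 3 * (s ^ 2 * p) * (L₃ * ν) := by gcongr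
    have a4 := mul_le_mul_of_nonneg_right h3 (mul_nonneg hν hp)
    linarith
  have e5 : i * (D * ((s * r + s ^ 2 * Q) * m)) ≤ 2 * (L₁ * r + L₂ * Q) * m := by
    have a1 : i * (D * ((s * r + s ^ 2 * Q) * m)) ≤ 3 * (D * ((s * r + s ^ 2 * Q) * m)) := by gcongr
    have a2 := mul_le_mul_of_nonneg_right h4 (mul_nonneg hr hm)
    have a3 := mul_le_mul_of_nonneg_right h5 (mul_nonneg hQ hm)
    linarith
  have e6 : i * (D * m) ≤ 3 * (D * m) := by gcongr
  linarith

lemma Lop_const_mul (q : Fin N → VF N) (b : VF N) (c : Fn N)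
    (hf : Smooth f) (k : ℝ) (x : ES N) :
    Lop q b c (fun x => k * f x) x = k * Lop q b c f x := by
  have h1 : ∀ i, pd1 (fun x => k * f x) i = fun x => k * pd1 f i x := fun i =>
    pd1_const_mul k (smooth_diff hf) i
  have h2 : ∀ i j, pd2 (fun x => k * f x) i j = fun x => k * pd2 f i j x := fun i j => by
    show pd1 (pd1 (fun x => k * f x) j) i = _
    rw [h1, pd1_const_mul k (smooth_diff (smooth_pd1 hf j))]
    rfl
  simp only [Lop, h1, h2, mul_add, mul_sum]
  congr 1
  · congr 1
    · exact sum_congr rfl fun i _ => sum_congr rfl fun j _ => by ring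
    · exact sum_congr rfl fun i _ => by ring
  · ring

lemma smooth_bV (n : ℕ) (a w : ℝ) {η u : Fn N} (hη : Smooth η) (hu : Smooth u) :
    Smooth (bV n a w η u) :=
  ContDiff.sum fun k _ => contDiff_const.mul ((hη.pow _).mul (smooth_SS k hu))

lemma Lop_bV (q : Fin N → VF N) (b : VF N) (n : ℕ) (a w : ℝ)
    {η u : Fn N} (hη : Smooth η) (hu : Smooth u) (x : ES N) :
    Lop q b (fun _ => 0) (bV n a w η u) x = ∑ k ∈ Finset.range (n + 1),
      (a * w) ^ k * Lop q b (fun _ => 0) (fun x => η x ^ (2 * k) * SS k u x) x := by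
  have hsm : ∀ k, Smooth fun x => η x ^ (2 * k) * SS k u x := fun k =>
    (hη.pow _).mul (smooth_SS k hu)
  have := Lop_sum q b (fun _ => 0) (Finset.range (n + 1))
    (f := fun k x => (a * w) ^ k * (η x ^ (2 * k) * SS k u x))
    (fun k => contDiff_const.mul (hsm k)) x
  refine this.trans (sum_congr rfl fun k _ => ?_)
  exact Lop_const_mul q b _ (hsm k) _ x

/-- The conditions on the coefficients and the cut-off at a point, under which the Bernstein
inequality holds. -/
def BerPt (q : Fin N → VF N) (b : VF N) (c η : Fn N)
    (B ν₀ L₁ L₂ L₃ : ℝ) (x : ES N) : Prop :=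
  ∃ ν d r ϱ : ℝ, ν₀ ≤ ν ∧ 0 ≤ r ∧ d + L₁ * r + L₂ * ϱ ^ 2 ≤ L₃ * ν ∧
    Pt q b c B ν d r ϱ x ∧ CutPt q b η B ν x

theorem bernstein_aux {B ν₀ L₁ L₂ L₃ c₀ a w s : ℝ} {q : Fin N → VF N}
    {b : VF N} {c η u : Fn N} {x : ES N} (hB : 0 ≤ B) (hν₀ : 0 < ν₀)
    (hL₁ : 0 < L₁) (hL₂ : 0 < L₂) (hL₃ : 0 < L₃) (ha : 0 < a) (ha1 : 3 * a ≤ ν₀)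
    (hs0 : 0 ≤ s) (hs1 : s ≤ 1) (hs2 : s ^ 2 = a * w)
    (e2 : 3 * berD N B * s ≤ 1 / 2) (e3 : 6 * L₃ * s ^ 2 ≤ 1 / 2)
    (e4 : 3 * berD N B * s ≤ 2 * L₁) (e5 : 3 * berD N B * s ^ 2 ≤ 2 * L₂)
    (hq : ∀ i j, Smooth (q i j)) (hb : ∀ j, Smooth (b j)) (hc : Smooth c)
    (hsym : ∀ i j, q i j = q j i)
    (hpos : ∀ x (ξ : Fin N → ℝ), 0 ≤ ∑ i, ∑ j, q i j x * ξ i * ξ j)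
    (hη : Smooth η) (h0 : 0 ≤ η x) (h1 : η x ≤ 1) (hu : Smooth u) (hcx : c x ≤ c₀)
    (hber : BerPt q b c η B ν₀ L₁ L₂ L₃ x) {n : ℕ} (hn : n = 2 ∨ n = 3) :
    bE n a w η u (Lop q b c u) x
      ≤ Lop q b (fun _ => 0) (bV n a w η u) x
        + (2 * |c₀| + 3 * berD N B) * bV n a w η u x := by
  obtain ⟨ν, d, r, ϱ, hν, hr, hfun, H, Hc⟩ := hber
  have S0 := SS_nonneg 0 u x
  have S1 := SS_nonneg 1 u x
  have S2 := SS_nonneg 2 u x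
  have S3 := SS_nonneg 3 u x
  have S4 := SS_nonneg 4 u x
  have z := energy_zero (b := b) hsym hu x
  rw [Lop_bV q b n a w hη hu]
  have hz : TT 0 u (Lop q b c u) x = EE q b (fun _ => 0) 0 u x + c x * SS 0 u x := by
    rw [← EE_eq]; rfl
  have hcS : c x * SS 0 u x ≤ |c₀| * SS 0 u x := by
    have := hcx.trans (le_abs_self c₀)
    gcongr
  set D := berD N B with hDdef
  have hD : 0 ≤ D := by
    have := comC_nonneg N hB
    rw [hDdef]; unfold berD; positivity
  have hDS : 0 ≤ D * SS 0 u x := mul_nonneg hD S0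
  have hν0 : 0 ≤ ν := hν₀.le.trans hν
  set y := s * η x with hy
  have hy0 : 0 ≤ y := mul_nonneg hs0 h0
  have hys : y ≤ s := mul_le_of_le_one_right hs0 h1
  have g1 := energy_one hq hb hc hsym hpos hη h0 h1 hu hs0 hs1 H Hc y hy
  have g2 := energy_two hq hb hc hsym hpos hη h0 h1 hu hs0 hs1 H hr Hc y hy
  have g3 := energy_three hq hb hc hsym hpos hη h0 h1 hu hs0 hs1 H hr Hc y hy
  have hp := Hc.ell fun i => pd1 u i x
  rw [← SS_one] at hp
  have hyy : y ^ 2 ≤ s ^ 2 := by gcongr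
  have hη2 : η x ^ 2 ≤ 1 := pow_le_one₀ h0 h1
  have ey : y ^ 2 = a * w * η x ^ 2 := by rw [hy, mul_pow, hs2]
  have ey4 : y ^ 4 = (a * w) ^ 2 * η x ^ 4 := by
    rw [show y ^ 4 = (y ^ 2) ^ 2 by ring, ey]; ring
  have ey6 : y ^ 6 = (a * w) ^ 3 * η x ^ 6 := by
    rw [show y ^ 6 = (y ^ 2) ^ 3 by ring, ey]; ring
  have es4 : s ^ 4 = (a * w) ^ 2 := by rw [show s ^ 4 = (s ^ 2) ^ 2 by ring, hs2]
  have es6 : s ^ 6 = (a * w) ^ 3 := by rw [show s ^ 6 = (s ^ 2) ^ 3 by ring, hs2]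
  have num := fun (p m i j : ℝ) (hp : 0 ≤ p) (hm : 0 ≤ m) (hmp : m ≤ s ^ 2 * p) (hj : 1 ≤ j)
    (hj' : j ≤ 3) (hi' : i ≤ 3) =>
    bern_num (Q := ϱ ^ 2) (c := c x) (c₀ := c₀) (d := d) hν0 hD hs0 hr (sq_nonneg ϱ) ha.le hL₁.le
      hL₂.le hL₃.le hp hm hmp (ha1.trans hν)
      e2
      e3
      e4
      e5
      hcx hfun hj hj' hi'
  have n1 := fun i => num (SS 1 u x) (y ^ 2 * SS 1 u x) i 1 S1 (by positivity)
    (mul_le_mul_of_nonneg_right hyy S1) (by norm_num) (by norm_num)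
  have n2 := fun i => num (y ^ 2 * SS 2 u x) (y ^ 4 * SS 2 u x) i 2 (by positivity) (by positivity)
    (by rw [show y ^ 4 * SS 2 u x = y ^ 2 * (y ^ 2 * SS 2 u x) by ring]
        exact mul_le_mul_of_nonneg_right hyy (by positivity)) (by norm_num) (by norm_num)
  have n3 := fun i j => num (y ^ 4 * SS 3 u x) (y ^ 6 * SS 3 u x) i j (by positivity)
    (by positivity)
    (by rw [show y ^ 6 * SS 3 u x = y ^ 2 * (y ^ 4 * SS 3 u x) by ring]
        exact mul_le_mul_of_nonneg_right hyy (by positivity))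
  have κ1 : a * (η x ^ 2 * SS 1 u x) ≤ 1 * a * SS 1 u x := by
    have := mul_le_mul_of_nonneg_left hη2 (mul_nonneg ha.le S1)
    linarith
  have κ2 : 2 * a * (a * w) * (η x ^ 4 * SS 2 u x) ≤ 2 * a * (y ^ 2 * SS 2 u x) := by
    have := mul_le_mul_of_nonneg_left hη2 (mul_nonneg ha.le
      (mul_nonneg (sq_nonneg y) S2))
    rw [ey] at this ⊢
    linarith
  have κ3 : 3 * a * (a * w) ^ 2 * (η x ^ 6 * SS 3 u x) ≤ 3 * a * (y ^ 4 * SS 3 u x) := by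
    have := mul_le_mul_of_nonneg_left hη2 (mul_nonneg ha.le
      (mul_nonneg (pow_nonneg hy0 4) S3))
    rw [ey4] at this ⊢
    linarith
  have z1 : 0 ≤ D * (s ^ 2 * ϱ ^ 2 * (y ^ 2 * SS 1 u x)) := by positivity
  have z2 : 0 ≤ D * (s * r * (y ^ 2 * SS 1 u x)) := by positivity
  have hνp : 0 ≤ ν * (y ^ 4 * SS 3 u x) := by positivity
  rw [← hDdef] at g1 g2 g3
  have P1 : ∀ X : ℝ, a * w * (η x ^ 2 * X) = y ^ 2 * X := fun X => by rw [ey]; ring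
  have P2 : ∀ X : ℝ, (a * w) ^ 2 * (η x ^ 4 * X) = y ^ 4 * X := fun X => by rw [ey4]; ring
  have P3 : ∀ X : ℝ, (a * w) ^ 3 * (η x ^ 6 * X) = y ^ 6 * X := fun X => by rw [ey6]; ring
  rw [es4] at g2
  rw [es6] at g3
  have g1' : s ^ 2 * Lop q b (fun _ => 0) (fun x => η x ^ 2 * SS 1 u x) x
    = a * w * Lop q b (fun _ => 0) (fun x => η x ^ 2 * SS 1 u x) x := by rw [hs2]
  have hDs : ∀ p, 0 ≤ p → D * s * ν * p ≤ 1 / 2 * (ν * p) := fun p hp => by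
    have : D * s ≤ 1 / 2 := by
      have := mul_nonneg hD hs0
      linarith
    have := mul_le_mul_of_nonneg_right this (mul_nonneg hν0 hp)
    linarith
  have z4 : 0 ≤ D * (y ^ 2 * SS 1 u x) := by positivity
  have z5 : 0 ≤ D * (y ^ 4 * SS 2 u x) := by positivity
  have z7 : 0 ≤ D * (y ^ 6 * SS 3 u x) := by positivity
  have z8 : 0 ≤ D * ((s * r + s ^ 2 * ϱ ^ 2) * (y ^ 4 * SS 2 u x)) := by positivity
  have z9 : 0 ≤ D * ((s * r + s ^ 2 * ϱ ^ 2) * (y ^ 6 * SS 3 u x)) := by positivity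
  have z10 : 0 ≤ D * (s * ν * SS 1 u x) := by positivity
  have z11 : 0 ≤ D * (s * ν * (y ^ 2 * SS 2 u x)) := by positivity
  rcases hn with rfl | rfl
  · simp only [bE, bV, sum_range_succ, sum_range_zero]
    norm_num
    simp only [hz, P1, P2]
    have f1 := n1 2 (by norm_num)
    have f2 := n2 2 (by norm_num)
    have f3 := hDs (y ^ 4 * SS 3 u x) (by positivity)
    clear num n1 n2 n3 P1 P2 P3 hDs hDdef
    linarith
  · simp only [bE, bV, sum_range_succ, sum_range_zero]
    norm_num
    simp only [hz, P1, P2, P3]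
    have f1 := n1 3 (by norm_num)
    have f2 := n2 3 (by norm_num)
    have f3 := n3 3 3 (by norm_num) (by norm_num) (by norm_num)
    have f4 := hDs (y ^ 6 * SS 4 u x) (by positivity)
    have hνp' : 0 ≤ ν * (y ^ 6 * SS 4 u x) := by positivity
    have z6 : 0 ≤ D * (s * ν * (y ^ 4 * SS 3 u x)) := by positivity
    clear num n1 n2 n3 P1 P2 P3 hDs hDdef
    linarith

theorem bernstein (N : ℕ) {B ν₀ L₁ L₂ L₃ W : ℝ} (c₀ : ℝ) (hB : 0 ≤ B) (hν₀ : 0 < ν₀)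
    (hL₁ : 0 < L₁) (hL₂ : 0 < L₂) (hL₃ : 0 < L₃) (hW : 0 ≤ W) :
    ∃ a > 0, ∃ C ≥ 0, ∀ (q : Fin N → VF N) (b : VF N) (c η u : Fn N)
      (x : ES N), (∀ i j, Smooth (q i j)) → (∀ j, Smooth (b j)) → Smooth c →
      (∀ i j, q i j = q j i) → (∀ x (ξ : Fin N → ℝ), 0 ≤ ∑ i, ∑ j, q i j x * ξ i * ξ j) →
      Smooth η → 0 ≤ η x → η x ≤ 1 → Smooth u → c x ≤ c₀ →
      (η x = 0 ∨ BerPt q b c η B ν₀ L₁ L₂ L₃ x) →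
      ∀ w, 0 ≤ w → w ≤ W → ∀ n, n = 2 ∨ n = 3 →
      bE n a w η u (Lop q b c u) x
        ≤ Lop q b (fun _ => 0) (bV n a w η u) x + C * bV n a w η u x := by
  set D := berD N B with hDdef
  have hD : 0 ≤ D := by
    have := comC_nonneg N hB
    rw [hDdef]; unfold berD; positivity
  obtain ⟨ε, hε, hε1, e2, e3, e4, e5⟩ : ∃ ε : ℝ, 0 < ε ∧ ε ≤ 1 ∧ 3 * D * ε ≤ 1 / 2 ∧
      6 * L₃ * ε ≤ 1 / 2 ∧ 3 * D * ε ≤ 2 * L₁ ∧ 3 * D * ε ≤ 2 * L₂ := by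
    have hm : 0 < min (min 1 (1 / (12 * L₃))) (min (1 / (6 * D + 1))
        (min (2 * L₁ / (3 * D + 1)) (2 * L₂ / (3 * D + 1)))) := by
      have : 0 < 6 * D + 1 := by linarith
      have : 0 < 3 * D + 1 := by linarith
      positivity
    refine ⟨_, hm, (min_le_left _ _).trans (min_le_left _ _), ?_, ?_, ?_, ?_⟩
    all_goals set ε := min (min 1 (1 / (12 * L₃))) (min (1 / (6 * D + 1))
        (min (2 * L₁ / (3 * D + 1)) (2 * L₂ / (3 * D + 1)))) with hεd
    · have : ε ≤ 1 / (6 * D + 1) := (min_le_right _ _).trans (min_le_left _ _)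
      rw [le_div_iff₀ (by linarith)] at this
      nlinarith
    · have : ε ≤ 1 / (12 * L₃) := (min_le_left _ _).trans (min_le_right _ _)
      rw [le_div_iff₀ (by linarith)] at this
      nlinarith
    · have : ε ≤ 2 * L₁ / (3 * D + 1) :=
        (min_le_right _ _).trans ((min_le_right _ _).trans (min_le_left _ _))
      rw [le_div_iff₀ (by linarith)] at this
      nlinarith
    · have : ε ≤ 2 * L₂ / (3 * D + 1) :=
        (min_le_right _ _).trans ((min_le_right _ _).trans (min_le_right _ _))
      rw [le_div_iff₀ (by linarith)] at this
      nlinarith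
  refine ⟨min (ν₀ / 3) (ε ^ 2 / (W + 1)), by positivity, 2 * |c₀| + 3 * D, by positivity, ?_⟩
  set a := min (ν₀ / 3) (ε ^ 2 / (W + 1)) with hadef
  have ha : 0 < a := by positivity
  have ha1 : 3 * a ≤ ν₀ := by
    have : a ≤ ν₀ / 3 := min_le_left _ _
    linarith
  intro q b c η u x hq hb hc hsym hpos hη h0 h1 hu hcx hcase w hw hwW n hn
  have haw : a * w ≤ ε ^ 2 := by
    have : a ≤ ε ^ 2 / (W + 1) := min_le_right _ _
    rw [le_div_iff₀ (by linarith)] at this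
    nlinarith
  set s := √(a * w) with hsdef
  have hs0 : 0 ≤ s := Real.sqrt_nonneg _
  have hs2 : s ^ 2 = a * w := Real.sq_sqrt (by positivity)
  have hsε : s ≤ ε := Real.sqrt_le_iff.2 ⟨hε.le, haw⟩
  have hs1 : s ≤ 1 := hsε.trans hε1
  have hss : s ^ 2 ≤ s := by nlinarith
  rcases hcase with hz0 | hber
  · have S0 := SS_nonneg 0 u x
    have S1 := SS_nonneg 1 u x
    have S2 := SS_nonneg 2 u x
    have S3 := SS_nonneg 3 u x
    have S4 := SS_nonneg 4 u x
    have z := energy_zero (b := b) hsym hu x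
    rw [Lop_bV q b n a w hη hu]
    have hz : TT 0 u (Lop q b c u) x = EE q b (fun _ => 0) 0 u x + c x * SS 0 u x := by
      rw [← EE_eq]; rfl
    have hcS : c x * SS 0 u x ≤ |c₀| * SS 0 u x := by
      have := hcx.trans (le_abs_self c₀)
      gcongr
    have hDS : 0 ≤ D * SS 0 u x := mul_nonneg hD S0
    have t : ∀ k, 0 ≤ Lop q b (fun _ => 0) (fun x => η x ^ (2 * (k + 1)) * SS (k + 1) u x) x :=
      fun k => energy_SS_of_zero (b := b) hsym hpos hη hu (k + 1) (2 * k) hz0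
    have hp := hpos x fun i => pd1 u i x
    have hpw : ∀ k, 0 ≤ (a * w) ^ k := fun k => by positivity
    have t0 := mul_nonneg (hpw 1) (t 0)
    have t1 := mul_nonneg (hpw 2) (t 1)
    have t2 := mul_nonneg (hpw 3) (t 2)
    norm_num at t0 t1 t2
    rcases hn with rfl | rfl <;>
    · simp only [bE, bV, sum_range_succ, sum_range_zero, hz0]
      norm_num
      rw [hz]
      linarith
  · exact bernstein_aux hB hν₀ hL₁ hL₂ hL₃ ha ha1 hs0 hs1 hs2
      ((mul_le_mul_of_nonneg_left hsε (by positivity)).trans e2)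
      ((mul_le_mul_of_nonneg_left (hss.trans hsε) (by positivity)).trans e3)
      ((mul_le_mul_of_nonneg_left hsε (by positivity)).trans e4)
      ((mul_le_mul_of_nonneg_left (hss.trans hsε) (by positivity)).trans e5)
      hq hb hc hsym hpos hη h0 h1 hu hcx hber hn

/-- A smooth nonincreasing function, equal to `1` on `(-∞, 1/4]` and to `0` on `[1, ∞)`. -/
def cutψ (t : ℝ) : ℝ := Real.smoothTransition ((1 - t) * (4 / 3))

lemma smooth_cutψ : Smooth cutψ :=
  Real.smoothTransition.contDiff.comp ((contDiff_const.sub contDiff_id).mul contDiff_const)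

lemma deriv_cutψ_nonpos (t : ℝ) : deriv cutψ t ≤ 0 := by
  have : Antitone cutψ := fun s t h => Real.smoothTransition.monotone (by linarith)
  exact this.deriv_nonpos

/-- The cut-off function, equal to `1` on the ball of radius `R/2` and to `0` off that of radius
`R`. -/
def cutη (R : ℝ) (x : ES N) : ℝ := cutψ (‖x‖ ^ 2 / R ^ 2)

lemma smooth_cutη (R : ℝ) : Smooth (cutη R : Fn N) :=
  smooth_cutψ.comp ((contDiff_norm_sq ℝ).div_const _)

lemma cutη_nonneg (R : ℝ) (x : ES N) : 0 ≤ cutη R x := Real.smoothTransition.nonneg _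

lemma cutη_le_one (R : ℝ) (x : ES N) : cutη R x ≤ 1 := Real.smoothTransition.le_one _

lemma cutη_eq_zero {R : ℝ} (hR : 0 < R) {x : ES N} (hx : R ≤ ‖x‖) : cutη R x = 0 := by
  apply Real.smoothTransition.zero_of_nonpos
  have : 1 ≤ ‖x‖ ^ 2 / R ^ 2 := by
    rw [le_div_iff₀ (by positivity)]; nlinarith
  nlinarith

lemma cutη_eq_one {R : ℝ} (hR : 0 < R) {x : ES N} (hx : ‖x‖ ≤ R / 2) : cutη R x = 1 := by
  apply Real.smoothTransition.one_of_one_le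
  have : ‖x‖ ^ 2 / R ^ 2 ≤ 1 / 4 := by
    rw [div_le_iff₀ (by positivity)]; nlinarith [norm_nonneg x]
  nlinarith

lemma pd1_radial {g : ℝ → ℝ} (hg : Differentiable ℝ g) (R : ℝ) (i : Fin N) :
    pd1 (fun x : ES N => g (‖x‖ ^ 2 / R ^ 2)) i
      = fun x => deriv g (‖x‖ ^ 2 / R ^ 2) * (2 / R ^ 2 * x i) := by
  ext x
  have h1 : HasFDerivAt (fun x : ES N => ‖x‖ ^ 2) (2 • innerSL ℝ x) x :=
    (hasStrictFDerivAt_norm_sq x).hasFDerivAt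
  have h2 : HasFDerivAt (fun x : ES N => ‖x‖ ^ 2 / R ^ 2) ((R ^ 2)⁻¹ • (2 • innerSL ℝ x)) x := by
    simpa [div_eq_inv_mul] using h1.const_mul (R ^ 2)⁻¹
  have h3 := ((hg (‖x‖ ^ 2 / R ^ 2)).hasDerivAt.comp_hasFDerivAt x h2).fderiv
  simp only [pd1]
  rw [show (fun x : ES N => g (‖x‖ ^ 2 / R ^ 2)) = g ∘ fun x => ‖x‖ ^ 2 / R ^ 2 from rfl, h3]
  have e : inner ℝ x (EuclideanSpace.single i (1 : ℝ)) = x i := by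
    simp [EuclideanSpace.inner_single_right]
  simp only [smul_apply, innerSL_apply_apply, e, smul_eq_mul, nsmul_eq_mul, Nat.cast_ofNat]
  ring

lemma pd1_cutη (R : ℝ) (i : Fin N) :
    pd1 (cutη R : Fn N) i = fun x => deriv cutψ (‖x‖ ^ 2 / R ^ 2) * (2 / R ^ 2 * x i) :=
  pd1_radial (smooth_cutψ.differentiable (by simp)) R i

lemma smooth_deriv_cutψ : Smooth (deriv cutψ) :=
  ((contDiff_infty_iff_deriv (f := cutψ)).1 smooth_cutψ).2

lemma pd2_cutη (R : ℝ) (i j : Fin N) (x : ES N) :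
    pd2 (cutη R : Fn N) i j x = deriv (deriv cutψ) (‖x‖ ^ 2 / R ^ 2) * (4 / R ^ 4 * (x i * x j))
      + deriv cutψ (‖x‖ ^ 2 / R ^ 2) * (2 / R ^ 2 * if j = i then 1 else 0) := by
  have hd : Differentiable ℝ (deriv cutψ) := smooth_deriv_cutψ.differentiable (by simp)
  have h1 : Differentiable ℝ fun x : ES N => deriv cutψ (‖x‖ ^ 2 / R ^ 2) :=
    hd.comp ((contDiff_norm_sq ℝ (n := 1)).div_const _ |>.differentiable (by simp))
  have h2 : Differentiable ℝ fun x : ES N => x j := smooth_diff (smooth_coord j)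
  show pd1 (pd1 (cutη R) j) i x = _
  rw [pd1_cutη, pd1_mul h1 (h2.const_mul _), pd1_const_mul _ h2, pd1_coord, pd1_radial hd]
  simp only
  ring

/-- Growth conditions on the coefficients at a point. -/
structure Growth (q : Fin N → VF N) (b : VF N) (G ν : ℝ) (x : ES N) :
    Prop where
  Q : ∀ ξ : ES N, |∑ i, ∑ j, q i j x * x i * ξ j| ≤ G * (1 + ‖x‖ ^ 2) * ν * ‖ξ‖
  tr : ∑ i, q i i x ≤ G * (1 + ‖x‖ ^ 2) * ν
  b : ∑ j, b j x * x j ≤ G * (1 + ‖x‖ ^ 2) * ν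

lemma norm_sq_eq_sum (x : ES N) : ‖x‖ ^ 2 = ∑ i, x i ^ 2 := by
  rw [EuclideanSpace.norm_sq_eq]; simp

theorem cutPt_of_growth (N : ℕ) : ∃ M ≥ 1, ∀ (q : Fin N → VF N) (b : VF N)
    (G ν R : ℝ) (x : ES N), 0 ≤ G → 0 ≤ ν → 1 ≤ R → ‖x‖ ≤ R → Growth q b G ν x →
    (∀ ξ : Fin N → ℝ, ν * ∑ i, ξ i ^ 2 ≤ ∑ i, ∑ j, q i j x * ξ i * ξ j) →
    CutPt q b (cutη R) (M * G) ν x := by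
  have hd : Continuous (deriv cutψ) := smooth_deriv_cutψ.continuous
  have hd2 : Continuous (deriv (deriv cutψ)) :=
    (((contDiff_infty_iff_deriv (f := deriv cutψ)).1 smooth_deriv_cutψ).2).continuous
  obtain ⟨m1, hm1⟩ := (isCompact_Icc (a := (0 : ℝ)) (b := 1)).exists_bound_of_continuousOn
    hd.continuousOn
  obtain ⟨m2, hm2⟩ := (isCompact_Icc (a := (0 : ℝ)) (b := 1)).exists_bound_of_continuousOn
    hd2.continuousOn
  have hm10 : 0 ≤ m1 := (norm_nonneg _).trans (hm1 0 (by simp))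
  have hm20 : 0 ≤ m2 := (norm_nonneg _).trans (hm2 0 (by simp))
  refine ⟨1 + 8 * m1 + 8 * m2, by linarith, ?_⟩
  intro q b G ν R x hG hν hR hx H hell
  have hR0 : 0 < R := by linarith
  set t := ‖x‖ ^ 2 / R ^ 2 with ht
  have htm : t ∈ Icc (0 : ℝ) 1 := by
    refine ⟨by positivity, ?_⟩
    rw [ht, div_le_one (by positivity)]; gcongr
  have e1 : |deriv cutψ t| ≤ m1 := hm1 t htm
  have e2 : |deriv (deriv cutψ) t| ≤ m2 := hm2 t htm
  have e0 := deriv_cutψ_nonpos t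
  have hxR : 1 + ‖x‖ ^ 2 ≤ 2 * R ^ 2 := by nlinarith [norm_nonneg x]
  have hxR2 : (1 + ‖x‖ ^ 2) * ‖x‖ ≤ 2 * R ^ 4 := by
    have : ‖x‖ ≤ R ^ 2 := hx.trans (by nlinarith)
    calc (1 + ‖x‖ ^ 2) * ‖x‖ ≤ 2 * R ^ 2 * R ^ 2 := by gcongr
      _ = _ := by ring
  have hGν : 0 ≤ G * ν := mul_nonneg hG hν
  refine ⟨hell, ?_, ?_⟩
  · have eL : Lop q b (fun _ => 0) (cutη R) x
        = deriv (deriv cutψ) t * (4 / R ^ 4) * (∑ i, ∑ j, q i j x * x i * x j)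
        + deriv cutψ t * (2 / R ^ 2) * (∑ i, q i i x)
        + deriv cutψ t * (2 / R ^ 2) * (∑ j, b j x * x j) := by
      simp only [Lop, pd2_cutη, pd1_cutη, zero_mul, add_zero, mul_add, sum_add_distrib,
        mul_sum, ← ht, mul_ite, mul_one, mul_zero, Finset.sum_ite_eq', Finset.mem_univ,
        if_true]
      congr 1
      · congr 1
        · exact sum_congr rfl fun i _ => sum_congr rfl fun j _ => by ring
        · exact sum_congr rfl fun i _ => by ring
      · exact sum_congr rfl fun i _ => by ring
    have a1 : -(8 * m2 * (G * ν)) ≤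
        deriv (deriv cutψ) t * (4 / R ^ 4) * (∑ i, ∑ j, q i j x * x i * x j) := by
      refine neg_le_of_abs_le ?_
      rw [abs_mul, abs_mul, abs_of_pos (by positivity : 0 < 4 / R ^ 4)]
      calc _ ≤ m2 * (4 / R ^ 4) * (G * (1 + ‖x‖ ^ 2) * ν * ‖x‖) := by gcongr; exact H.Q x
        _ = m2 * (4 / R ^ 4) * (G * ν * ((1 + ‖x‖ ^ 2) * ‖x‖)) := by ring
        _ ≤ m2 * (4 / R ^ 4) * (G * ν * (2 * R ^ 4)) := by gcongr
        _ = _ := by field_simp; ring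
    have a2 : ∀ y, y ≤ G * (1 + ‖x‖ ^ 2) * ν →
        -(4 * m1 * (G * ν)) ≤ deriv cutψ t * (2 / R ^ 2) * y := fun y hy => by
      have : y ≤ G * ν * (2 * R ^ 2) := hy.trans (by
        rw [show G * (1 + ‖x‖ ^ 2) * ν = G * ν * (1 + ‖x‖ ^ 2) by ring]; gcongr)
      have h2 : -deriv cutψ t * (2 / R ^ 2) * y ≤ -deriv cutψ t * (2 / R ^ 2) * (G * ν * (2 * R ^ 2)) := by
        have : 0 ≤ -deriv cutψ t := by linarith
        gcongr
      have h3 : -deriv cutψ t * (2 / R ^ 2) * (G * ν * (2 * R ^ 2)) = -deriv cutψ t * 4 * (G * ν) := by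
        field_simp; ring
      have h4 : -deriv cutψ t * 4 * (G * ν) ≤ m1 * 4 * (G * ν) := by
        have := (neg_le_abs _).trans e1
        gcongr
      linarith
    have b1 := a2 _ H.tr
    have b2 := a2 _ H.b
    rw [eL]
    linarith
  · intro τ ξ
    have eL : ∑ i, ∑ j, q i j x * pd1 (cutη R) i x * ξ j = deriv cutψ t * (2 / R ^ 2)
        * ∑ i, ∑ j, q i j x * x i * (WithLp.toLp 2 ξ : ES N) j := by
      simp only [pd1_cutη, mul_sum, ← ht]
      exact sum_congr rfl fun i _ => sum_congr rfl fun j _ => by ring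
    set z : ES N := WithLp.toLp 2 ξ with hz
    have hzn : ∑ i, ξ i ^ 2 = ‖z‖ ^ 2 := by rw [norm_sq_eq_sum]
    rw [eL, hzn]
    refine neg_le_of_abs_le ?_
    rw [abs_mul, abs_mul, abs_mul, abs_of_pos (by positivity : 0 < 2 / R ^ 2)]
    have := H.Q z
    calc _ ≤ |τ| * (m1 * (2 / R ^ 2) * (G * (1 + ‖x‖ ^ 2) * ν * ‖z‖)) := by gcongr
      _ = |τ| * (m1 * (2 / R ^ 2) * (G * ν * ‖z‖ * (1 + ‖x‖ ^ 2))) := by ring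
      _ ≤ |τ| * (m1 * (2 / R ^ 2) * (G * ν * ‖z‖ * (2 * R ^ 2))) := by gcongr
      _ = 2 * m1 * (G * ν) * (2 * |τ| * ‖z‖) := by field_simp
      _ ≤ 2 * m1 * (G * ν) * (|τ| ^ 2 + ‖z‖ ^ 2) := by
        gcongr; exact two_mul_le_add_sq _ _
      _ ≤ _ := by
        rw [sq_abs]
        have h1 : 0 ≤ G * ν * (τ ^ 2 + ‖z‖ ^ 2) := by positivity
        have h2 := mul_nonneg hm10 h1
        have h3 := mul_nonneg hm20 h1
        linarith

/-! ### Iterating the scheme -/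

lemma Gen.P0_le (G : Gen N) (hN : 1 ≤ N) {S : ℝ} (h : ∀ x, f x ≤ S) (z : ℝ)
    (x : ES N) : G.P0 z f x ≤ S := by
  have hN' : (0 : ℝ) < N := by exact_mod_cast hN
  rw [Gen.P0, div_le_iff₀ hN']
  have h1 : ∑ k : Fin N, (f (flow (G.s k) G.b z x) + f (flow (G.s k) G.b (-z) x)) / 2
      ≤ ∑ _k : Fin N, S := sum_le_sum fun k _ => by
    linarith [h (flow (G.s k) G.b z x), h (flow (G.s k) G.b (-z) x)]
  simpa [mul_comm] using h1

lemma Gen.P0_neg (G : Gen N) (f : Fn N) (z : ℝ) (x : ES N) :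
    G.P0 z (fun x => -f x) x = -G.P0 z f x := by
  simp only [Gen.P0, ← neg_div, ← Finset.sum_neg_distrib, neg_add]

lemma Gen.P0_sub (G : Gen N) (f g : Fn N) (z : ℝ) (x : ES N) :
    G.P0 z (fun x => f x - g x) x = G.P0 z f x - G.P0 z g x := by
  simp only [Gen.P0, ← sub_div, ← sum_sub_distrib]
  congr 1
  exact sum_congr rfl fun k _ => by ring

lemma Gen.P_sub (G : Gen N) (f g : Fn N) (z : ℝ) (x : ES N) :
    G.P z (fun x => f x - g x) x = G.P z f x - G.P z g x := by
  simp only [Gen.P, Gen.P0_sub]; ring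

lemma Gen.abs_P_le (G : Gen N) (hN : 1 ≤ N) {S c₀ z : ℝ} (h : ∀ x, |f x| ≤ S)
    (hc : ∀ x, G.c x ≤ c₀) (hz : ∀ x, 0 ≤ 1 + z ^ 2 * G.c x) (x : ES N) :
    |G.P z f x| ≤ (1 + z ^ 2 * c₀) * S := by
  have h1 : |G.P0 z f x| ≤ S := by
    refine abs_le.2 ⟨?_, G.P0_le hN (fun y => (le_abs_self _).trans (h y)) z x⟩
    have := G.P0_le hN (fun y => (neg_le_abs (f y)).trans (h y)) z x
    rw [G.P0_neg] at this
    linarith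
  rw [Gen.P, abs_mul, abs_of_nonneg (hz x)]
  have : 1 + z ^ 2 * G.c x ≤ 1 + z ^ 2 * c₀ := by nlinarith [hc x, sq_nonneg z]
  exact mul_le_mul this h1 (abs_nonneg _) ((hz x).trans this)

/-- The iterates of the scheme with varying generators. -/
def evo (g : ℕ → Gen N) (z : ℝ) : ℕ → Fn N → Fn N
  | 0, f => f
  | k + 1, f => (g k).P z (evo g z k f)

lemma smooth_evo (g : ℕ → Gen N) (z : ℝ) (k : ℕ) (hf : Smooth f) :
    Smooth (evo g z k f) := by
  induction k with
  | zero => exact hf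
  | succ k ih => exact (g k).smooth_P ih z

lemma evo_sub (g : ℕ → Gen N) (z : ℝ) (k : ℕ) (f f' : Fn N) :
    evo g z k (fun x => f x - f' x) = fun x => evo g z k f x - evo g z k f' x := by
  induction k with
  | zero => rfl
  | succ k ih => ext x; simp only [evo, ih, Gen.P_sub]

lemma Gen.P_eq_schemeV (G : Gen N) (z : ℝ) (f : Fn N) :
    (fun _ : Unit => G.P z f) = schemeV G.s G.b (fun _ _ _ z x => 1 + z * z * G.c x) z
      (fun _ : Unit => f) := by
  ext _ x
  simp only [Gen.P, Gen.P0, schemeV, branch, Finset.univ_unique, sum_singleton]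
  rw [← mul_div_assoc, mul_sum]
  congr 1
  exact sum_congr rfl fun k _ => by ring

lemma Gen.P_stable (G : Gen N) (hN : 1 ≤ N) (m : ℕ) : ∃ C, 0 ≤ C ∧ ∀ z f K, |z| ≤ 1 → 0 ≤ K →
    Smooth f → JB m Unit (fun _ => f) K →
    JB m Unit (fun _ => G.P z f) ((1 + C * z ^ 2) * K) := by
  obtain ⟨C, hC, h⟩ := schemeV_stable hN G.hs G.hb m Unit (fun _ _ _ z x => 1 + z * z * G.c x)
    (fun _ _ _ => (Amp.of (Sm.const 1)).add ((Amp.var.mul .var).mul (.of G.hc)))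
    (fun _ _ _ x => by simp)
  refine ⟨C, hC, fun z f K hz hK hf hJ => ?_⟩
  rw [G.P_eq_schemeV]
  exact h z _ K hz hK (fun _ => hf) hJ

lemma evo_stable (hN : 1 ≤ N) {ι : Type*} [Finite ι] (Γ : ι → Gen N) (m : ℕ) :
    ∃ C, 0 ≤ C ∧ ∀ (ix : ℕ → ι) z k f K, |z| ≤ 1 → Smooth f → Bd m f K →
      Bd m (evo (fun k => Γ (ix k)) z k f) (C * exp (C * (k * z ^ 2)) * K) := by
  choose C hC h using fun i => (Γ i).P_stable hN m
  obtain ⟨D, hD, hJ⟩ := exists_JB (N := N) m Unit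
  obtain ⟨M, hM⟩ := (Set.finite_range C).bddAbove
  have hM' : ∀ i, C i ≤ max M D := fun i => (hM (mem_range_self i)).trans (le_max_left _ _)
  have hM0 : 0 ≤ max M D := hD.trans (le_max_right _ _)
  refine ⟨max M D, hM0, fun ix z k f K hz hf hb => ?_⟩
  have hK := hb.nonneg
  have hmono : ∀ {F : Fn N} {K K' : ℝ}, 0 ≤ K → K ≤ K' → JB m Unit (fun _ => F) K →
      JB m Unit (fun _ => F) K' := by
    have : ∀ (m : ℕ) (ι : Type) [Fintype ι] (F : ι → Fn N) (K K' : ℝ), 0 ≤ K → K ≤ K' →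
        JB m ι F K → JB m ι F K' := by
      intro m
      induction m with
      | zero => exact fun ι _ F K K' h0 h h1 x => (h1 x).trans (pow_le_pow_left₀ h0 h 2)
      | succ m ih => exact fun ι _ F K K' h0 h h1 => ih _ _ _ _ h0 h h1
    intro F K K' h0 h h1
    exact this m Unit _ K K' h0 h h1
  have main : JB m Unit (fun _ => evo (fun k => Γ (ix k)) z k f)
      (exp (max M D * (k * z ^ 2)) * (D * K)) := by
    induction k with
    | zero => simpa [evo] using hJ (fun _ => f) K (fun _ => hb) hK
    | succ k ih =>
      refine hmono (by have := hC (ix k); positivity) ?_ (h (ix k) z _ _ hz (by positivity)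
        (smooth_evo _ z k hf) ih)
      have h1 : 1 + C (ix k) * z ^ 2 ≤ exp (max M D * z ^ 2) := by
        have := mul_le_mul_of_nonneg_right (hM' (ix k)) (sq_nonneg z)
        linarith [Real.add_one_le_exp (max M D * z ^ 2)]
      calc _ ≤ exp (max M D * z ^ 2) * (exp (max M D * (k * z ^ 2)) * (D * K)) := by
            gcongr
        _ = _ := by rw [← mul_assoc, ← exp_add]; push_cast; ring_nf
  refine (JB.bd (by positivity) main ()).mono ?_
  have : D ≤ max M D := le_max_right _ _
  calc _ ≤ exp (max M D * (k * z ^ 2)) * (max M D * K) := by gcongr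
    _ = _ := by ring

/-! ### One step of the scheme and the Bernstein functional -/

lemma abs_TT_le (k : ℕ) {f g : Fn N} {K L : ℝ} (hf : Bd k f K) (hg : Bd k g L) (x : ES N) :
    |TT k f g x| ≤ N ^ k * (K * L) := by
  induction k generalizing f g with
  | zero =>
    simp only [TT, pow_zero, one_mul, abs_mul]
    exact mul_le_mul (hf x) (hg x) (abs_nonneg _) ((abs_nonneg _).trans (hf x))
  | succ k ih =>
    calc |TT (k + 1) f g x| ≤ ∑ i, |TT k (pd1 f i) (pd1 g i) x| := abs_sum_le_sum_abs _ _
      _ ≤ ∑ _i : Fin N, (N : ℝ) ^ k * (K * L) := sum_le_sum fun i _ => ih (hf.2 i) (hg.2 i)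
      _ = _ := by simp [pow_succ]; ring

lemma SS_bd (k m : ℕ) : ∃ C : ℝ, 0 ≤ C ∧ ∀ (f : Fn N) K, Smooth f → Bd (k + m) f K →
    Bd m (SS k f) (C * K ^ 2) := by
  induction k with
  | zero =>
    refine ⟨2 ^ m, by positivity, fun f K hf h => ?_⟩
    have := Bd.mul hf hf (h.of_le (k := m) (by omega)) (h.of_le (k := m) (by omega))
    simpa only [SS, sq] using this
  | succ k ih =>
    obtain ⟨C, hC, h⟩ := ih
    refine ⟨N * C, by positivity, fun f K hf hb => ?_⟩
    have h1 : Bd (k + m + 1) f K := hb.of_le (by omega)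
    have := Bd.sum (m := m) Finset.univ (fun i => smooth_SS k (smooth_pd1 hf i))
      (fun i _ => h (pd1 f i) K (smooth_pd1 hf i) (h1.2 i))
    exact this.mono (by simp [mul_assoc])

lemma Gen.A_bd (G : Gen N) (m : ℕ) : ∃ C : ℝ, 0 ≤ C ∧ ∀ (f : Fn N) K, Smooth f →
    Bd (m + 2) f K → Bd m (G.A f) (C * K) := by
  obtain ⟨Q, hQ⟩ := exists_Bd_of_finite (fun p : Fin N × Fin N => G.q_Sm p.1 p.2) m
  obtain ⟨D, hD⟩ := exists_Bd_of_finite G.hb m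
  obtain ⟨E, hE⟩ := G.hc.2 m
  refine ⟨N * (N * (2 ^ m * |Q|)) + N * (2 ^ m * |D|) + 2 ^ m * |E|, by positivity,
    fun f K hf h => ?_⟩
  have h1 : Bd (m + 1 + 1) f K := h
  have e1 := Bd.sum (m := m) Finset.univ (f := fun i x => ∑ j, G.q i j x * pd1 (pd1 f j) i x)
    (K := fun _ => ∑ _j : Fin N, 2 ^ m * (|Q| * K))
    (fun i => ContDiff.sum fun j _ => (G.q_Sm i j).1.mul (smooth_pd1 (smooth_pd1 hf j) i))
    (fun i _ => Bd.sum Finset.univ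
      (fun j => (G.q_Sm i j).1.mul (smooth_pd1 (smooth_pd1 hf j) i))
      (fun j _ => Bd.mul (G.q_Sm i j).1 (smooth_pd1 (smooth_pd1 hf j) i)
        ((hQ (i, j)).mono (le_abs_self Q)) ((h1.2 j).2 i)))
  have e2 := Bd.sum (m := m) Finset.univ (f := fun j x => G.b j x * pd1 f j x)
    (K := fun _ => 2 ^ m * (|D| * K))
    (fun j => (G.hb j).1.mul (smooth_pd1 hf j))
    (fun j _ => Bd.mul (G.hb j).1 (smooth_pd1 hf j) ((hD j).mono (le_abs_self D))
      ((h1.2 j).of_le (by omega)))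
  have e3 := Bd.mul (m := m) G.hc.1 hf (hE.mono (le_abs_self E)) (h.of_le (by omega))
  have s1 : Smooth fun x => ∑ i, ∑ j, G.q i j x * pd1 (pd1 f j) i x :=
    ContDiff.sum fun i _ => ContDiff.sum fun j _ =>
      (G.q_Sm i j).1.mul (smooth_pd1 (smooth_pd1 hf j) i)
  have s2 : Smooth fun x => ∑ j, G.b j x * pd1 f j x :=
    ContDiff.sum fun j _ => (G.hb j).1.mul (smooth_pd1 hf j)
  have e4 := Bd.add (s1.add s2) (G.hc.1.mul hf) (Bd.add s1 s2 e1 e2) e3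
  refine Bd.mono (K := _) (f := G.A f) e4 (le_of_eq ?_)
  simp
  ring

lemma Sm_of_zero (hf : Smooth f) {R : ℝ} (h : ∀ x, R < ‖x‖ → f x = 0) :
    Sm f := by
  refine ⟨hf, fun m => ?_⟩
  induction m generalizing f with
  | zero =>
    obtain ⟨K, hK⟩ := ((isCompact_closedBall (0 : ES N) R).image hf.continuous.abs).bddAbove
    refine ⟨max K 0, fun x => ?_⟩
    by_cases hx : R < ‖x‖
    · simp [h x hx]
    · exact (hK ⟨x, by simpa using hx, rfl⟩).trans (le_max_left _ _)
  | succ m ih =>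
    obtain ⟨K, hK⟩ := ih hf h
    have h1 : ∀ i x, R < ‖x‖ → pd1 f i x = 0 := fun i x hx => by
      have : f =ᶠ[𝓝 x] fun _ => 0 := by
        filter_upwards [(isOpen_lt continuous_const continuous_norm).mem_nhds hx] with y hy
        exact h y hy
      simp [pd1, this.fderiv_eq]
    choose L hL using fun i => ih (smooth_pd1 hf i) (h1 i)
    refine ⟨|K| + ∑ i, |L i|, hK.mono ?_, fun i => (hL i).mono ?_⟩
    · exact (le_abs_self K).trans (le_add_of_nonneg_right (by positivity))
    · exact (le_abs_self _).trans ((single_le_sum (f := fun i => |L i|)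
        (fun _ _ => abs_nonneg _) (Finset.mem_univ i)).trans (le_add_of_nonneg_left (abs_nonneg _)))

lemma Gen.q_nonneg (G : Gen N) (x : ES N) (ξ : Fin N → ℝ) :
    0 ≤ ∑ i, ∑ j, G.q i j x * ξ i * ξ j := by
  have : ∑ i, ∑ j, G.q i j x * ξ i * ξ j
      = (1 / (2 * N)) * ∑ k, (∑ i, G.s k i x * ξ i) ^ 2 := by
    have e1 : ∀ i j, G.q i j x * ξ i * ξ j
        = ∑ k, 1 / (2 * (N : ℝ)) * (G.s k i x * ξ i * (G.s k j x * ξ j)) := fun i j => by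
      rw [Gen.q, mul_sum, sum_mul, sum_mul]
      exact sum_congr rfl fun _ _ => by ring
    have e2 : ∀ k, 1 / (2 * (N : ℝ)) * (∑ i, G.s k i x * ξ i) ^ 2
        = ∑ i, ∑ j, 1 / (2 * (N : ℝ)) * (G.s k i x * ξ i * (G.s k j x * ξ j)) := fun k => by
      rw [sq, sum_mul_sum, mul_sum]
      exact sum_congr rfl fun _ _ => mul_sum _ _ _
    rw [mul_sum, sum_congr rfl fun k _ => e2 k]
    refine Eq.trans (sum_congr rfl fun i _ => ?_) sum_comm
    refine Eq.trans ?_ sum_comm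
    exact sum_congr rfl fun j _ => e1 i j
  rw [this]
  positivity

lemma TT_lin (k : ℕ) {u f g : Fn N} (a : ℝ) (hf : Smooth f) (hg : Smooth g)
    (x : ES N) : TT k u (fun x => a * f x + g x) x = a * TT k u f x + TT k u g x := by
  induction k generalizing u f g with
  | zero => simp only [TT]; ring
  | succ k ih =>
    simp only [TT]
    rw [mul_sum, ← sum_add_distrib]
    refine sum_congr rfl fun i _ => ?_
    rw [pd1_add (smooth_diff (contDiff_const.mul hf)) (smooth_diff hg),
      pd1_const_mul a (smooth_diff hf), ih (smooth_pd1 hf i) (smooth_pd1 hg i)]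

lemma SS_add (k : ℕ) {u v : Fn N} (hu : Smooth u) (hv : Smooth v) (x : ES N) :
    SS k (fun x => u x + v x) x = SS k u x + 2 * TT k u v x + SS k v x := by
  induction k generalizing u v with
  | zero => simp only [SS, TT]; ring
  | succ k ih =>
    simp only [SS, TT]
    rw [mul_sum, ← sum_add_distrib, ← sum_add_distrib]
    refine sum_congr rfl fun i _ => ?_
    rw [pd1_add (smooth_diff hu) (smooth_diff hv), ih (smooth_pd1 hu i) (smooth_pd1 hv i)]

lemma step_num {p p' d E e S T S' D h ζ : ℝ} (hp : 0 ≤ p) (hpp : p ≤ p') (hpE : p' ≤ E)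
    (h1 : p' ≤ p + h * d + E * h ^ 2) (h2 : p' - p ≤ E * h) (he : 0 ≤ e) (he1 : e ≤ 1)
    (hS : 0 ≤ S) (hSD : S ≤ D) (hT : |T| ≤ D) (hh : 0 ≤ h) (hζ : h ^ 2 ≤ ζ)
    (hS' : S' ≤ S + 2 * h * T + D * ζ) :
    p' * (e * S') ≤ p * (e * S) + h * (2 * (p * (e * T)) + d * (e * S)) + 4 * E * D * ζ := by
  have hD : 0 ≤ D := hS.trans hSD
  have hE : 0 ≤ E := hp.trans (hpp.trans hpE)
  have hζ0 : 0 ≤ ζ := (sq_nonneg h).trans hζ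
  have a1 : p' * (e * S') ≤ p' * (e * (S + 2 * h * T + D * ζ)) := by
    have := hp.trans hpp; gcongr
  have a2 : p' * (e * S) ≤ (p + h * d + E * h ^ 2) * (e * S) := by gcongr
  have a3 : e * S ≤ D := by nlinarith
  have a4 : E * h ^ 2 * (e * S) ≤ E * ζ * D := by gcongr
  have a5 : e * T ≤ D := by
    have : e * T ≤ e * |T| := by gcongr; exact le_abs_self T
    nlinarith [abs_nonneg T]
  have a6 : 2 * h * ((p' - p) * (e * T)) ≤ 2 * E * ζ * D := by
    have b1 : (p' - p) * (e * T) ≤ (p' - p) * D :=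
      mul_le_mul_of_nonneg_left a5 (by linarith)
    have b2 : (p' - p) * D ≤ E * h * D := by gcongr
    have b3 : 2 * h * ((p' - p) * (e * T)) ≤ 2 * h * (E * h * D) :=
      mul_le_mul_of_nonneg_left (b1.trans b2) (by linarith)
    have b4 : h ^ 2 * (E * D) ≤ ζ * (E * D) := by gcongr
    nlinarith
  have a7 : p' * (e * (D * ζ)) ≤ E * (1 * (D * ζ)) := by
    have := hp.trans hpp; gcongr
  nlinarith

lemma pow_step {u u' ε Λ : ℝ} (h0 : 0 ≤ u) (h1 : u ≤ u') (h2 : u' ≤ u + ε) (h3 : u' ≤ Λ)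
    {k : ℕ} (hk : k ≤ 3) :
    u' ^ k ≤ 1 + Λ + Λ ^ 2 + Λ ^ 3 ∧ u' ^ k ≤ u ^ k + k * ε * u ^ (k - 1) + (1 + 3 * Λ + ε) * ε ^ 2
      ∧ u' ^ k - u ^ k ≤ (1 + 2 * Λ + 3 * Λ ^ 2) * ε := by
  have hΛ : 0 ≤ Λ := h0.trans (h1.trans h3)
  have hu' := h0.trans h1
  have hε : 0 ≤ ε := by linarith
  have huΛ : u ≤ Λ := h1.trans h3
  have hb : u' ^ k ≤ (u + ε) ^ k := by gcongr
  have p2 : u' ^ 2 ≤ Λ ^ 2 := by gcongr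
  have p3 : u' ^ 3 ≤ Λ ^ 3 := by gcongr
  have q2 : 0 ≤ Λ ^ 2 := by positivity
  have q3 : 0 ≤ Λ ^ 3 := by positivity
  have hε2 : 0 ≤ ε ^ 2 := by positivity
  have d0 : 0 ≤ u' - u := by linarith
  have e1 : u ^ 2 ≤ Λ ^ 2 := by gcongr
  have e2 : u * u' ≤ Λ ^ 2 := by rw [sq]; gcongr
  have hm : 0 ≤ Λ * ε := by positivity
  have hm2 : 0 ≤ Λ ^ 2 * ε := by positivity
  have hm3 : 0 ≤ Λ * ε ^ 2 := by positivity
  have hm4 : u * ε ^ 2 ≤ Λ * ε ^ 2 := by gcongr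
  interval_cases k
  · refine ⟨by rw [pow_zero]; linarith, ?_, ?_⟩
    · have : 0 ≤ (1 + 3 * Λ + ε) * ε ^ 2 := by positivity
      simp only [pow_zero, Nat.cast_zero, zero_mul, add_zero]
      linarith
    · have : 0 ≤ (1 + 2 * Λ + 3 * Λ ^ 2) * ε := by positivity
      simpa using this
  · refine ⟨by simp; linarith, by simp at hb ⊢; nlinarith [pow_nonneg hε 3], by simp; nlinarith⟩
  · refine ⟨by linarith, ?_, ?_⟩
    · push_cast; norm_num; nlinarith [pow_nonneg hε 3]
    · have : u' ^ 2 - u ^ 2 = (u' - u) * (u' + u) := by ring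
      have h : (u' - u) * (u' + u) ≤ ε * (Λ + Λ) := by gcongr; linarith
      nlinarith
  · refine ⟨by linarith, ?_, ?_⟩
    · push_cast; nlinarith [pow_nonneg hε 3]
    · have : u' ^ 3 - u ^ 3 = (u' - u) * (u' ^ 2 + u * u' + u ^ 2) := by ring
      have h : (u' - u) * (u' ^ 2 + u * u' + u ^ 2) ≤ ε * (Λ ^ 2 + Λ ^ 2 + Λ ^ 2) := by
        gcongr; linarith
      nlinarith

lemma Sm.pow (h : Sm f) (k : ℕ) : Sm fun x => f x ^ k := by
  induction k with
  | zero => simpa using Sm.const 1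
  | succ k ih => simpa only [pow_succ] using ih.mul h

lemma bV_bd {η : Fn N} (hη : Sm η) (n : ℕ) {E : ℝ} : ∃ C : ℝ, 0 ≤ C ∧
    ∀ (u : Fn N) K a w, Smooth u → Bd (n + 3) u K →
      (∀ k ≤ n, |(a * w) ^ k| ≤ E) → Bd 3 (bV n a w η u) (C * K ^ 2) := by
  choose D hD using fun k => (hη.pow (2 * k)).2 3
  choose C hC h using fun k => SS_bd (N := N) k 3
  refine ⟨∑ k ∈ Finset.range (n + 1), |E| * (2 ^ 3 * (|D k| * C k)),
    sum_nonneg fun k _ => by have := hC k; positivity, fun u K a w hu hb hE => ?_⟩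
  rw [sum_mul]
  have hs : ∀ k, Smooth fun x => η x ^ (2 * k) * SS k u x := fun k =>
    (hη.pow (2 * k)).1.mul (smooth_SS k hu)
  refine Bd.sum (f := fun k x => (a * w) ^ k * (η x ^ (2 * k) * SS k u x)) _
    (fun k => contDiff_const.mul (hs k)) (fun k hk => ?_)
  have hk' : k ≤ n := by simpa [Nat.lt_succ_iff] using hk
  have := Bd.const_mul ((a * w) ^ k) (hs k) (Bd.mul (hη.pow (2 * k)).1 (smooth_SS k hu)
    ((hD k).mono (le_abs_self _)) (h k u K hu (hb.of_le (by omega))))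
  refine this.mono ?_
  have h0 := hC k
  calc |(a * w) ^ k| * (2 ^ 3 * (|D k| * (C k * K ^ 2)))
      ≤ |E| * (2 ^ 3 * (|D k| * (C k * K ^ 2))) := by
        exact mul_le_mul_of_nonneg_right ((hE k hk').trans (le_abs_self _)) (by positivity)
    _ = _ := by ring

/-- The energy densities after one step of the scheme. -/
lemma SS_P_le (G : Gen N) (hN : 1 ≤ N) : ∃ D : ℝ, 0 ≤ D ∧ ∀ z (u : Fn N) K, |z| ≤ 1 →
    Smooth u → Bd 6 u K → ∀ k ≤ 3, ∀ x, SS k u x ≤ D * K ^ 2 ∧ |TT k u (G.A u) x| ≤ D * K ^ 2 ∧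
      SS k (G.P z u) x ≤ SS k u x + 2 * z ^ 2 * TT k u (G.A u) x + D * K ^ 2 * |z| ^ 3 := by
  obtain ⟨CA, hCA, hA⟩ := G.A_bd 3
  obtain ⟨Cc, hCc, hc⟩ := G.consistent hN 3
  have hN1 : (1 : ℝ) ≤ N := by exact_mod_cast hN
  have hNk : ∀ k ≤ 3, (N : ℝ) ^ k ≤ N ^ 3 := fun k hk => pow_le_pow_right₀ hN1 hk
  refine ⟨N ^ 3 * (1 + CA + 2 * Cc + (CA + Cc) ^ 2), by positivity, fun z u K hz hu hb k hk x => ?_⟩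
  have hK := hb.nonneg
  have hF := hA u K hu (hb.of_le (by omega))
  have hR := hc u K z hu hb hz
  have sF := G.smooth_A hu
  set R : Fn N := fun x => G.P z u x - u x - z ^ 2 * G.A u x with hRdef
  have sR : Smooth R := ((G.smooth_P hu z).sub hu).sub (contDiff_const.mul sF)
  have z1 : |z| ^ 3 ≤ z ^ 2 := by
    rw [pow_succ, sq_abs]; exact mul_le_of_le_one_right (sq_nonneg _) hz
  have z2 : (z ^ 2) ^ 2 ≤ |z| ^ 3 := by
    rw [← sq_abs z, ← pow_mul]; exact pow_le_pow_of_le_one (abs_nonneg _) hz (by norm_num)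
  have hv : Bd 3 (fun x => z ^ 2 * G.A u x + R x) ((CA + Cc) * K * z ^ 2) := by
    refine (Bd.add (contDiff_const.mul sF) sR (Bd.const_mul _ sF hF) hR).mono ?_
    rw [abs_of_nonneg (sq_nonneg z)]
    have := mul_le_mul_of_nonneg_left z1 (mul_nonneg hCc hK)
    nlinarith
  have b0 : SS k u x ≤ N ^ 3 * K ^ 2 := by
    rw [SS_eq_TT]
    have := (le_abs_self _).trans (abs_TT_le k (hb.of_le (by omega)) (hb.of_le (by omega)) x)
    calc _ ≤ _ := this
      _ ≤ N ^ 3 * (K * K) := by gcongr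
      _ = _ := by ring
  have b1 : |TT k u (G.A u) x| ≤ N ^ 3 * (CA * K ^ 2) := by
    have := abs_TT_le k (hb.of_le (by omega)) (hF.of_le hk) x
    calc _ ≤ _ := this
      _ ≤ N ^ 3 * (K * (CA * K)) := by gcongr
      _ = _ := by ring
  have b2 : |TT k u R x| ≤ N ^ 3 * (Cc * K ^ 2) * |z| ^ 3 := by
    have := abs_TT_le k (hb.of_le (by omega)) (hR.of_le hk) x
    calc _ ≤ _ := this
      _ ≤ N ^ 3 * (K * (Cc * K * |z| ^ 3)) := by gcongr
      _ = _ := by ring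
  have b3 : SS k (fun x => z ^ 2 * G.A u x + R x) x ≤ N ^ 3 * ((CA + Cc) ^ 2 * K ^ 2) * |z| ^ 3 := by
    rw [SS_eq_TT]
    have := (le_abs_self _).trans (abs_TT_le k (hv.of_le hk) (hv.of_le hk) x)
    calc _ ≤ _ := this
      _ ≤ N ^ 3 * ((CA + Cc) * K * z ^ 2 * ((CA + Cc) * K * z ^ 2)) := by gcongr
      _ = N ^ 3 * ((CA + Cc) ^ 2 * K ^ 2) * (z ^ 2) ^ 2 := by ring
      _ ≤ _ := by gcongr
  have e : G.P z u = fun x => u x + (z ^ 2 * G.A u x + R x) := by ext x; rw [hRdef]; ring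
  have p1 : 0 ≤ (N : ℝ) ^ 3 * K ^ 2 := by positivity
  have p2 : 0 ≤ (N : ℝ) ^ 3 * K ^ 2 * CA := by positivity
  have p3 : 0 ≤ (N : ℝ) ^ 3 * K ^ 2 * Cc := by positivity
  have p4 : 0 ≤ (N : ℝ) ^ 3 * K ^ 2 * (CA + Cc) ^ 2 := by positivity
  refine ⟨by linarith, by linarith, ?_⟩
  rw [e, SS_add k hu ((contDiff_const.mul sF).add sR), TT_lin k _ sF sR]
  have h5 := (abs_le.1 b2).2
  have p5 : 0 ≤ (N : ℝ) ^ 3 * K ^ 2 * (1 + CA) * |z| ^ 3 := by positivity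
  nlinarith

theorem bern_step (G : Gen N) (hN : 1 ≤ N) {η : Fn N} (hη : Sm η) (h0 : ∀ x, 0 ≤ η x)
    (h1 : ∀ x, η x ≤ 1) {n : ℕ} (hn : n ≤ 3) {a Cb W : ℝ} (ha : 0 < a) (hCb : 0 ≤ Cb) (hW : 0 ≤ W)
    (hber : ∀ u x w, Smooth u → 0 ≤ w → w ≤ W → bE n a w η u (G.A u) x
      ≤ G.A0 (bV n a w η u) x + Cb * bV n a w η u x) :
    ∃ C : ℝ, 0 ≤ C ∧ ∀ z (u : Fn N) K w w' S, |z| ≤ 1 → Smooth u → Bd 6 u K → 0 ≤ w →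
      w ≤ w' → w' ≤ w + z ^ 2 → w' ≤ W → (∀ x, bV n a w η u x ≤ S) →
      ∀ x, bV n a w' η (G.P z u) x ≤ (1 + Cb * z ^ 2) * S + C * K ^ 2 * |z| ^ 3 := by
  obtain ⟨D, hD, hS⟩ := SS_P_le G hN
  obtain ⟨Cd, hCd, hc⟩ := G.drop.consistent hN 0
  set Λ := a * W with hΛdef
  have hΛ : 0 ≤ Λ := by positivity
  set E := (1 + Λ + Λ ^ 2 + Λ ^ 3) + (1 + 3 * Λ + a) * a ^ 2 + (1 + 2 * Λ + 3 * Λ ^ 2) * a with hE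
  have hE1 : 1 + Λ + Λ ^ 2 + Λ ^ 3 ≤ E := by
    have : 0 ≤ (1 + 3 * Λ + a) * a ^ 2 + (1 + 2 * Λ + 3 * Λ ^ 2) * a := by positivity
    linarith
  have hE2 : (1 + 3 * Λ + a) * a ^ 2 ≤ E := by
    have : 0 ≤ (1 + Λ + Λ ^ 2 + Λ ^ 3) + (1 + 2 * Λ + 3 * Λ ^ 2) * a := by positivity
    linarith
  have hE3 : (1 + 2 * Λ + 3 * Λ ^ 2) * a ≤ E := by
    have : 0 ≤ (1 + Λ + Λ ^ 2 + Λ ^ 3) + (1 + 3 * Λ + a) * a ^ 2 := by positivity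
    linarith
  have hE0 : 0 ≤ E := le_trans (by positivity) hE1
  clear_value E
  obtain ⟨CV, hCV, hV⟩ := bV_bd hη n (E := E)
  refine ⟨16 * E * D + Cd * CV, by positivity, fun z u K w w' S hz hu hb hw hww hw' hw'W hVS x => ?_⟩
  have z2 : (z ^ 2) ^ 2 ≤ |z| ^ 3 := by
    rw [← sq_abs z, ← pow_mul]; exact pow_le_pow_of_le_one (abs_nonneg _) hz (by norm_num)
  have z3 : z ^ 2 ≤ 1 := by rw [← sq_abs]; exact pow_le_one₀ (abs_nonneg _) hz
  have u0 : 0 ≤ a * w := by positivity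
  have u1 : a * w ≤ a * w' := by gcongr
  have u2 : a * w' ≤ a * w + a * z ^ 2 := by nlinarith
  have u3 : a * w' ≤ Λ := by rw [hΛdef]; gcongr
  have hterm : ∀ k ∈ Finset.range (n + 1),
      (a * w') ^ k * (η x ^ (2 * k) * SS k (G.P z u) x)
        ≤ (a * w) ^ k * (η x ^ (2 * k) * SS k u x)
          + z ^ 2 * (2 * ((a * w) ^ k * (η x ^ (2 * k) * TT k u (G.A u) x))
            + k * a * (a * w) ^ (k - 1) * (η x ^ (2 * k) * SS k u x))
          + 4 * E * (D * K ^ 2) * |z| ^ 3 := by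
    intro k hk
    have hk3 : k ≤ 3 := by have := Finset.mem_range.1 hk; omega
    obtain ⟨q1, q2, q3⟩ := pow_step u0 u1 u2 u3 hk3
    obtain ⟨s1, s2, s3⟩ := hS z u K hz hu hb k hk3 x
    refine step_num (pow_nonneg u0 k) (pow_le_pow_left₀ u0 u1 k) (q1.trans hE1) ?_ ?_
      (pow_nonneg (h0 x) _) (pow_le_one₀ (h0 x) (h1 x)) (SS_nonneg _ _ _) s1 s2 (sq_nonneg z) z2 s3
    · have : (1 + 3 * Λ + a * z ^ 2) * (a * z ^ 2) ^ 2 ≤ E * (z ^ 2) ^ 2 := by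
        calc _ ≤ (1 + 3 * Λ + a) * (a * z ^ 2) ^ 2 := by gcongr; nlinarith
          _ = ((1 + 3 * Λ + a) * a ^ 2) * (z ^ 2) ^ 2 := by ring
          _ ≤ _ := by gcongr
      linarith
    · calc _ ≤ _ := q3
        _ = (1 + 2 * Λ + 3 * Λ ^ 2) * a * z ^ 2 := by ring
        _ ≤ _ := by gcongr
  have hsum := sum_le_sum hterm
  have hEk : ∀ k ≤ n, |(a * w) ^ k| ≤ E := fun k hk => by
    rw [abs_of_nonneg (by positivity)]
    exact (pow_le_pow_left₀ u0 u1 k).trans ((pow_step u0 u1 u2 u3 (hk.trans hn)).1.trans hE1)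
  have hVb := hV u K a w hu (hb.of_le (by omega)) hEk
  have sV := smooth_bV n a w hη.1 hu
  have hcon := hc _ _ z sV hVb hz x
  have hP0 := G.P0_le hN hVS z x
  rw [Gen.P_drop, Gen.A_drop] at hcon
  have hbE := hber u x w hu hw (hww.trans hw'W)
  have hmain : bV n a w' η (G.P z u) x ≤ bV n a w η u x + z ^ 2 * bE n a w η u (G.A u) x
      + 16 * E * (D * K ^ 2) * |z| ^ 3 := by
    refine le_trans hsum ?_
    rw [sum_add_distrib, sum_add_distrib, ← mul_sum, sum_add_distrib,
      ← mul_sum]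
    have hcard : ∑ _k ∈ Finset.range (n + 1), 4 * E * (D * K ^ 2) * |z| ^ 3
        ≤ 16 * E * (D * K ^ 2) * |z| ^ 3 := by
      rw [sum_const, Finset.card_range, nsmul_eq_mul]
      have h4 : ((n + 1 : ℕ) : ℝ) ≤ 4 := by exact_mod_cast (by omega : n + 1 ≤ 4)
      have h5 : 0 ≤ E * (D * K ^ 2) * |z| ^ 3 := by positivity
      nlinarith
    exact add_le_add_right hcard _
  have hcon' := (abs_le.1 hcon).1
  have hh := sq_nonneg z
  have g1 := mul_le_mul_of_nonneg_left hbE hh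
  have g2 := mul_le_mul_of_nonneg_left (hVS x) (mul_nonneg hh hCb)
  nlinarith

/-! ### Bernstein estimates for the iterates of the scheme -/

lemma Pt.mono {q : Fin N → VF N} {b : VF N} {c : Fn N}
    {B B' ν d r ϱ : ℝ} {x : ES N} (h : Pt q b c B ν d r ϱ x) (hB : B ≤ B') :
    Pt q b c B' ν d r ϱ x := by
  have hν := h.ν_nonneg
  have hm : B * ν ≤ B' * ν := by gcongr
  exact ⟨h.B_nonneg.trans hB, hν, fun i j l => (h.q1 i j l).trans hm,
    fun Ξ hΞ => (h.q2 Ξ hΞ).trans (by gcongr), fun i j k l m => (h.q3 i j k l m).trans hm,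
    h.b1, h.b2, h.b3, h.c1, h.c2, h.c3⟩

/-- Quantitative hypotheses on a generator in the ball of radius `R`. -/
structure GenHyp (G : Gen N) (B ν₀ L₁ L₂ L₃ c₀ R : ℝ) : Prop where
  c_le : ∀ x, G.c x ≤ c₀
  ball : ∀ x, ‖x‖ ≤ R → ∃ ν d r ϱ : ℝ, ν₀ ≤ ν ∧ 0 ≤ r ∧ d + L₁ * r + L₂ * ϱ ^ 2 ≤ L₃ * ν ∧
    Pt G.q G.b G.c B ν d r ϱ x ∧ Growth G.q G.b B ν x ∧
    ∀ ξ : Fin N → ℝ, ν * ∑ i, ξ i ^ 2 ≤ ∑ i, ∑ j, G.q i j x * ξ i * ξ j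

lemma GenHyp.bern {B ν₀ L₁ L₂ L₃ : ℝ} (N : ℕ) (c₀ : ℝ) (hB : 0 ≤ B) (hν₀ : 0 < ν₀) (hL₁ : 0 < L₁)
    (hL₂ : 0 < L₂) (hL₃ : 0 < L₃) {W : ℝ} (hW : 0 ≤ W) :
    ∃ a > 0, ∃ C ≥ 0, ∀ (G : Gen N) R, 1 ≤ R → GenHyp G B ν₀ L₁ L₂ L₃ c₀ R →
      ∀ n, n = 2 ∨ n = 3 → ∀ (u : Fn N) x w, Smooth u → 0 ≤ w → w ≤ W →
      bE n a w (cutη R) u (G.A u) x ≤ G.A0 (bV n a w (cutη R) u) x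
        + C * bV n a w (cutη R) u x := by
  obtain ⟨M, hM, hcut⟩ := cutPt_of_growth N
  have hMB : B ≤ M * B := le_mul_of_one_le_left hB hM
  obtain ⟨a, ha, C, hC, h⟩ := bernstein N c₀ (hB.trans hMB) hν₀ hL₁ hL₂ hL₃ hW
  refine ⟨a, ha, C, hC, fun G R hR H n hn u x w hu hw hwW => ?_⟩
  refine h G.q G.b G.c (cutη R) u x (fun i j => (G.q_Sm i j).1) (fun j => (G.hb j).1) G.hc.1
    G.q_symm G.q_nonneg (smooth_cutη R) (cutη_nonneg R x) (cutη_le_one R x) hu (H.c_le x) ?_ w hw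
    hwW n hn
  rcases le_or_gt ‖x‖ R with hx | hx
  · obtain ⟨ν, d, r, ϱ, h1, h2, h3, h4, h5, h6⟩ := H.ball x hx
    exact Or.inr ⟨ν, d, r, ϱ, h1, h2, h3, h4.mono hMB,
      hcut G.q G.b B ν R x hB h4.ν_nonneg hR hx h5 h6⟩
  · exact Or.inl (cutη_eq_zero (by linarith) hx.le)

lemma Sm_cutη {R : ℝ} (hR : 0 < R) : Sm (cutη R : Fn N) :=
  Sm_of_zero (smooth_cutη R) (R := R) fun _ hx => cutη_eq_zero hR hx.le

theorem evo_bern_aux (hN : 1 ≤ N) {B ν₀ L₁ L₂ L₃ : ℝ} (c₀ : ℝ) (hB : 0 ≤ B) (hν₀ : 0 < ν₀)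
    (hL₁ : 0 < L₁) (hL₂ : 0 < L₂) (hL₃ : 0 < L₃) {T : ℝ} (hT : 0 ≤ T) :
    ∃ a > 0, ∃ C ≥ 0, ∀ (ι : Type) [Finite ι] (Γ : ι → Gen N) (R : ℝ), 1 ≤ R →
      (∀ i, GenHyp (Γ i) B ν₀ L₁ L₂ L₃ c₀ R) → ∀ K δ : ℝ, 0 < δ → ∃ z₀ > 0, z₀ ≤ 1 ∧
      ∀ z, 0 < z → z ≤ z₀ → ∀ (ix : ℕ → ι) (k : ℕ) (φ : Fn N), k * z ^ 2 ≤ T →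
        Smooth φ → Bd 6 φ K → ∀ n, n = 2 ∨ n = 3 → ∀ w κ : ℝ, 0 ≤ w → w ≤ 1 → 0 ≤ κ → κ ≤ 1 →
        ∀ S, 0 ≤ S → (∀ x, bV n a w (cutη R) φ x ≤ S) →
        ∀ x, bV n a (w + κ * (k * z ^ 2)) (cutη R) (evo (fun j => Γ (ix j)) z k φ) x
          ≤ C * (S + k * z ^ 2 * δ ^ 2) := by
  obtain ⟨a, ha, Cb, hCb, hb⟩ := GenHyp.bern N c₀ hB hν₀ hL₁ hL₂ hL₃ (W := T + 1) (by linarith)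
  refine ⟨a, ha, exp (Cb * T), (exp_pos _).le, fun ι _ Γ R hR H K δ hδ => ?_⟩
  have hη := Sm_cutη (N := N) (by linarith : 0 < R)
  have hstep : ∀ p : ι × Bool, ∃ C : ℝ, 0 ≤ C ∧ ∀ z (u : Fn N) K w w' S, |z| ≤ 1 →
      Smooth u → Bd 6 u K → 0 ≤ w → w ≤ w' → w' ≤ w + z ^ 2 → w' ≤ T + 1 →
      (∀ x, bV (cond p.2 2 3) a w (cutη R) u x ≤ S) →
      ∀ x, bV (cond p.2 2 3) a w' (cutη R) ((Γ p.1).P z u) x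
        ≤ (1 + Cb * z ^ 2) * S + C * K ^ 2 * |z| ^ 3 := fun p =>
    bern_step (Γ p.1) hN hη (cutη_nonneg R) (cutη_le_one R) (by cases p.2 <;> simp) ha hCb
      (by linarith) (hb (Γ p.1) R hR (H p.1) _ (by cases p.2 <;> simp))
  choose C hC hst using hstep
  obtain ⟨M, hM⟩ := (Set.finite_range C).bddAbove
  obtain ⟨D, hD, hstab⟩ := evo_stable hN Γ 6
  set L := |M| * (D * exp (D * T) * K) ^ 2 + 1 with hL
  have hLpos : 0 < L := by positivity
  refine ⟨min 1 (δ ^ 2 / L), by positivity, min_le_left _ _,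
    fun z hz hz0 ix k φ hk hφ hφK n hn w κ hw hw1 hκ hκ1 S hS hV x => ?_⟩
  have hz1 : |z| ≤ 1 := by rw [abs_of_pos hz]; exact hz0.trans (min_le_left _ _)
  have hzδ : L * z ≤ δ ^ 2 := by
    have := (le_div_iff₀ hLpos).1 (hz0.trans (min_le_right _ _)); linarith
  have main : ∀ m ≤ k, ∀ x, bV n a (w + κ * (m * z ^ 2)) (cutη R)
      (evo (fun j => Γ (ix j)) z m φ) x ≤ exp (Cb * (m * z ^ 2)) * (S + m * z ^ 2 * δ ^ 2) := by
    intro m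
    induction m with
    | zero => intro _ x; simpa [evo] using hV x
    | succ m ih =>
      intro hm x
      have hmk : (m : ℝ) * z ^ 2 ≤ T := le_trans (by gcongr; omega) hk
      have hmk' : ((m + 1 : ℕ) : ℝ) * z ^ 2 ≤ T := le_trans (by gcongr) hk
      have hbd : Bd 6 (evo (fun j => Γ (ix j)) z m φ) (D * exp (D * T) * K) := by
        refine (hstab ix z m φ K hz1 hφ hφK).mono ?_
        have := hφK.nonneg
        gcongr
      have hz2 : 0 ≤ z ^ 2 := sq_nonneg z
      obtain ⟨β, hβ⟩ : ∃ β : Bool, n = cond β 2 3 := by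
        rcases hn with rfl | rfl
        exacts [⟨true, rfl⟩, ⟨false, rfl⟩]
      have key := hst (ix m, β) z (evo (fun j => Γ (ix j)) z m φ) _ (w + κ * (m * z ^ 2))
        (w + κ * ((m + 1 : ℕ) * z ^ 2)) _ hz1 (smooth_evo _ z m hφ) hbd (by positivity)
        (by push_cast; nlinarith) (by push_cast; nlinarith) (by nlinarith)
        (by rw [← hβ]; exact ih (by omega)) x
      rw [← hβ] at key
      refine le_trans key ?_
      have hE : C (ix m, β) * (D * exp (D * T) * K) ^ 2 * |z| ^ 3 ≤ z ^ 2 * δ ^ 2 := by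
        have h1 : C (ix m, β) ≤ |M| := (hM (mem_range_self _)).trans (le_abs_self _)
        rw [abs_of_pos hz]
        calc _ ≤ |M| * (D * exp (D * T) * K) ^ 2 * z ^ 3 := by gcongr
          _ ≤ L * z ^ 3 := by gcongr; rw [hL]; linarith
          _ = z ^ 2 * (L * z) := by ring
          _ ≤ _ := by gcongr
      have e1 : 1 + Cb * z ^ 2 ≤ exp (Cb * z ^ 2) := by
        linarith [Real.add_one_le_exp (Cb * z ^ 2)]
      have e2 : 1 ≤ exp (Cb * ((m + 1 : ℕ) * z ^ 2)) := Real.one_le_exp (by positivity)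
      calc _ ≤ exp (Cb * z ^ 2) * (exp (Cb * (m * z ^ 2)) * (S + m * z ^ 2 * δ ^ 2))
            + exp (Cb * ((m + 1 : ℕ) * z ^ 2)) * (z ^ 2 * δ ^ 2) := by
            refine add_le_add (by gcongr) (hE.trans ?_)
            exact le_mul_of_one_le_left (by positivity) e2
        _ = _ := by
          rw [← mul_assoc, ← exp_add]
          push_cast
          rw [show Cb * z ^ 2 + Cb * (m * z ^ 2) = Cb * ((m + 1) * z ^ 2) by ring]
          ring
  refine (main k le_rfl x).trans ?_
  gcongr

/-- Smoothing and stability estimates for the iterates of the scheme in the ball of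
radius `R / 2`. -/
structure EvoEst {ι : Type} (Γ : ι → Gen N) (C R T z δ K : ℝ) : Prop where
  smoothing : ∀ (ix : ℕ → ι) (k : ℕ) (φ : Fn N), k * z ^ 2 ≤ T → Smooth φ → Bd 6 φ K →
    ∀ S, (∀ x, |φ x| ≤ S) → ∀ j ≤ 3, ∀ x, ‖x‖ ≤ R / 2 →
    (k * z ^ 2) ^ j * SS j (evo (fun j => Γ (ix j)) z k φ) x ≤ C * (S ^ 2 + k * z ^ 2 * δ ^ 2)
  stability : ∀ (ix : ℕ → ι) (k : ℕ) (φ : Fn N), k * z ^ 2 ≤ T → Smooth φ → Bd 6 φ K →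
    ∀ n, n = 2 ∨ n = 3 → ∀ S, (∀ j ≤ n, ∀ x, SS j φ x ≤ S) → ∀ j ≤ n, ∀ x, ‖x‖ ≤ R / 2 →
    SS j (evo (fun j => Γ (ix j)) z k φ) x ≤ C * (S + k * z ^ 2 * δ ^ 2)

lemma SS_le_bV {n j : ℕ} (hj : j ≤ n) {a w : ℝ} (ha : 0 ≤ a) (hw : 0 ≤ w) {η u : Fn N}
    {x : ES N} (_ : 0 ≤ η x) (h : η x = 1) : (a * w) ^ j * SS j u x ≤ bV n a w η u x := by
  have := single_le_sum
    (f := fun k => (a * w) ^ k * (η x ^ (2 * k) * SS k u x)) (s := Finset.range (n + 1))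
    (fun k _ => by have := SS_nonneg k u x; positivity) (Finset.mem_range.2 (by omega : j < n + 1))
  simpa [bV, h] using this

lemma bV_le {n : ℕ} (hn : n ≤ 3) {a S : ℝ} (ha : 0 ≤ a) {η u : Fn N} {x : ES N}
    (hη : 0 ≤ η x) (hη1 : η x ≤ 1) (h : ∀ j ≤ n, SS j u x ≤ S) :
    bV n a 1 η u x ≤ 4 * (1 + a) ^ 3 * S := by
  have hS : 0 ≤ S := (SS_nonneg 0 u x).trans (h 0 (by omega))
  have : ∀ k ∈ Finset.range (n + 1), (a * 1) ^ k * (η x ^ (2 * k) * SS k u x) ≤ (1 + a) ^ 3 * S := by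
    intro k hk
    have hk : k ≤ n := by simpa [Nat.lt_succ_iff] using hk
    have e1 : (a * 1) ^ k ≤ (1 + a) ^ 3 := by
      rw [mul_one]
      exact (pow_le_pow_left₀ ha (by linarith) k).trans
        (pow_le_pow_right₀ (by linarith) (hk.trans hn))
    have e2 : η x ^ (2 * k) * SS k u x ≤ 1 * S :=
      mul_le_mul (pow_le_one₀ hη hη1) (h k hk) (SS_nonneg _ _ _) zero_le_one
    rw [one_mul] at e2
    have := SS_nonneg k u x
    exact mul_le_mul e1 e2 (by positivity) (by positivity)
  refine (sum_le_card_nsmul _ _ _ this).trans ?_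
  rw [Finset.card_range, nsmul_eq_mul]
  have h4 : ((n + 1 : ℕ) : ℝ) ≤ 4 := by exact_mod_cast (by omega : n + 1 ≤ 4)
  have : 0 ≤ (1 + a) ^ 3 * S := by positivity
  nlinarith

theorem exists_evoEst (hN : 1 ≤ N) {B ν₀ L₁ L₂ L₃ : ℝ} (c₀ : ℝ) (hB : 0 ≤ B) (hν₀ : 0 < ν₀)
    (hL₁ : 0 < L₁) (hL₂ : 0 < L₂) (hL₃ : 0 < L₃) {T : ℝ} (hT : 0 ≤ T) :
    ∃ C ≥ 0, ∀ (ι : Type) [Finite ι] (Γ : ι → Gen N) (R : ℝ), 1 ≤ R →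
      (∀ i, GenHyp (Γ i) B ν₀ L₁ L₂ L₃ c₀ R) → ∀ K δ : ℝ, 0 < δ → ∃ z₀ > 0, z₀ ≤ 1 ∧
      ∀ z, 0 < z → z ≤ z₀ → EvoEst Γ C R T z δ K := by
  obtain ⟨a, ha, C, hC, h⟩ := evo_bern_aux hN c₀ hB hν₀ hL₁ hL₂ hL₃ hT
  set m := min 1 a with hm
  have hm0 : 0 < m := by positivity
  have hma : ∀ j ≤ 3, m ^ 3 ≤ a ^ j := fun j hj =>
    (pow_le_pow_of_le_one hm0.le (min_le_left _ _) hj).trans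
      (pow_le_pow_left₀ hm0.le (min_le_right _ _) j)
  set D := 4 * (1 + a) ^ 3 with hD
  have hD1 : 1 ≤ D := by rw [hD]; nlinarith [pow_le_pow_left₀ zero_le_one (by linarith : 1 ≤ 1 + a) 3]
  clear_value m D
  refine ⟨C * D / m ^ 3, by positivity, fun ι _ Γ R hR H K δ hδ => ?_⟩
  obtain ⟨z₀, hz₀, hz1, hz⟩ := h ι Γ R hR H K δ hδ
  have hη1 : ∀ x : ES N, ‖x‖ ≤ R / 2 → cutη R x = 1 := fun x hx =>
    cutη_eq_one (by linarith) hx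
  refine ⟨z₀, hz₀, hz1, fun z hz0 hzz => ⟨?_, ?_⟩⟩
  · intro ix k φ hk hφ hφK S hS j hj x hx
    have hτ : 0 ≤ k * z ^ 2 := by positivity
    have h0 : ∀ x, bV 3 a 0 (cutη R) φ x ≤ S ^ 2 := fun x => by
      have : bV 3 a 0 (cutη R) φ x = φ x ^ 2 := by simp [bV, sum_range_succ, SS]
      rw [this]
      exact sq_le_sq' (abs_le.1 (hS x)).1 (abs_le.1 (hS x)).2
    have := hz z hz0 hzz ix k φ hk hφ hφK 3 (Or.inr rfl) 0 1 le_rfl zero_le_one zero_le_one le_rfl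
      _ (sq_nonneg S) h0 x
    rw [zero_add, one_mul] at this
    have h1 := (SS_le_bV (u := evo (fun j => Γ (ix j)) z k φ) hj ha.le hτ (cutη_nonneg R x)
      (hη1 x hx)).trans this
    rw [mul_pow, mul_assoc] at h1
    set A := (k * z ^ 2) ^ j * SS j (evo (fun j => Γ (ix j)) z k φ) x
    have hA : 0 ≤ A := mul_nonneg (pow_nonneg hτ _) (SS_nonneg _ _ _)
    have h2 : m ^ 3 * A ≤ C * (S ^ 2 + k * z ^ 2 * δ ^ 2) :=
      (mul_le_mul_of_nonneg_right (hma j hj) hA).trans h1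
    rw [div_mul_eq_mul_div, le_div_iff₀ (by positivity)]
    have : 0 ≤ C * (S ^ 2 + k * z ^ 2 * δ ^ 2) := by positivity
    nlinarith
  · intro ix k φ hk hφ hφK n hn S hS j hj x hx
    have hn3 : n ≤ 3 := by omega
    have hS0 : 0 ≤ S := (SS_nonneg 0 φ x).trans (hS 0 (by omega) x)
    have hτ : 0 ≤ k * z ^ 2 := by positivity
    have := hz z hz0 hzz ix k φ hk hφ hφK n hn 1 0 zero_le_one le_rfl le_rfl zero_le_one
      (D * S) (by positivity) (fun x => hD ▸ bV_le hn3 ha.le (cutη_nonneg R x)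
        (cutη_le_one R x) fun j hj => hS j hj x) x
    rw [zero_mul, add_zero] at this
    have h1 := (SS_le_bV (u := evo (fun j => Γ (ix j)) z k φ) hj ha.le zero_le_one
      (cutη_nonneg R x) (hη1 x hx)).trans this
    rw [mul_one] at h1
    set A := SS j (evo (fun j => Γ (ix j)) z k φ) x
    have hA : 0 ≤ A := SS_nonneg _ _ _
    have h2 : m ^ 3 * A ≤ C * (D * S + k * z ^ 2 * δ ^ 2) :=
      (mul_le_mul_of_nonneg_right (hma j (hj.trans hn3)) hA).trans h1
    rw [div_mul_eq_mul_div, le_div_iff₀ (by positivity)]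
    have e : C * (D * S + k * z ^ 2 * δ ^ 2) ≤ C * D * (S + k * z ^ 2 * δ ^ 2) := by
      have : 0 ≤ k * z ^ 2 * δ ^ 2 := by positivity
      have : C * (D * S + k * z ^ 2 * δ ^ 2) ≤ C * (D * S + D * (k * z ^ 2 * δ ^ 2)) := by
        exact mul_le_mul_of_nonneg_left
          (by have := le_mul_of_one_le_left this hD1; linarith) hC
      linarith
    linarith

/-- The mollification of `f` at scale `ε` with kernel `κ`. -/
def molk (κ : Fn N) (ε : ℝ) (f : Fn N) (x : ES N) : ℝ := ∫ y, κ y * f (x - ε • y)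

/-- A smooth compactly supported kernel. -/
def Ker (κ : Fn N) : Prop := Smooth κ ∧ HasCompactSupport κ

lemma Ker.pd1 {κ : Fn N} (h : Ker κ) (i : Fin N) : Ker (pd1 κ i) :=
  ⟨smooth_pd1 h.1 i, h.2.fderiv_apply (𝕜 := ℝ) _⟩

lemma Ker.integrable {κ : Fn N} (h : Ker κ) : Integrable κ :=
  h.1.continuous.integrable_of_hasCompactSupport h.2

lemma Ker.integrable_mul {κ f : Fn N} (h : Ker κ) (hf : Continuous f) :
    Integrable (fun y => κ y * f y) :=
  (h.1.continuous.mul hf).integrable_of_hasCompactSupport h.2.mul_right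

lemma Ker.integrable_molk {κ f : Fn N} (h : Ker κ) (hf : Continuous f) (ε : ℝ) (x : ES N) :
    Integrable (fun y => κ y * f (x - ε • y)) :=
  h.integrable_mul (hf.comp (by fun_prop : Continuous fun y => x - ε • y))

/-- The `L¹` norm of a kernel. -/
def kerNorm (κ : Fn N) : ℝ := ∫ y, |κ y|

lemma kerNorm_nonneg (κ : Fn N) : 0 ≤ kerNorm κ := integral_nonneg fun _ => abs_nonneg _

lemma abs_molk_le {κ f : Fn N} (h : Ker κ) {ε K : ℝ} {x : ES N}
    (hK : ∀ y, κ y ≠ 0 → |f (x - ε • y)| ≤ K) : |molk κ ε f x| ≤ K * kerNorm κ := by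
  rw [molk, kerNorm, ← integral_const_mul, ← norm_eq_abs]
  refine norm_integral_le_of_norm_le (h.integrable.abs.const_mul K) (ae_of_all _ fun y => ?_)
  rw [norm_eq_abs, abs_mul, mul_comm]
  by_cases hy : κ y = 0
  · simp [hy]
  · exact mul_le_mul_of_nonneg_right (hK y hy) (abs_nonneg _)

lemma molk_sub_const {κ f : Fn N} (h : Ker κ) (hf : Continuous f) (ε a : ℝ) (x : ES N) :
    molk κ ε (fun y => f y - a) x = molk κ ε f x - a * ∫ y, κ y := by
  simp only [molk, mul_sub]
  rw [integral_sub (h.integrable_molk hf ε x) (h.integrable.mul_const a), integral_mul_const,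
    mul_comm a]

lemma ker_dilate {κ : Fn N} (h : Ker κ) {ε : ℝ} (hε : 0 < ε) (a : ℝ) :
    Ker fun y => a * κ (ε⁻¹ • y) := by
  refine ⟨contDiff_const.mul (h.1.comp (contDiff_id.const_smul ε⁻¹)), ?_⟩
  exact (h.2.comp_smul (inv_ne_zero hε.ne')).mul_left

lemma molk_eq_convolution (κ f : Fn N) {ε : ℝ} (hε : 0 < ε) :
    molk κ ε f = convolution (fun y => (ε ^ N)⁻¹ * κ (ε⁻¹ • y)) f
      (ContinuousLinearMap.mul ℝ ℝ) volume := by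
  ext x
  rw [convolution_def, molk]
  have := Measure.integral_comp_smul (volume : Measure (ES N))
    (fun y => κ (ε⁻¹ • y) * f (x - y)) ε
  simp only [smul_smul, inv_mul_cancel₀ hε.ne', one_smul, finrank_euclideanSpace,
    Fintype.card_fin] at this
  rw [this, abs_of_pos (by positivity), smul_eq_mul, ← integral_const_mul]
  refine integral_congr_ae (ae_of_all _ fun y => ?_)
  simp [mul_assoc]

lemma smooth_molk {κ f : Fn N} (h : Ker κ) (hf : Continuous f) {ε : ℝ} (hε : 0 < ε) :
    Smooth (molk κ ε f) := by
  have hk := ker_dilate h hε (ε ^ N)⁻¹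
  rw [molk_eq_convolution κ f hε]
  exact hk.2.contDiff_convolution_left (n := ⊤) _ hk.1 hf.locallyIntegrable

lemma pd1_molk_left {κ f : Fn N} (h : Ker κ) (hf : Continuous f) {ε : ℝ} (hε : 0 < ε)
    (i : Fin N) : pd1 (molk κ ε f) i = fun x => ε⁻¹ * molk (pd1 κ i) ε f x := by
  have hk := ker_dilate h hε (ε ^ N)⁻¹
  have hd : ∀ y, pd1 (fun y => (ε ^ N)⁻¹ * κ (ε⁻¹ • y)) i y
      = ε⁻¹ * ((ε ^ N)⁻¹ * pd1 κ i (ε⁻¹ • y)) := by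
    intro y
    have hκd := smooth_diff h.1
    rw [pd1_const_mul (f := fun y => κ (ε⁻¹ • y)) _
      (hκd.comp (by fun_prop : Differentiable ℝ fun y : ES N => ε⁻¹ • y))]
    have : pd1 (fun y => κ (ε⁻¹ • y)) i y = ε⁻¹ * pd1 κ i (ε⁻¹ • y) := by
      have h1 : HasFDerivAt (fun y : ES N => κ (ε⁻¹ • y))
          ((fderiv ℝ κ (ε⁻¹ • y)).comp (ε⁻¹ • ContinuousLinearMap.id ℝ (ES N))) y :=
        (hκd _).hasFDerivAt.comp y (ε⁻¹ • ContinuousLinearMap.id ℝ (ES N)).hasFDerivAt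
      simp [_root_.pd1, h1.fderiv]
    simp only [this]; ring
  ext x
  have h1 := hk.2.hasFDerivAt_convolution_left (ContinuousLinearMap.mul ℝ ℝ)
    (hk.1.of_le (by simp)) hf.locallyIntegrable (μ := volume) x
  rw [molk_eq_convolution κ f hε, molk_eq_convolution _ f hε]
  simp only [_root_.pd1, h1.fderiv]
  rw [convolution_def, convolution_def, ContinuousLinearMap.integral_apply]
  · rw [← integral_const_mul]
    refine integral_congr_ae (ae_of_all _ fun y => ?_)
    have := hd y
    simp only [_root_.pd1] at this
    simp [this, ContinuousLinearMap.precompL_apply]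
    ring
  · exact ((hk.2.fderiv ℝ).convolutionExists_left _
      (hk.1.continuous_fderiv (by simp)) hf.locallyIntegrable) x

lemma norm_fderiv_le_sum (f : Fn N) (x : ES N) : ‖fderiv ℝ f x‖ ≤ ∑ j, |pd1 f j x| := by
  refine ContinuousLinearMap.opNorm_le_bound _
    (sum_nonneg fun _ _ => abs_nonneg _) fun v => ?_
  rw [fderiv_apply_eq, norm_eq_abs, sum_mul]
  refine (abs_sum_le_sum_abs _ _).trans (sum_le_sum fun j _ => ?_)
  rw [abs_mul]
  exact mul_le_mul_of_nonneg_left (by simpa using PiLp.norm_apply_le v j) (abs_nonneg _)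

lemma pd1_molk_right {κ f : Fn N} (h : Ker κ) (hf : ContDiff ℝ 1 f) {K : ℝ}
    (hK : ∀ i x, |pd1 f i x| ≤ K) (ε : ℝ) (i : Fin N) :
    pd1 (molk κ ε f) i = molk κ ε (pd1 f i) := by
  ext x
  have hfd : Differentiable ℝ f := hf.differentiable one_ne_zero
  have hc : Continuous (fderiv ℝ f) := hf.continuous_fderiv one_ne_zero
  have hF' : ∀ x, Continuous fun y => κ y • fderiv ℝ f (x - ε • y) := fun x =>
    h.1.continuous.smul (hc.comp (by fun_prop))
  have key : HasFDerivAt (molk κ ε f) (∫ y, κ y • fderiv ℝ f (x - ε • y)) x := by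
    refine hasFDerivAt_integral_of_dominated_of_fderiv_le (μ := volume) (s := univ)
      (F := fun x y => κ y * f (x - ε • y)) (F' := fun x y => κ y • fderiv ℝ f (x - ε • y))
      (bound := fun y => |κ y| * (N * K)) univ_mem
      (Eventually.of_forall fun x => (h.integrable_molk hfd.continuous ε x).1)
      (h.integrable_molk hfd.continuous ε x) (hF' x).aestronglyMeasurable
      (ae_of_all _ fun y x _ => ?_) (h.integrable.abs.mul_const _) (ae_of_all _ fun y x _ => ?_)
    · rw [norm_smul, norm_eq_abs]
      refine mul_le_mul_of_nonneg_left ((norm_fderiv_le_sum _ _).trans ?_) (abs_nonneg _)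
      exact (sum_le_sum fun j _ => hK j _).trans (by simp)
    · have h1 : HasFDerivAt (fun x => f (x - ε • y)) (fderiv ℝ f (x - ε • y)) x := by
        have h2 := (hfd (x - ε • y)).hasFDerivAt.comp x ((hasFDerivAt_id x).sub_const (ε • y))
        rwa [ContinuousLinearMap.comp_id] at h2
      exact h1.const_mul (κ y)
  simp only [pd1, key.fderiv]
  rw [ContinuousLinearMap.integral_apply]
  · simp [molk, pd1]
  · exact (hF' x).integrable_of_hasCompactSupport h.2.smul_right

/-- A nonnegative kernel of mass one supported in the unit ball. -/
lemma exists_mollifier (N : ℕ) : ∃ κ : Fn N, Ker κ ∧ (∀ y, 0 ≤ κ y) ∧ ∫ y, κ y = 1 ∧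
    ∀ y, κ y ≠ 0 → ‖y‖ ≤ 1 := by
  let f : ContDiffBump (0 : ES N) := ⟨1 / 2, 1, by norm_num, by norm_num⟩
  refine ⟨f.normed volume, ⟨f.contDiff_normed, f.hasCompactSupport_normed⟩, f.nonneg_normed,
    f.integral_normed, fun y hy => ?_⟩
  have : y ∈ Function.support (f.normed volume) := hy
  rw [f.support_normed_eq] at this
  exact (mem_ball_zero_iff.1 this).le

/-- Nonnegative smooth kernels of mass one supported in the unit ball. -/
structure Moll (κ : Fn N) : Prop where
  ker : Ker κ
  nonneg : ∀ y, 0 ≤ κ y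
  int : ∫ y, κ y = 1
  supp : ∀ y, κ y ≠ 0 → ‖y‖ ≤ 1

lemma exists_moll (N : ℕ) : ∃ κ : Fn N, Moll κ := by
  obtain ⟨κ, h1, h2, h3, h4⟩ := exists_mollifier N
  exact ⟨κ, h1, h2, h3, h4⟩

lemma Moll.kerNorm {κ : Fn N} (h : Moll κ) : kerNorm κ = 1 := by
  simp [Schauder.kerNorm, abs_of_nonneg (h.nonneg _), h.int]

lemma Moll.abs_le {κ f : Fn N} (h : Moll κ) {ε K : ℝ} {x : ES N}
    (hK : ∀ y, |f y| ≤ K) : |molk κ ε f x| ≤ K := by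
  simpa [h.kerNorm] using abs_molk_le h.ker (fun y _ => hK _)

lemma norm_shift_le {y : ES N} (hy : ‖y‖ ≤ 1) {ε : ℝ} (hε : 0 < ε) (x : ES N) :
    ‖x - ε • y - x‖ ≤ ε := by
  rw [sub_sub_cancel_left, norm_neg, norm_smul, norm_eq_abs, abs_of_pos hε]
  exact mul_le_of_le_one_right hε.le hy

lemma Moll.abs_sub_le {κ f : Fn N} (h : Moll κ) (hf : Continuous f) {ε L : ℝ} (hε : 0 < ε)
    {x : ES N} (hL : ∀ y, ‖y - x‖ ≤ ε → |f y - f x| ≤ L) : |molk κ ε f x - f x| ≤ L := by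
  have h1 := molk_sub_const h.ker hf ε (f x) x
  rw [h.int, mul_one] at h1
  rw [← h1]
  simpa [h.kerNorm] using abs_molk_le (f := fun y => f y - f x) h.ker
    (fun y hy => hL _ (norm_shift_le (h.supp y hy) hε x))

/-- Functions bounded and `θ`-Hölder continuous with constant `H`. -/
structure HB (θ H : ℝ) (g : Fn N) : Prop where
  bd : ∀ x, |g x| ≤ H
  hol : ∀ x y, |g x - g y| ≤ H * ‖x - y‖ ^ θ

lemma HB.nonneg {θ H : ℝ} {g : Fn N} (h : HB θ H g) : 0 ≤ H := (abs_nonneg _).trans (h.bd 0)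

lemma continuous_of_hol {θ H : ℝ} (hθ : 0 < θ) {g : Fn N}
    (h : ∀ x y, |g x - g y| ≤ H * ‖x - y‖ ^ θ) : Continuous g := by
  refine continuous_iff_continuousAt.2 fun x => ?_
  rw [ContinuousAt, tendsto_iff_norm_sub_tendsto_zero]
  have h1 : Tendsto (fun y => H * ‖y - x‖ ^ θ) (𝓝 x) (𝓝 0) := by
    have : Continuous fun y => H * ‖y - x‖ ^ θ :=
      continuous_const.mul ((continuous_id.sub continuous_const).norm.rpow_const
        fun _ => Or.inr hθ.le)
    simpa [hθ.ne'] using this.tendsto x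
  exact squeeze_zero (fun _ => norm_nonneg _) (fun y => h y x) h1

lemma HB.cont {θ H : ℝ} (hθ : 0 < θ) {g : Fn N} (h : HB θ H g) : Continuous g :=
  continuous_of_hol hθ h.hol

lemma molk_sub {κ f g : Fn N} (h : Ker κ) (hf : Continuous f) (hg : Continuous g) (ε : ℝ)
    (x : ES N) : molk κ ε (fun y => f y - g y) x = molk κ ε f x - molk κ ε g x := by
  simp only [molk, mul_sub]
  exact integral_sub (h.integrable_molk hf ε x) (h.integrable_molk hg ε x)

lemma Moll.hb {κ g : Fn N} (h : Moll κ) {θ H : ℝ} (hθ : 0 < θ) (hg : HB θ H g) (ε : ℝ) :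
    HB θ H (molk κ ε g) := by
  refine ⟨fun x => h.abs_le hg.bd, fun x y => ?_⟩
  have hc := hg.cont hθ
  have e : molk κ ε g x - molk κ ε g y = molk κ ε (fun z => g z - g (z - (x - y))) x := by
    rw [molk_sub (g := fun z => g (z - (x - y))) h.ker hc
      (hc.comp (by fun_prop : Continuous fun z => z - (x - y)))]
    congr 1
    exact integral_congr_ae (ae_of_all _ fun z => by
      have : x - ε • z - (x - y) = y - ε • z := by abel
      simp only [this])
  rw [e]
  exact h.abs_le fun z => by simpa using hg.hol z (z - (x - y))

lemma HB.moll_sub {κ g : Fn N} (h : Moll κ) {θ H : ℝ} (hθ : 0 < θ) (hg : HB θ H g) {ε : ℝ}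
    (hε : 0 < ε) (x : ES N) : |g x - molk κ ε g x| ≤ H * ε ^ θ := by
  rw [abs_sub_comm]
  refine h.abs_sub_le (hg.cont hθ) hε fun y hy => (hg.hol y x).trans ?_
  exact mul_le_mul_of_nonneg_left (rpow_le_rpow (norm_nonneg _) hy hθ.le) hg.nonneg

lemma pd1_supp {κ : Fn N} (h : ∀ y, κ y ≠ 0 → ‖y‖ ≤ 1) (i : Fin N) (y : ES N)
    (hy : pd1 κ i y ≠ 0) : ‖y‖ ≤ 1 := by
  have h1 : y ∈ tsupport κ := by
    apply support_fderiv_subset ℝ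
    intro h0
    exact hy (by simp [pd1, h0])
  have h2 : tsupport κ ⊆ closedBall 0 1 :=
    closure_minimal (fun z hz => mem_closedBall_zero_iff.2 (h z hz)) isClosed_closedBall
  exact mem_closedBall_zero_iff.1 (h2 h1)

lemma SS_const_mul (k : ℕ) (a : ℝ) (hf : Smooth f) (x : ES N) :
    SS k (fun x => a * f x) x = a ^ 2 * SS k f x := by
  induction k generalizing f with
  | zero => simp only [SS]; ring
  | succ k ih =>
    simp only [SS, mul_sum]
    refine sum_congr rfl fun i _ => ?_
    rw [pd1_const_mul a (smooth_diff hf), ih (smooth_pd1 hf i)]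

lemma SS_molk_le (k : ℕ) {κ : Fn N} (h : Ker κ) (hs : ∀ y, κ y ≠ 0 → ‖y‖ ≤ 1) :
    ∃ C, 0 ≤ C ∧ ∀ (ε : ℝ) (g : Fn N) (x : ES N) (S : ℝ), 0 < ε → Continuous g →
      (∀ y, ‖y - x‖ ≤ ε → |g y| ≤ S) → SS k (molk κ ε g) x ≤ C * ((ε⁻¹) ^ k * S) ^ 2 := by
  induction k generalizing κ with
  | zero =>
    refine ⟨kerNorm κ ^ 2, by positivity, fun ε g x S hε hg hS => ?_⟩
    have h1 := abs_molk_le (f := g) h (fun y hy => hS _ (norm_shift_le (hs y hy) hε x))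
    have h2 := pow_le_pow_left₀ (abs_nonneg _) h1 2
    rw [sq_abs] at h2
    simp only [SS]
    nlinarith
  | succ k ih =>
    choose C hC0 hC using fun i => ih (h.pd1 i) (pd1_supp hs i)
    refine ⟨∑ i, C i, sum_nonneg fun i _ => hC0 i, fun ε g x S hε hg hS => ?_⟩
    simp only [SS, sum_mul]
    refine sum_le_sum fun i _ => ?_
    rw [pd1_molk_left h hg hε, SS_const_mul k _ (smooth_molk (h.pd1 i) hg hε)]
    calc _ ≤ (ε⁻¹) ^ 2 * (C i * ((ε⁻¹) ^ k * S) ^ 2) :=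
          mul_le_mul_of_nonneg_left (hC i ε g x S hε hg hS) (by positivity)
      _ = _ := by ring

/-- Derivative bounds for mollified Hölder functions. -/
lemma SS_molk_hol (k : ℕ) {κ : Fn N} (h : Moll κ) :
    ∃ C, 0 ≤ C ∧ ∀ (ε θ H : ℝ) (g : Fn N) (x : ES N), 0 < ε → 0 < θ → HB θ H g →
      SS (k + 1) (molk κ ε g) x ≤ C * ((ε⁻¹) ^ (k + 1) * (H * ε ^ θ)) ^ 2 := by
  obtain ⟨C, hC0, hC⟩ := SS_molk_le (k + 1) h.ker h.supp
  refine ⟨C, hC0, fun ε θ H g x hε hθ hg => ?_⟩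
  have hc := hg.cont hθ
  have e : molk κ ε (fun y => g y - g x) = fun z => molk κ ε g z - g x := by
    ext z; rw [molk_sub_const h.ker hc, h.int, mul_one]
  have := hC ε (fun y => g y - g x) x (H * ε ^ θ) hε (hc.sub continuous_const) fun y hy =>
    (hg.hol y x).trans (mul_le_mul_of_nonneg_left
      (rpow_le_rpow (norm_nonneg _) hy hθ.le) hg.nonneg)
  rw [e] at this
  convert this using 1
  simp only [SS]
  refine sum_congr rfl fun i _ => ?_
  rw [pd1_sub (smooth_diff (smooth_molk h.ker hc hε)) (differentiable_const _), pd1_const]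
  simp

/-- Mollification at a fixed scale bounds all derivatives by the sup norm. -/
lemma Bd_molk (m : ℕ) {κ : Fn N} (h : Ker κ) {ε : ℝ} (hε : 0 < ε) :
    ∃ C, 0 ≤ C ∧ ∀ (g : Fn N) (S : ℝ), Continuous g → (∀ y, |g y| ≤ S) →
      Bd m (molk κ ε g) (C * S) := by
  induction m generalizing κ with
  | zero =>
    refine ⟨kerNorm κ, kerNorm_nonneg κ, fun g S hg hS x => ?_⟩
    rw [mul_comm]
    exact abs_molk_le h fun y _ => hS _
  | succ m ih =>
    obtain ⟨C0, hC00, hC0⟩ := ih h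
    choose C hCn hC using fun i => ih (h.pd1 i)
    have hs : 0 ≤ ∑ i, ε⁻¹ * C i := sum_nonneg fun i _ => by have := hCn i; positivity
    refine ⟨C0 + ∑ i, ε⁻¹ * C i, by linarith, fun g S hg hS => ⟨?_, fun i => ?_⟩⟩
    all_goals have hS0 : 0 ≤ S := (abs_nonneg _).trans (hS 0)
    · exact (hC0 g S hg hS).mono (by nlinarith)
    · rw [pd1_molk_left h hg hε]
      refine ((hC i g S hg hS).const_mul ε⁻¹ (smooth_molk (h.pd1 i) hg hε)).mono ?_
      rw [abs_of_pos (by positivity), ← mul_assoc]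
      refine mul_le_mul_of_nonneg_right ?_ hS0
      have := single_le_sum (f := fun i => ε⁻¹ * C i)
        (fun i _ => by have := hCn i; positivity) (Finset.mem_univ i)
      linarith

lemma Moll.bd {m : ℕ} {κ : Fn N} (h : Moll κ) {K : ℝ}
    (hf : Smooth f) (hK : Bd m f K) (ε : ℝ) : Bd m (molk κ ε f) K := by
  induction m generalizing f with
  | zero => exact fun x => h.abs_le hK
  | succ m ih =>
    refine ⟨ih hf hK.1, fun i => ?_⟩
    rw [pd1_molk_right h.ker (hf.of_le (by simp)) (fun i x => (hK.2 i).zero x)]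
    exact ih (smooth_pd1 hf i) (hK.2 i)

lemma rpow_sub_le {a t h : ℝ} (ha : 0 ≤ a) (ha1 : a ≤ 1) (ht : 0 < t) (hh : h ≤ t) :
    a * t ^ (a - 1) * h ≤ t ^ a - (t - h) ^ a := by
  have h1 : (t - h) ^ a = t ^ a * (1 + -(h / t)) ^ a := by
    rw [← Real.mul_rpow ht.le (by have := (div_le_one ht).2 hh; linarith)]
    congr 1; field_simp; ring
  have h2 := _root_.rpow_one_add_le_one_add_mul_self
    (s := -(h / t)) (by have := (div_le_one ht).2 hh; linarith) ha ha1
  have h3 := mul_le_mul_of_nonneg_left h2 (Real.rpow_nonneg ht.le a)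
  rw [h1, Real.rpow_sub_one ht.ne']
  have : a * (t ^ a / t) * h = t ^ a * (a * (h / t)) := by ring
  linarith

lemma rpow_neg_sub_le {p t h : ℝ} (hp : 0 ≤ p) (hp1 : p ≤ 1) (hh0 : 0 ≤ h) (ht : 0 < t)
    (hh : h ≤ t) : p / 2 * t ^ (-p - 1) * h ≤ t ^ (-p) - (t + h) ^ (-p) := by
  have hth : 0 < t + h := by linarith
  have h1 : (t + h) ^ (-p) = t ^ (-p) * (1 + -(h / (t + h))) ^ p := by
    have e : 1 + -(h / (t + h)) = t / (t + h) := by field_simp; ring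
    rw [e, Real.div_rpow ht.le hth.le, Real.rpow_neg hth.le, Real.rpow_neg ht.le]
    have := (Real.rpow_pos_of_pos ht p).ne'
    field_simp
  have hle : h / (t + h) ≤ 1 := (div_le_one hth).2 (by linarith)
  have h2 := _root_.rpow_one_add_le_one_add_mul_self (s := -(h / (t + h))) (by linarith) hp hp1
  have h3 := mul_le_mul_of_nonneg_left h2 (Real.rpow_nonneg ht.le (-p))
  rw [h1, Real.rpow_sub_one ht.ne']
  have h4 : h / (2 * t) ≤ h / (t + h) := div_le_div_of_nonneg_left hh0 hth (by linarith)
  have h5 := mul_le_mul_of_nonneg_left h4 (mul_nonneg (Real.rpow_nonneg ht.le (-p)) hp)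
  have : p / 2 * (t ^ (-p) / t) * h = t ^ (-p) * p * (h / (2 * t)) := by field_simp
  nlinarith

lemma sum_short {a h r : ℝ} (ha : 0 < a) (ha1 : a ≤ 1) (hh : 0 < h) (hr : 0 ≤ r) (j : ℕ) :
    ∑ m ∈ Finset.range j, (if (m + 1 : ℝ) * h ≤ r then h * ((m + 1) * h) ^ (a - 1) else 0)
      ≤ r ^ a / a := by
  have key : ∀ m ∈ Finset.range j,
      (if (m + 1 : ℝ) * h ≤ r then h * ((m + 1 : ℝ) * h) ^ (a - 1) else 0)
      ≤ min (((m + 1 : ℕ) * h) ^ a) (r ^ a) / a - min ((m * h) ^ a) (r ^ a) / a := by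
    intro m _
    rw [← sub_div, le_div_iff₀ ha]
    have hm : ((m : ℝ) * h) ^ a ≤ ((m + 1 : ℕ) * h) ^ a :=
      rpow_le_rpow (by positivity) (by push_cast; nlinarith) ha.le
    split_ifs with hmr
    · have h1 : ((m + 1 : ℕ) * h) ^ a ≤ r ^ a :=
        rpow_le_rpow (by positivity) (by push_cast; exact hmr) ha.le
      rw [min_eq_left h1, min_eq_left (hm.trans h1)]
      have := rpow_sub_le (t := (m + 1) * h) (h := h) ha.le ha1 (by positivity)
        (by nlinarith [Nat.cast_nonneg (α := ℝ) m])
      have e : ((m : ℝ) + 1) * h - h = m * h := by ring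
      rw [e] at this
      push_cast
      linarith
    · rw [zero_mul, sub_nonneg]
      exact min_le_min_right _ hm
  refine (sum_le_sum key).trans ?_
  rw [Finset.sum_range_sub (fun m : ℕ => min (((m : ℝ) * h) ^ a) (r ^ a) / a)]
  have h1 : 0 ≤ min (((0 : ℕ) * h) ^ a) (r ^ a) / a := by
    have := Real.rpow_nonneg hr a
    positivity
  have h2 : min (((j : ℕ) * h) ^ a) (r ^ a) / a ≤ r ^ a / a :=
    div_le_div_of_nonneg_right (min_le_right _ _) ha.le
  linarith

lemma sum_long {p h r : ℝ} (hp : 0 < p) (hp1 : p ≤ 1) (hh : 0 < h) (hr : 0 < r) (j : ℕ) :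
    ∑ m ∈ Finset.range j, (if r < (m + 1 : ℝ) * h then h * ((m + 1) * h) ^ (-p - 1) else 0)
      ≤ 2 / p * r ^ (-p) := by
  have key : ∀ m ∈ Finset.range j,
      (if r < (m + 1 : ℝ) * h then h * ((m + 1 : ℝ) * h) ^ (-p - 1) else 0)
      ≤ 2 / p * min (((m + 1 : ℝ) * h) ^ (-p)) (r ^ (-p))
        - 2 / p * min (((((m + 1 : ℕ) : ℝ) + 1) * h) ^ (-p)) (r ^ (-p)) := by
    intro m _
    rw [← mul_sub]
    have hm : ((((m + 1 : ℕ) : ℝ) + 1) * h) ^ (-p) ≤ ((m + 1 : ℝ) * h) ^ (-p) :=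
      Real.rpow_le_rpow_of_nonpos (by positivity) (by push_cast; nlinarith) (by linarith)
    split_ifs with hmr
    · have h1 : ((m + 1 : ℝ) * h) ^ (-p) ≤ r ^ (-p) :=
        Real.rpow_le_rpow_of_nonpos hr hmr.le (by linarith)
      rw [min_eq_left h1, min_eq_left (hm.trans h1)]
      have := rpow_neg_sub_le (t := (m + 1) * h) (h := h) hp.le hp1 hh.le (by positivity)
        (by nlinarith [Nat.cast_nonneg (α := ℝ) m])
      have e : ((m : ℝ) + 1) * h + h = (((m + 1 : ℕ) : ℝ) + 1) * h := by push_cast; ring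
      rw [e] at this
      have := mul_le_mul_of_nonneg_left this (by positivity : 0 ≤ 2 / p)
      refine le_trans (le_of_eq ?_) this
      field_simp
    · exact mul_nonneg (by positivity) (sub_nonneg.2 (min_le_min_right _ hm))
  refine (sum_le_sum key).trans ?_
  rw [Finset.sum_range_sub' (fun m : ℕ => 2 / p * min ((((m : ℝ) + 1) * h) ^ (-p)) (r ^ (-p)))]
  have h1 : 0 ≤ 2 / p * min ((((j : ℝ) + 1) * h) ^ (-p)) (r ^ (-p)) := by positivity
  have h2 : 2 / p * min (((((0 : ℕ) : ℝ) + 1) * h) ^ (-p)) (r ^ (-p)) ≤ 2 / p * r ^ (-p) :=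
    mul_le_mul_of_nonneg_left (min_le_right _ _) (by positivity)
  linarith

lemma sqrt_rpow_mul {t : ℝ} (ht : 0 < t) (θ : ℝ) (n : ℕ) :
    √t ^ θ * (√t)⁻¹ ^ n = t ^ ((θ - n) / 2) := by
  have hs := Real.sqrt_pos.2 ht
  rw [← Real.rpow_natCast, Real.inv_rpow hs.le, ← Real.rpow_neg hs.le, ← Real.rpow_add hs,
    Real.sqrt_eq_rpow, ← Real.rpow_mul ht.le]
  congr 1; ring

/-- Summation of the singular bounds on the second derivatives. -/
lemma sum_singular {θ h : ℝ} (hθ : θ ∈ Ioo (0:ℝ) 1) (hh : 0 < h) (j : ℕ) :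
    ∑ m ∈ Finset.range j, h * (√((m + 1) * h) ^ θ * (√((m + 1) * h))⁻¹ ^ 2)
      ≤ (j * h) ^ (θ / 2) / (θ / 2) := by
  refine le_trans (le_of_eq (sum_congr rfl fun m hm => ?_))
    (sum_short (a := θ / 2) (r := j * h) (by linarith [hθ.1]) (by linarith [hθ.2]) hh
      (by positivity) j)
  have : (m : ℝ) + 1 ≤ j := by exact_mod_cast Finset.mem_range.1 hm
  rw [if_pos (by gcongr), sqrt_rpow_mul (by positivity)]
  congr 2; push_cast; ring

/-- Summation of the singular bounds on the increments of the second derivatives. -/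
lemma sum_holder {θ h r : ℝ} (hθ : θ ∈ Ioo (0:ℝ) 1) (hh : 0 < h) (hr : 0 < r) (j : ℕ)
    {F : ℕ → ℝ} {A : ℝ} (hA : 0 ≤ A)
    (h2 : ∀ m < j, F m ≤ A * (√((m + 1) * h) ^ θ * (√((m + 1) * h))⁻¹ ^ 2))
    (h3 : ∀ m < j, F m ≤ A * (√((m + 1) * h) ^ θ * (√((m + 1) * h))⁻¹ ^ 3) * r) :
    ∑ m ∈ Finset.range j, h * F m ≤ A * (2 / θ + 4 / (1 - θ)) * r ^ θ := by
  have hr2 : 0 < r ^ 2 := by positivity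
  have key : ∀ m ∈ Finset.range j, h * F m ≤
      A * (if (m + 1 : ℝ) * h ≤ r ^ 2 then h * ((m + 1) * h) ^ (θ / 2 - 1) else 0) +
      A * r * (if r ^ 2 < (m + 1 : ℝ) * h then
        h * ((m + 1) * h) ^ (-((1 - θ) / 2) - 1) else 0) := by
    intro m hm
    have hm := Finset.mem_range.1 hm
    have hpos : 0 < ((m : ℝ) + 1) * h := by positivity
    rcases le_or_gt ((m + 1 : ℝ) * h) (r ^ 2) with hmr | hmr
    · rw [if_pos hmr, if_neg hmr.not_gt, mul_zero, add_zero]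
      have := mul_le_mul_of_nonneg_left (h2 m hm) hh.le
      rw [sqrt_rpow_mul hpos] at this
      have e : (θ - (2 : ℕ)) / 2 = θ / 2 - 1 := by push_cast; ring
      rw [e] at this
      linarith
    · rw [if_neg hmr.not_ge, if_pos hmr, mul_zero, zero_add]
      have := mul_le_mul_of_nonneg_left (h3 m hm) hh.le
      rw [sqrt_rpow_mul hpos] at this
      have e : (θ - (3 : ℕ)) / 2 = -((1 - θ) / 2) - 1 := by push_cast; ring
      rw [e] at this
      linarith
  refine (sum_le_sum key).trans ?_
  rw [sum_add_distrib, ← mul_sum, ← mul_sum]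
  have s1 := mul_le_mul_of_nonneg_left (sum_short (a := θ / 2) (r := r ^ 2)
    (by linarith [hθ.1]) (by linarith [hθ.2]) hh hr2.le j) hA
  have s2 := mul_le_mul_of_nonneg_left (sum_long (p := (1 - θ) / 2) (r := r ^ 2)
    (by linarith [hθ.2]) (by linarith [hθ.1]) hh hr2 j) (mul_nonneg hA hr.le)
  have e1 : (r ^ 2) ^ (θ / 2) = r ^ θ := by
    rw [← Real.rpow_natCast r 2, ← Real.rpow_mul hr.le]; congr 1; push_cast; ring
  have e2 : r * (r ^ 2) ^ (-((1 - θ) / 2)) = r ^ θ := by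
    rw [← Real.rpow_natCast r 2, ← Real.rpow_mul hr.le, mul_comm, ← Real.rpow_add_one hr.ne']
    congr 1; push_cast; ring
  rw [e1] at s1
  have h1θ : 1 - θ ≠ 0 := by linarith [hθ.2]
  calc _ ≤ A * (r ^ θ / (θ / 2)) + A * r * (2 / ((1 - θ) / 2) * (r ^ 2) ^ (-((1 - θ) / 2))) :=
        add_le_add s1 s2
    _ = A * (r ^ θ / (θ / 2)) + A * (2 / ((1 - θ) / 2)) * (r * (r ^ 2) ^ (-((1 - θ) / 2))) := by
        ring
    _ = _ := by rw [e2]; have := hθ.1.ne'; field_simp; ring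

lemma SS_add_le (k : ℕ) {u v : Fn N} (hu : Smooth u) (hv : Smooth v) (x : ES N) :
    SS k (fun x => u x + v x) x ≤ 2 * (SS k u x + SS k v x) := by
  induction k generalizing u v with
  | zero => simp only [SS]; nlinarith [sq_nonneg (u x - v x)]
  | succ k ih =>
    simp only [SS, ← sum_add_distrib, mul_sum]
    refine sum_le_sum fun i _ => ?_
    rw [pd1_add (smooth_diff hu) (smooth_diff hv)]
    exact ih (smooth_pd1 hu i) (smooth_pd1 hv i)

lemma rpow_le_one_max {s a M : ℝ} (hs : 0 < s) (hM : 1 ≤ M) (hsM : s ≤ M) (ha : 0 ≤ a)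
    (ha1 : a ≤ 1) : s ^ a ≤ M :=
  (rpow_le_rpow hs.le hsM ha).trans
    ((Real.rpow_le_rpow_of_exponent_le hM ha1).trans_eq (Real.rpow_one M))

lemma hol_aux {s M θ : ℝ} (hs : 0 < s) (hM : 1 ≤ M) (hsM : s ≤ M) (hθ : θ ∈ Ioo (0:ℝ) 1) {n : ℕ}
    (hn : 2 ≤ n) (hn3 : n ≤ 3) {H δ : ℝ} (hH : 0 ≤ H) (hδ : 0 ≤ δ) :
    let Y := s ^ θ * s⁻¹ ^ n
    (s⁻¹ ^ n ≤ M ^ 0 * s⁻¹ ^ n) ∧ (∀ j ≤ n, s⁻¹ ^ j ≤ M ^ 3 * s⁻¹ ^ n) ∧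
    H ≤ M ^ 3 * (H * Y) ∧ δ * s ≤ M ^ 4 * (δ * Y) ∧
    (∀ j ≤ n, s⁻¹ ^ j * (H * s ^ θ) ≤ M ^ 3 * (H * Y)) ∧
    (∀ j ≤ n, s⁻¹ ^ j * (s * δ) ≤ M ^ 4 * (δ * Y)) := by
  intro Y
  have hE : 0 < s ^ θ := Real.rpow_pos_of_pos hs θ
  have hi : 0 < s⁻¹ := inv_pos.2 hs
  have h0 : 0 ≤ Y := by positivity
  have h1 : s ≤ M * s ^ θ := by
    have := rpow_le_one_max hs hM hsM (a := 1 - θ) (by linarith [hθ.2]) (by linarith [hθ.1])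
    calc s = s ^ (1 - θ) * s ^ θ := by
          rw [← Real.rpow_add hs]; simp
      _ ≤ _ := mul_le_mul_of_nonneg_right this hE.le
  have h2 : ∀ j ≤ n, s⁻¹ ^ j ≤ M ^ 3 * s⁻¹ ^ n := by
    intro j hj
    have e : s⁻¹ ^ j = s ^ (n - j) * s⁻¹ ^ n := by
      obtain ⟨m, rfl⟩ := Nat.exists_eq_add_of_le hj
      have : s ^ m * s⁻¹ ^ m = 1 := by rw [← mul_pow, mul_inv_cancel₀ hs.ne', one_pow]
      rw [Nat.add_sub_cancel_left, pow_add, mul_left_comm, this, mul_one]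
    rw [e]
    refine mul_le_mul_of_nonneg_right ?_ (by positivity)
    exact (pow_le_pow_left₀ hs.le hsM _).trans (pow_le_pow_right₀ hM (by omega))
  have h3 : 1 ≤ M ^ 3 * Y := by
    have e1 : (1 : ℝ) = s * s ^ (n - 1) * s⁻¹ ^ n := by
      have : s * s ^ (n - 1) = s ^ n := by rw [← pow_succ']; congr 1; omega
      rw [this, ← mul_pow, mul_inv_cancel₀ hs.ne', one_pow]
    have e2 : s ^ (n - 1) ≤ M ^ 2 :=
      (pow_le_pow_left₀ hs.le hsM _).trans (pow_le_pow_right₀ hM (by omega))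
    calc (1 : ℝ) = s * s ^ (n - 1) * s⁻¹ ^ n := e1
      _ ≤ (M * s ^ θ) * M ^ 2 * s⁻¹ ^ n := by gcongr
      _ = _ := by simp only [Y]; ring
  refine ⟨by simp, h2, by nlinarith, ?_, fun j hj => ?_, fun j hj => ?_⟩
  · have : δ * s ≤ δ * M := by gcongr
    have : δ * M * 1 ≤ δ * M * (M ^ 3 * Y) := by gcongr
    nlinarith
  · calc _ ≤ M ^ 3 * s⁻¹ ^ n * (H * s ^ θ) := mul_le_mul_of_nonneg_right (h2 j hj) (by positivity)
      _ = _ := by simp only [Y]; ring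
  · calc _ ≤ M ^ 3 * s⁻¹ ^ n * (M * s ^ θ * δ) :=
          mul_le_mul (h2 j hj) (by gcongr) (by positivity) (by positivity)
      _ = _ := by simp only [Y]; ring

/-- Smoothing of Hölder data by the discrete evolution. -/
lemma evo_hol {κ : Fn N} (hκ : Moll κ) {θ : ℝ} (hθ : θ ∈ Ioo (0:ℝ) 1) {C T : ℝ}
    (hC : 0 ≤ C) :
    ∃ C', 0 ≤ C' ∧ ∀ (ι : Type) (Γ : ι → Gen N) (R z δ K H : ℝ), EvoEst Γ C R T z δ (2 * K) →
      0 ≤ δ → 0 < z → ∀ (ix : ℕ → ι) (k : ℕ) (φ : Fn N), 1 ≤ k → k * z ^ 2 ≤ T →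
      Smooth φ → Bd 6 φ K → HB θ H φ → ∀ n, n = 2 ∨ n = 3 → ∀ j ≤ n, ∀ x, ‖x‖ ≤ R / 2 →
      SS j (evo (fun j => Γ (ix j)) z k φ) x
        ≤ C' * ((H + δ) * (√(k * z ^ 2) ^ θ * (√(k * z ^ 2))⁻¹ ^ n)) ^ 2 := by
  choose Cm hCm0 hCm using fun k => SS_molk_hol k hκ
  set M := max 1 √T
  have hM : 1 ≤ M := le_max_left _ _
  set D := 1 + Cm 0 + Cm 1 + Cm 2
  have hD : 1 ≤ D := by have := hCm0 0; have := hCm0 1; have := hCm0 2; simp only [D]; linarith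
  refine ⟨2 * (C * M ^ 8 + C * (D * M ^ 8)), by positivity, ?_⟩
  intro ι Γ R z δ K H hE hδ hz ix k φ hk hkT hφ hφK hφH n hn j hj x hx
  have hn2 : 2 ≤ n := by omega
  have hn3 : n ≤ 3 := by omega
  have hk' : (1 : ℝ) ≤ k := by exact_mod_cast hk
  have hτ : 0 < k * z ^ 2 := by positivity
  set s := √(k * z ^ 2)
  have hs : 0 < s := Real.sqrt_pos.2 hτ
  have hs2 : k * z ^ 2 = s ^ 2 := (Real.sq_sqrt hτ.le).symm
  have hsM : s ≤ M := (Real.sqrt_le_sqrt hkT).trans (le_max_right _ _)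
  have hH := hφH.nonneg
  obtain ⟨-, -, a1, a2, a3, a4⟩ := hol_aux hs hM hsM hθ hn2 hn3 hH hδ
  set Y := s ^ θ * s⁻¹ ^ n
  have hY : 0 ≤ Y := by positivity
  have hφs : Smooth (molk κ s φ) := smooth_molk hκ.ker hφ.continuous hs
  have hBs := hκ.bd hφ hφK s
  have hK := hφK.nonneg
  -- the rough part
  have p1 : SS j (evo (fun j => Γ (ix j)) z k fun x => φ x - molk κ s φ x) x
      ≤ C * M ^ 8 * ((H + δ) * Y) ^ 2 := by
    have h1 := hE.smoothing ix k (fun x => φ x - molk κ s φ x) hkT (hφ.sub hφs)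
      ((Bd.sub hφ hφs hφK hBs).mono (by linarith)) (H * s ^ θ)
      (hφH.moll_sub hκ hθ.1 hs) j (hj.trans hn3) x hx
    set A := SS j (evo (fun j => Γ (ix j)) z k fun x => φ x - molk κ s φ x) x
    rw [hs2] at h1
    have h2 : A = (s⁻¹ ^ j) ^ 2 * ((s ^ 2) ^ j * A) := by
      have : (s⁻¹ ^ j) ^ 2 * (s ^ 2) ^ j = 1 := by
        rw [← pow_mul, mul_comm j 2, pow_mul, ← mul_pow, ← mul_pow, inv_mul_cancel₀ hs.ne',
          one_pow, one_pow]
      rw [← mul_assoc, this, one_mul]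
    rw [h2]
    have h3 := mul_le_mul_of_nonneg_left h1 (by positivity : 0 ≤ (s⁻¹ ^ j) ^ 2)
    refine h3.trans ?_
    have e1 := pow_le_pow_left₀ (by positivity) (a3 j hj) 2
    have e2 := pow_le_pow_left₀ (by positivity) (a4 j hj) 2
    have e3 : (M ^ 3 * (H * Y)) ^ 2 ≤ M ^ 8 * (H * Y) ^ 2 := by
      rw [mul_pow, ← pow_mul]; gcongr; norm_num
    have e4 : (H * Y) ^ 2 + (δ * Y) ^ 2 ≤ ((H + δ) * Y) ^ 2 := by
      nlinarith [mul_nonneg (mul_nonneg hH hδ) (sq_nonneg Y)]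
    calc _ = C * ((s⁻¹ ^ j * (H * s ^ θ)) ^ 2 + (s⁻¹ ^ j * (s * δ)) ^ 2) := by ring
      _ ≤ C * (M ^ 8 * (H * Y) ^ 2 + M ^ 8 * (δ * Y) ^ 2) := by
          refine mul_le_mul_of_nonneg_left ?_ hC
          have : (M ^ 4 * (δ * Y)) ^ 2 = M ^ 8 * (δ * Y) ^ 2 := by ring
          linarith
      _ = C * M ^ 8 * ((H * Y) ^ 2 + (δ * Y) ^ 2) := by ring
      _ ≤ _ := by gcongr
  -- the smooth part
  have p2 : SS j (evo (fun j => Γ (ix j)) z k (molk κ s φ)) x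
      ≤ C * (D * M ^ 8) * ((H + δ) * Y) ^ 2 := by
    have hS : ∀ j ≤ n, ∀ x, SS j (molk κ s φ) x ≤ D * (M ^ 3 * (H * Y)) ^ 2 := by
      intro j hj x
      rcases j with _ | j
      · have h1 := pow_le_pow_left₀ (abs_nonneg _) (hκ.abs_le (ε := s) (x := x) hφH.bd) 2
        rw [sq_abs] at h1
        have h2 := pow_le_pow_left₀ hH a1 2
        simp only [SS]
        nlinarith [sq_nonneg (M ^ 3 * (H * Y))]
      · refine (hCm j s θ H φ x hs hθ.1 hφH).trans ?_
        have h1 := pow_le_pow_left₀ (by positivity) (a3 (j + 1) hj) 2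
        have h2 : Cm j ≤ D := by
          have := hCm0 0; have := hCm0 1; have := hCm0 2
          have : j = 0 ∨ j = 1 ∨ j = 2 := by omega
          rcases this with rfl | rfl | rfl <;> simp only [D] <;> linarith
        exact mul_le_mul h2 h1 (by positivity) (by positivity)
    have h1 := hE.stability ix k _ hkT hφs (hBs.mono (by linarith)) n hn _ hS j hj x hx
    refine h1.trans ?_
    rw [mul_assoc C]
    refine mul_le_mul_of_nonneg_left ?_ hC
    have e2 := pow_le_pow_left₀ (by positivity) a2 2
    rw [hs2]
    have e3 : (M ^ 3 * (H * Y)) ^ 2 ≤ M ^ 8 * (H * Y) ^ 2 := by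
      rw [mul_pow, ← pow_mul]; gcongr; norm_num
    have e4 : (H * Y) ^ 2 + (δ * Y) ^ 2 ≤ ((H + δ) * Y) ^ 2 := by
      nlinarith [mul_nonneg (mul_nonneg hH hδ) (sq_nonneg Y)]
    have e5 : s ^ 2 * δ ^ 2 ≤ D * (M ^ 8 * (δ * Y) ^ 2) := by
      have : (M ^ 4 * (δ * Y)) ^ 2 = M ^ 8 * (δ * Y) ^ 2 := by ring
      have : 0 ≤ M ^ 8 * (δ * Y) ^ 2 := by positivity
      nlinarith
    calc _ ≤ D * (M ^ 8 * (H * Y) ^ 2) + D * (M ^ 8 * (δ * Y) ^ 2) := by gcongr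
      _ = D * M ^ 8 * ((H * Y) ^ 2 + (δ * Y) ^ 2) := by ring
      _ ≤ _ := by gcongr
  have hsum : evo (fun j => Γ (ix j)) z k φ = fun x =>
      evo (fun j => Γ (ix j)) z k (fun x => φ x - molk κ s φ x) x
        + evo (fun j => Γ (ix j)) z k (molk κ s φ) x := by
    rw [evo_sub]; ext x; ring
  rw [hsum]
  refine (SS_add_le j (smooth_evo _ z k (hφ.sub hφs)) (smooth_evo _ z k hφs) x).trans ?_
  linarith

lemma abs_pd1_of_SS {u : Fn N} {x : ES N} {L : ℝ} (hL : 0 ≤ L) (h : SS 1 u x ≤ L ^ 2)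
    (i : Fin N) : |pd1 u i x| ≤ L := by
  refine abs_le_of_sq_le_sq (le_trans ?_ h) hL
  rw [SS_one]
  exact single_le_sum (f := fun i => pd1 u i x ^ 2) (fun _ _ => sq_nonneg _)
    (Finset.mem_univ i)

lemma abs_pd1_of_SS_succ {k : ℕ} {u : Fn N} {x : ES N} {L : ℝ} (h : SS (k + 1) u x ≤ L)
    (i : Fin N) : SS k (pd1 u i) x ≤ L :=
  (single_le_sum (f := fun i => SS k (pd1 u i) x) (fun _ _ => SS_nonneg _ _ _)
    (Finset.mem_univ i)).trans h

lemma abs_pd2_of_SS {u : Fn N} {x : ES N} {L : ℝ} (hL : 0 ≤ L) (h : SS 2 u x ≤ L ^ 2)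
    (i j : Fin N) : |pd1 (pd1 u i) j x| ≤ L :=
  abs_pd1_of_SS hL (abs_pd1_of_SS_succ h i) j

lemma abs_pd3_of_SS {u : Fn N} {x : ES N} {L : ℝ} (hL : 0 ≤ L) (h : SS 3 u x ≤ L ^ 2)
    (i j k : Fin N) : |pd1 (pd1 (pd1 u i) j) k x| ≤ L :=
  abs_pd2_of_SS hL (abs_pd1_of_SS_succ h i) j k

lemma lip_of_pd1 {F : Fn N} (hF : Differentiable ℝ F) {ρ L : ℝ}
    (h : ∀ z, ‖z‖ ≤ ρ → ∀ i, |pd1 F i z| ≤ L) {x y : ES N} (hx : ‖x‖ ≤ ρ) (hy : ‖y‖ ≤ ρ) :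
    |F x - F y| ≤ N * L * ‖x - y‖ := by
  have := (convex_closedBall (0 : ES N) ρ).norm_image_sub_le_of_norm_fderiv_le (f := F) (𝕜 := ℝ)
    (C := N * L) (x := y) (y := x) (fun z _ => hF z) (fun z hz => ?_)
    (mem_closedBall_zero_iff.2 hy) (mem_closedBall_zero_iff.2 hx)
  · simpa using this
  · refine (norm_fderiv_le_sum F z).trans ?_
    exact (sum_le_sum fun i _ => h z (mem_closedBall_zero_iff.1 hz) i).trans (by simp)

lemma lip_of_pd1_univ {F : Fn N} (hF : Differentiable ℝ F) {L : ℝ}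
    (h : ∀ z i, |pd1 F i z| ≤ L) (x y : ES N) : |F x - F y| ≤ N * L * ‖x - y‖ :=
  lip_of_pd1 hF (ρ := max ‖x‖ ‖y‖) (fun z _ i => h z i) (le_max_left _ _) (le_max_right _ _)

/-- `C²` functions with bounded derivatives and `θ`-Hölder second derivatives. -/
structure C2H (θ M : ℝ) (f : Fn N) : Prop where
  smooth : ContDiff ℝ 2 f
  b0 : ∀ x, |f x| ≤ M
  b1 : ∀ i x, |pd1 f i x| ≤ M
  b2 : ∀ i j, HB θ M (pd1 (pd1 f i) j)

lemma C2H.nonneg {θ M : ℝ} (h : C2H θ M f) : 0 ≤ M := (abs_nonneg _).trans (h.b0 0)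

lemma C2H.d1 {θ M : ℝ} (h : C2H θ M f) (i : Fin N) : ContDiff ℝ 1 (pd1 f i) :=
  contDiff_pd1 h.smooth (by norm_num) i

lemma C2H.pd1_molk {κ : Fn N} (hκ : Moll κ) {θ M : ℝ} (h : C2H θ M f) (ε : ℝ)
    (i : Fin N) : pd1 (molk κ ε f) i = molk κ ε (pd1 f i) :=
  pd1_molk_right hκ.ker (h.smooth.of_le (by norm_num)) h.b1 ε i

lemma C2H.pd2_molk {κ : Fn N} (hκ : Moll κ) {θ M : ℝ} (h : C2H θ M f) (ε : ℝ)
    (i j : Fin N) : pd1 (pd1 (molk κ ε f) i) j = molk κ ε (pd1 (pd1 f i) j) := by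
  rw [h.pd1_molk hκ, pd1_molk_right hκ.ker (h.d1 i) fun j x => (h.b2 i j).bd x]

lemma C2H.molk {κ : Fn N} (hκ : Moll κ) {θ M : ℝ} (hθ : 0 < θ)
    (h : C2H θ M f) {ε : ℝ} (hε : 0 < ε) : C2H θ M (molk κ ε f) where
  smooth := (smooth_molk hκ.ker h.smooth.continuous hε).of_le (smooth_le 2)
  b0 x := hκ.abs_le h.b0
  b1 i x := by rw [h.pd1_molk hκ]; exact hκ.abs_le (h.b1 i)
  b2 i j := by rw [h.pd2_molk hκ]; exact hκ.hb hθ (h.b2 i j) ε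

lemma C2H.bd {θ M : ℝ} (h : C2H θ M f) : Bd 2 f M :=
  ⟨⟨h.b0, h.b1⟩, fun i => ⟨h.b1 i, fun j => (h.b2 i j).bd⟩⟩

lemma Moll.sub_le_of_lip {κ f : Fn N} (hκ : Moll κ) (hf : ContDiff ℝ 1 f) {M r : ℝ}
    (h : ∀ i x, |pd1 f i x| ≤ M) (hr : 0 < r) (x : ES N) : |f x - Schauder.molk κ r f x| ≤ N * M * r := by
  rw [abs_sub_comm]
  refine hκ.abs_sub_le hf.continuous hr fun y hy =>
    (lip_of_pd1_univ (hf.differentiable one_ne_zero) (fun z i => h i z) y x).trans ?_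
  by_cases hN : Nonempty (Fin N)
  · have : 0 ≤ M := (abs_nonneg _).trans (h (Classical.arbitrary _) 0)
    gcongr
  · have : N = 0 := by
      rcases N with _ | n
      · rfl
      · exact absurd ⟨0⟩ hN
    subst this; simp

lemma C2H.moll_sub {κ : Fn N} (hκ : Moll κ) {θ M : ℝ} (hθ : θ ∈ Ioo (0:ℝ) 1)
    (h : C2H θ M f) {r : ℝ} (hr : 0 < r) (hr1 : r ≤ 1) :
    Bd 2 (fun x => f x - Schauder.molk κ r f x) ((N + 1) * M * r ^ θ) := by
  have hM := h.nonneg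
  have hrθ : r ≤ r ^ θ := by
    simpa using Real.rpow_le_rpow_of_exponent_ge hr hr1 hθ.2.le
  have hr0 : 0 < r ^ θ := by positivity
  have e0 : N * M * r ≤ (N + 1) * M * r ^ θ := by gcongr; linarith
  have e1 : M * r ^ θ ≤ (N + 1) * M * r ^ θ := by
    have : 0 ≤ N * (M * r ^ θ) := by positivity
    nlinarith
  have hm := h.molk hκ hθ.1 hr
  have p1 : ∀ i, pd1 (fun x => f x - Schauder.molk κ r f x) i
      = fun x => pd1 f i x - Schauder.molk κ r (pd1 f i) x := by
    intro i
    rw [pd1_sub (h.smooth.differentiable (by norm_num)) (hm.smooth.differentiable (by norm_num)),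
      h.pd1_molk hκ]
  have p2 : ∀ i j, pd1 (pd1 (fun x => f x - Schauder.molk κ r f x) i) j
      = fun x => pd1 (pd1 f i) j x - Schauder.molk κ r (pd1 (pd1 f i) j) x := by
    intro i j
    rw [p1, pd1_sub ((h.d1 i).differentiable (by norm_num)) (by
      rw [← h.pd1_molk hκ]; exact (hm.d1 i).differentiable (by norm_num)), ← h.pd1_molk hκ,
      h.pd2_molk hκ]
  have q1 : ∀ i x, |pd1 (fun x => f x - Schauder.molk κ r f x) i x| ≤ (N + 1) * M * r ^ θ := by
    intro i x
    rw [p1]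
    exact (hκ.sub_le_of_lip (h.d1 i) (fun j x => (h.b2 i j).bd x) hr x).trans e0
  refine ⟨⟨fun x => ?_, q1⟩, fun i => ⟨q1 i, fun j x => ?_⟩⟩
  · exact (hκ.sub_le_of_lip (h.smooth.of_le (by norm_num)) h.b1 hr x).trans e0
  · rw [p2]
    exact ((h.b2 i j).moll_sub hκ hθ.1 hr x).trans e1

lemma C2H.bd_three {κ : Fn N} (hκ : Moll κ) : ∃ C, 0 ≤ C ∧ ∀ (θ M r : ℝ) (f : Fn N),
    θ ∈ Ioo (0:ℝ) 1 → C2H θ M f → 0 < r → r ≤ 1 →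
    Bd 3 (Schauder.molk κ r f) (C * (M * (r⁻¹ * r ^ θ))) := by
  obtain ⟨C, hC, h⟩ := SS_molk_hol 0 hκ
  refine ⟨1 + C, by linarith, fun θ M r f hθ hf hr hr1 => ?_⟩
  have hM := hf.nonneg
  have hrθ : 1 ≤ r⁻¹ * r ^ θ := by
    have : r ≤ r ^ θ := by simpa using Real.rpow_le_rpow_of_exponent_ge hr hr1 hθ.2.le
    rw [← inv_mul_cancel₀ hr.ne']; gcongr
  have e0 : M ≤ (1 + C) * (M * (r⁻¹ * r ^ θ)) := by
    have : M * 1 ≤ M * (r⁻¹ * r ^ θ) := by gcongr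
    have : 0 ≤ C * (M * (r⁻¹ * r ^ θ)) := by positivity
    linarith
  have hb := (hf.molk hκ hθ.1 hr).bd.mono e0
  refine ⟨hb, fun i => ⟨hb.2 i, fun j => ⟨(hb.2 i).2 j, fun k x => ?_⟩⟩⟩
  rw [hf.pd2_molk hκ]
  have h1 := h r θ M _ x hr hθ.1 (hf.b2 i j)
  refine abs_pd1_of_SS (by positivity) (h1.trans ?_) k
  have h2 : C ≤ (1 + C) ^ 2 := by nlinarith
  calc C * ((r⁻¹) ^ (0 + 1) * (M * r ^ θ)) ^ 2 ≤ (1 + C) ^ 2 * ((r⁻¹) ^ (0 + 1) * (M * r ^ θ)) ^ 2 := by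
        gcongr
    _ = _ := by rw [zero_add, pow_one]; ring

/-- Bounds on a ball for the first and second derivatives and for the Hölder seminorm of the
second derivatives. -/
structure LH (ρ θ A : ℝ) (u : Fn N) : Prop where
  d1 : ∀ i x, ‖x‖ ≤ ρ → |pd1 u i x| ≤ A
  d2 : ∀ i j x, ‖x‖ ≤ ρ → |pd1 (pd1 u i) j x| ≤ A
  hol : ∀ i j x y, ‖x‖ ≤ ρ → ‖y‖ ≤ ρ →
    |pd1 (pd1 u i) j x - pd1 (pd1 u i) j y| ≤ A * ‖x - y‖ ^ θ

lemma LH.mono {ρ θ A B : ℝ} {u : Fn N} (h : LH ρ θ A u) (hAB : A ≤ B) : LH ρ θ B u where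
  d1 i x hx := (h.d1 i x hx).trans hAB
  d2 i j x hx := (h.d2 i j x hx).trans hAB
  hol i j x y hx hy := (h.hol i j x y hx hy).trans (by gcongr)

lemma LH.add {ρ θ A B : ℝ} {u v : Fn N} (h : LH ρ θ A u) (h' : LH ρ θ B v)
    (hu : Smooth u) (hv : Smooth v) : LH ρ θ (A + B) fun x => u x + v x := by
  have p1 : ∀ i, pd1 (fun x => u x + v x) i = fun x => pd1 u i x + pd1 v i x := fun i =>
    pd1_add (smooth_diff hu) (smooth_diff hv) i
  have p2 : ∀ i j, pd1 (pd1 (fun x => u x + v x) i) j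
      = fun x => pd1 (pd1 u i) j x + pd1 (pd1 v i) j x := fun i j => by
    rw [p1, pd1_add (smooth_diff (smooth_pd1 hu i)) (smooth_diff (smooth_pd1 hv i))]
  refine ⟨fun i x hx => ?_, fun i j x hx => ?_, fun i j x y hx hy => ?_⟩
  · rw [p1]; exact (abs_add_le _ _).trans (add_le_add (h.d1 i x hx) (h'.d1 i x hx))
  · rw [p2]; exact (abs_add_le _ _).trans (add_le_add (h.d2 i j x hx) (h'.d2 i j x hx))
  · simp only [p2]
    rw [add_sub_add_comm, add_mul]
    exact (abs_add_le _ _).trans (add_le_add (h.hol i j x y hx hy) (h'.hol i j x y hx hy))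

/-- Regularity of weighted sums of functions with integrable singular bounds. -/
lemma LH_sum {θ h T ρ A : ℝ} (hθ : θ ∈ Ioo (0:ℝ) 1) (hh : 0 < h) (hA : 0 ≤ A) {j : ℕ}
    (hj : j * h ≤ T) {E : ℕ → Fn N} (hE : ∀ m, Smooth (E m))
    (hb : ∀ m < j, ∀ n, n = 2 ∨ n = 3 → ∀ k ≤ n, ∀ x, ‖x‖ ≤ ρ →
      SS k (E m) x ≤ (A * (√((m + 1) * h) ^ θ * (√((m + 1) * h))⁻¹ ^ n)) ^ 2) :
    LH ρ θ (A * (T ^ (θ / 2) / (θ / 2)) + (2 + N) * A * (2 / θ + 4 / (1 - θ)))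
      fun x => ∑ m ∈ Finset.range j, h * E m x := by
  have hjh : 0 ≤ j * h := by positivity
  have hT : 0 ≤ T := hjh.trans hj
  have hθ1 : 0 < 1 - θ := by linarith [hθ.2]
  have hθ0 := hθ.1
  set W : ℕ → ℕ → ℝ := fun m n => √((m + 1) * h) ^ θ * (√((m + 1) * h))⁻¹ ^ n with hW
  have hW0 : ∀ m n, 0 ≤ W m n := fun m n => by positivity
  have p1 : ∀ i, pd1 (fun x => ∑ m ∈ Finset.range j, h * E m x) i
      = fun x => ∑ m ∈ Finset.range j, h * pd1 (E m) i x := by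
    intro i
    rw [pd1_sum _ fun m => (smooth_diff (hE m)).const_mul h]
    ext x
    exact sum_congr rfl fun m _ => by rw [pd1_const_mul h (smooth_diff (hE m))]
  have p2 : ∀ i k, pd1 (pd1 (fun x => ∑ m ∈ Finset.range j, h * E m x) i) k
      = fun x => ∑ m ∈ Finset.range j, h * pd1 (pd1 (E m) i) k x := by
    intro i k
    rw [p1, pd1_sum _ fun m => (smooth_diff (smooth_pd1 (hE m) i)).const_mul h]
    ext x
    exact sum_congr rfl fun m _ => by
      rw [pd1_const_mul h (smooth_diff (smooth_pd1 (hE m) i))]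
  have b1 : ∀ m < j, ∀ i x, ‖x‖ ≤ ρ → |pd1 (E m) i x| ≤ A * W m 2 := fun m hm i x hx =>
    abs_pd1_of_SS (mul_nonneg hA (hW0 m 2)) (hb m hm 2 (.inl rfl) 1 (by norm_num) x hx) i
  have b2 : ∀ m < j, ∀ i k x, ‖x‖ ≤ ρ → |pd1 (pd1 (E m) i) k x| ≤ A * W m 2 :=
    fun m hm i k x hx =>
      abs_pd2_of_SS (mul_nonneg hA (hW0 m 2)) (hb m hm 2 (.inl rfl) 2 le_rfl x hx) i k
  have b3 : ∀ m < j, ∀ i k l x, ‖x‖ ≤ ρ → |pd1 (pd1 (pd1 (E m) i) k) l x| ≤ A * W m 3 :=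
    fun m hm i k l x hx =>
      abs_pd3_of_SS (mul_nonneg hA (hW0 m 3)) (hb m hm 3 (.inr rfl) 3 le_rfl x hx) i k l
  have s2 : ∑ m ∈ Finset.range j, h * W m 2 ≤ T ^ (θ / 2) / (θ / 2) := by
    refine (sum_singular hθ hh j).trans ?_
    gcongr
  have hsum : ∀ F : ℕ → ℝ, (∀ m < j, |F m| ≤ A * W m 2) →
      |∑ m ∈ Finset.range j, h * F m| ≤ A * (T ^ (θ / 2) / (θ / 2)) := by
    intro F hF
    refine (abs_sum_le_sum_abs _ _).trans (le_trans ?_ (mul_le_mul_of_nonneg_left s2 hA))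
    rw [mul_sum]
    refine sum_le_sum fun m hm => ?_
    rw [abs_mul, abs_of_pos hh]
    have := mul_le_mul_of_nonneg_left (hF m (Finset.mem_range.1 hm)) hh.le
    linarith
  have hD : 0 ≤ (2 + N) * A * (2 / θ + 4 / (1 - θ)) := by positivity
  have hD' : 0 ≤ A * (T ^ (θ / 2) / (θ / 2)) := by positivity
  refine ⟨fun i x hx => ?_, fun i k x hx => ?_, fun i k x y hx hy => ?_⟩
  · rw [p1]
    exact (hsum _ fun m hm => b1 m hm i x hx).trans (by linarith)
  · rw [p2]
    exact (hsum _ fun m hm => b2 m hm i k x hx).trans (by linarith)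
  · simp only [p2]
    rcases eq_or_ne x y with rfl | hxy
    · simp only [sub_self, abs_zero]; positivity
    have hr : 0 < ‖x - y‖ := norm_pos_iff.2 (sub_ne_zero.2 hxy)
    rw [← sum_sub_distrib]
    refine (abs_sum_le_sum_abs _ _).trans ?_
    have h1 : ∀ m ∈ Finset.range j, |h * pd1 (pd1 (E m) i) k x - h * pd1 (pd1 (E m) i) k y|
        = h * |pd1 (pd1 (E m) i) k x - pd1 (pd1 (E m) i) k y| := fun m _ => by
      rw [← mul_sub, abs_mul, abs_of_pos hh]
    rw [sum_congr rfl h1]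
    refine (sum_holder (A := (2 + N) * A) hθ hh hr j (by positivity) (fun m hm => ?_)
      (fun m hm => ?_)).trans ?_
    · refine (abs_sub _ _).trans ?_
      have e1 := b2 m hm i k x hx
      have e2 := b2 m hm i k y hy
      have e3 : 0 ≤ (N : ℝ) * (A * W m 2) := by have := hW0 m 2; positivity
      change _ ≤ (2 + N) * A * W m 2
      linarith
    · have e1 := lip_of_pd1 (smooth_diff (smooth_pd1 (smooth_pd1 (hE m) i) k))
        (fun z hz l => b3 m hm i k l z hz) hx hy
      have e3 : 0 ≤ 2 * (A * W m 3) * ‖x - y‖ := by have := hW0 m 3; positivity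
      change _ ≤ (2 + N) * A * W m 3 * ‖x - y‖
      linarith
    · have : 0 ≤ ‖x - y‖ ^ θ := by positivity
      gcongr
      linarith

lemma rpow_aux {r θ : ℝ} (hθ : θ ∈ Ioo (0:ℝ) 1) (hr : 0 < r) (hr1 : r ≤ 1) :
    r ≤ r ^ θ ∧ 1 ≤ r⁻¹ * r ^ θ := by
  have : r ≤ r ^ θ := by simpa using Real.rpow_le_rpow_of_exponent_ge hr hr1 hθ.2.le
  refine ⟨this, ?_⟩
  rw [← inv_mul_cancel₀ hr.ne']; gcongr

lemma sq_mul_add_le {C D C' p q P : ℝ} (hC : 0 ≤ C) (hD : 0 ≤ D) (hp : 0 ≤ p) (hq : 0 ≤ q)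
    (hP : p + q ≤ P) (hC' : C * (1 + D) ≤ C') (hC1 : 1 ≤ C') :
    C * (p ^ 2 + D * q ^ 2) ≤ (C' * P) ^ 2 := by
  have h1 : p ^ 2 + D * q ^ 2 ≤ (1 + D) * P ^ 2 := by
    have h2 : p ^ 2 + q ^ 2 ≤ P ^ 2 := by nlinarith
    nlinarith [mul_nonneg hD (sq_nonneg p), sq_nonneg q, mul_le_mul_of_nonneg_left h2 hD]
  have h3 : C' ≤ C' ^ 2 := by nlinarith
  calc C * (p ^ 2 + D * q ^ 2) ≤ C * ((1 + D) * P ^ 2) := by gcongr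
    _ = C * (1 + D) * P ^ 2 := by ring
    _ ≤ C' ^ 2 * P ^ 2 := by gcongr; linarith
    _ = _ := by ring

set_option maxHeartbeats 1000000 in
/-- Uniform Hölder bounds for the evolution of a regularized `C^{2+θ}` datum. -/
theorem evo_c2h {κ : Fn N} (hκ : Moll κ) {θ : ℝ} (hθ : θ ∈ Ioo (0:ℝ) 1) {C T : ℝ}
    (hC : 0 ≤ C) (hT : 0 ≤ T) :
    ∃ C', 0 ≤ C' ∧ ∀ (ι : Type) (Γ : ι → Gen N) (R z ρ K H : ℝ), 0 < ρ → ρ ≤ 1 →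
      EvoEst Γ C R T z (ρ ^ 2) (2 * K) →
      ∀ (ix : ℕ → ι) (k : ℕ) (f : Fn N), k * z ^ 2 ≤ T → C2H θ H f → Bd 6 (molk κ ρ f) K →
        LH (R / 2) θ (C' * (H + ρ)) (evo (fun j => Γ (ix j)) z k (molk κ ρ f)) := by
  choose Cs hCs0 hCs using fun k => SS_bd (N := N) k 0
  obtain ⟨C3, hC30, hC3⟩ := C2H.bd_three hκ
  set D := 1 + Cs 0 + Cs 1 + Cs 2 + Cs 3 with hD
  have hD1 : 1 ≤ D := by
    have := hCs0 0; have := hCs0 1; have := hCs0 2; have := hCs0 3; simp only [hD]; linarith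
  have hCsD : ∀ j ≤ 3, Cs j ≤ D := by
    intro j hj
    have := hCs0 0; have := hCs0 1; have := hCs0 2; have := hCs0 3
    interval_cases j <;> simp only [hD] <;> linarith
  set E := D * (1 + C3 + (N + 1)) with hEdef
  have hN0 : (0:ℝ) ≤ N := Nat.cast_nonneg N
  have hDE : D ≤ E := by rw [hEdef]; nlinarith
  have hE1 : 1 ≤ E := hD1.trans hDE
  have hE3 : D * C3 ≤ E := by rw [hEdef]; nlinarith
  have hEN : D * (N + 1) ≤ E := by rw [hEdef]; nlinarith
  clear_value D E
  clear hEdef hD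
  have hSS : ∀ j ≤ 3, ∀ (φ : Fn N) L, Smooth φ → Bd j φ L → ∀ x,
      SS j φ x ≤ (D * L) ^ 2 := by
    intro j hj φ L hφ hb x
    have h1 := (le_abs_self _).trans ((hCs j φ L hφ hb).zero x)
    have h2 : Cs j ≤ D ^ 2 := by have := hCsD j hj; nlinarith
    rw [mul_pow]
    exact h1.trans (by gcongr)
  set C₁ := 1 + C * (1 + T) with hC₁
  have hC₁1 : 1 ≤ C₁ := by have : 0 ≤ C * (1 + T) := by positivity
                           linarith
  have hC₁2 : C * (1 + T) ≤ C₁ := by linarith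
  clear_value C₁
  clear hC₁
  refine ⟨(2 + N) * (C₁ * E), by positivity, ?_⟩
  intro ι Γ R z ρ K H hρ hρ1 hest ix k f hkT hf hbK
  have hH := hf.nonneg
  have hfρ := hf.molk hκ hθ.1 hρ
  have hfs : Smooth (molk κ ρ f) := smooth_molk hκ.ker hf.smooth.continuous hρ
  have hK := hbK.nonneg
  have hkz : 0 ≤ k * z ^ 2 := by positivity
  have hLE : ∀ L, 0 ≤ L → D * L ≤ E * L := by
    intro L hL
    gcongr
  -- evolution estimates
  have key : ∀ n, n = 2 ∨ n = 3 → ∀ (φ : Fn N) L P, Smooth φ → Bd 6 φ (2 * K) →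
      Bd n φ L → D * L + ρ ^ 2 ≤ P → ∀ j ≤ n, ∀ x, ‖x‖ ≤ R / 2 →
      SS j (evo (fun j => Γ (ix j)) z k φ) x ≤ (C₁ * P) ^ 2 := by
    intro n hn φ L P hφ hφK hφL hP j hj x hx
    have hL := hφL.nonneg
    refine (hest.stability ix k φ hkT hφ hφK n hn ((D * L) ^ 2)
      (fun j hj x => hSS j (by omega) φ L hφ (hφL.of_le hj) x) j hj x hx).trans ?_
    calc C * ((D * L) ^ 2 + k * z ^ 2 * (ρ ^ 2) ^ 2)
        ≤ C * ((D * L) ^ 2 + T * (ρ ^ 2) ^ 2) := by gcongr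
      _ ≤ _ := sq_mul_add_le hC hT (by positivity) (by positivity) hP hC₁2 hC₁1
  have hbK2 : Bd 6 (molk κ ρ f) (2 * K) := hbK.mono (by linarith)
  have hρ2 : ρ ^ 2 ≤ ρ := by nlinarith
  have hHρ : D * H + ρ ^ 2 ≤ E * (H + ρ) := by
    have := hLE H hH
    have : 1 * ρ ≤ E * ρ := by gcongr
    linarith
  have hQ : 0 ≤ C₁ * (E * (H + ρ)) := by positivity
  have hbig : C₁ * (E * (H + ρ)) ≤ (2 + N) * (C₁ * E) * (H + ρ) := by
    have : 0 ≤ N * (C₁ * (E * (H + ρ))) := by positivity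
    linarith
  have c1 := key 2 (.inl rfl) _ _ _ hfs hbK2 hfρ.bd hHρ
  have d2 : ∀ i j x, ‖x‖ ≤ R / 2 →
      |pd1 (pd1 (evo (fun j => Γ (ix j)) z k (molk κ ρ f)) i) j x| ≤ C₁ * (E * (H + ρ)) :=
    fun i j x hx => abs_pd2_of_SS hQ (c1 2 le_rfl x hx) i j
  refine ⟨fun i x hx => (abs_pd1_of_SS hQ (c1 1 (by norm_num) x hx) i).trans hbig,
    fun i j x hx => (d2 i j x hx).trans hbig, fun i j x y hx hy => ?_⟩
  rcases eq_or_ne x y with rfl | hxy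
  · simp only [sub_self, abs_zero]; positivity
  set r := ‖x - y‖ with hrdef
  have hr : 0 < r := norm_pos_iff.2 (sub_ne_zero.2 hxy)
  have hrθ : 0 < r ^ θ := by positivity
  -- third derivative bound
  have third : ∀ (φ : Fn N) L P, Smooth φ → Bd 6 φ (2 * K) →
      Bd 3 φ L → D * L + ρ ^ 2 ≤ P →
      |pd1 (pd1 (evo (fun j => Γ (ix j)) z k φ) i) j x
        - pd1 (pd1 (evo (fun j => Γ (ix j)) z k φ) i) j y| ≤ N * (C₁ * P) * r := by
    intro φ L P hφ hφK hφL hP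
    have hL := hφL.nonneg
    have hP0 : 0 ≤ P := le_trans (by positivity) hP
    have hs := smooth_evo (fun j => Γ (ix j)) z k hφ
    exact lip_of_pd1 (smooth_diff (smooth_pd1 (smooth_pd1 hs i) j))
      (fun w hw l => abs_pd3_of_SS (by positivity)
        (key 3 (.inr rfl) φ L P hφ hφK hφL hP 3 le_rfl w hw) i j l) hx hy
  rcases le_total 1 r with hr1 | hr1
  · have h1 : 1 ≤ r ^ θ := Real.one_le_rpow hr1 hθ.1.le
    refine (abs_sub _ _).trans ((add_le_add (d2 i j x hx) (d2 i j y hy)).trans ?_)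
    have : C₁ * (E * (H + ρ)) * 1 ≤ C₁ * (E * (H + ρ)) * r ^ θ := by gcongr
    have h3 : 0 ≤ N * (C₁ * (E * (H + ρ)) * r ^ θ) := by positivity
    linarith
  obtain ⟨a1, a2⟩ := rpow_aux hθ hr hr1
  rcases le_total r ρ with hrρ | hrρ
  · have hb3 := hC3 θ H ρ f hθ hf hρ hρ1
    have hmono : ρ⁻¹ * ρ ^ θ ≤ r⁻¹ * r ^ θ := by
      have : ∀ s : ℝ, 0 < s → s⁻¹ * s ^ θ = s ^ (θ - 1) := fun s hs => by
        rw [Real.rpow_sub_one hs.ne', inv_mul_eq_div]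
      rw [this ρ hρ, this r hr]
      exact Real.rpow_le_rpow_of_nonpos hr hrρ (by linarith [hθ.2])
    have h1 : D * (C3 * (H * (ρ⁻¹ * ρ ^ θ))) + ρ ^ 2 ≤ E * (H + ρ) * (r⁻¹ * r ^ θ) := by
      have e1 : D * (C3 * (H * (ρ⁻¹ * ρ ^ θ))) ≤ E * H * (r⁻¹ * r ^ θ) := by
        calc _ = D * C3 * H * (ρ⁻¹ * ρ ^ θ) := by ring
          _ ≤ _ := by gcongr
      have e2 : ρ ^ 2 ≤ E * ρ * (r⁻¹ * r ^ θ) := by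
        calc ρ ^ 2 ≤ 1 * ρ * 1 := by linarith
          _ ≤ _ := by gcongr
      linarith
    refine (third _ _ _ hfs hbK2 hb3 h1).trans (le_of_eq_of_le (b := N * (C₁ * (E * (H + ρ)) * r ^ θ)) ?_ ?_)
    · field_simp
    · have : 0 ≤ C₁ * (E * (H + ρ)) * r ^ θ := by positivity
      linarith
  · have hbb := hfρ.molk hκ hθ.1 hr
    have hbs : Smooth (molk κ r (molk κ ρ f)) := smooth_molk hκ.ker hfs.continuous hr
    have hbb3 := hC3 θ H r _ hθ hfρ hr hr1
    have hbb6 : Bd 6 (molk κ r (molk κ ρ f)) K := hκ.bd hfs hbK r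
    have haa := hfρ.moll_sub hκ hθ hr hr1
    have has : Smooth (fun x => molk κ ρ f x - molk κ r (molk κ ρ f) x) := hfs.sub hbs
    have haa6 : Bd 6 (fun x => molk κ ρ f x - molk κ r (molk κ ρ f) x) (2 * K) := by
      rw [two_mul]; exact hbK.sub hfs hbs hbb6
    have h1 : D * (C3 * (H * (r⁻¹ * r ^ θ))) + ρ ^ 2 ≤ E * (H + ρ) * (r⁻¹ * r ^ θ) := by
      have e1 : D * (C3 * (H * (r⁻¹ * r ^ θ))) ≤ E * H * (r⁻¹ * r ^ θ) := by
        calc _ = D * C3 * H * (r⁻¹ * r ^ θ) := by ring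
          _ ≤ _ := by gcongr
      have e2 : ρ ^ 2 ≤ E * ρ * (r⁻¹ * r ^ θ) := by
        calc ρ ^ 2 ≤ 1 * ρ * 1 := by linarith
          _ ≤ _ := by gcongr
      linarith
    have h2 : D * ((N + 1) * H * r ^ θ) + ρ ^ 2 ≤ E * (H + ρ) * r ^ θ := by
      have e1 : D * ((N + 1) * H * r ^ θ) ≤ E * H * r ^ θ := by
        calc _ = D * (N + 1) * H * r ^ θ := by ring
          _ ≤ _ := by gcongr
      have e2 : ρ ^ 2 ≤ E * ρ * r ^ θ := by
        calc ρ ^ 2 = 1 * ρ * ρ := by ring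
          _ ≤ _ := by gcongr; linarith
      linarith
    have t3 := third _ _ _ hbs (hbb6.mono (by linarith)) hbb3 h1
    have ca := fun x hx => abs_pd2_of_SS (by positivity)
      (key 2 (.inl rfl) _ _ _ has haa6 haa h2 2 le_rfl x hx) i j
    have hsf := smooth_evo (fun j => Γ (ix j)) z k hfs
    have hsb := smooth_evo (fun j => Γ (ix j)) z k hbs
    have hpa : ∀ w, pd1 (pd1 (evo (fun j => Γ (ix j)) z k
        (fun x => molk κ ρ f x - molk κ r (molk κ ρ f) x)) i) j w
        = pd1 (pd1 (evo (fun j => Γ (ix j)) z k (molk κ ρ f)) i) j w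
          - pd1 (pd1 (evo (fun j => Γ (ix j)) z k (molk κ r (molk κ ρ f))) i) j w := by
      intro w
      rw [evo_sub, pd1_sub (smooth_diff hsf) (smooth_diff hsb),
        pd1_sub (smooth_diff (smooth_pd1 hsf i)) (smooth_diff (smooth_pd1 hsb i))]
    have ex := ca x hx
    have ey := ca y hy
    rw [hpa] at ex ey
    have t3' : N * (C₁ * (E * (H + ρ) * (r⁻¹ * r ^ θ))) * r
        = N * (C₁ * (E * (H + ρ)) * r ^ θ) := by field_simp
    rw [t3'] at t3
    have e2 : (2 + N) * (C₁ * E) * (H + ρ) * r ^ θ = 2 * (C₁ * (E * (H + ρ) * r ^ θ))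
        + N * (C₁ * (E * (H + ρ)) * r ^ θ) := by ring
    rw [e2]
    rw [abs_le] at ex ey t3 ⊢
    constructor <;> linarith [ex.1, ex.2, ey.1, ey.2, t3.1, t3.2]

/-- The inhomogeneous scheme. -/
def usol (g : ℕ → Gen N) (z : ℝ) (f : Fn N) (s : ℕ → Fn N) : ℕ → Fn N
  | 0 => f
  | k + 1 => (g k).P z (fun x => usol g z f s k x + z ^ 2 * s k x)

lemma Gen.P_add (G : Gen N) (f g : Fn N) (z : ℝ) (x : ES N) :
    G.P z (fun x => f x + g x) x = G.P z f x + G.P z g x := by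
  have h := G.P_sub (fun x => f x + g x) g z x
  simp only [add_sub_cancel_right] at h
  have h' : G.P z (fun x => f x) x = G.P z f x := rfl
  linarith

lemma Gen.P_const_mul (G : Gen N) (a : ℝ) (f : Fn N) (z : ℝ) (x : ES N) :
    G.P z (fun x => a * f x) x = a * G.P z f x := by
  simp only [Gen.P, Gen.P0, ← mul_add, mul_div_assoc, ← mul_sum]
  ring

lemma Gen.P_sum (G : Gen N) {ι : Type*} (t : Finset ι) (f : ι → Fn N) (z : ℝ) (x : ES N) :
    G.P z (fun x => ∑ i ∈ t, f i x) x = ∑ i ∈ t, G.P z (f i) x := by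
  induction t using Finset.induction_on with
  | empty => simp [Gen.P, Gen.P0]
  | insert a t ha ih =>
    simp only [sum_insert ha]
    rw [G.P_add (f a) (fun x => ∑ i ∈ t, f i x), ih]

lemma usol_eq (g : ℕ → Gen N) (z : ℝ) (f : Fn N) (s : ℕ → Fn N) (j : ℕ) :
    usol g z f s j = fun x => evo g z j f x
      + ∑ i ∈ Finset.range j, z ^ 2 * evo (fun k => g (i + k)) z (j - i) (s i) x := by
  induction j with
  | zero => ext x; simp [usol, evo]
  | succ j ih =>
    ext x
    simp only [usol, ih, evo]
    rw [(g j).P_add (fun x => evo g z j f x + ∑ i ∈ Finset.range j, z ^ 2 *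
        evo (fun k => g (i + k)) z (j - i) (s i) x) (fun x => z ^ 2 * s j x),
      (g j).P_add (fun x => evo g z j f x), (g j).P_sum, (g j).P_const_mul,
      sum_range_succ, ← add_assoc]
    congr 1
    · congr 1
      refine sum_congr rfl fun i hi => ?_
      have hi := Finset.mem_range.1 hi
      rw [(g j).P_const_mul, Nat.succ_sub hi.le]
      simp only [evo, Nat.add_sub_cancel' hi.le]
    · simp [evo]

lemma usol_eq_reflect (g : ℕ → Gen N) (z : ℝ) (f : Fn N) (s : ℕ → Fn N) (j : ℕ) :
    usol g z f s j = fun x => evo g z j f x + ∑ m ∈ Finset.range j,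
      z ^ 2 * evo (fun k => g (j - 1 - m + k)) z (m + 1) (s (j - 1 - m)) x := by
  rw [usol_eq]
  ext x
  rw [← Finset.sum_range_reflect]
  congr 1
  refine sum_congr rfl fun m hm => ?_
  have := Finset.mem_range.1 hm
  rw [show j - (j - 1 - m) = m + 1 by omega]

/-! ### The inhomogeneous scheme -/

lemma smooth_usol (g : ℕ → Gen N) (z : ℝ) {s : ℕ → Fn N}
    (hf : Smooth f) (hs : ∀ k, Smooth (s k)) (j : ℕ) :
    Smooth (usol g z f s j) := by
  induction j with
  | zero => exact hf
  | succ j ih => exact (g j).smooth_P (ih.add (contDiff_const.mul (hs j))) z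

lemma abs_usol_le (g : ℕ → Gen N) (hN : 1 ≤ N) {s : ℕ → Fn N} {S S' c₀ z : ℝ}
    (hc₀ : 0 ≤ c₀) (hf : ∀ x, |f x| ≤ S) (hs : ∀ k x, |s k x| ≤ S')
    (hc : ∀ k x, (g k).c x ≤ c₀) (hz : ∀ k x, 0 ≤ 1 + z ^ 2 * (g k).c x) (j : ℕ) (x : ES N) :
    |usol g z f s j x| ≤ exp (c₀ * (j * z ^ 2)) * (S + j * z ^ 2 * S') := by
  induction j generalizing x with
  | zero => simpa [usol] using hf x
  | succ j ih =>
    have hS' : 0 ≤ S' := (abs_nonneg _).trans (hs 0 x)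
    have hS : 0 ≤ S := (abs_nonneg _).trans (hf x)
    have e1 : (1:ℝ) ≤ exp (c₀ * (j * z ^ 2)) := Real.one_le_exp (by positivity)
    have h1 : ∀ y, |usol g z f s j y + z ^ 2 * s j y| ≤
        exp (c₀ * (j * z ^ 2)) * (S + ((j + 1 : ℕ) : ℝ) * z ^ 2 * S') := fun y => by
      refine (abs_add_le _ _).trans ?_
      have h2 := ih y
      have h3 : |z ^ 2 * s j y| ≤ z ^ 2 * S' := by
        rw [abs_mul, abs_of_nonneg (sq_nonneg z)]
        exact mul_le_mul_of_nonneg_left (hs j y) (sq_nonneg z)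
      have h4 : 1 * (z ^ 2 * S') ≤ exp (c₀ * (j * z ^ 2)) * (z ^ 2 * S') := by gcongr
      push_cast
      linarith
    refine ((g j).abs_P_le hN h1 (hc j) (hz j) x).trans ?_
    have : 1 + z ^ 2 * c₀ ≤ exp (z ^ 2 * c₀) := by linarith [Real.add_one_le_exp (z ^ 2 * c₀)]
    calc _ ≤ exp (z ^ 2 * c₀) * (exp (c₀ * (j * z ^ 2)) *
          (S + ((j + 1 : ℕ) : ℝ) * z ^ 2 * S')) := by gcongr
      _ = _ := by rw [← mul_assoc, ← exp_add]; push_cast; ring_nf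

/-- Uniform Schauder bounds for the scheme. -/
theorem usol_lh {κ : Fn N} (hκ : Moll κ) {θ : ℝ} (hθ : θ ∈ Ioo (0:ℝ) 1) {C T : ℝ}
    (hC : 0 ≤ C) (hT : 0 ≤ T) :
    ∃ C', 0 ≤ C' ∧ ∀ (ι : Type) (Γ : ι → Gen N) (R z ρ K H : ℝ), 0 < ρ → ρ ≤ 1 → 0 < z →
      EvoEst Γ C R T z (ρ ^ 2) (2 * K) →
      ∀ (ix : ℕ → ι) (j : ℕ) (f : Fn N) (s : ℕ → Fn N), j * z ^ 2 ≤ T → C2H θ H f →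
        Bd 6 (molk κ ρ f) K → (∀ k, Smooth (s k)) → (∀ k, HB θ H (s k)) →
        (∀ k, Bd 6 (s k) K) →
        LH (R / 2) θ (C' * (H + ρ)) (usol (fun j => Γ (ix j)) z (molk κ ρ f) s j) := by
  obtain ⟨C₁, hC₁, h1⟩ := evo_c2h hκ hθ hC hT
  obtain ⟨C₂, hC₂, h2⟩ := evo_hol hκ hθ (T := T) hC
  have hθ1 : 0 < 1 - θ := by linarith [hθ.2]
  have hθ0 := hθ.1
  refine ⟨C₁ + (1 + C₂) * (T ^ (θ / 2) / (θ / 2) + (2 + N) * (2 / θ + 4 / (1 - θ))),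
    by positivity, ?_⟩
  intro ι Γ R z ρ K H hρ hρ1 hz hest ix j f s hj hf hbf hs hsH hsK
  have hH := hf.nonneg
  have hfs : Smooth (molk κ ρ f) := smooth_molk hκ.ker hf.smooth.continuous hρ
  have hρ2 : ρ ^ 2 ≤ ρ := by nlinarith
  have hE : ∀ m, Smooth
      (evo (fun k => Γ (ix (j - 1 - m + k))) z (m + 1) (s (j - 1 - m))) :=
    fun m => smooth_evo _ z _ (hs _)
  have a1 := h1 ι Γ R z ρ K H hρ hρ1 hest ix j f hj hf hbf
  have a2 := LH_sum (ρ := R / 2) (A := (1 + C₂) * (H + ρ)) hθ (sq_pos_of_pos hz) (by positivity)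
    hj hE (fun m hm n hn k hk x hx => by
      have hmT : ((m + 1 : ℕ) : ℝ) * z ^ 2 ≤ T := by
        refine le_trans ?_ hj
        have : ((m + 1 : ℕ) : ℝ) ≤ j := by exact_mod_cast hm
        gcongr
      have h3 := h2 ι Γ R z (ρ ^ 2) K H hest (by positivity) hz (fun k => ix (j - 1 - m + k)) (m + 1)
        (s (j - 1 - m)) (by omega) hmT (hs _) (hsK _) (hsH _) n hn k hk x hx
      push_cast at h3
      refine h3.trans ?_
      set W := √((m + 1 : ℝ) * z ^ 2) ^ θ * (√((m + 1 : ℝ) * z ^ 2))⁻¹ ^ n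
      have hW : 0 ≤ W := by positivity
      have h4 : C₂ ≤ (1 + C₂) ^ 2 := by nlinarith
      calc C₂ * ((H + ρ ^ 2) * W) ^ 2 ≤ (1 + C₂) ^ 2 * ((H + ρ) * W) ^ 2 := by gcongr
        _ = _ := by ring)
  rw [usol_eq_reflect]
  have := a1.add a2 (smooth_evo _ z j hfs) (.sum fun m _ => contDiff_const.mul (hE m))
  refine this.mono (le_of_eq ?_)
  ring

/-- Bounds for the derivatives of the scheme, uniform in the step. -/
lemma usol_stable (hN : 1 ≤ N) {ι : Type*} [Finite ι] (Γ : ι → Gen N) (m : ℕ) {T : ℝ}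
    (hT : 0 ≤ T) :
    ∃ C, 0 ≤ C ∧ ∀ (ix : ℕ → ι) (z : ℝ) (j : ℕ) (f : Fn N) (s : ℕ → Fn N) K, |z| ≤ 1 → j * z ^ 2 ≤ T →
      Smooth f → (∀ k, Smooth (s k)) → Bd m f K → (∀ k, Bd m (s k) K) →
      Bd m (usol (fun k => Γ (ix k)) z f s j) (C * K) := by
  obtain ⟨C, hC, h⟩ := evo_stable hN Γ m
  refine ⟨(1 + T) * (C * exp (C * T)), by positivity, ?_⟩
  intro ix z j f s K hz hj hf hs hfK hsK
  have hK := hfK.nonneg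
  rw [usol_eq]
  have hle : ∀ k : ℕ, k ≤ j → C * exp (C * (k * z ^ 2)) * K ≤ C * exp (C * T) * K := by
    intro k hk
    have : k * z ^ 2 ≤ T := le_trans (by gcongr) hj
    gcongr
  have a1 := (h ix z j f K hz hf hfK).mono (hle j le_rfl)
  have hE : ∀ i, Smooth (evo (fun k => Γ (ix (i + k))) z (j - i) (s i)) :=
    fun i => smooth_evo _ z _ (hs _)
  have a2 := Bd.sum (m := m) (Finset.range j)
    (K := fun _ => |z ^ 2| * (C * exp (C * T) * K)) (fun i => contDiff_const.mul (hE i))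
    (fun i _ => (((h (fun k => ix (i + k)) z (j - i) (s i) K hz (hs i) (hsK i)).mono
      (hle _ (Nat.sub_le _ _))).const_mul (z ^ 2) (hE i)))
  refine (a1.add (smooth_evo _ z j hf) (.sum fun i _ => contDiff_const.mul (hE i)) a2).mono ?_
  rw [sum_const, Finset.card_range, nsmul_eq_mul, abs_of_nonneg (sq_nonneg z)]
  have : j * z ^ 2 * (C * exp (C * T) * K) ≤ T * (C * exp (C * T) * K) := by gcongr
  linarith

/-- The increments of the scheme. -/
lemma usol_step (hN : 1 ≤ N) {ι : Type*} [Finite ι] (Γ : ι → Gen N) {T : ℝ} (hT : 0 ≤ T) :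
    ∃ C, 0 ≤ C ∧ ∀ (ix : ℕ → ι) (z : ℝ) (j : ℕ) (f : Fn N) (s : ℕ → Fn N) K, |z| ≤ 1 → j * z ^ 2 ≤ T →
      Smooth f → (∀ k, Smooth (s k)) → Bd 3 f K → (∀ k, Bd 3 (s k) K) → ∀ x,
      |usol (fun k => Γ (ix k)) z f s (j + 1) x - usol (fun k => Γ (ix k)) z f s j x
        - z ^ 2 * ((Γ (ix j)).A (usol (fun k => Γ (ix k)) z f s j) x + s j x)| ≤ C * K * |z| ^ 3 := by
  obtain ⟨C, hC, h⟩ := usol_stable hN Γ 3 hT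
  choose D hD hc using fun i => (Γ i).consistent hN 0
  choose E hE ha using fun i => (Γ i).A_bd 0
  obtain ⟨D', hD'⟩ := (Set.finite_range D).bddAbove
  obtain ⟨E', hE'⟩ := (Set.finite_range E).bddAbove
  refine ⟨max D' 0 * (C + 1) + max E' 0, by positivity, ?_⟩
  intro ix z j f s K hz hj hf hs hfK hsK x
  have hK := hfK.nonneg
  set u := usol (fun k => Γ (ix k)) z f s j with hu
  have hus : Smooth u := smooth_usol _ z hf hs j
  have hub : Bd 3 u (C * K) := h ix z j f s K hz hj hf hs hfK hsK
  have hz2 : z ^ 2 ≤ 1 := by rw [← sq_abs]; exact pow_le_one₀ (abs_nonneg z) hz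
  have hsz : Smooth fun x => z ^ 2 * s j x := contDiff_const.mul (hs j)
  have hb : Bd (0 + 3) (fun x => u x + z ^ 2 * s j x) ((C + 1) * K) := by
    refine (hub.add hus hsz ((hsK j).const_mul (z ^ 2) (hs j))).mono ?_
    rw [abs_of_nonneg (sq_nonneg z)]
    have : z ^ 2 * K ≤ 1 * K := by gcongr
    linarith
  have h1 := (hc (ix j) _ _ z (hus.add hsz) hb hz).zero x
  have h2 := (ha (ix j) (s j) K (hs j) ((hsK j).of_le (by norm_num))).zero x
  have h3 : (Γ (ix j)).A (fun x => u x + z ^ 2 * s j x) x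
      = (Γ (ix j)).A u x + z ^ 2 * (Γ (ix j)).A (s j) x := by
    unfold Gen.A
    rw [Lop_add _ _ _ hus hsz, Lop_const_mul _ _ _ (hs j)]
  have hD2 : D (ix j) ≤ max D' 0 := (hD' (mem_range_self _)).trans (le_max_left _ _)
  have hE2 : E (ix j) ≤ max E' 0 := (hE' (mem_range_self _)).trans (le_max_left _ _)
  have h4 : |z| ^ 4 ≤ |z| ^ 3 := pow_le_pow_of_le_one (abs_nonneg z) hz (by norm_num)
  have e1 : usol (fun k => Γ (ix k)) z f s (j + 1) x - u x
        - z ^ 2 * ((Γ (ix j)).A u x + s j x)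
      = ((Γ (ix j)).P z (fun x => u x + z ^ 2 * s j x) x - (u x + z ^ 2 * s j x)
        - z ^ 2 * (Γ (ix j)).A (fun x => u x + z ^ 2 * s j x) x)
        + z ^ 4 * (Γ (ix j)).A (s j) x := by
    rw [h3]; simp only [usol]; rw [← hu]; ring
  rw [e1]
  refine (abs_add_le _ _).trans ?_
  have h5 : |z ^ 4 * (Γ (ix j)).A (s j) x| ≤ |z| ^ 3 * (max E' 0 * K) := by
    rw [abs_mul, abs_pow]
    exact mul_le_mul h4 (h2.trans (by gcongr)) (abs_nonneg _) (by positivity)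
  have h6 : D (ix j) * ((C + 1) * K) * |z| ^ 3 ≤ max D' 0 * ((C + 1) * K) * |z| ^ 3 := by gcongr
  linarith

/-! ### Smooth Cholesky factorization -/

/-- A positive definite matrix with `C^m` entries has a `C^m` factorization. -/
theorem exists_cholesky {E : Type*} [NormedAddCommGroup E] [NormedSpace ℝ E] (m : WithTop ℕ∞)
    (n : ℕ) : ∀ Q : Fin n → Fin n → E → ℝ, (∀ i j, ContDiff ℝ m (Q i j)) →
    (∀ i j, Q i j = Q j i) →
    (∀ x (ξ : Fin n → ℝ), ξ ≠ 0 → 0 < ∑ i, ∑ j, Q i j x * ξ i * ξ j) →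
    ∃ σ : Fin n → Fin n → E → ℝ, (∀ k i, ContDiff ℝ m (σ k i)) ∧
      ∀ i j x, Q i j x = ∑ k, σ k i x * σ k j x := by
  induction n with
  | zero => exact fun Q _ _ _ => ⟨fun i => i.elim0, fun i => i.elim0, fun i => i.elim0⟩
  | succ n ih =>
    intro Q hQ hsymm hpos
    have h0 : ∀ x, 0 < Q 0 0 x := fun x => by
      have := hpos x (Pi.single 0 1) (fun h => by simpa using congrFun h 0)
      simpa [Fin.sum_univ_succ, Pi.single_apply, Fin.succ_ne_zero] using this
    have hs : ContDiff ℝ m fun x => √(Q 0 0 x) := (hQ 0 0).sqrt fun x => (h0 x).ne'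
    have hs0 : ∀ x, √(Q 0 0 x) ≠ 0 := fun x => (Real.sqrt_pos.2 (h0 x)).ne'
    obtain ⟨σ, hσ, hσQ⟩ := ih
      (fun i j x => Q i.succ j.succ x - Q 0 i.succ x * Q 0 j.succ x / Q 0 0 x)
      (fun i j => (hQ _ _).sub (((hQ _ _).mul (hQ _ _)).div (hQ 0 0) fun x => (h0 x).ne'))
      (fun i j => by ext x; rw [hsymm i.succ j.succ]; ring)
      (fun x ξ hξ => by
        have h1 := h0 x
        set e := ∑ j, Q 0 (Fin.succ j) x * ξ j with he
        have h2 := hpos x (Fin.cons (-e / Q 0 0 x) ξ) (fun h => hξ (by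
          ext i; simpa using congrFun h i.succ))
        have h3 : ∑ i, ∑ j, Q i j x * (Fin.cons (-e / Q 0 0 x) ξ : Fin (n + 1) → ℝ) i
            * (Fin.cons (-e / Q 0 0 x) ξ : Fin (n + 1) → ℝ) j
            = Q 0 0 x * (-e / Q 0 0 x) * (-e / Q 0 0 x) + 2 * (-e / Q 0 0 x) * e
              + ∑ i, ∑ j, Q (Fin.succ i) (Fin.succ j) x * ξ i * ξ j := by
          rw [Fin.sum_univ_succ]
          simp only [Fin.sum_univ_succ, Fin.cons_zero, Fin.cons_succ, sum_add_distrib]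
          have a1 : ∑ i, Q 0 (Fin.succ i) x * (-e / Q 0 0 x) * ξ i = (-e / Q 0 0 x) * e := by
            rw [he, mul_sum]; exact sum_congr rfl fun i _ => by ring
          have a2 : ∑ i, Q (Fin.succ i) 0 x * ξ i * (-e / Q 0 0 x) = (-e / Q 0 0 x) * e := by
            rw [he, mul_sum]
            exact sum_congr rfl fun i _ => by rw [hsymm i.succ 0]; ring
          rw [a1, a2]; ring
        rw [h3] at h2
        have h4 : ∑ i, ∑ j, (Q (Fin.succ i) (Fin.succ j) x
            - Q 0 (Fin.succ i) x * Q 0 (Fin.succ j) x / Q 0 0 x) * ξ i * ξ j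
            = ∑ i, ∑ j, Q (Fin.succ i) (Fin.succ j) x * ξ i * ξ j - e * e / Q 0 0 x := by
          have a3 : e * e / Q 0 0 x = ∑ i, ∑ j,
              Q 0 (Fin.succ i) x * Q 0 (Fin.succ j) x / Q 0 0 x * ξ i * ξ j := by
            rw [he, sum_mul_sum, sum_div]
            refine sum_congr rfl fun i _ => ?_
            rw [sum_div]
            exact sum_congr rfl fun j _ => by ring
          rw [a3, ← sum_sub_distrib]
          refine sum_congr rfl fun i _ => ?_
          rw [← sum_sub_distrib]
          exact sum_congr rfl fun j _ => by ring
        rw [h4]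
        have h5 : Q 0 0 x * (-e / Q 0 0 x) * (-e / Q 0 0 x) + 2 * (-e / Q 0 0 x) * e
            = -(e * e / Q 0 0 x) := by field_simp; ring
        linarith)
    refine ⟨Fin.cons (fun i x => Q 0 i x / √(Q 0 0 x)) fun k => Fin.cons (fun _ => 0) (σ k),
      fun k i => ?_, fun i j x => ?_⟩
    · refine Fin.cases ?_ (fun k => ?_) k
      · exact (hQ 0 i).div hs hs0
      · refine Fin.cases ?_ (fun i => ?_) i
        · simpa using contDiff_const
        · simpa using hσ k i
    · have hsq : √(Q 0 0 x) * √(Q 0 0 x) = Q 0 0 x := Real.mul_self_sqrt (h0 x).le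
      have hne := hs0 x
      have hq := (h0 x).ne'
      have hmain : ∀ i j, Q 0 i x / √(Q 0 0 x) * (Q 0 j x / √(Q 0 0 x))
          = Q 0 i x * Q 0 j x / Q 0 0 x := fun i j => by
        rw [div_mul_div_comm, hsq]
      rw [Fin.sum_univ_succ]
      simp only [Fin.cons_zero, Fin.cons_succ, hmain]
      refine Fin.cases ?_ (fun i => ?_) i
      · simp only [Fin.cons_zero, zero_mul, sum_const_zero, add_zero]
        field_simp
      · refine Fin.cases ?_ (fun j => ?_) j
        · simp only [Fin.cons_zero, mul_zero, sum_const_zero, add_zero]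
          rw [hsymm i.succ 0]; field_simp
        · simp only [Fin.cons_succ]
          rw [← hσQ i j x]; ring

/-! ### Uniform convergence with derivatives -/

/-- Uniform convergence on `U` of the derivatives of order at most `m`, the limits being
bounded. -/
def Cv : ℕ → Set (ES N) → (ℕ → Fn N) → Fn N → Prop
  | 0, U, F, f => (∀ ε > 0, ∀ᶠ n in atTop, ∀ x ∈ U, |F n x - f x| ≤ ε) ∧
      ∃ M, ∀ x ∈ U, |f x| ≤ M
  | m + 1, U, F, f => Cv m U F f ∧ ∀ i, Cv m U (fun n => pd1 (F n) i) (pd1 f i)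

variable {U : Set (ES N)} {F G : ℕ → Fn N} {f g : Fn N}

lemma Cv.add {m : ℕ} (hF : ∀ n, Smooth (F n)) (hG : ∀ n, Smooth (G n))
    (hf : ContDiff ℝ m f) (hg : ContDiff ℝ m g) (h : Cv m U F f) (h' : Cv m U G g) :
    Cv m U (fun n x => F n x + G n x) fun x => f x + g x := by
  induction m generalizing F G f g with
  | zero =>
    obtain ⟨h1, M, hM⟩ := h
    obtain ⟨h2, L, hL⟩ := h'
    refine ⟨fun ε hε => ?_, M + L, fun x hx =>
      (abs_add_le _ _).trans (add_le_add (hM x hx) (hL x hx))⟩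
    filter_upwards [h1 (ε / 2) (by positivity), h2 (ε / 2) (by positivity)] with n a b x hx
    rw [add_sub_add_comm]
    refine (abs_add_le _ _).trans ?_
    linarith [a x hx, b x hx]
  | succ m ih =>
    have l1 : (m : WithTop ℕ∞) ≤ (m + 1 : ℕ) := by exact_mod_cast Nat.le_succ m
    refine ⟨ih hF hG (hf.of_le l1) (hg.of_le l1) h.1 h'.1, fun i => ?_⟩
    have e1 : ∀ n, pd1 (fun x => F n x + G n x) i = fun x => pd1 (F n) i x + pd1 (G n) i x :=
      fun n => pd1_add (smooth_diff (hF n)) (smooth_diff (hG n)) i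
    have d : ∀ {f : Fn N}, ContDiff ℝ (m + 1 : ℕ) f → Differentiable ℝ f := fun hf =>
      hf.differentiable (by simp)
    rw [pd1_add (d hf) (d hg)]
    simp only [e1]
    exact ih (fun n => smooth_pd1 (hF n) i) (fun n => smooth_pd1 (hG n) i)
      (contDiff_pd1 hf (by simp) i) (contDiff_pd1 hg (by simp) i) (h.2 i) (h'.2 i)

lemma Cv.mul {m : ℕ} (hF : ∀ n, Smooth (F n)) (hG : ∀ n, Smooth (G n))
    (hf : ContDiff ℝ m f) (hg : ContDiff ℝ m g) (h : Cv m U F f) (h' : Cv m U G g) :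
    Cv m U (fun n x => F n x * G n x) fun x => f x * g x := by
  induction m generalizing F G f g with
  | zero =>
    obtain ⟨h1, M, hM⟩ := h
    obtain ⟨h2, L, hL⟩ := h'
    refine ⟨fun ε hε => ?_, |M| * |L|, fun x hx => ?_⟩
    · set D := |M| + |L| + 1 with hD
      have hD0 : 0 < D := by positivity
      filter_upwards [h1 (min 1 (ε / (2 * D))) (by positivity),
        h2 (ε / (2 * D)) (by positivity)] with n a b x hx
      have ha := a x hx
      have hb := b x hx
      have e1 : |F n x| ≤ D := by
        have h3 : |F n x - f x| ≤ 1 := ha.trans (min_le_left _ _)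
        have h4 := hM x hx
        have h5 : |F n x| ≤ |F n x - f x| + |f x| := by
          simpa using abs_add_le (F n x - f x) (f x)
        have := le_abs_self M
        have := abs_nonneg L
        linarith
      have e2 : |g x| ≤ D := by
        have := hL x hx
        have := le_abs_self L
        have := abs_nonneg M
        linarith
      calc |F n x * G n x - f x * g x| = |F n x * (G n x - g x) + (F n x - f x) * g x| := by
            ring_nf
        _ ≤ |F n x| * |G n x - g x| + |F n x - f x| * |g x| := by
            rw [← abs_mul, ← abs_mul]; exact abs_add_le _ _
        _ ≤ D * (ε / (2 * D)) + ε / (2 * D) * D := by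
            gcongr
            exact ha.trans (min_le_right _ _)
        _ = ε := by field_simp; ring
    · rw [abs_mul]
      exact mul_le_mul ((hM x hx).trans (le_abs_self _)) ((hL x hx).trans (le_abs_self _))
        (abs_nonneg _) (abs_nonneg _)
  | succ m ih =>
    have l1 : (m : WithTop ℕ∞) ≤ (m + 1 : ℕ) := by exact_mod_cast Nat.le_succ m
    refine ⟨ih hF hG (hf.of_le l1) (hg.of_le l1) h.1 h'.1, fun i => ?_⟩
    have e1 : ∀ n, pd1 (fun x => F n x * G n x) i
        = fun x => pd1 (F n) i x * G n x + F n x * pd1 (G n) i x :=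
      fun n => pd1_mul (smooth_diff (hF n)) (smooth_diff (hG n)) i
    have d : ∀ {f : Fn N}, ContDiff ℝ (m + 1 : ℕ) f → Differentiable ℝ f := fun hf =>
      hf.differentiable (by simp)
    have p : ∀ {f : Fn N}, ContDiff ℝ (m + 1 : ℕ) f → ContDiff ℝ m (pd1 f i) := fun hf =>
      contDiff_pd1 hf (by simp) i
    rw [pd1_mul (d hf) (d hg)]
    simp only [e1]
    exact Cv.add (fun n => (smooth_pd1 (hF n) i).mul (hG n))
      (fun n => (hF n).mul (smooth_pd1 (hG n) i)) ((p hf).mul (hg.of_le l1))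
      ((hf.of_le l1).mul (p hg))
      (ih (fun n => smooth_pd1 (hF n) i) hG (p hf) (hg.of_le l1) (h.2 i) h'.1)
      (ih hF (fun n => smooth_pd1 (hG n) i) (hf.of_le l1) (p hg) h.1 (h'.2 i))

lemma Cv.const (m : ℕ) (a : ℝ) : Cv m U (fun _ _ => a) fun _ => a := by
  induction m generalizing a with
  | zero => exact ⟨fun ε hε => .of_forall fun n x _ => by simpa using hε.le, |a|, fun _ _ => le_rfl⟩
  | succ m ih => exact ⟨ih a, fun i => by simp only [pd1_const]; exact ih 0⟩

lemma Cv.sum {m : ℕ} {ι : Type*} (s : Finset ι) {F : ι → ℕ → Fn N} {f : ι → Fn N}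
    (hF : ∀ k n, Smooth (F k n)) (hf : ∀ k, ContDiff ℝ m (f k))
    (h : ∀ k, Cv m U (F k) (f k)) :
    Cv m U (fun n x => ∑ k ∈ s, F k n x) fun x => ∑ k ∈ s, f k x := by
  induction s using Finset.induction_on with
  | empty => simpa using Cv.const m 0
  | insert a s ha ih =>
    simp only [sum_insert ha]
    exact (h a).add (hF a) (fun n => .sum fun k _ => hF k n) (hf a) (.sum fun k _ => hf k) ih

lemma pd1_congr (hU : IsOpen U) (h : ∀ x ∈ U, f x = g x) (i : Fin N) :
    ∀ x ∈ U, pd1 f i x = pd1 g i x := fun x hx => by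
  have : f =ᶠ[𝓝 x] g := Filter.eventually_of_mem (hU.mem_nhds hx) h
  simp only [pd1, this.fderiv_eq]

lemma Cv.congr {m : ℕ} (hU : IsOpen U) (h : ∀ x ∈ U, f x = g x) (hf : Cv m U F f) :
    Cv m U F g := by
  induction m generalizing F f g with
  | zero =>
    obtain ⟨h1, M, hM⟩ := hf
    refine ⟨fun ε hε => (h1 ε hε).mono fun n hn x hx => ?_, M, fun x hx => ?_⟩
    · rw [← h x hx]; exact hn x hx
    · rw [← h x hx]; exact hM x hx
  | succ m ih => exact ⟨ih h hf.1, fun i => ih (pd1_congr hU h i) (hf.2 i)⟩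

lemma Cv.zero {m : ℕ} (h : Cv m U F f) : Cv 0 U F f := by
  induction m with
  | zero => exact h
  | succ m ih => exact ih h.1

lemma hasCompactSupport_pd1 (hf : HasCompactSupport f) (i : Fin N) :
    HasCompactSupport (pd1 f i) :=
  (hf.fderiv (𝕜 := ℝ)).comp_left (g := fun L : ES N →L[ℝ] ℝ => L (EuclideanSpace.single i 1)) rfl

lemma exists_abs_le_of_hasCompactSupport (hf : Continuous f) (hc : HasCompactSupport f) :
    ∃ M, ∀ x, |f x| ≤ M := hf.bounded_above_of_compact_support hc

/-- Regularizations of compactly supported functions converge. -/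
lemma Cv_molk {κ : Fn N} (hκ : Moll κ) {m : ℕ} (hf : ContDiff ℝ m f)
    (hc : HasCompactSupport f) : Cv m U (fun n => molk κ (1 / ((n:ℝ) + 1)) f) f := by
  induction m generalizing f with
  | zero =>
    have hcont := hf.continuous
    refine ⟨fun ε hε => ?_, ?_⟩
    · have hu := hc.uniformContinuous_of_continuous hcont
      obtain ⟨η, hη, hu⟩ := Metric.uniformContinuous_iff.1 hu ε hε
      have ht := tendsto_one_div_add_atTop_nhds_zero_nat (𝕜 := ℝ)
      filter_upwards [ht.eventually_lt_const hη] with n hn x _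
      refine hκ.abs_sub_le hcont (by positivity) fun y hy => ?_
      have := hu (a := y) (b := x) (by rw [dist_eq_norm]; linarith)
      rw [Real.dist_eq] at this
      exact this.le
    · obtain ⟨M, hM⟩ := exists_abs_le_of_hasCompactSupport hcont hc
      exact ⟨M, fun x _ => hM x⟩
  | succ m ih =>
    have l1 : (m : WithTop ℕ∞) ≤ (m + 1 : ℕ) := by exact_mod_cast Nat.le_succ m
    have l2 : (1 : WithTop ℕ∞) ≤ (m + 1 : ℕ) := by exact_mod_cast Nat.le_add_left 1 m
    refine ⟨ih (hf.of_le l1) hc, fun i => ?_⟩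
    have hp := contDiff_pd1 hf (m := m) (by simp) i
    have hb : ∃ K, ∀ i x, |pd1 f i x| ≤ K := by
      choose M hM using fun i => exists_abs_le_of_hasCompactSupport
        (contDiff_pd1 hf (m := m) (by simp) i).continuous (hasCompactSupport_pd1 hc i)
      obtain ⟨K, hK⟩ := (Set.finite_range M).bddAbove
      exact ⟨K, fun i x => (hM i x).trans (hK (mem_range_self i))⟩
    obtain ⟨K, hK⟩ := hb
    simp only [pd1_molk_right hκ.ker (hf.of_le l2) hK]
    exact ih hp (hasCompactSupport_pd1 hc i)

/-! ### Perturbation of the structural conditions -/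

/-- Closeness at `x` of the derivatives of order at most three. -/
structure Near (ε : ℝ) (f g : Fn N) (x : ES N) : Prop where
  d0 : |f x - g x| ≤ ε
  d1 : ∀ i, |pd1 f i x - pd1 g i x| ≤ ε
  d2 : ∀ i j, |pd1 (pd1 f i) j x - pd1 (pd1 g i) j x| ≤ ε
  d3 : ∀ i j k, |pd1 (pd1 (pd1 f i) j) k x - pd1 (pd1 (pd1 g i) j) k x| ≤ ε

lemma Cv.near {U : Set (ES N)} {F : ℕ → Fn N} (h : Cv 3 U F f) {ε : ℝ}
    (hε : 0 < ε) : ∀ᶠ n in atTop, ∀ x ∈ U, Near ε (F n) f x := by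
  have h0 := h.zero.1 ε hε
  have h1 := eventually_all.2 fun i => (h.2 i).zero.1 ε hε
  have h2 := eventually_all.2 fun i => eventually_all.2 fun j => ((h.2 i).2 j).zero.1 ε hε
  have h3 := eventually_all.2 fun i => eventually_all.2 fun j => eventually_all.2 fun k =>
    (((h.2 i).2 j).2 k).1 ε hε
  filter_upwards [h0, h1, h2, h3] with n a0 a1 a2 a3 x hx
  exact ⟨a0 x hx, fun i => a1 i x hx, fun i j => a2 i j x hx, fun i j k => a3 i j k x hx⟩

lemma abs_bilin_le {ι κ : Type*} [Fintype ι] [Fintype κ] {ε : ℝ} {a : ι → κ → ℝ}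
    (h : ∀ i j, |a i j| ≤ ε) (u : ι → ℝ) (v : κ → ℝ) :
    |∑ i, ∑ j, a i j * u i * v j| ≤ ε * ((∑ i, |u i|) * ∑ j, |v j|) := by
  rw [sum_mul_sum, mul_sum]
  refine (abs_sum_le_sum_abs _ _).trans (sum_le_sum fun i _ => ?_)
  rw [mul_sum]
  refine (abs_sum_le_sum_abs _ _).trans (sum_le_sum fun j _ => ?_)
  rw [abs_mul, abs_mul, mul_assoc]
  exact mul_le_mul_of_nonneg_right (h i j) (by positivity)

lemma abs_quad_le {ι : Type*} [Fintype ι] {ε : ℝ} (hε : 0 ≤ ε) {a : ι → ι → ℝ}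
    (h : ∀ i j, |a i j| ≤ ε) (u : ι → ℝ) :
    |∑ i, ∑ j, a i j * u i * u j| ≤ ε * Fintype.card ι * ∑ i, u i ^ 2 := by
  refine (abs_bilin_le h u u).trans ?_
  have := sq_sum_le_card_mul_sum_sq (s := Finset.univ) (f := fun i => |u i|)
  simp only [sq_abs, Finset.card_univ] at this
  rw [← pow_two, mul_assoc]
  gcongr

lemma abs_apply_le (x : ES N) (i : Fin N) : |x i| ≤ ‖x‖ := by
  simpa using PiLp.norm_apply_le x i

lemma sum_abs_le (x : ES N) : ∑ i, |x i| ≤ N * ‖x‖ := by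
  refine (sum_le_sum fun i _ => abs_apply_le x i).trans ?_
  simp

section

variable {q q' : Fin N → VF N} {b b' : VF N} {c c' : Fn N}
  {B ν₀ ν d r ϱ L₁ L₂ L₃ ε : ℝ} {x : ES N}

/-- The smallness of the perturbation. -/
structure Small (N : ℕ) (ν₀ L₁ L₂ ε : ℝ) : Prop where
  nonneg : 0 ≤ ε
  le_one : ε ≤ 1
  le : ε * (2 * ((N:ℝ) ^ 2 + N + 1) + L₁ + L₂) ≤ ν₀

lemma Small.le' (hs : Small N ν₀ L₁ L₂ ε) (h1 : 0 < L₁) (h2 : 0 < L₂) (hν : ν₀ ≤ ν) :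
    ε ≤ ν ∧ ε * (N : ℝ) ^ 2 ≤ ν / 2 ∧ ε * N ≤ ν / 2 ∧ ε * (N + L₁ + L₂) ≤ ν := by
  have h0 := hs.nonneg
  have h := hs.le
  have hN : (0:ℝ) ≤ N := Nat.cast_nonneg N
  have a1 := mul_nonneg h0 hN
  have a2 := mul_nonneg h0 h1.le
  have a3 := mul_nonneg h0 h2.le
  have a4 := mul_nonneg h0 (sq_nonneg (N:ℝ))
  refine ⟨?_, ?_, ?_, ?_⟩ <;> nlinarith

lemma le_of_near {a a' M M' : ℝ} (h : |a' - a| ≤ ε) (ha : |a| ≤ M) (hM : M + ε ≤ M') :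
    |a'| ≤ M' := by
  have := abs_sub_abs_le_abs_sub a' a
  linarith

lemma Pt.perturb (h : Pt q b c B ν d r ϱ x) (hs : Small N ν₀ L₁ L₂ ε) (h1 : 0 < L₁) (h2 : 0 < L₂)
    (hν : ν₀ ≤ ν) (hq : ∀ i j, Near ε (q' i j) (q i j) x) (hb : ∀ j, Near ε (b' j) (b j) x)
    (hc : Near ε c' c x) :
    Pt q' b' c' (2 * (B + 1)) (ν / 2) (d + N * ε) (r + ε) (ϱ + ε) x := by
  obtain ⟨s1, s2, s3, -⟩ := hs.le' h1 h2 hν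
  have hB := h.B_nonneg
  have hν' := h.ν_nonneg
  have e0 : B * ν + ε ≤ 2 * (B + 1) * (ν / 2) := by linarith
  refine ⟨by positivity, by positivity, fun i j l => le_of_near ((hq i j).d1 l) (h.q1 i j l) e0,
    fun Ξ hΞ => ?_, fun i j m k l => le_of_near ((hq i j).d3 m k l) (h.q3 i j m k l) e0,
    fun ξ => ?_, fun j k l => le_of_near ((hb j).d2 k l) (h.b2 j k l) le_rfl,
    fun j m k l => le_of_near ((hb j).d3 m k l) (h.b3 j m k l) le_rfl,
    fun k => le_of_near (hc.d1 k) (h.c1 k) le_rfl,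
    fun k l => le_of_near (hc.d2 k l) (h.c2 k l) le_rfl,
    fun m k l => le_of_near (hc.d3 m k l) (h.c3 m k l) le_rfl⟩
  · have a1 := abs_quad_le (ι := Fin N × Fin N) hs.nonneg (a := fun p r =>
      pd1 (pd1 (q' r.1 r.2) p.1) p.2 x - pd1 (pd1 (q r.1 r.2) p.1) p.2 x)
      (fun p r => (hq r.1 r.2).d2 p.1 p.2) (fun p => Ξ p.1 p.2)
    simp only [Fintype.sum_prod_type, Fintype.card_prod, Fintype.card_fin] at a1
    have a2 := h.q2 Ξ hΞ
    have a3 : (∑ k, ∑ l, ∑ i, ∑ j, pd1 (pd1 (q' i j) k) l x * Ξ i j * Ξ k l)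
        - ∑ k, ∑ l, ∑ i, ∑ j, pd1 (pd1 (q i j) k) l x * Ξ i j * Ξ k l
        = ∑ k, ∑ l, ∑ i, ∑ j, (pd1 (pd1 (q' i j) k) l x - pd1 (pd1 (q i j) k) l x)
          * Ξ k l * Ξ i j := by
      simp only [← sum_sub_distrib]
      refine sum_congr rfl fun k _ => sum_congr rfl fun l _ =>
        sum_congr rfl fun i _ => sum_congr rfl fun j _ => by ring
    have a4 := (le_abs_self _).trans a1
    rw [← a3] at a4
    set S := ∑ i, ∑ j, Ξ i j ^ 2 with hS
    have hS0 : 0 ≤ S := by positivity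
    push_cast at a4
    nlinarith [mul_le_mul_of_nonneg_right s2 hS0, mul_nonneg hν' hS0]
  · have a1 := abs_quad_le hs.nonneg (a := fun i j => pd1 (b' i) j x - pd1 (b i) j x)
      (fun i j => (hb i).d1 j) ξ
    have a2 := h.b1 ξ
    have a3 : (∑ i, ∑ j, pd1 (b' i) j x * ξ j * ξ i) - ∑ i, ∑ j, pd1 (b i) j x * ξ j * ξ i
        = ∑ i, ∑ j, (pd1 (b' i) j x - pd1 (b i) j x) * ξ i * ξ j := by
      simp only [← sum_sub_distrib]
      exact sum_congr rfl fun i _ => sum_congr rfl fun j _ => by ring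
    have a4 := (le_abs_self _).trans a1
    rw [← a3, Fintype.card_fin] at a4
    linarith

lemma Growth.perturb (h : Growth q b B ν x) (hs : Small N ν₀ L₁ L₂ ε) (h1 : 0 < L₁)
    (h2 : 0 < L₂) (hν : ν₀ ≤ ν) (hq : ∀ i j, |q' i j x - q i j x| ≤ ε)
    (hb : ∀ j, |b' j x - b j x| ≤ ε) : Growth q' b' (2 * (B + 1)) (ν / 2) x := by
  obtain ⟨s1, s2, s3, -⟩ := hs.le' h1 h2 hν
  have hε := hs.nonneg
  have hx := norm_nonneg x
  have hN : (0:ℝ) ≤ N := Nat.cast_nonneg N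
  have hx2 : ‖x‖ ≤ 1 + ‖x‖ ^ 2 := by nlinarith [sq_nonneg (‖x‖ - 1)]
  have hν0 : 0 ≤ ν := hε.trans s1
  have e : ∀ a, B * (1 + ‖x‖ ^ 2) * ν * a + (1 + ‖x‖ ^ 2) * ν * a
      = 2 * (B + 1) * (1 + ‖x‖ ^ 2) * (ν / 2) * a := fun a => by ring
  refine ⟨fun ξ => ?_, ?_, ?_⟩
  · have a1 := abs_bilin_le (a := fun i j => q' i j x - q i j x) hq (fun i => x i) fun j => ξ j
    have a3 : (∑ i, ∑ j, q' i j x * x i * ξ j) - ∑ i, ∑ j, q i j x * x i * ξ j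
        = ∑ i, ∑ j, (q' i j x - q i j x) * x i * ξ j := by
      simp only [← sum_sub_distrib]
      exact sum_congr rfl fun i _ => sum_congr rfl fun j _ => by ring
    rw [← a3] at a1
    refine le_of_near a1 (h.Q ξ) ?_
    rw [← e]
    refine add_le_add_right ?_ _
    calc ε * ((∑ i, |x i|) * ∑ j, |ξ j|) ≤ ε * ((N * ‖x‖) * (N * ‖ξ‖)) := by
          gcongr <;> exact sum_abs_le _
      _ = ε * (N:ℝ) ^ 2 * (‖x‖ * ‖ξ‖) := by ring
      _ ≤ ν / 2 * ((1 + ‖x‖ ^ 2) * ‖ξ‖) := by gcongr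
      _ ≤ (1 + ‖x‖ ^ 2) * ν * ‖ξ‖ := by
          have : 0 ≤ ν * ((1 + ‖x‖ ^ 2) * ‖ξ‖) := by positivity
          linarith
  · have a1 : (∑ i, q' i i x) ≤ ∑ i, q i i x + N * ε := by
      have : ∑ i, q' i i x ≤ ∑ i : Fin N, (q i i x + ε) := sum_le_sum fun i _ => by
        linarith [(le_abs_self _).trans (hq i i)]
      simpa [sum_add_distrib] using this
    have := h.tr
    have := e 1
    have : 0 ≤ ‖x‖ ^ 2 * ν := by positivity
    nlinarith
  · have a1 : (∑ j, b' j x * x j) ≤ ∑ j, b j x * x j + N * (ε * ‖x‖) := by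
      have : ∑ j, b' j x * x j ≤ ∑ j : Fin N, (b j x * x j + ε * ‖x‖) :=
        sum_le_sum fun j _ => by
          have : (b' j x - b j x) * x j ≤ ε * ‖x‖ := by
            refine (le_abs_self _).trans ?_
            rw [abs_mul]
            exact mul_le_mul (hb j) (abs_apply_le x j) (abs_nonneg _) hε
          linarith
      simpa [sum_add_distrib] using this
    have := h.b
    have := e 1
    have : N * (ε * ‖x‖) ≤ ν / 2 * (1 + ‖x‖ ^ 2) := by
      calc N * (ε * ‖x‖) = ε * N * ‖x‖ := by ring
        _ ≤ _ := by gcongr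
    have : 0 ≤ (1 + ‖x‖ ^ 2) * ν := by positivity
    linarith

lemma ellip_perturb (h : ∀ ξ : Fin N → ℝ, ν * ∑ i, ξ i ^ 2 ≤ ∑ i, ∑ j, q i j x * ξ i * ξ j)
    (hs : Small N ν₀ L₁ L₂ ε) (h1 : 0 < L₁) (h2 : 0 < L₂) (hν : ν₀ ≤ ν)
    (hq : ∀ i j, |q' i j x - q i j x| ≤ ε) (ξ : Fin N → ℝ) :
    ν / 2 * ∑ i, ξ i ^ 2 ≤ ∑ i, ∑ j, q' i j x * ξ i * ξ j := by
  obtain ⟨s1, s2, s3, -⟩ := hs.le' h1 h2 hν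
  have a1 := abs_quad_le hs.nonneg (a := fun i j => q' i j x - q i j x) hq ξ
  have a3 : (∑ i, ∑ j, q' i j x * ξ i * ξ j) - ∑ i, ∑ j, q i j x * ξ i * ξ j
      = ∑ i, ∑ j, (q' i j x - q i j x) * ξ i * ξ j := by
    simp only [← sum_sub_distrib]
    exact sum_congr rfl fun i _ => sum_congr rfl fun j _ => by ring
  rw [← a3, Fintype.card_fin] at a1
  have a2 := (abs_le.1 a1).1
  have := h ξ
  have hS : 0 ≤ ∑ i, ξ i ^ 2 := by positivity
  nlinarith [mul_le_mul_of_nonneg_right s3 hS]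

lemma funz_perturb (h : d + L₁ * r + L₂ * ϱ ^ 2 ≤ L₃ * ν) (hs : Small N ν₀ L₁ L₂ ε) (h1 : 0 < L₁)
    (h2 : 0 < L₂) (hν : ν₀ ≤ ν) :
    d + N * ε + L₁ * (r + ε) + L₂ / 2 * (ϱ + ε) ^ 2 ≤ 2 * (L₃ + 1) * (ν / 2) := by
  obtain ⟨s1, s2, s3, s4⟩ := hs.le' h1 h2 hν
  have a : L₂ / 2 * (ϱ + ε) ^ 2 ≤ L₂ * ϱ ^ 2 + L₂ * ε := by
    have b1 : (ϱ + ε) ^ 2 ≤ 2 * ϱ ^ 2 + 2 * ε := by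
      nlinarith [sq_nonneg (ϱ - ε), hs.nonneg, hs.le_one]
    nlinarith
  linarith

end

/-! ### Approximating generators -/

lemma Moll.le {κ f : Fn N} (h : Moll κ) (hf : Continuous f) {ε K : ℝ} {x : ES N}
    (hK : ∀ y, f y ≤ K) : molk κ ε f x ≤ K := by
  have h1 : K = ∫ y, κ y * K := by rw [integral_mul_const, h.int, one_mul]
  rw [h1, molk]
  exact integral_mono (h.ker.integrable_molk hf ε x) (h.ker.integrable.mul_const K)
    fun y => mul_le_mul_of_nonneg_left (hK _) (h.nonneg y)

lemma Sm_molk {κ f : Fn N} (h : Ker κ) (hf : Continuous f) {K : ℝ} (hK : ∀ x, |f x| ≤ K)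
    {ε : ℝ} (hε : 0 < ε) : Sm (molk κ ε f) :=
  ⟨smooth_molk h hf hε, fun m => by
    obtain ⟨C, -, hC⟩ := Bd_molk m h hε
    exact ⟨_, hC f K hf hK⟩⟩

lemma hasCompactSupport_cutη {R : ℝ} (hR : 0 < R) : HasCompactSupport (cutη R : Fn N) :=
  HasCompactSupport.of_support_subset_isCompact (isCompact_closedBall 0 R) fun x hx => by
    rw [mem_closedBall_zero_iff]
    by_contra h
    exact hx (cutη_eq_zero hR (not_le.1 h).le)

/-- Regularizations of a truncated function. -/
lemma exists_approx {κ : Fn N} (hκ : Moll κ) {R : ℝ} (hR : 0 < R)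
    (hf : ContDiff ℝ 3 f) : ∃ F : ℕ → Fn N, ∃ g, ContDiff ℝ 3 g ∧ (∀ n, Sm (F n)) ∧
    Cv 3 (ball 0 R) F g ∧ (∀ x ∈ ball (0 : ES N) R, g x = f x) ∧
    ∀ K, 0 ≤ K → (∀ x, f x ≤ K) → ∀ n x, F n x ≤ K := by
  have hc : HasCompactSupport fun x => cutη (2 * R) x * f x :=
    (hasCompactSupport_cutη (by positivity)).mul_right
  have hg : ContDiff ℝ 3 fun x => cutη (2 * R) x * f x :=
    ((smooth_cutη _).of_le (smooth_le 3)).mul hf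
  obtain ⟨K, hK⟩ := exists_abs_le_of_hasCompactSupport hg.continuous hc
  refine ⟨_, _, hg, fun n => Sm_molk hκ.ker hg.continuous hK (by positivity),
    Cv_molk hκ (m := 3) hg hc, fun x hx => ?_, fun K hK hfK n x => hκ.le hg.continuous fun y => ?_⟩
  · rw [mem_ball_zero_iff] at hx
    rw [cutη_eq_one (by positivity) (by linarith), one_mul]
  · exact (mul_le_mul_of_nonneg_left (hfK y) (cutη_nonneg _ y)).trans
      (mul_le_of_le_one_left hK (cutη_le_one _ y))

theorem exists_gen_near (hN : 1 ≤ N) {q : Fin N → VF N} {b : VF N}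
    {c : Fn N} (hq : ∀ i j, ContDiff ℝ 3 (q i j)) (hb : ∀ j, ContDiff ℝ 3 (b j))
    (hc : ContDiff ℝ 3 c) (hsymm : ∀ i j, q i j = q j i)
    (hpos : ∀ x (ξ : Fin N → ℝ), ξ ≠ 0 → 0 < ∑ i, ∑ j, q i j x * ξ i * ξ j) {c₀ : ℝ} (hc₀ : 0 ≤ c₀)
    (hcc : ∀ x, c x ≤ c₀) {R ε : ℝ} (hR : 0 < R) (hε : 0 < ε) :
    ∃ G : Gen N, (∀ x, G.c x ≤ c₀) ∧ ∀ x ∈ ball (0 : ES N) R, (∀ i j, Near ε (G.q i j) (q i j) x) ∧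
      (∀ j, Near ε (G.b j) (b j) x) ∧ Near ε G.c c x := by
  obtain ⟨κ, hκ⟩ := exists_moll N
  obtain ⟨σ, hσ, hσq⟩ := exists_cholesky 3 N q hq hsymm hpos
  choose S s hs hSm hS hsσ _ using fun k i =>
    exists_approx hκ hR (f := fun x => √(2 * N) * σ k i x) (contDiff_const.mul (hσ k i))
  choose β b' hb' hβm hβ hbb _ using fun j => exists_approx hκ hR (hb j)
  obtain ⟨γ, c', hc', hγm, hγ, hcc', hγc⟩ := exists_approx hκ hR hc
  let G : ℕ → Gen N := fun n => ⟨fun k i => S k i n, fun j => β j n, γ n, fun k i => hSm k i n,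
    fun j => hβm j n, hγm n⟩
  have hU : IsOpen (ball (0 : ES N) R) := isOpen_ball
  have hq' : ∀ i j, Cv 3 (ball 0 R) (fun n => (G n).q i j) (q i j) := fun i j => by
    have h1 : ∀ k, Cv 3 (ball 0 R) (fun n x => S k i n x * S k j n x) fun x => s k i x * s k j x :=
      fun k => (hS k i).mul (fun n => (hSm k i n).1) (fun n => (hSm k j n).1) (hs k i) (hs k j)
        (hS k j)
    have h2 := Cv.sum Finset.univ (fun k n => (hSm k i n).1.mul (hSm k j n).1)
      (fun k => (hs k i).mul (hs k j)) h1
    have h3 := (Cv.const (U := ball (0 : ES N) R) 3 (1 / (2 * N))).mul (fun n => contDiff_const)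
      (fun n => ContDiff.sum fun k _ => (hSm k i n).1.mul (hSm k j n).1) contDiff_const
      (ContDiff.sum fun k _ => (hs k i).mul (hs k j)) h2
    refine h3.congr hU fun x hx => ?_
    have hN' : (0:ℝ) < N := by exact_mod_cast hN
    have e : ∀ k, s k i x * s k j x = (2 * N) * (σ k i x * σ k j x) := fun k => by
      rw [hsσ k i x hx, hsσ k j x hx, mul_mul_mul_comm, Real.mul_self_sqrt (by positivity)]
    simp only [e]
    rw [← mul_sum, ← hσq]
    field_simp
  have h1 := eventually_all.2 fun i => eventually_all.2 fun j => (hq' i j).near hε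
  have h2 := eventually_all.2 fun j => ((hβ j).congr hU (hbb j)).near hε
  have h3 := (hγ.congr hU hcc').near hε
  obtain ⟨n, a1, a2, a3⟩ := (h1.and (h2.and h3)).exists
  exact ⟨G n, fun x => hγc c₀ hc₀ hcc n x, fun x hx =>
    ⟨fun i j => a1 i j x hx, fun j => a2 j x hx, a3 x hx⟩⟩

section

variable {T : ℝ} {q : ℝ → ES N → Fin N → Fin N → ℝ} {b : ℝ → ES N → Fin N → ℝ} {c : ℝ → Fn N}

/-- The constant in the structural conditions. -/
def _root_.Hyp2.B₀ (H : Hyp2 N T q b c) : ℝ := H.K₁ + H.K₂ + H.K₃ + H.C₁ + H.C₂ + H.C₃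

lemma _root_.Hyp2.r_nonneg (H : Hyp2 N T q b c) {t : ℝ} (ht : t ∈ Icc 0 T) (x : ES N) : 0 ≤ H.r t x :=
  (abs_nonneg _).trans (H.db2_bound t ht x ⟨0, H.N_pos⟩ ⟨0, H.N_pos⟩ ⟨0, H.N_pos⟩)

lemma _root_.Hyp2.ν_pos (H : Hyp2 N T q b c) {t : ℝ} (ht : t ∈ Icc 0 T) (x : ES N) : 0 < H.ν t x :=
  H.ν₀_pos.trans_le (H.ν_lb t ht x)

lemma _root_.Hyp2.ellip' (H : Hyp2 N T q b c) {t : ℝ} (ht : t ∈ Icc 0 T) (x : ES N) (ξ : Fin N → ℝ) :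
    H.ν t x * ∑ i, ξ i ^ 2 ≤ ∑ i, ∑ j, q t x i j * ξ i * ξ j := by
  have := H.ellip t ht x (WithLp.toLp 2 ξ)
  rwa [norm_sq_eq_sum] at this

lemma _root_.Hyp2.pt (H : Hyp2 N T q b c) {t : ℝ} (ht : t ∈ Icc 0 T) (x : ES N) :
    Pt (fun i j x => q t x i j) (fun j x => b t x j) (c t) H.B₀ (H.ν t x) (H.d t x) (H.r t x)
      (H.ϱ t x) x := by
  have hν := (H.ν_pos ht x).le
  have p1 := H.K₁_pos
  have p2 := H.K₂_pos
  have p3 := H.K₃_pos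
  have p4 := H.C₁_pos
  have p5 := H.C₂_pos
  have p6 := H.C₃_pos
  have e1 : H.K₁ * H.ν t x ≤ H.B₀ * H.ν t x := by
    unfold _root_.Hyp2.B₀; gcongr; linarith
  have e2 : H.K₂ * H.ν t x ≤ H.B₀ * H.ν t x := by
    unfold _root_.Hyp2.B₀; gcongr; linarith
  have e3 : H.K₃ * H.ν t x ≤ H.B₀ * H.ν t x := by
    unfold _root_.Hyp2.B₀; gcongr; linarith
  refine ⟨by unfold _root_.Hyp2.B₀; positivity, hν, fun i j l => (H.dq1_bound t ht x i j l).trans e1,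
    fun Ξ hΞ => ?_, fun i j m k l => (H.dq3_bound t ht x i j l k m).trans e3, fun ξ => ?_,
    fun j k l => H.db2_bound t ht x j l k, fun j m k l => H.db3_bound t ht x j l k m,
    H.dc1_bound t ht x, fun k l => H.dc2_bound t ht x l k, fun m k l => H.dc3_bound t ht x l k m⟩
  · have h1 := H.dq2_quad t ht x Ξ hΞ
    refine le_trans (le_of_eq ?_) (h1.trans (mul_le_mul_of_nonneg_right e2 (by positivity)))
    have : ∀ (a : Fin N → Fin N → Fin N → Fin N → ℝ),
        ∑ k, ∑ l, ∑ i, ∑ j, a k l i j = ∑ i, ∑ j, ∑ k, ∑ l, a l k i j := fun a => by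
      simp only [← Fintype.sum_prod_type' (f := fun (i j : Fin N) => _)]
      rw [sum_comm]
      refine sum_congr rfl fun p _ => ?_
      rw [Fintype.sum_prod_type, sum_comm, ← Fintype.sum_prod_type']
    rw [this]
    refine sum_congr rfl fun i _ => sum_congr rfl fun j _ =>
      sum_congr rfl fun k _ => sum_congr rfl fun l _ => ?_
    rw [hΞ l k]; rfl
  · have := H.dissip t ht x (WithLp.toLp 2 ξ)
    rwa [norm_sq_eq_sum] at this

lemma _root_.Hyp2.growth (H : Hyp2 N T q b c) {t : ℝ} (ht : t ∈ Icc 0 T) (x : ES N) :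
    Growth (fun i j x => q t x i j) (fun j x => b t x j) H.B₀ (H.ν t x) x := by
  have hν := (H.ν_pos ht x).le
  have p1 := H.K₁_pos
  have p2 := H.K₂_pos
  have p3 := H.K₃_pos
  have p4 := H.C₁_pos
  have p5 := H.C₂_pos
  have p6 := H.C₃_pos
  have key : ∀ C, C ≤ H.B₀ → C * (1 + ‖x‖ ^ 2) * H.ν t x ≤ H.B₀ * (1 + ‖x‖ ^ 2) * H.ν t x :=
    fun C hC => by gcongr
  refine ⟨fun ξ => ?_, (H.growth_tr t ht x).trans (key _ ?_),
    (H.growth_b t ht x).trans (key _ ?_)⟩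
  · set y : ES N := (EuclideanSpace.equiv (Fin N) ℝ).symm fun i => ∑ j, q t x i j * x j with hy
    have e : ∑ i, ∑ j, q t x i j * x i * ξ j = inner ℝ y ξ := by
      rw [sum_comm, PiLp.inner_apply]
      refine sum_congr rfl fun j _ => ?_
      simp only [hy, PiLp.continuousLinearEquiv_symm_apply, RCLike.inner_apply, conj_trivial]
      rw [mul_sum]
      refine sum_congr rfl fun i _ => ?_
      rw [H.q_symm t ht x i j]; ring
    simp only [e]
    refine (abs_real_inner_le_norm y ξ).trans ?_
    gcongr
    exact (H.growth_Q t ht x).trans (key _ (by unfold _root_.Hyp2.B₀; linarith))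
  all_goals unfold _root_.Hyp2.B₀; linarith

/-- Smooth bounded generators approximating the frozen operators. -/
theorem _root_.Hyp2.exists_gen (H : Hyp2 N T q b c) : ∃ B ν₁ L₁ L₂ L₃ c₁ : ℝ, 0 ≤ B ∧ 0 < ν₁ ∧ 0 < L₁ ∧
    0 < L₂ ∧ 0 < L₃ ∧ 0 ≤ c₁ ∧ ∀ t ∈ Icc 0 T, ∀ R ε, 0 < R → 0 < ε → ∃ G : Gen N,
      GenHyp G B ν₁ L₁ L₂ L₃ c₁ R ∧ ∀ x, ‖x‖ ≤ R → (∀ i j, |G.q i j x - q t x i j| ≤ ε) ∧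
        (∀ j, |G.b j x - b t x j| ≤ ε) ∧ |G.c x - c t x| ≤ ε := by
  have h1 := H.L₁_pos
  have h2 := H.L₂_pos
  have h3 := H.L₃_pos
  have hν₀ := H.ν₀_pos
  refine ⟨2 * (H.B₀ + 1), H.ν₀ / 2, H.L₁, H.L₂ / 2, 2 * (H.L₃ + 1), max H.c₀ 0, ?_, by positivity,
    h1, by positivity, by positivity, le_max_right _ _, fun t ht R ε hR hε => ?_⟩
  · have := H.pt (t := 0) ⟨le_rfl, H.T_pos.le⟩ 0 |>.B_nonneg
    positivity
  set D : ℝ := 2 * ((N:ℝ) ^ 2 + N + 1) + H.L₁ + H.L₂ with hD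
  have hD0 : 0 < D := by positivity
  set η := min ε (min 1 (H.ν₀ / D)) with hη
  have hη0 : 0 < η := by positivity
  have hηε : η ≤ ε := min_le_left _ _
  have hs : Small N H.ν₀ H.L₁ H.L₂ η := ⟨hη0.le, (min_le_right _ _).trans (min_le_left _ _), by
    rw [← hD, ← le_div_iff₀ hD0]; exact (min_le_right _ _).trans (min_le_right _ _)⟩
  have hpos : ∀ x (ξ : Fin N → ℝ), ξ ≠ 0 → 0 < ∑ i, ∑ j, q t x i j * ξ i * ξ j := fun x ξ hξ => by
    refine lt_of_lt_of_le (mul_pos (H.ν_pos ht x) ?_) (H.ellip' ht x ξ)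
    obtain ⟨i, hi⟩ := Function.ne_iff.1 hξ
    exact Finset.sum_pos' (fun i _ => sq_nonneg _) ⟨i, Finset.mem_univ i, by
      have : ξ i ≠ 0 := hi
      positivity⟩
  obtain ⟨G, hGc, hG⟩ := exists_gen_near H.N_pos (q := fun i j x => q t x i j)
    (b := fun j x => b t x j) (c := c t) (H.smooth_q t ht) (H.smooth_b t ht) (H.smooth_c t ht)
    (fun i j => funext fun x => H.q_symm t ht x i j) hpos (le_max_right H.c₀ 0)
    (fun x => (H.c_ub t ht x).trans (le_max_left _ _)) (R := R + 1) (by positivity) hη0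
  have hG' : ∀ x, ‖x‖ ≤ R → _ := fun x hx => hG x (by rw [mem_ball_zero_iff]; linarith)
  refine ⟨G, ⟨hGc, fun x hx => ?_⟩, fun x hx => ?_⟩
  · obtain ⟨a1, a2, a3⟩ := hG' x hx
    have hν := H.ν_lb t ht x
    refine ⟨H.ν t x / 2, H.d t x + N * η, H.r t x + η, H.ϱ t x + η, by linarith,
      add_nonneg (H.r_nonneg ht x) hη0.le, funz_perturb (H.funz t ht x) hs h1 h2 hν,
      (H.pt ht x).perturb hs h1 h2 hν a1 a2 a3,
      (H.growth ht x).perturb hs h1 h2 hν (fun i j => (a1 i j).d0) fun j => (a2 j).d0,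
      ellip_perturb (q := fun i j x => q t x i j) (H.ellip' ht x) hs h1 h2 hν fun i j => (a1 i j).d0⟩
  · obtain ⟨a1, a2, a3⟩ := hG' x hx
    exact ⟨fun i j => (a1 i j).d0.trans hηε, fun j => (a2 j).d0.trans hηε, a3.d0.trans hηε⟩

/-! ### Approximate solutions -/

/-- Closeness of two sets of coefficients in the ball of radius `R`. -/
def Close (ε R : ℝ) (q q' : Fin N → VF N) (b b' : VF N)
    (c c' : Fn N) : Prop :=
  ∀ x, ‖x‖ ≤ R → (∀ i j, |q i j x - q' i j x| ≤ ε) ∧ (∀ j, |b j x - b' j x| ≤ ε) ∧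
    |c x - c' x| ≤ ε

lemma Close.Lop_sub {ε R : ℝ} {q q' : Fin N → VF N} {b b' : VF N}
    {c c' : Fn N} (h : Close ε R q q' b b' c c') {u : Fn N} {A : ℝ} {x : ES N}
    (hx : ‖x‖ ≤ R) (h0 : |u x| ≤ A) (h1 : ∀ i, |pd1 u i x| ≤ A)
    (h2 : ∀ i j, |pd1 (pd1 u i) j x| ≤ A) :
    |Lop q b c u x - Lop q' b' c' u x| ≤ ε * (((N:ℝ) ^ 2 + N + 1) * A) := by
  obtain ⟨a1, a2, a3⟩ := h x hx
  have hε : 0 ≤ ε := (abs_nonneg _).trans a3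
  have e : Lop q b c u x - Lop q' b' c' u x = (∑ i, ∑ j, (q i j x - q' i j x) * pd2 u i j x)
      + (∑ j, (b j x - b' j x) * pd1 u j x) + (c x - c' x) * u x := by
    simp only [Lop, sub_mul, sum_sub_distrib]; ring
  have m : ∀ {a v : ℝ}, |a| ≤ ε → |v| ≤ A → |a * v| ≤ ε * A := fun ha hv => by
    rw [abs_mul]; exact mul_le_mul ha hv (abs_nonneg _) hε
  have s1 : |∑ i, ∑ j, (q i j x - q' i j x) * pd2 u i j x| ≤ (N:ℝ) * (N * (ε * A)) := by
    refine (abs_sum_le_sum_abs _ _).trans ((sum_le_sum fun i _ =>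
      (abs_sum_le_sum_abs _ _).trans (sum_le_sum fun j _ =>
        m (a1 i j) (h2 j i))).trans ?_)
    simp
  have s2 : |∑ j, (b j x - b' j x) * pd1 u j x| ≤ (N:ℝ) * (ε * A) := by
    refine (abs_sum_le_sum_abs _ _).trans ((sum_le_sum fun j _ =>
        m (a2 j) (h1 j)).trans ?_)
    simp
  rw [e]
  refine (abs_add_three _ _ _).trans ?_
  have := m a3 h0
  nlinarith

lemma abs_telescope {v w : ℕ → ℝ} {h e a η : ℝ} (hh : 0 ≤ h) {p k : ℕ}
    (h1 : ∀ j, p ≤ j → j < p + k → |v (j + 1) - v j - h * w j| ≤ e)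
    (h2 : ∀ j, p ≤ j → j < p + k → |w j - a| ≤ η) :
    |v (p + k) - v p - k * (h * a)| ≤ k * (h * η + e) := by
  induction k with
  | zero => simp
  | succ k ih =>
    have i1 := ih (fun j hj hk => h1 j hj (by omega)) fun j hj hk => h2 j hj (by omega)
    have i2 := h1 (p + k) (by omega) (by omega)
    have i3 := mul_le_mul_of_nonneg_left (h2 (p + k) (by omega) (by omega)) hh
    rw [← abs_of_nonneg hh, ← abs_mul, abs_of_nonneg hh] at i3
    have e1 : v (p + (k + 1)) - v p - ((k + 1 : ℕ) : ℝ) * (h * a) = (v (p + k) - v p - k * (h * a))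
      + (v (p + k + 1) - v (p + k) - h * w (p + k)) + h * (w (p + k) - a) := by
      push_cast; rw [← add_assoc]; ring
    rw [e1]
    refine (abs_add_three _ _ _).trans ?_
    push_cast
    linarith

lemma eventually_time_modulus {T R ε : ℝ} {h : ℝ → Fn N}
    (hc : ContinuousOn (fun p : ℝ × ES N => h p.1 p.2) (Icc 0 T ×ˢ closedBall (0 : ES N) R))
    (hε : 0 < ε) : ∀ᶠ τ in 𝓝[>] (0:ℝ), ∀ s ∈ Icc 0 T, ∀ t ∈ Icc 0 T, |s - t| ≤ τ →
      ∀ x : ES N, ‖x‖ ≤ R → |h s x - h t x| ≤ ε := by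
  have hu := (isCompact_Icc.prod (isCompact_closedBall _ _)).uniformContinuousOn_of_continuous hc
  obtain ⟨r, hr, hu⟩ := Metric.uniformContinuousOn_iff.1 hu ε hε
  filter_upwards [Ioo_mem_nhdsGT hr] with τ hτ s hs t ht hst x hx
  have hx' : x ∈ closedBall (0 : ES N) R := by simpa using hx
  have := hu (s, x) ⟨hs, hx'⟩ (t, x) ⟨ht, hx'⟩ (by
    rw [Prod.dist_eq, dist_self, Real.dist_eq, max_eq_left (abs_nonneg _)]
    exact hst.trans_lt hτ.2)
  exact this.le

lemma _root_.Hyp2.eventually_close (H : Hyp2 N T q b c) {R ε : ℝ} (hR : 0 < R) (hε : 0 < ε) :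
    ∀ᶠ τ in 𝓝[>] (0:ℝ), ∀ s ∈ Icc 0 T, ∀ t ∈ Icc 0 T, |s - t| ≤ τ →
      Close ε R (fun i j x => q s x i j) (fun i j x => q t x i j) (fun j x => b s x j)
        (fun j x => b t x j) (c s) (c t) := by
  filter_upwards [eventually_all.2 fun i => eventually_all.2 fun j =>
    eventually_time_modulus (h := fun t x => q t x i j) (H.holder_q R hR i j).1 hε, eventually_all.2 fun j =>
    eventually_time_modulus (h := fun t x => b t x j) (H.holder_b R hR j).1 hε,
    eventually_time_modulus (H.holder_c R hR).1 hε] with τ h1 h2 h3 s hs t ht hst x hx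
  exact ⟨fun i j => h1 i j s hs t ht hst x hx, fun j => h2 j s hs t ht hst x hx,
    h3 s hs t ht hst x hx⟩

lemma _root_.Hyp2.exists_coef_bd (H : Hyp2 N T q b c) {R : ℝ} (hR : 0 < R) : ∃ M, 0 ≤ M ∧
    ∀ t ∈ Icc 0 T, Close M R (fun i j x => q t x i j) 0 (fun j x => b t x j) 0 (c t) 0 := by
  have key : ∀ {h : ℝ → Fn N}, SpaceHolderUnif T H.δ R h → ∀ᶠ M in atTop,
      ∀ t ∈ Icc 0 T, ∀ x : ES N, ‖x‖ ≤ R → |h t x| ≤ M := fun hh => by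
    obtain ⟨-, K, hK⟩ := hh
    filter_upwards [eventually_ge_atTop K] with M hM t ht x hx
    exact ((hK t ht x (by simpa using hx)).1).trans hM
  obtain ⟨M, h0, h1, h2, h3⟩ := ((eventually_ge_atTop (0:ℝ)).and
    ((eventually_all.2 fun i => eventually_all.2 fun j => key (H.holder_q R hR i j)).and
    ((eventually_all.2 fun j => key (H.holder_b R hR j)).and (key (H.holder_c R hR))))).exists
  refine ⟨M, h0, fun t ht x hx => ⟨fun i j => ?_, fun j => ?_, ?_⟩⟩
  · simpa using h1 i j t ht x hx
  · simpa using h2 j t ht x hx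
  · simpa using h3 t ht x hx

/-- Approximate solutions, with precision `ε` in the ball of radius `R`. -/
structure Apx (T : ℝ) (q : ℝ → ES N → Fin N → Fin N → ℝ) (b : ℝ → ES N → Fin N → ℝ)
    (c : ℝ → Fn N) (f : Fn N) (g : ℝ → Fn N) (θ C F R ε : ℝ) (U : ℝ → Fn N) :
    Prop where
  smooth : ∀ t, Smooth (U t)
  bd : ∀ t ∈ Icc 0 T, ∀ x, |U t x| ≤ C * F
  lh : ∀ t ∈ Icc 0 T, LH R θ (C * (F + ε)) (U t)
  init : ∀ x, |U 0 x - f x| ≤ ε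
  time : ∀ s ∈ Icc 0 T, ∀ t ∈ Icc 0 T, s ≤ t → ∀ x, ‖x‖ ≤ R → ∀ a η, 0 ≤ η → η ≤ ε⁻¹ →
    (∀ σ ∈ Icc s t, |Aop q b c (U σ) σ x + g σ x - a| ≤ η) →
    |U t x - U s x - (t - s) * a| ≤ (t - s) * η + ε

/-- Generators close to the frozen operators at all times. -/
lemma exists_gens {B ν₁ L₁ L₂ L₃ c₁ R ε τ : ℝ} (hτ : 0 < τ)
    (h : ∀ t ∈ Icc 0 T, ∃ G : Gen N, GenHyp G B ν₁ L₁ L₂ L₃ c₁ R ∧ ∀ x, ‖x‖ ≤ R →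
      (∀ i j, |G.q i j x - q t x i j| ≤ ε) ∧ (∀ j, |G.b j x - b t x j| ≤ ε) ∧
        |G.c x - c t x| ≤ ε)
    (hcl : ∀ s ∈ Icc 0 T, ∀ t ∈ Icc 0 T, |s - t| ≤ τ →
      Close ε R (fun i j x => q s x i j) (fun i j x => q t x i j) (fun j x => b s x j)
        (fun j x => b t x j) (c s) (c t)) :
    ∃ (ι : Type) (_ : Finite ι) (Γ : ι → Gen N), (∀ i, GenHyp (Γ i) B ν₁ L₁ L₂ L₃ c₁ R) ∧
      ∀ t ∈ Icc 0 T, ∃ i, Close (2 * ε) R (Γ i).q (fun i j x => q t x i j) (Γ i).b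
        (fun j x => b t x j) (Γ i).c (c t) := by
  obtain ⟨S, hS, hfin, hcov⟩ := (isCompact_Icc (a := (0:ℝ)) (b := T)).finite_cover_balls hτ
  choose G hG1 hG2 using h
  refine ⟨S, hfin, fun i => G i (hS i.2), fun i => hG1 i (hS i.2), fun t ht => ?_⟩
  obtain ⟨s, hs, hts⟩ := mem_iUnion₂.1 (hcov ht)
  rw [mem_ball, Real.dist_eq, abs_sub_comm] at hts
  refine ⟨⟨s, hs⟩, fun x hx => ?_⟩
  obtain ⟨a1, a2, a3⟩ := hG2 s (hS hs) x hx
  obtain ⟨b1, b2, b3⟩ := hcl s (hS hs) t ht hts.le x hx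
  have tri : ∀ {u v w : ℝ}, |u - v| ≤ ε → |v - w| ≤ ε → |u - w| ≤ 2 * ε := fun h h' => by
    linarith [abs_sub_le _ _ _ |>.trans (add_le_add h h')]
  exact ⟨fun i j => tri (a1 i j) (b1 i j), fun j => tri (a2 j) (b2 j), tri a3 b3⟩

/-! ### Existence of approximate solutions -/

lemma time_est {v : ℕ → ℝ} {w : ℝ → ℝ} {h T e M K ε : ℝ} (hh : 0 < h) (he : 0 ≤ e) (he1 : e ≤ 1)
    (hTe : 2 * T * e ≤ ε / 2) (hM : h * (2 * K + 2 + M) ≤ ε / 2)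
    (h1 : ∀ σ ∈ Icc 0 T, |v (⌊σ / h⌋₊ + 1) - v ⌊σ / h⌋₊ - h * w σ| ≤ h * (2 * e))
    (h2 : ∀ σ ∈ Icc 0 T, |w σ| ≤ M) {s t : ℝ} (hs : s ∈ Icc 0 T) (ht : t ∈ Icc 0 T) (hst : s ≤ t)
    {a η : ℝ} (hη : 0 ≤ η) (hη1 : η ≤ K) (ha : ∀ σ ∈ Icc s t, |w σ - a| ≤ η) :
    |v ⌊t / h⌋₊ - v ⌊s / h⌋₊ - (t - s) * a| ≤ (t - s) * η + ε := by
  obtain ⟨k, hk⟩ := Nat.exists_eq_add_of_le (Nat.floor_le_floor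
    (div_le_div_of_nonneg_right hst hh.le : s / h ≤ t / h))
  set p := ⌊s / h⌋₊ with hp
  have hs1 : p * h ≤ s := by
    rw [← le_div_iff₀ hh]; exact Nat.floor_le (div_nonneg hs.1 hh.le)
  have hs2 : s < (p + 1) * h := by rw [← div_lt_iff₀ hh]; exact Nat.lt_floor_add_one _
  have ht1 : (p + k) * h ≤ t := by
    have := Nat.floor_le (div_nonneg ht.1 hh.le)
    rw [hk] at this
    rw [← le_div_iff₀ hh]; exact_mod_cast this
  have ht2 : t < (p + k + 1) * h := by
    have := Nat.lt_floor_add_one (t / h)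
    rw [hk] at this
    rw [← div_lt_iff₀ hh]; exact_mod_cast this
  have hσ : ∀ j : ℕ, p ≤ j → j < p + k → max s (j * h) ∈ Icc s t ∧ ⌊max s (j * h) / h⌋₊ = j := by
    intro j hj hjk
    have c1 : (p:ℝ) ≤ j := by exact_mod_cast hj
    have c2 : (j:ℝ) + 1 ≤ p + k := by exact_mod_cast hjk
    have hjt : j * h ≤ t := by nlinarith
    refine ⟨⟨le_max_left _ _, max_le hst hjt⟩, ?_⟩
    rw [Nat.floor_eq_iff (div_nonneg (hs.1.trans (le_max_left _ _)) hh.le), le_div_iff₀ hh,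
      div_lt_iff₀ hh]
    refine ⟨le_max_right _ _, max_lt ?_ (by linarith)⟩
    nlinarith
  have hmem : ∀ {σ}, σ ∈ Icc s t → σ ∈ Icc 0 T := fun h => ⟨hs.1.trans h.1, h.2.trans ht.2⟩
  have key := abs_telescope (v := v) (w := fun j => w (max s (j * h))) (a := a) (η := η)
    (e := h * (2 * e)) hh.le (p := p) (k := k)
    (fun j hj hjk => by
      obtain ⟨b1, b2⟩ := hσ j hj hjk
      have := h1 _ (hmem b1)
      rwa [b2] at this)
    (fun j hj hjk => ha _ (hσ j hj hjk).1)
  rw [hk]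
  have haM : |a| ≤ K + M := by
    have b1 := ha s ⟨le_rfl, hst⟩
    have b2 := h2 s hs
    have b3 := abs_sub_abs_le_abs_sub a (w s)
    rw [abs_sub_comm] at b3
    linarith
  have hd : |(k * h - (t - s)) * a| ≤ h * (K + M) := by
    rw [abs_mul]
    refine mul_le_mul (abs_le.2 ⟨?_, ?_⟩) haM (abs_nonneg _) hh.le <;> nlinarith
  have e1 : v (p + k) - v p - (t - s) * a
      = (v (p + k) - v p - k * (h * a)) + (k * h - (t - s)) * a := by ring
  rw [e1]
  refine (abs_add_le _ _).trans ?_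
  have hkh : k * h ≤ t - s + h := by nlinarith
  have hts : t - s ≤ T := by linarith [hs.1, ht.2]
  have : k * (h * η + h * (2 * e)) ≤ (t - s) * η + T * (2 * e) + h * (K + 2) := by
    calc k * (h * η + h * (2 * e)) = (k * h) * (η + 2 * e) := by ring
      _ ≤ (t - s + h) * (η + 2 * e) := by gcongr
      _ = (t - s) * η + (t - s) * (2 * e) + h * (η + 2 * e) := by ring
      _ ≤ _ := by gcongr; linarith
  linarith

lemma eventually_pos_factor {ι : Type} [Finite ι] (Γ : ι → Gen N) :
    ∀ᶠ z in 𝓝[>] (0:ℝ), ∀ i x, 0 ≤ 1 + z ^ 2 * (Γ i).c x := by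
  refine eventually_all.2 fun i => ?_
  obtain ⟨K, hK⟩ := (Γ i).hc.2 0
  have ht : Tendsto (fun z : ℝ => z ^ 2 * K) (𝓝[>] 0) (𝓝 0) := by
    have : Tendsto (fun z : ℝ => z ^ 2 * K) (𝓝 0) (𝓝 (0 ^ 2 * K)) :=
      (Continuous.tendsto (by fun_prop) _)
    simpa using this.mono_left nhdsWithin_le_nhds
  filter_upwards [ht.eventually_le_const one_pos] with z hz x
  have h1 := (abs_le.1 (hK x)).1
  nlinarith [sq_nonneg z]

set_option maxHeartbeats 2000000 in
theorem _root_.Hyp2.exists_apx (H : Hyp2 N T q b c) {θ : ℝ} (hθ : θ ∈ Ioo (0:ℝ) 1) :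
    ∃ C, 0 ≤ C ∧ ∀ (F : ℝ) (f : Fn N) (g : ℝ → Fn N), C2H θ F f →
      ContinuousOn (fun p : ℝ × ES N => g p.1 p.2) (Icc 0 T ×ˢ univ) →
      (∀ t ∈ Icc 0 T, HB θ F (g t)) → ∀ R ε : ℝ, 1 ≤ R → 0 < ε → ε ≤ 1 →
      ∃ U, Apx T q b c f g θ C F R ε U := by
  have hT := H.T_pos
  have hN := H.N_pos
  obtain ⟨κ, hκ⟩ := exists_moll N
  obtain ⟨B, ν₁, L₁, L₂, L₃, c₁, hB, hν₁, hL₁, hL₂, hL₃, hc₁, hgen⟩ := H.exists_gen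
  obtain ⟨C₀, hC₀, hevo⟩ := exists_evoEst hN c₁ hB hν₁ hL₁ hL₂ hL₃ hT.le
  obtain ⟨C', hC', hlh⟩ := usol_lh hκ hθ hC₀ hT.le
  set E := exp (c₁ * T) * (1 + T) with hE
  have hE0 : 0 ≤ E := by positivity
  clear_value E
  refine ⟨max C' E, hC'.trans (le_max_left _ _), fun F f g hf hg hgF R ε hR hε hε1 => ?_⟩
  have hF := hf.nonneg
  set C := max C' E with hC
  have hC0 : 0 ≤ C := hC'.trans (le_max_left _ _)
  have hCC : C' ≤ C := le_max_left _ _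
  have hCE : E ≤ C := le_max_right _ _
  clear_value C
  set A := C * (F + 1) with hA
  have hA0 : 0 ≤ A := by positivity
  obtain ⟨Mc, hMc, hcoef⟩ := H.exists_coef_bd (R := R) (by linarith)
  set P := ((N:ℝ) ^ 2 + N + 1) * A with hP
  have hP0 : 0 ≤ P := by positivity
  set M := Mc * P + F with hM
  have hM0 : 0 ≤ M := by positivity
  set e := min 1 (ε / (4 * (T + 1))) with he
  have he0 : 0 < e := by positivity
  have he1 : e ≤ 1 := min_le_left _ _
  have heT : 2 * T * e ≤ ε / 2 := by
    have : e ≤ ε / (4 * (T + 1)) := min_le_right _ _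
    rw [le_div_iff₀ (by positivity)] at this
    linarith
  clear_value e M P A
  set e₀ := e / (2 * (3 * P + 1)) with he₀
  have he₀0 : 0 < e₀ := by positivity
  have he₀e : 3 * e₀ * P + e₀ = e / 2 := by rw [he₀]; field_simp
  clear_value e₀
  -- time modulus
  obtain ⟨τ, ⟨hτcl, hτg⟩, hτ⟩ := (((H.eventually_close (R := 2 * R) (by linarith) he₀0).and
    (eventually_time_modulus (R := R) (hg.mono (prod_mono_right (subset_univ _))) he₀0)).and
    (eventually_mem_nhdsWithin)).exists
  have hτ0 : 0 < τ := hτ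
  obtain ⟨ι, hι, Γ, hΓ, hΓcl⟩ := exists_gens hτ0
    (fun t ht => hgen t ht (2 * R) e₀ (by linarith) he₀0) hτcl
  -- mollification
  have hρ : ∀ᶠ ρ in 𝓝[>] (0:ℝ), (N + 1) * F * ρ ^ θ ≤ min ε (e / 2) := by
    have : Tendsto (fun ρ : ℝ => (N + 1) * F * ρ ^ θ) (𝓝 0) (𝓝 ((N + 1) * F * 0 ^ θ)) :=
      ((Real.continuousAt_rpow_const 0 θ (Or.inr hθ.1.le)).tendsto).const_mul _
    rw [Real.zero_rpow hθ.1.ne', mul_zero] at this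
    exact (this.mono_left nhdsWithin_le_nhds).eventually_le_const (by positivity)
  obtain ⟨ρ, hρ1, hρ0, hρε⟩ := (hρ.and (Ioc_mem_nhdsGT hε)).exists
  have hρθ : F * ρ ^ θ ≤ e / 2 := by
    refine le_trans ?_ (hρ1.trans (min_le_right _ _))
    have : (0:ℝ) ≤ N * (F * ρ ^ θ) := by positivity
    linarith
  obtain ⟨Ck, hCk, hbd⟩ := Bd_molk 6 hκ.ker hρ0
  obtain ⟨C₂, hC₂, hstep⟩ := usol_step hN Γ hT.le
  obtain ⟨z₀, hz₀, hz₀1, hev⟩ := hevo ι Γ (2 * R) (by linarith) hΓ (2 * (Ck * F)) (ρ ^ 2)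
    (by positivity)
  have hz2 : ∀ᶠ z in 𝓝[>] (0:ℝ), z ^ 2 ≤ τ ∧ C₂ * (Ck * F) * z ≤ e ∧ z ^ 2 * (2 * ε⁻¹ + 2 + M) ≤ ε / 2 := by
    have l1 : Tendsto (fun z : ℝ => z ^ 2) (𝓝 0) (𝓝 0) := by
      simpa using (Continuous.tendsto (by fun_prop : Continuous fun z : ℝ => z ^ 2) 0)
    have l2 : Tendsto (fun z : ℝ => C₂ * (Ck * F) * z) (𝓝 0) (𝓝 0) := by
      simpa using (tendsto_id (x := 𝓝 (0:ℝ))).const_mul (C₂ * (Ck * F))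
    have l3 : Tendsto (fun z : ℝ => z ^ 2 * (2 * ε⁻¹ + 2 + M)) (𝓝 0) (𝓝 0) := by
      simpa using l1.mul_const (2 * ε⁻¹ + 2 + M)
    exact ((l1.eventually_le_const hτ0).and ((l2.eventually_le_const he0).and
      (l3.eventually_le_const (by positivity)))).filter_mono nhdsWithin_le_nhds
  obtain ⟨z, ⟨hzτ, hze, hzM⟩, hzpos, hz0, hzz⟩ :=
    (hz2.and ((eventually_pos_factor Γ).and (Ioc_mem_nhdsGT hz₀))).exists
  have hh : 0 < z ^ 2 := by positivity
  have hm : ∀ j : ℕ, min (j * z ^ 2) T ∈ Icc 0 T := fun j =>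
    ⟨le_min (by positivity) hT.le, min_le_right _ _⟩
  choose ix hix using fun j : ℕ => hΓcl _ (hm j)
  set s : ℕ → Fn N := fun j => molk κ ρ (g (min (j * z ^ 2) T)) with hs
  have hgc : ∀ j : ℕ, HB θ F (g (min (j * z ^ 2) T)) := fun j => hgF _ (hm j)
  have hss : ∀ j, Smooth (s j) := fun j => smooth_molk hκ.ker ((hgc j).cont hθ.1) hρ0
  have hsH : ∀ j, HB θ F (s j) := fun j => hκ.hb hθ.1 (hgc j) ρ
  have hsB : ∀ j, Bd 6 (s j) (Ck * F) := fun j => hbd _ _ ((hgc j).cont hθ.1) (hgc j).bd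
  have hfB : Bd 6 (molk κ ρ f) (Ck * F) := hbd _ _ hf.smooth.continuous hf.b0
  have hfs := smooth_molk hκ.ker hf.smooth.continuous hρ0
  set v := usol (fun j => Γ (ix j)) z (molk κ ρ f) s with hv
  have hsub := hf.moll_sub hκ hθ hρ0 (hρε.trans hε1)
  have hj : ∀ {t}, t ∈ Icc 0 T → (⌊t / z ^ 2⌋₊ : ℝ) * z ^ 2 ≤ t := fun ht => by
    rw [← le_div_iff₀ hh]; exact Nat.floor_le (div_nonneg ht.1 hh.le)
  have hvE : ∀ t ∈ Icc 0 T, ∀ x, |v ⌊t / z ^ 2⌋₊ x| ≤ C * F := fun t ht x => by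
    have hjT := (hj ht).trans ht.2
    refine (abs_usol_le _ hN hc₁ (fun x => hκ.abs_le hf.b0) (fun k x => (hsH k).bd x)
      (fun k => (hΓ (ix k)).c_le) (fun k => hzpos (ix k)) _ x).trans ?_
    refine le_trans ?_ (mul_le_mul_of_nonneg_right hCE hF)
    calc _ ≤ exp (c₁ * T) * (F + T * F) := by gcongr
      _ = E * F := by rw [hE]; ring
  have hvL : ∀ t ∈ Icc 0 T, LH R θ (C * (F + ρ)) (v ⌊t / z ^ 2⌋₊) := fun t ht => by
    have h1 := hlh ι Γ (2 * R) z ρ (Ck * F) F hρ0 (hρε.trans hε1) hz0 (hev z hz0 hzz) ix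
      ⌊t / z ^ 2⌋₊ f s ((hj ht).trans ht.2) hf hfB hss hsH hsB
    rw [mul_div_cancel_left₀ _ (two_ne_zero)] at h1
    exact h1.mono (by gcongr)
  refine ⟨fun t => v ⌊t / z ^ 2⌋₊, fun t => smooth_usol _ _ hfs hss _, hvE,
    fun t ht => (hvL t ht).mono (by gcongr), fun x => ?_, ?_⟩
  · simp only [zero_div, Nat.floor_zero]
    rw [abs_sub_comm]
    exact (hsub.zero x).trans (hρ1.trans (min_le_left _ _))
  intro t₁ ht₁ t₂ ht₂ h12 x hx a η hη hη1 haη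
  have hA1 : C * (F + ρ) ≤ A := by rw [hA]; gcongr; linarith
  have hA2 : C * F ≤ A := by rw [hA]; gcongr; linarith
  have d0 : ∀ t ∈ Icc 0 T, |v ⌊t / z ^ 2⌋₊ x| ≤ A := fun t ht => (hvE t ht x).trans hA2
  have d1 : ∀ t ∈ Icc 0 T, ∀ i, |pd1 (v ⌊t / z ^ 2⌋₊) i x| ≤ A := fun t ht i =>
    ((hvL t ht).d1 i x hx).trans hA1
  have d2 : ∀ t ∈ Icc 0 T, ∀ i j, |pd1 (pd1 (v ⌊t / z ^ 2⌋₊) i) j x| ≤ A := fun t ht i j =>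
    ((hvL t ht).d2 i j x hx).trans hA1
  refine time_est (v := fun j => v j x)
    (w := fun σ => Aop q b c (v ⌊σ / z ^ 2⌋₊) σ x + g σ x) hh he0.le he1 heT hzM
    (fun σ hσ => ?_) (fun σ hσ => ?_) ht₁ ht₂ h12 hη hη1 haη
  · set j := ⌊σ / z ^ 2⌋₊ with hjσ
    have hjle : j * z ^ 2 ≤ σ := hj hσ
    have hjlt : σ < (j + 1) * z ^ 2 := by
      rw [← div_lt_iff₀ hh]; exact Nat.lt_floor_add_one _
    have hmin : min (j * z ^ 2) T = j * z ^ 2 := min_eq_left (hjle.trans hσ.2)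
    have hjI : j * z ^ 2 ∈ Icc 0 T := ⟨by positivity, hjle.trans hσ.2⟩
    have hdist : |j * z ^ 2 - σ| ≤ τ := by
      rw [abs_le]; constructor <;> linarith
    have b1 := hstep ix z j (molk κ ρ f) s (Ck * F) (by rw [abs_of_pos hz0]; linarith)
      hjI.2 hfs hss (hfB.of_le (by norm_num)) (fun k => (hsB k).of_le (by norm_num)) x
    have hix' := hix j
    rw [hmin] at hix'
    have hx2 : ‖x‖ ≤ 2 * R := by linarith
    have b2 := hix'.Lop_sub hx2 (d0 σ hσ) (d1 σ hσ) (d2 σ hσ)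
    have b3 := (hτcl _ hjI _ hσ hdist).Lop_sub hx2 (d0 σ hσ) (d1 σ hσ) (d2 σ hσ)
    rw [← hP] at b2 b3
    have b4 : |s j x - g (j * z ^ 2) x| ≤ e / 2 := by
      have := (hgc j).moll_sub hκ hθ.1 hρ0 x
      rw [abs_sub_comm] at this
      simp only [hs]
      rw [hmin] at this ⊢
      exact this.trans hρθ
    have b5 := hτg _ hjI _ hσ hdist x hx
    have b6 : |(Γ (ix j)).A (v j) x + s j x - (Aop q b c (v j) σ x + g σ x)| ≤ e := by
      have e1 : (Γ (ix j)).A (v j) x + s j x - (Aop q b c (v j) σ x + g σ x)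
          = (Lop (Γ (ix j)).q (Γ (ix j)).b (Γ (ix j)).c (v j) x
              - Lop (fun i k x => q (j * z ^ 2) x i k) (fun k x => b (j * z ^ 2) x k)
                (c (j * z ^ 2)) (v j) x)
            + (Lop (fun i k x => q (j * z ^ 2) x i k) (fun k x => b (j * z ^ 2) x k)
                (c (j * z ^ 2)) (v j) x
              - Lop (fun i k x => q σ x i k) (fun k x => b σ x k) (c σ) (v j) x)
            + ((s j x - g (j * z ^ 2) x) + (g (j * z ^ 2) x - g σ x)) := by
        simp only [Gen.A, Aop, Lop]; ring
      rw [e1]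
      refine (abs_add_three _ _ _).trans ?_
      have := abs_add_le (s j x - g (j * z ^ 2) x) (g (j * z ^ 2) x - g σ x)
      linarith
    have e2 : v (j + 1) x - v j x - z ^ 2 * (Aop q b c (v j) σ x + g σ x)
        = (v (j + 1) x - v j x - z ^ 2 * ((Γ (ix j)).A (v j) x + s j x))
          + z ^ 2 * ((Γ (ix j)).A (v j) x + s j x - (Aop q b c (v j) σ x + g σ x)) := by ring
    rw [e2]
    refine (abs_add_le _ _).trans ?_
    rw [abs_mul, abs_of_pos hh]
    rw [abs_of_pos hz0] at b1
    have b7 : C₂ * (Ck * F) * z ^ 3 ≤ z ^ 2 * e := by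
      linarith [mul_le_mul_of_nonneg_left hze hh.le]
    linarith [mul_le_mul_of_nonneg_left b6 hh.le]
  · have b1 := (hcoef σ hσ).Lop_sub hx (d0 σ hσ) (d1 σ hσ) (d2 σ hσ)
    have b2 : Lop (0 : Fin N → VF N) 0 0 (v ⌊σ / z ^ 2⌋₊) x = 0 := by simp [Lop]
    rw [b2, sub_zero, ← hP] at b1
    refine (abs_add_le _ _).trans ?_
    rw [hM]
    exact add_le_add b1 ((hgF σ hσ).bd x)

/-! ### Pointwise limits of approximate solutions -/

lemma taylor_one {V : Fn N} (hV : Differentiable ℝ V) {x y : ES N} {L : ℝ}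
    (h : ∀ z, ‖z - x‖ ≤ ‖y - x‖ → ∀ i, |pd1 V i z - pd1 V i x| ≤ L) :
    |V y - V x - ∑ i, pd1 V i x * (y - x) i| ≤ N * L * ‖y - x‖ := by
  rw [← fderiv_apply_eq]
  refine (convex_closedBall x ‖y - x‖).norm_image_sub_le_of_norm_fderiv_le' (𝕜 := ℝ)
    (fun z _ => hV z) (fun z hz => ?_) (mem_closedBall_self (norm_nonneg _))
    (by rw [mem_closedBall, dist_eq_norm])
  rw [mem_closedBall, dist_eq_norm] at hz
  refine ContinuousLinearMap.opNorm_le_of_unit_norm (by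
    rcases Nat.eq_zero_or_pos N with rfl | hN
    · simp
    · have := (abs_nonneg _).trans (h z hz ⟨0, hN⟩)
      positivity) fun v hv => ?_
  rw [sub_apply, fderiv_apply_eq, fderiv_apply_eq, ← sum_sub_distrib,
    norm_eq_abs]
  refine (abs_sum_le_sum_abs _ _).trans ((sum_le_card_nsmul _ _ L fun i _ => ?_).trans
    (by simp))
  rw [← sub_mul, abs_mul]
  have h1 := abs_apply_le v i
  rw [hv] at h1
  exact (mul_le_of_le_one_right (abs_nonneg _) h1).trans (h z hz i)

lemma interp {V : Fn N} (hV : Differentiable ℝ V) {x : ES N} {L δ h : ℝ} (hh : 0 < h)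
    (h0 : ∀ z, ‖z - x‖ ≤ h → |V z| ≤ δ)
    (h1 : ∀ z, ‖z - x‖ ≤ h → ∀ i, |pd1 V i z - pd1 V i x| ≤ L) (i : Fin N) :
    |pd1 V i x| ≤ 2 * δ / h + N * L := by
  have e : (x + EuclideanSpace.single i h) - x = EuclideanSpace.single i h := by abel
  have e1 : ‖(x + EuclideanSpace.single i h) - x‖ = h := by
    rw [e, PiLp.norm_single, norm_eq_abs, abs_of_pos hh]
  have k := taylor_one hV (x := x) (y := x + EuclideanSpace.single i h) (L := L)
    (by rw [e1]; exact h1)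
  have es : ∑ j, pd1 V j x * (EuclideanSpace.single i h : ES N) j = pd1 V i x * h := by
    rw [Finset.sum_eq_single i] <;> simp +contextual
  rw [e1, e, es] at k
  have k1 := abs_le.1 (h0 _ e1.le)
  have k2 := abs_le.1 (h0 x (by simpa using hh.le))
  have k3 := abs_le.1 k
  have : |pd1 V i x| * h ≤ (2 * δ / h + N * L) * h := by
    rw [add_mul, div_mul_cancel₀ _ hh.ne', ← abs_of_pos hh, ← abs_mul, abs_of_pos hh, abs_le]
    constructor <;> linarith
  exact le_of_mul_le_mul_right this hh

lemma hasFDerivAt_lim {l : Filter ℕ} [l.NeBot] {V : ℕ → Fn N} (hV : ∀ n, Differentiable ℝ (V n))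
    {v : Fn N} {w : VF N} (h0 : ∀ x, Tendsto (fun n => V n x) l (𝓝 (v x)))
    (h1 : ∀ i x, Tendsto (fun n => pd1 (V n) i x) l (𝓝 (w i x))) {θ K : ℝ} (hθ : 0 < θ)
    (hK : ∀ ρ, ∀ᶠ n in l, ∀ x y, ‖x‖ ≤ ρ → ‖y‖ ≤ ρ → ∀ i,
      |pd1 (V n) i x - pd1 (V n) i y| ≤ K * ‖x - y‖ ^ θ) :
    Differentiable ℝ v ∧ ∀ i x, pd1 v i x = w i x := by
  have hK0 : ∀ i : Fin N, 0 ≤ K := fun i => by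
    obtain ⟨n, hn⟩ := (hK 1).exists
    have := (abs_nonneg _).trans (hn 0 (EuclideanSpace.single i 1) (by simp) (by simp) i)
    simpa using this
  have key : ∀ x y, |v y - v x - ∑ i, w i x * (y - x) i| ≤ N * (K * ‖y - x‖ ^ θ) * ‖y - x‖ := by
    intro x y
    refine le_of_tendsto ((((h0 y).sub (h0 x)).sub
      (tendsto_finsetSum _ fun i _ => (h1 i x).mul_const _)).abs) ?_
    filter_upwards [hK (‖x‖ + ‖y - x‖)] with n hn
    refine taylor_one (hV n) fun z hz i => (hn z x ?_ ?_ i).trans ?_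
    · calc ‖z‖ = ‖x + (z - x)‖ := by congr 1; abel
        _ ≤ _ := (norm_add_le _ _).trans (by linarith)
    · linarith [norm_nonneg (y - x)]
    · exact mul_le_mul_of_nonneg_left (rpow_le_rpow (norm_nonneg _) hz hθ.le) (hK0 i)
  have hd : ∀ x, HasFDerivAt v (∑ i, w i x • (EuclideanSpace.proj i : ES N →L[ℝ] ℝ)) x := by
    intro x
    rw [hasFDerivAt_iff_isLittleO]
    have h2 : Tendsto (fun y : ES N => N * (K * ‖y - x‖ ^ θ)) (𝓝 x) (𝓝 0) := by
      have : Continuous fun y : ES N => N * (K * ‖y - x‖ ^ θ) :=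
        ((((continuous_id.sub continuous_const).norm).rpow_const
          fun _ => Or.inr hθ.le).const_mul K).const_mul _
      simpa [Real.zero_rpow hθ.ne'] using this.tendsto x
    rw [Asymptotics.isLittleO_iff]
    intro ε hε
    filter_upwards [h2.eventually_le_const hε] with y hy
    have := key x y
    rw [norm_eq_abs]
    simp only [sum_apply, smul_apply, smul_eq_mul,
      PiLp.proj_apply]
    exact this.trans (mul_le_mul_of_nonneg_right hy (norm_nonneg _))
  refine ⟨fun x => (hd x).differentiableAt, fun i x => ?_⟩
  rw [pd1, (hd x).fderiv]
  simp only [sum_apply, smul_apply, smul_eq_mul,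
    PiLp.proj_apply]
  rw [Finset.sum_eq_single i] <;> simp +contextual

lemma contDiff_of_pd1 (hf : Differentiable ℝ f) {n : ℕ}
    (h : ∀ i, ContDiff ℝ n (pd1 f i)) : ContDiff ℝ (n + 1) f := by
  refine contDiff_succ_iff_fderiv.2 ⟨hf, by simp, ?_⟩
  have : fderiv ℝ f = fun x => ∑ i, pd1 f i x • (EuclideanSpace.proj i : ES N →L[ℝ] ℝ) := by
    ext x v
    simp [fderiv_apply_eq, sum_apply]
  rw [this]
  exact ContDiff.sum fun i _ => (h i).smul contDiff_const

lemma c2h_lim {l : Filter ℕ} [l.NeBot] {V : ℕ → Fn N} (hV : ∀ n, Smooth (V n))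
    {v : Fn N} {v1 : VF N} {v2 : Fin N → VF N}
    (h0 : ∀ x, Tendsto (fun n => V n x) l (𝓝 (v x)))
    (h1 : ∀ i x, Tendsto (fun n => pd1 (V n) i x) l (𝓝 (v1 i x)))
    (h2 : ∀ i j x, Tendsto (fun n => pd1 (pd1 (V n) i) j x) l (𝓝 (v2 i j x)))
    {θ A : ℝ} (hθ : 0 < θ) (hb : ∀ n x, |V n x| ≤ A)
    (hl : ∀ A' > A, ∀ ρ, ∀ᶠ n in l, LH ρ θ A' (V n)) :
    C2H θ A v ∧ (∀ i x, pd1 v i x = v1 i x) ∧ ∀ i j x, pd1 (pd1 v i) j x = v2 i j x := by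
  have hd : ∀ n, Differentiable ℝ (V n) := fun n => smooth_diff (hV n)
  have hd1 : ∀ i n, Differentiable ℝ (pd1 (V n) i) := fun i n => smooth_diff (smooth_pd1 (hV n) i)
  obtain ⟨k0, k1⟩ := hasFDerivAt_lim hd h0 h1 (θ := 1) (K := N * (A + 1)) one_pos fun ρ => by
    filter_upwards [hl (A + 1) (by linarith) ρ] with n hn x y hx hy i
    rw [Real.rpow_one]
    exact lip_of_pd1 (hd1 i n) (fun z hz j => hn.d2 i j z hz) hx hy
  have e1 : ∀ i, pd1 v i = v1 i := fun i => funext (k1 i)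
  have key : ∀ i, Differentiable ℝ (v1 i) ∧ ∀ j x, pd1 (v1 i) j x = v2 i j x := fun i =>
    hasFDerivAt_lim (hd1 i) (h1 i) (h2 i) (θ := θ) (K := A + 1) hθ fun ρ => by
      filter_upwards [hl (A + 1) (by linarith) ρ] with n hn x y hx hy j
      exact hn.hol i j x y hx hy
  have e2 : ∀ i j, pd1 (pd1 v i) j = v2 i j := fun i j => by
    rw [e1]; exact funext ((key i).2 j)
  have hH : ∀ i j, HB θ A (v2 i j) := fun i j => by
    refine ⟨fun x => le_of_forall_gt_imp_ge_of_dense fun A' hA' => le_of_tendsto (h2 i j x).abs ?_,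
      fun x y => ?_⟩
    · filter_upwards [hl A' hA' ‖x‖] with n hn
      exact hn.d2 i j x le_rfl
    · have : Tendsto (fun A' => A' * ‖x - y‖ ^ θ) (𝓝[>] A) (𝓝 (A * ‖x - y‖ ^ θ)) :=
        (tendsto_id.mul_const _).mono_left nhdsWithin_le_nhds
      refine ge_of_tendsto this ?_
      filter_upwards [self_mem_nhdsWithin] with A' hA'
      refine le_of_tendsto ((h2 i j x).sub (h2 i j y)).abs ?_
      filter_upwards [hl A' hA' (max ‖x‖ ‖y‖)] with n hn
      exact hn.hol i j x y (le_max_left _ _) (le_max_right _ _)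
  refine ⟨⟨?_, fun x => le_of_tendsto (h0 x).abs (Eventually.of_forall fun n => hb n x),
    fun i x => ?_, fun i j => e2 i j ▸ hH i j⟩, k1, fun i j x => congrFun (e2 i j) x⟩
  · refine contDiff_of_pd1 (n := 1) k0 fun i => contDiff_of_pd1 (n := 0) (e1 i ▸ (key i).1)
      fun j => ?_
    rw [e2]
    exact contDiff_zero.2 (continuous_of_hol hθ (hH i j).hol)
  · rw [k1]
    refine le_of_forall_gt_imp_ge_of_dense fun A' hA' => le_of_tendsto (h1 i x).abs ?_
    filter_upwards [hl A' hA' ‖x‖] with n hn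
    exact hn.d1 i x le_rfl

/-! ### Equicontinuity in time and existence of the solution -/

/-- Equicontinuity in time of a sequence of functions, locally uniformly in space. -/
def TM (T : ℝ) (l : Filter ℕ) (W : ℕ → ℝ → Fn N) : Prop :=
  ∀ ρ, ∀ κ > (0:ℝ), ∀ᶠ τ in 𝓝[>] (0:ℝ), ∀ᶠ n in l, ∀ s ∈ Icc 0 T, ∀ t ∈ Icc 0 T,
    |s - t| ≤ τ → ∀ x, ‖x‖ ≤ ρ → |W n s x - W n t x| ≤ κ

lemma TM.deriv {T : ℝ} {l : Filter ℕ} {W : ℕ → ℝ → Fn N} (hW : TM T l W)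
    (hd : ∀ n t, Differentiable ℝ (W n t)) {K θ : ℝ} (hθ : 0 < θ)
    (hK : ∀ ρ, ∀ᶠ n in l, ∀ t ∈ Icc 0 T, ∀ i x y, ‖x‖ ≤ ρ → ‖y‖ ≤ ρ →
      |pd1 (W n t) i x - pd1 (W n t) i y| ≤ K * ‖x - y‖ ^ θ) (i : Fin N) :
    TM T l fun n t => pd1 (W n t) i := by
  intro ρ κ hκ
  have h1 : ∀ᶠ h in 𝓝[>] (0:ℝ), N * (2 * (|K| * h ^ θ)) ≤ κ / 2 := by
    have : Tendsto (fun h : ℝ => N * (2 * (|K| * h ^ θ))) (𝓝 0) (𝓝 (N * (2 * (|K| * 0 ^ θ)))) :=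
      (((Real.continuousAt_rpow_const 0 θ (Or.inr hθ.le)).tendsto.const_mul _).const_mul _).const_mul
        _
    rw [Real.zero_rpow hθ.ne'] at this
    exact (this.mono_left nhdsWithin_le_nhds).eventually_le_const (by simpa using half_pos hκ)
  obtain ⟨h, hh1, hh, hh2⟩ := (h1.and (Ioc_mem_nhdsGT one_pos)).exists
  filter_upwards [hW (ρ + 1) (κ * h / 4) (by positivity)] with τ hτ
  filter_upwards [hτ, hK (ρ + 1)] with n h3 h4 s hs t ht hst x hx
  have hz : ∀ z, ‖z - x‖ ≤ h → ‖z‖ ≤ ρ + 1 := fun z hz => by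
    calc ‖z‖ = ‖x + (z - x)‖ := by congr 1; abel
      _ ≤ _ := (norm_add_le _ _).trans (by linarith)
  have e : ∀ i z, pd1 (fun x => W n s x - W n t x) i z = pd1 (W n s) i z - pd1 (W n t) i z :=
    fun i z => by rw [pd1_sub (hd n s) (hd n t)]
  rw [← e]
  refine (interp ((hd n s).sub (hd n t)) hh (L := 2 * (|K| * h ^ θ))
    (fun z hzh => h3 s hs t ht hst z (hz z hzh)) (fun z hzh i => ?_) i).trans ?_
  · have h5 : ∀ r ∈ Icc 0 T, |pd1 (W n r) i z - pd1 (W n r) i x| ≤ |K| * h ^ θ := fun r hr =>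
      (h4 r hr i z x (hz z hzh) (hz x (by simpa using hh.le))).trans
        (mul_le_mul (le_abs_self K) (rpow_le_rpow (norm_nonneg _) hzh hθ.le)
          (by positivity) (abs_nonneg _))
    have e2 : pd1 (fun x => W n s x - W n t x) i z - pd1 (fun x => W n s x - W n t x) i x
        = (pd1 (W n s) i z - pd1 (W n s) i x) - (pd1 (W n t) i z - pd1 (W n t) i x) := by
      rw [e, e]; ring
    change |pd1 (fun x => W n s x - W n t x) i z - pd1 (fun x => W n s x - W n t x) i x| ≤ _
    rw [e2]
    refine (abs_sub _ _).trans ?_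
    linarith [h5 s hs, h5 t ht]
  · have : 2 * (κ * h / 4) / h = κ / 2 := by field_simp; norm_num
    linarith

lemma TM.continuousOn {T : ℝ} {l : Filter ℕ} [l.NeBot] {W : ℕ → ℝ → Fn N} (hW : TM T l W)
    {w : ℝ → Fn N} (h : ∀ t ∈ Icc 0 T, ∀ x, Tendsto (fun n => W n t x) l (𝓝 (w t x)))
    (hc : ∀ t ∈ Icc 0 T, Continuous (w t)) :
    ContinuousOn (fun p : ℝ × ES N => w p.1 p.2) (Icc 0 T ×ˢ univ) := by
  rintro ⟨t₀, x₀⟩ ⟨ht₀, -⟩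
  refine Metric.tendsto_nhds.2 fun ε hε => ?_
  obtain ⟨τ, hτ1, hτ0⟩ := ((hW (‖x₀‖ + 1) (ε / 2) (half_pos hε)).and
    eventually_mem_nhdsWithin).exists
  have a1 : ∀ᶠ p : ℝ × ES N in 𝓝 (t₀, x₀), |p.1 - t₀| ≤ τ := by
    have : Tendsto (fun p : ℝ × ES N => |p.1 - t₀|) (𝓝 (t₀, x₀)) (𝓝 |t₀ - t₀|) :=
      Continuous.tendsto (by fun_prop) _
    exact this.eventually_le_const (by simpa using hτ0)
  have a2 : ∀ᶠ p : ℝ × ES N in 𝓝 (t₀, x₀), ‖p.2‖ ≤ ‖x₀‖ + 1 := by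
    have : Tendsto (fun p : ℝ × ES N => ‖p.2‖) (𝓝 (t₀, x₀)) (𝓝 ‖x₀‖) :=
      Continuous.tendsto (by fun_prop) (t₀, x₀)
    exact this.eventually_le_const (by linarith)
  have a3 : ∀ᶠ p : ℝ × ES N in 𝓝 (t₀, x₀), |w t₀ p.2 - w t₀ x₀| < ε / 2 := by
    have : Tendsto (fun p : ℝ × ES N => w t₀ p.2) (𝓝 (t₀, x₀)) (𝓝 (w t₀ x₀)) :=
      ((hc t₀ ht₀).comp continuous_snd).tendsto (t₀, x₀)
    exact (Metric.tendsto_nhds.1 this (ε / 2) (half_pos hε))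
  filter_upwards [nhdsWithin_le_nhds a1, nhdsWithin_le_nhds a2, nhdsWithin_le_nhds a3,
    self_mem_nhdsWithin] with p h1 h2 h3 h4
  have h5 : |w p.1 p.2 - w t₀ p.2| ≤ ε / 2 := by
    refine le_of_tendsto ((h _ h4.1 p.2).sub (h _ ht₀ p.2)).abs ?_
    filter_upwards [hτ1] with n hn
    exact hn _ h4.1 _ ht₀ h1 _ h2
  rw [Real.dist_eq]
  exact (abs_sub_le _ (w t₀ p.2) _).trans_lt (by linarith)

lemma exists_ulim {l : Ultrafilter ℕ} {a : ℕ → ℝ} {M : ℝ} (h : ∀ᶠ n in (l : Filter ℕ), |a n| ≤ M) :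
    ∃ L, Tendsto a l (𝓝 L) := by
  obtain ⟨L, -, hL⟩ := (isCompact_Icc (a := -M) (b := M)).ultrafilter_le_nhds (l.map a) (by
    rw [Ultrafilter.coe_map, le_principal_iff, mem_map]
    filter_upwards [h] with n hn
    exact abs_le.1 hn)
  exact ⟨L, hL⟩

lemma TM.aop {l : Filter ℕ} (H : Hyp2 N T q b c) {g : ℝ → Fn N}
    (hg : ContinuousOn (fun p : ℝ × ES N => g p.1 p.2) (Icc 0 T ×ˢ univ))
    {U : ℕ → ℝ → Fn N} (hs : ∀ n t, Smooth (U n t)) {A : ℝ} (hA : 0 ≤ A)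
    (hb : ∀ n, ∀ t ∈ Icc 0 T, ∀ x, |U n t x| ≤ A) {θ : ℝ}
    (hl : ∀ ρ, ∀ᶠ n in l, ∀ t ∈ Icc 0 T, LH ρ θ A (U n t))
    (h0 : TM T l U) (h1 : ∀ i, TM T l fun n t => pd1 (U n t) i)
    (h2 : ∀ i j, TM T l fun n t => pd1 (pd1 (U n t) i) j) :
    TM T l fun n t x => Aop q b c (U n t) t x + g t x := by
  intro ρ κ hκ
  wlog hρ : 0 < ρ generalizing ρ
  · filter_upwards [this 1 one_pos] with τ hτ
    filter_upwards [hτ] with n hn s hs t ht hst x hx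
    exact hn s hs t ht hst x (by linarith)
  obtain ⟨Mc, hMc, hcoef⟩ := H.exists_coef_bd hρ
  set P := (N:ℝ) ^ 2 + N + 1 with hP
  have hP0 : 0 < P := by positivity
  clear_value P
  have hκ' : 0 < κ / (3 * (P * (Mc + 1))) := by positivity
  have hκ1 : Mc * (P * (κ / (3 * (P * (Mc + 1))))) ≤ κ / 3 := by
    have : Mc * (P * (κ / (3 * (P * (Mc + 1))))) = κ / 3 * (Mc / (Mc + 1)) := by field_simp
    rw [this]
    exact mul_le_of_le_one_right (by positivity) ((div_le_one (by positivity)).2 (by linarith))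
  have hκ2 : κ / (3 * (P * (A + 1))) * (P * A) ≤ κ / 3 := by
    have : κ / (3 * (P * (A + 1))) * (P * A) = κ / 3 * (A / (A + 1)) := by field_simp
    rw [this]
    exact mul_le_of_le_one_right (by positivity) ((div_le_one (by positivity)).2 (by linarith))
  filter_upwards [h0 ρ _ hκ', eventually_all.2 fun i => h1 i ρ _ hκ',
    eventually_all.2 fun i => eventually_all.2 fun j => h2 i j ρ _ hκ',
    H.eventually_close hρ (show 0 < κ / (3 * (P * (A + 1))) by positivity),
    eventually_time_modulus (R := ρ) (hg.mono (prod_mono_right (subset_univ _)))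
      (show 0 < κ / 3 by positivity)] with τ k0 k1 k2 k3 k4
  filter_upwards [k0, eventually_all.2 k1, eventually_all.2 fun i => eventually_all.2 (k2 i), hl ρ]
    with n m0 m1 m2 hL s hs' t ht hst x hx
  have a1 := (k3 s hs' t ht hst).Lop_sub hx (hb n s hs' x) (fun i => (hL s hs').d1 i x hx)
    (fun i j => (hL s hs').d2 i j x hx)
  have e1 : ∀ i, pd1 (fun x => U n s x - U n t x) i = fun x => pd1 (U n s) i x - pd1 (U n t) i x :=
    fun i => pd1_sub (smooth_diff (hs n s)) (smooth_diff (hs n t)) i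
  have e2 : ∀ i j, pd1 (fun x => pd1 (U n s) i x - pd1 (U n t) i x) j
      = fun x => pd1 (pd1 (U n s) i) j x - pd1 (pd1 (U n t) i) j x := fun i j =>
    pd1_sub (smooth_diff (smooth_pd1 (hs n s) i)) (smooth_diff (smooth_pd1 (hs n t) i)) j
  have a2 := (hcoef t ht).Lop_sub (u := fun x => U n s x - U n t x) hx (m0 s hs' t ht hst x hx)
    (fun i => by rw [e1]; exact m1 i s hs' t ht hst x hx)
    (fun i j => by rw [e1, e2]; exact m2 i j s hs' t ht hst x hx)
  have e3 : Aop q b c (U n s) s x + g s x - (Aop q b c (U n t) t x + g t x)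
      = (Lop (fun i j x => q s x i j) (fun j x => b s x j) (c s) (U n s) x
          - Lop (fun i j x => q t x i j) (fun j x => b t x j) (c t) (U n s) x)
        + (Lop (fun i j x => q t x i j) (fun j x => b t x j) (c t) (fun x => U n s x - U n t x) x
          - Lop 0 0 0 (fun x => U n s x - U n t x) x) + (g s x - g t x) := by
    simp only [Aop, Lop, e1, e2, pd2, mul_sub, sum_sub_distrib, Pi.zero_apply, zero_mul,
      sum_const_zero]
    ring
  rw [e3]
  rw [← hP] at a1 a2
  refine (abs_add_three _ _ _).trans ?_
  linarith [k4 s hs' t ht hst x hx]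

lemma TM.of_apx {l : Filter ℕ} (hl : l ≤ atTop) (H : Hyp2 N T q b c)
    {g : ℝ → Fn N} {θ C F : ℝ} (hC : 0 ≤ C) (hF : 0 ≤ F)
    (hgF : ∀ t ∈ Icc 0 T, HB θ F (g t)) {U : ℕ → ℝ → Fn N}
    (hU : ∀ n : ℕ, Apx T q b c f g θ C F (n + 1) (1 / (n + 1)) (U n)) {A : ℝ}
    (hA : C * F ≤ A) (hL : ∀ ρ, ∀ᶠ n in l, ∀ t ∈ Icc 0 T, LH ρ θ A (U n t)) : TM T l U := by
  intro ρ κ hκ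
  wlog hρ : 0 < ρ generalizing ρ
  · filter_upwards [this 1 one_pos] with τ hτ
    filter_upwards [hτ] with n hn s hs t ht hst x hx
    exact hn s hs t ht hst x (by linarith)
  obtain ⟨Mc, hMc, hcoef⟩ := H.exists_coef_bd hρ
  have hA0 : 0 ≤ A := le_trans (by positivity) hA
  set M := Mc * (((N:ℝ) ^ 2 + N + 1) * A) + F with hM
  have hM0 : 0 ≤ M := by positivity
  have hτ : ∀ᶠ τ in 𝓝[>] (0:ℝ), τ * M ≤ κ / 2 := by
    have : Tendsto (fun τ : ℝ => τ * M) (𝓝 0) (𝓝 (0 * M)) := tendsto_id.mul_const _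
    exact (this.mono_left nhdsWithin_le_nhds).eventually_le_const (by simpa using half_pos hκ)
  have hn1 : ∀ᶠ n : ℕ in l, 1 / ((n:ℝ) + 1) ≤ κ / 2 :=
    hl (tendsto_one_div_add_atTop_nhds_zero_nat.eventually_le_const (half_pos hκ))
  have hn2 : ∀ᶠ n : ℕ in l, max ρ M ≤ n := hl (tendsto_natCast_atTop_atTop.eventually_ge_atTop _)
  filter_upwards [hτ] with τ hτ
  filter_upwards [hL ρ, hn1, hn2] with n h1 h2 h3
  have h4 : ρ ≤ n := (le_max_left _ _).trans h3
  have h5 : M ≤ n := (le_max_right _ _).trans h3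
  have key : ∀ s ∈ Icc 0 T, ∀ t ∈ Icc 0 T, s ≤ t → |s - t| ≤ τ → ∀ x, ‖x‖ ≤ ρ →
      |U n t x - U n s x| ≤ κ := by
    intro s hs t ht h hst x hx
    have := (hU n).time s hs t ht h x (by linarith) 0 M hM0 (by rw [one_div, inv_inv]; linarith)
      fun σ hσ => by
        have hσ' : σ ∈ Icc 0 T := ⟨hs.1.trans hσ.1, hσ.2.trans ht.2⟩
        have b1 := (hcoef σ hσ').Lop_sub hx (((hU n).bd σ hσ' x).trans hA)
          (fun i => (h1 σ hσ').d1 i x hx) (fun i j => (h1 σ hσ').d2 i j x hx)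
        have b2 : Lop (0 : Fin N → VF N) 0 0 (U n σ) x = 0 := by simp [Lop]
        rw [b2, sub_zero] at b1
        rw [sub_zero]
        exact (abs_add_le _ _).trans (add_le_add b1 ((hgF σ hσ').bd x))
    rw [mul_zero, sub_zero] at this
    rw [abs_sub_comm, abs_of_nonneg (sub_nonneg.2 h)] at hst
    linarith [mul_le_mul_of_nonneg_right hst hM0]
  intro s hs t ht hst x hx
  rcases le_total s t with h | h
  · rw [abs_sub_comm]; exact key s hs t ht h hst x hx
  · exact key t ht s hs h (by rwa [abs_sub_comm]) x hx

/-- Existence of a bounded classical solution with spatial Schauder bounds. -/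
theorem _root_.Hyp2.exists_sol (H : Hyp2 N T q b c) {θ : ℝ} (hθ : θ ∈ Ioo (0:ℝ) 1) :
    ∃ C, 0 ≤ C ∧ ∀ (F : ℝ) (f : Fn N) (g : ℝ → Fn N), C2H θ F f →
      ContinuousOn (fun p : ℝ × ES N => g p.1 p.2) (Icc 0 T ×ˢ univ) →
      (∀ t ∈ Icc 0 T, HB θ F (g t)) →
      ∃ u, IsBCSolInhom q b c T f g u ∧ ∀ t ∈ Icc 0 T, C2H θ (C * F) (u t) := by
  obtain ⟨C, hC, hC'⟩ := H.exists_apx hθ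
  refine ⟨C, hC, fun F f g hf hg hgF => ?_⟩
  have hF := hf.nonneg
  choose U hU using fun n : ℕ => hC' F f g hf hg hgF (n + 1) (1 / (n + 1)) (by simp)
    (by positivity) (by rw [div_le_one (by positivity)]; simp)
  set l := hyperfilter ℕ
  have hl : (l : Filter ℕ) ≤ atTop := Nat.hyperfilter_le_atTop
  have hε : Tendsto (fun n : ℕ => 1 / ((n:ℝ) + 1)) l (𝓝 0) :=
    tendsto_one_div_add_atTop_nhds_zero_nat.mono_left hl
  have hLH : ∀ A > C * F, ∀ ρ, ∀ᶠ n in (l : Filter ℕ), ∀ t ∈ Icc 0 T, LH ρ θ A (U n t) := by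
    intro A hA ρ
    have h1 : Tendsto (fun n : ℕ => C * (F + 1 / ((n:ℝ) + 1))) l (𝓝 (C * (F + 0))) :=
      (hε.const_add F).const_mul C
    rw [add_zero] at h1
    filter_upwards [h1.eventually_le_const hA,
      hl (tendsto_natCast_atTop_atTop.eventually_ge_atTop ρ)] with n h2 h3 t ht
    have h4 := ((hU n).lh t ht).mono h2
    exact ⟨fun i x hx => h4.d1 i x (by linarith), fun i j x hx => h4.d2 i j x (by linarith),
      fun i j x y hx hy => h4.hol i j x y (by linarith) (by linarith)⟩
  set A := C * F + 1 with hA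
  have hA0 : 0 ≤ A := by positivity
  have hLA := hLH A (by linarith)
  have hs : ∀ n t, Smooth (U n t) := fun n t => (hU n).smooth t
  have t0 : TM T l U := TM.of_apx hl H hC hF hgF hU (by linarith) hLA
  have t1 : ∀ i, TM T l fun n t => pd1 (U n t) i :=
    t0.deriv (fun n t => smooth_diff (hs n t)) one_pos (K := N * A) fun ρ => by
      filter_upwards [hLA ρ] with n hn t ht i x y hx hy
      rw [Real.rpow_one]
      exact lip_of_pd1 (smooth_diff (smooth_pd1 (hs n t) i)) (fun z hz j => (hn t ht).d2 i j z hz)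
        hx hy
  have t2 : ∀ i j, TM T l fun n t => pd1 (pd1 (U n t) i) j := fun i =>
    (t1 i).deriv (fun n t => smooth_diff (smooth_pd1 (hs n t) i)) hθ.1 (K := A) fun ρ => by
      filter_upwards [hLA ρ] with n hn t ht j x y hx hy
      exact (hn t ht).hol i j x y hx hy
  have tG := TM.aop H hg hs hA0 (fun n t ht x => ((hU n).bd t ht x).trans (by linarith)) hLA t0 t1 t2
  have ex0 : ∀ t x, ∃ L, t ∈ Icc 0 T → Tendsto (fun n => U n t x) l (𝓝 L) := fun t x => by
    by_cases ht : t ∈ Icc 0 T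
    · obtain ⟨L, hL⟩ := exists_ulim (l := l) (Eventually.of_forall fun n => (hU n).bd t ht x)
      exact ⟨L, fun _ => hL⟩
    · exact ⟨0, fun h => absurd h ht⟩
  have ex1 : ∀ t i x, ∃ L, t ∈ Icc 0 T → Tendsto (fun n => pd1 (U n t) i x) l (𝓝 L) := fun t i x => by
    by_cases ht : t ∈ Icc 0 T
    · obtain ⟨L, hL⟩ := exists_ulim (l := l) ((hLA ‖x‖).mono fun n hn => (hn t ht).d1 i x le_rfl)
      exact ⟨L, fun _ => hL⟩
    · exact ⟨0, fun h => absurd h ht⟩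
  have ex2 : ∀ t i j x, ∃ L, t ∈ Icc 0 T → Tendsto (fun n => pd1 (pd1 (U n t) i) j x) l (𝓝 L) :=
    fun t i j x => by
      by_cases ht : t ∈ Icc 0 T
      · obtain ⟨L, hL⟩ := exists_ulim (l := l)
          ((hLA ‖x‖).mono fun n hn => (hn t ht).d2 i j x le_rfl)
        exact ⟨L, fun _ => hL⟩
      · exact ⟨0, fun h => absurd h ht⟩
  choose u hu using ex0
  choose u1 hu1 using ex1
  choose u2 hu2 using ex2
  have hlim : ∀ t ∈ Icc 0 T, C2H θ (C * F) (u t) ∧ (∀ i x, pd1 (u t) i x = u1 t i x) ∧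
      ∀ i j x, pd1 (pd1 (u t) i) j x = u2 t i j x := fun t ht =>
    c2h_lim (l := l) (fun n => hs n t) (fun x => hu t x ht) (fun i x => hu1 t i x ht)
      (fun i j x => hu2 t i j x ht) hθ.1 (fun n x => (hU n).bd t ht x)
      fun A' hA' ρ => (hLH A' hA' ρ).mono fun n hn => hn t ht
  have h1 : ∀ i, ∀ t ∈ Icc 0 T, ∀ x, Tendsto (fun n => pd1 (U n t) i x) l (𝓝 (pd1 (u t) i x)) :=
    fun i t ht x => by rw [(hlim t ht).2.1]; exact hu1 t i x ht
  have h2 : ∀ i j, ∀ t ∈ Icc 0 T, ∀ x,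
      Tendsto (fun n => pd1 (pd1 (U n t) i) j x) l (𝓝 (pd1 (pd1 (u t) i) j x)) :=
    fun i j t ht x => by rw [(hlim t ht).2.2]; exact hu2 t i j x ht
  have hG : ∀ t ∈ Icc 0 T, ∀ x, Tendsto (fun n => Aop q b c (U n t) t x + g t x) l
      (𝓝 (Aop q b c (u t) t x + g t x)) := fun t ht x =>
    (((tendsto_finsetSum _ fun i _ => tendsto_finsetSum _ fun j _ =>
      (h2 j i t ht x).const_mul _).add (tendsto_finsetSum _ fun j _ =>
      (h1 j t ht x).const_mul _)).add ((hu t x ht).const_mul _)).add_const _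
  have c1 : ∀ i, ∀ t ∈ Icc 0 T, Continuous (pd1 (u t) i) := fun i t ht =>
    ((hlim t ht).1.d1 i).continuous
  have c2 : ∀ i j, ∀ t ∈ Icc 0 T, Continuous (pd1 (pd1 (u t) i) j) := fun i j t ht =>
    continuous_of_hol hθ.1 ((hlim t ht).1.b2 i j).hol
  have cG : ∀ t ∈ Icc 0 T, Continuous fun x => Aop q b c (u t) t x + g t x := fun t ht =>
    (((continuous_finsetSum _ fun i _ => continuous_finsetSum _ fun j _ =>
      (H.smooth_q t ht i j).continuous.mul (c2 j i t ht)).add (continuous_finsetSum _ fun j _ =>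
      (H.smooth_b t ht j).continuous.mul (c1 j t ht))).add
      ((H.smooth_c t ht).continuous.mul (hlim t ht).1.smooth.continuous)).add
      ((hgF t ht).cont hθ.1)
  have hder : ∀ x, ∀ s ∈ Icc 0 T, HasDerivWithinAt (fun t => u t x)
      (Aop q b c (u s) s x + g s x) (Icc 0 T) s := by
    intro x s hs
    rw [hasDerivWithinAt_iff_isLittleO, Asymptotics.isLittleO_iff]
    intro κ hκ
    obtain ⟨τ, hτ, hτ0⟩ := ((tG ‖x‖ κ hκ).and eventually_mem_nhdsWithin).exists
    have hnear : ∀ᶠ t in 𝓝 s, |t - s| ≤ τ := by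
      have : Tendsto (fun t : ℝ => |t - s|) (𝓝 s) (𝓝 |s - s|) :=
        Continuous.tendsto (by fun_prop) _
      exact this.eventually_le_const (by simpa using hτ0)
    filter_upwards [nhdsWithin_le_nhds hnear, self_mem_nhdsWithin] with t htτ ht
    rw [norm_eq_abs, norm_eq_abs, smul_eq_mul]
    have hlim' := (((hu t x ht).sub (hu s x hs)).sub ((hG s hs x).const_mul (t - s))).abs
    have hrhs : Tendsto (fun n : ℕ => κ * |t - s| + 1 / ((n:ℝ) + 1)) l (𝓝 (κ * |t - s| + 0)) :=
      hε.const_add _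
    rw [add_zero] at hrhs
    refine le_of_tendsto_of_tendsto hlim' hrhs ?_
    filter_upwards [hτ, hl (tendsto_natCast_atTop_atTop.eventually_ge_atTop (max ‖x‖ κ))]
      with n hn hnx
    have n1 : ‖x‖ ≤ n + 1 := by linarith [(le_max_left ‖x‖ κ).trans hnx]
    have n2 : κ ≤ (1 / ((n:ℝ) + 1))⁻¹ := by
      rw [one_div, inv_inv]; linarith [(le_max_right ‖x‖ κ).trans hnx]
    rcases le_total s t with h | h
    · have := (hU n).time s hs t ht h x n1 (Aop q b c (U n s) s x + g s x) κ hκ.le n2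
        fun σ hσ => hn σ ⟨hs.1.trans hσ.1, hσ.2.trans ht.2⟩ s hs
          (by rw [abs_of_nonneg (sub_nonneg.2 hσ.1)]
              rw [abs_of_nonneg (sub_nonneg.2 h)] at htτ; linarith [hσ.2]) x le_rfl
      rw [abs_of_nonneg (sub_nonneg.2 h), mul_comm κ]
      exact this
    · have := (hU n).time t ht s hs h x n1 (Aop q b c (U n s) s x + g s x) κ hκ.le n2
        fun σ hσ => hn σ ⟨ht.1.trans hσ.1, hσ.2.trans hs.2⟩ s hs
          (by rw [abs_of_nonpos (sub_nonpos.2 hσ.2)]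
              rw [abs_of_nonpos (sub_nonpos.2 h)] at htτ; linarith [hσ.1]) x le_rfl
      rw [abs_of_nonpos (sub_nonpos.2 h)]
      have e : U n t x - U n s x - (t - s) * (Aop q b c (U n s) s x + g s x)
          = -(U n s x - U n t x - (s - t) * (Aop q b c (U n s) s x + g s x)) := by ring
      rw [e, abs_neg]
      linarith
  have hdw : ∀ x, ∀ s ∈ Icc 0 T, derivWithin (fun t => u t x) (Icc 0 T) s
      = Aop q b c (u s) s x + g s x := fun x s hs =>
    (hder x s hs).derivWithin (uniqueDiffOn_Icc H.T_pos s hs)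
  refine ⟨u, ⟨⟨C * F, fun t ht x => (hlim t ht).1.b0 x⟩, fun t ht => (hlim t ht).1.smooth,
    fun x t ht => (hder x t ht).differentiableWithinAt, ?_, fun i => (t1 i).continuousOn (h1 i) (c1 i),
    fun i j => (t2 j i).continuousOn (h2 j i) (c2 j i), fun t ht x => hdw x t ht, fun x => ?_⟩,
    fun t ht => (hlim t ht).1⟩
  · exact (tG.continuousOn hG cG).congr fun p hp => hdw p.2 p.1 hp.1
  · have h0T : (0:ℝ) ∈ Icc 0 T := ⟨le_rfl, H.T_pos.le⟩
    refine tendsto_nhds_unique (hu 0 x h0T) ?_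
    rw [tendsto_iff_dist_tendsto_zero]
    exact squeeze_zero (fun _ => dist_nonneg) (fun n => by rw [Real.dist_eq]; exact (hU n).init x) hε

/-! ### Uniqueness -/

lemma hasDerivAt_line {F : Fn N} (hF : Differentiable ℝ F) (x v : ES N) (r : ℝ) :
    HasDerivAt (fun r : ℝ => F (x + r • v)) (∑ i, pd1 F i (x + r • v) * v i) r := by
  have h1 : HasDerivAt (fun r : ℝ => x + r • v) v r := by
    simpa using ((hasDerivAt_id r).smul_const v).const_add x
  have := (hF (x + r • v)).hasFDerivAt.comp_hasDerivAt r h1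
  rwa [fderiv_apply_eq] at this

lemma max_second_order {Y : Fn N} (hY : ContDiff ℝ 2 Y) {x : ES N} (hm : ∀ z, Y z ≤ Y x) :
    (∀ i, pd1 Y i x = 0) ∧ ∀ v : ES N, ∑ j, (∑ i, pd1 (pd1 Y j) i x * v i) * v j ≤ 0 := by
  have hd : Differentiable ℝ Y := hY.differentiable two_ne_zero
  have hd1 : ∀ i, Differentiable ℝ (pd1 Y i) := fun i =>
    (contDiff_pd1 (m := 1) hY (by norm_num) i).differentiable one_ne_zero
  have hz : fderiv ℝ Y x = 0 :=
    IsLocalMax.fderiv_eq_zero (Eventually.of_forall hm : ∀ᶠ z in 𝓝 x, Y z ≤ Y x)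
  refine ⟨fun i => by simp [pd1, hz], fun v => ?_⟩
  set G : ℝ → ℝ := fun r => Y (x + r • v) with hG
  have g1 : deriv G = fun r => ∑ j, pd1 Y j (x + r • v) * v j :=
    funext fun r => (hasDerivAt_line hd x v r).deriv
  have g2 : deriv (deriv G) 0 = ∑ j, (∑ i, pd1 (pd1 Y j) i x * v i) * v j := by
    rw [g1]
    have := HasDerivAt.fun_sum fun j (_ : j ∈ Finset.univ) =>
      (hasDerivAt_line (hd1 j) x v 0).mul_const (v j)
    simpa using this.deriv
  rw [← g2]
  by_contra! hpos
  have hmin : IsLocalMin G 0 := isLocalMin_of_deriv_deriv_pos hpos (by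
    rw [g1]; simp [pd1, hz]) (hasDerivAt_line hd x v 0).continuousAt
  have hconst : G =ᶠ[𝓝 0] fun _ => G 0 := hmin.mono fun r hr =>
    le_antisymm (by simpa [hG] using hm (x + r • v)) hr
  have := hconst.deriv.deriv_eq
  simp only [deriv_const'] at this
  rw [this] at hpos
  exact lt_irrefl _ hpos

lemma _root_.Hyp2.aop_le_of_max (H : Hyp2 N T q b c) {t : ℝ} (ht : t ∈ Icc 0 T) {Y : Fn N}
    (hY : ContDiff ℝ 2 Y) {x : ES N} (hm : ∀ z, Y z ≤ Y x) : Aop q b c Y t x ≤ c t x * Y x := by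
  obtain ⟨h1, h2⟩ := max_second_order hY hm
  obtain ⟨σ, -, hσ⟩ := exists_cholesky (E := ℝ) 0 N (fun i j _ => q t x i j)
    (fun _ _ => contDiff_const) (fun i j => funext fun _ => H.q_symm t ht x i j) fun _ ξ hξ => by
      refine lt_of_lt_of_le (mul_pos (H.ν_pos ht x) ?_) (H.ellip' ht x ξ)
      obtain ⟨i, hi⟩ := Function.ne_iff.1 hξ
      exact Finset.sum_pos' (fun i _ => sq_nonneg _) ⟨i, Finset.mem_univ i, sq_pos_of_ne_zero hi⟩
  have e : ∑ i, ∑ j, q t x i j * pd2 Y i j x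
      = ∑ k, ∑ j, (∑ i, pd1 (pd1 Y j) i x * σ k i 0) * σ k j 0 := by
    simp only [fun i j => hσ i j 0, pd2, sum_mul]
    rw [sum_comm, sum_comm (f := fun k j => ∑ i, pd1 (pd1 Y j) i x * σ k i 0 * σ k j 0)]
    refine sum_congr rfl fun j _ => ?_
    rw [sum_comm]
    exact sum_congr rfl fun k _ => sum_congr rfl fun i _ => by ring
  have h3 : ∑ i, ∑ j, q t x i j * pd2 Y i j x ≤ 0 := by
    rw [e]
    exact Finset.sum_nonpos fun k _ => h2 (WithLp.toLp 2 fun i => σ k i 0)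
  simp only [Aop, h1, mul_zero, sum_const_zero]
  linarith

lemma continuousOn_of_pd1 {w : ℝ → Fn N} (hd : ∀ t ∈ Icc 0 T, Differentiable ℝ (w t))
    (hc : ∀ x, ContinuousOn (fun t => w t x) (Icc 0 T))
    (h1 : ∀ i, ContinuousOn (fun p : ℝ × ES N => pd1 (w p.1) i p.2) (Icc 0 T ×ˢ univ)) :
    ContinuousOn (fun p : ℝ × ES N => w p.1 p.2) (Icc 0 T ×ˢ univ) := by
  rintro ⟨t₀, x₀⟩ ⟨ht₀, -⟩
  have hL : ∀ᶠ L in atTop, ∀ i, ∀ t ∈ Icc 0 T, ∀ x, ‖x‖ ≤ ‖x₀‖ + 1 → |pd1 (w t) i x| ≤ L := by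
    refine eventually_all.2 fun i => ?_
    obtain ⟨L, hL⟩ := (isCompact_Icc.prod (isCompact_closedBall (0 : ES N)
      (‖x₀‖ + 1))).exists_bound_of_continuousOn ((h1 i).mono (prod_mono_right (subset_univ _)))
    filter_upwards [eventually_ge_atTop L] with L' hL' t ht x hx
    exact (hL (t, x) ⟨ht, by simpa using hx⟩).trans hL'
  obtain ⟨L, hL⟩ := hL.exists
  have l1 : Tendsto (fun p : ℝ × ES N => N * L * ‖p.2 - x₀‖ + |w p.1 x₀ - w t₀ x₀|)
      (𝓝[Icc 0 T ×ˢ univ] (t₀, x₀)) (𝓝 (N * L * ‖x₀ - x₀‖ + |w t₀ x₀ - w t₀ x₀|)) := by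
    have : Tendsto (fun p : ℝ × ES N => w p.1 x₀) (𝓝[Icc 0 T ×ˢ univ] (t₀, x₀))
        (𝓝 (w t₀ x₀)) := ((hc x₀ t₀ ht₀).tendsto).comp
      (tendsto_nhdsWithin_of_tendsto_nhds_of_eventually_within _
        ((continuous_fst.tendsto' _ _ rfl).mono_left nhdsWithin_le_nhds)
        (eventually_mem_nhdsWithin.mono fun p hp => hp.1))
    exact ((((continuous_snd.tendsto (t₀, x₀)).mono_left nhdsWithin_le_nhds).sub_const
      x₀).norm.const_mul _).add (this.sub_const _).abs
  rw [sub_self, sub_self, norm_zero, abs_zero, mul_zero, add_zero] at l1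
  refine tendsto_iff_dist_tendsto_zero.2 (squeeze_zero' (Eventually.of_forall fun _ => dist_nonneg)
    ?_ l1)
  have l2 : ∀ᶠ p : ℝ × ES N in 𝓝 (t₀, x₀), ‖p.2‖ ≤ ‖x₀‖ + 1 :=
    ((continuous_snd.tendsto (t₀, x₀)).norm).eventually_le_const (lt_add_one _)
  filter_upwards [nhdsWithin_le_nhds l2, self_mem_nhdsWithin] with p hp hpI
  rw [Real.dist_eq]
  exact (abs_sub_le _ (w p.1 x₀) _).trans (add_le_add (lip_of_pd1 (hd _ hpI.1)
    (fun z hz i => hL i _ hpI.1 z hz) hp (by linarith)) le_rfl)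

lemma aop_lin {F G : Fn N} (hF : ContDiff ℝ 2 F) (hG : ContDiff ℝ 2 G) (α β m t : ℝ)
    (x : ES N) : Aop q b c (fun y => α * F y - β * (G y + m)) t x
      = α * Aop q b c F t x - β * (Aop q b c G t x + c t x * m) := by
  have d1 : ∀ {F : Fn N}, ContDiff ℝ 2 F → ∀ i, Differentiable ℝ (pd1 F i) := fun h i =>
    (contDiff_pd1 (m := 1) h (by norm_num) i).differentiable one_ne_zero
  have hFd := hF.differentiable two_ne_zero
  have hGd := hG.differentiable two_ne_zero
  have e1 : ∀ i, pd1 (fun y => α * F y - β * (G y + m)) i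
      = fun y => α * pd1 F i y - β * pd1 G i y := fun i => by
    rw [pd1_sub (hFd.const_mul α) ((hGd.add_const m).const_mul β), pd1_const_mul α hFd,
      pd1_const_mul β (hGd.add_const m), pd1_add hGd (differentiable_const m), pd1_const]
    simp
  have e2 : ∀ i j, pd1 (fun y => α * pd1 F i y - β * pd1 G i y) j
      = fun y => α * pd1 (pd1 F i) j y - β * pd1 (pd1 G i) j y := fun i j => by
    rw [pd1_sub ((d1 hF i).const_mul α) ((d1 hG i).const_mul β), pd1_const_mul α (d1 hF i),
      pd1_const_mul β (d1 hG i)]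
  simp only [Aop, pd2, e1, e2]
  simp only [mul_sub, sum_sub_distrib, mul_add, mul_sum,
    mul_left_comm _ α, mul_left_comm _ β]
  ring

lemma _root_.Hyp2.le_of_sol (H : Hyp2 N T q b c) {g u v : ℝ → Fn N}
    (hu : IsBCSolInhom q b c T f g u) (hv : IsBCSolInhom q b c T f g v) :
    ∀ t ∈ Icc 0 T, ∀ x, v t x ≤ u t x := by
  intro t₁ ht₁ x₁
  by_contra! hlt
  obtain ⟨φ, lam, hlam, hφ0, hφ2, hφt, M, hM⟩ := H.liap
  obtain ⟨⟨B₁, hB₁⟩, u2, ud, -, u1, -, ueq, u0⟩ := hu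
  obtain ⟨⟨B₂, hB₂⟩, v2, vd, -, v1, -, veq, v0⟩ := hv
  have cont : ContinuousOn (fun p : ℝ × ES N => v p.1 p.2 - u p.1 p.2) (Icc 0 T ×ˢ univ) :=
    (continuousOn_of_pd1 (fun t ht => (v2 t ht).differentiable two_ne_zero)
      (fun x t ht => (vd x t ht).continuousWithinAt) v1).sub
    (continuousOn_of_pd1 (fun t ht => (u2 t ht).differentiable two_ne_zero)
      (fun x t ht => (ud x t ht).continuousWithinAt) u1)
  set k := lam + |H.c₀| + 1 with hk
  set m := max M 0 + 1 with hm
  have hm0 : 1 ≤ m := by linarith [le_max_right M 0]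
  have hmM : M + 1 ≤ m := by linarith [le_max_left M 0]
  have hk0 : 0 < k := by positivity
  clear_value m
  obtain ⟨ε, hε, hpos⟩ : ∃ ε : ℝ, 0 < ε ∧
      0 < exp (-k * t₁) * (v t₁ x₁ - u t₁ x₁) - ε * (φ x₁ + m) := by
    have h1 : 0 < exp (-k * t₁) * (v t₁ x₁ - u t₁ x₁) :=
      mul_pos (exp_pos _) (sub_pos.2 hlt)
    have h2 : 0 < φ x₁ + m := by linarith [hφ0 x₁]
    refine ⟨_, half_pos (div_pos h1 h2), ?_⟩
    rw [div_div, mul_comm _ (2:ℝ), ← div_div, div_mul_cancel₀ _ h2.ne']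
    linarith
  set Y : ℝ → Fn N := fun t x => exp (-k * t) * (v t x - u t x) - ε * (φ x + m) with hY
  obtain ⟨K, hK, hKs⟩ := mem_cocompact.1 ((hφt.eventually_gt_atTop ((B₂ + B₁) / ε)))
  have out : ∀ t ∈ Icc 0 T, ∀ x, 0 < Y t x → x ∈ K := fun t ht x hYp => by
    by_contra hx
    have h1 : B₂ + B₁ < ε * φ x := by
      have := hKs hx
      rw [mem_ofPred_eq, div_lt_iff₀ hε] at this
      linarith
    have h2 : exp (-k * t) ≤ 1 := Real.exp_le_one_iff.2 (by nlinarith [ht.1])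
    have h3 := abs_le.1 (hB₁ t ht x)
    have h4 := abs_le.1 (hB₂ t ht x)
    have h5 : exp (-k * t) * (v t x - u t x) ≤ 1 * (B₂ + B₁) :=
      (mul_le_mul_of_nonneg_left (by linarith [h3.1, h4.2]) (exp_pos _).le).trans
        (mul_le_mul_of_nonneg_right h2 (by linarith [h3.1, h4.2, h3.2, h4.1]))
    have h6 : 0 < ε * m := by positivity
    simp only [hY] at hYp
    linarith
  have Yc : ContinuousOn (fun p : ℝ × ES N => Y p.1 p.2) (Icc 0 T ×ˢ univ) :=
    ((by fun_prop : Continuous fun p : ℝ × ES N => exp (-k * p.1)).continuousOn.mul cont).sub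
      ((((hφ2.continuous.comp continuous_snd).add_const m).const_mul ε).continuousOn)
  obtain ⟨⟨t₀, x₀⟩, ⟨ht₀, -⟩, hmax⟩ := (isCompact_Icc.prod hK).exists_isMaxOn
    ⟨(t₁, x₁), ht₁, out t₁ ht₁ x₁ hpos⟩ (Yc.mono (prod_mono_right (subset_univ _)))
  have hp₀ : 0 < Y t₀ x₀ := hpos.trans_le
    (hmax (a := (t₁, x₁)) ⟨ht₁, out t₁ ht₁ x₁ hpos⟩)
  have hmx : ∀ t ∈ Icc 0 T, ∀ x, Y t x ≤ Y t₀ x₀ := fun t ht x => by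
    rcases le_or_gt (Y t x) 0 with h | h
    · exact h.trans hp₀.le
    · exact hmax (a := (t, x)) ⟨ht, out t ht x h⟩
  have hw2 : ∀ t ∈ Icc 0 T, ContDiff ℝ 2 fun x => v t x - u t x := fun t ht =>
    (v2 t ht).sub (u2 t ht)
  have hsp := H.aop_le_of_max ht₀ (Y := Y t₀) ((contDiff_const.mul (hw2 t₀ ht₀)).sub
    (contDiff_const.mul (hφ2.add contDiff_const))) (hmx t₀ ht₀)
  rw [show Aop q b c (Y t₀) t₀ x₀ = _ from aop_lin (hw2 t₀ ht₀) hφ2 _ _ _ _ _] at hsp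
  have hlin : Aop q b c (fun x => v t₀ x - u t₀ x) t₀ x₀
      = Aop q b c (v t₀) t₀ x₀ - Aop q b c (u t₀) t₀ x₀ := by
    simpa using aop_lin (q := q) (b := b) (c := c) (v2 t₀ ht₀) (u2 t₀ ht₀) 1 1 0 t₀ x₀
  have hder := ((((hasDerivAt_id t₀).const_mul (-k)).exp.hasDerivWithinAt (s := Icc 0 T)).mul
    ((vd x₀ t₀ ht₀).hasDerivWithinAt.sub (ud x₀ t₀ ht₀).hasDerivWithinAt)).sub_const
      (ε * (φ x₀ + m))
  rw [veq t₀ ht₀, ueq t₀ ht₀] at hder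
  have ht0 : 0 < t₀ := ht₀.1.lt_of_ne fun h => by
    have : Y t₀ x₀ = - (ε * (φ x₀ + m)) := by
      change 0 = t₀ at h; subst h; simp [hY, u0, v0]
    have := mul_pos hε (by linarith [hφ0 x₀] : 0 < φ x₀ + m)
    linarith
  have hloc : IsLocalMaxOn (fun t => Y t x₀) (Icc 0 T) t₀ :=
    eventually_mem_nhdsWithin.mono fun t ht => hmx t ht x₀
  have htime := hloc.hasFDerivWithinAt_nonpos hder.hasFDerivWithinAt
    (sub_mem_posTangentConeAt_of_segment_subset ((convex_Icc 0 T).segment_subset ht₀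
      ⟨le_rfl, H.T_pos.le⟩))
  simp only [ContinuousLinearMap.toSpanSingleton_apply, smul_eq_mul, Pi.sub_apply, zero_sub, mul_one, id, neg_mul,
    neg_nonpos] at htime
  have htime' := nonneg_of_mul_nonneg_right htime ht0
  have hc := H.c_ub t₀ ht₀ x₀
  have hca := le_abs_self H.c₀
  have hMx := hM t₀ ht₀ x₀
  simp only [hY] at hp₀ hsp
  rw [neg_mul] at hsp hp₀
  rw [hlin] at hsp
  generalize exp (-(k * t₀)) = e at *
  generalize Aop q b c (v t₀) t₀ x₀ = av at *
  generalize Aop q b c (u t₀) t₀ x₀ = au at *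
  generalize Aop q b c φ t₀ x₀ = aφ at *
  have hφx := hφ0 x₀
  generalize φ x₀ = p at *
  have h1 : (c t₀ x₀ - k) * (e * (v t₀ x₀ - u t₀ x₀) - ε * (p + m)) < 0 :=
    mul_neg_of_neg_of_pos (by linarith) hp₀
  have h2 : ε * (aφ + c t₀ x₀ * m - k * (p + m)) < 0 := mul_neg_of_pos_of_neg hε (by
    have : c t₀ x₀ * m ≤ |H.c₀| * m := mul_le_mul_of_nonneg_right (by linarith) (by linarith)
    have := mul_nonneg (abs_nonneg H.c₀) hφx.le
    have := mul_pos hlam (by linarith : 0 < m)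
    rw [hk]; nlinarith)
  nlinarith

end

/-! ### The norms of `C^α_b` in coordinates -/

lemma le_of_supNormE {k : ℕ} {F : ℝ} (hF : 0 ≤ F)
    (h : supNormE k f ≤ ENNReal.ofReal F) (x : ES N) : ‖iteratedFDeriv ℝ k f x‖ ≤ F :=
  (ENNReal.ofReal_le_ofReal_iff hF).1 ((le_iSup (f := fun x : ES N =>
    ENNReal.ofReal ‖iteratedFDeriv ℝ k f x‖) x).trans h)

lemma le_of_holderSemiE {k : ℕ} {θ F : ℝ} (hF : 0 ≤ F)
    (h : holderSemiE k θ f ≤ ENNReal.ofReal F) (x y : ES N) :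
    ‖iteratedFDeriv ℝ k f x - iteratedFDeriv ℝ k f y‖ ≤ F * ‖x - y‖ ^ θ := by
  rcases eq_or_ne x y with rfl | hne
  · simpa using mul_nonneg hF (Real.zero_rpow_nonneg θ)
  · simp only [holderSemiE, iSup_le_iff] at h
    have := (ENNReal.ofReal_le_ofReal_iff hF).1 (h x y hne)
    rwa [div_le_iff₀ (Real.rpow_pos_of_pos (norm_pos_iff.2 (sub_ne_zero.2 hne)) θ)] at this

lemma supNormE_le {k : ℕ} {A : ℝ} (h : ∀ x, ‖iteratedFDeriv ℝ k f x‖ ≤ A) :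
    supNormE k f ≤ ENNReal.ofReal A := iSup_le fun x => ENNReal.ofReal_le_ofReal (h x)

lemma holderSemiE_le {k : ℕ} {θ A : ℝ}
    (h : ∀ x y, ‖iteratedFDeriv ℝ k f x - iteratedFDeriv ℝ k f y‖ ≤ A * ‖x - y‖ ^ θ) :
    holderSemiE k θ f ≤ ENNReal.ofReal A :=
  iSup_le fun x => iSup_le fun y => iSup_le fun hne => ENNReal.ofReal_le_ofReal <|
    (div_le_iff₀ (Real.rpow_pos_of_pos (norm_pos_iff.2 (sub_ne_zero.2 hne)) θ)).2 (h x y)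

lemma cbNorm_theta {θ : ℝ} (hθ : θ ∈ Ioo (0:ℝ) 1) (g : Fn N) :
    CbNorm θ g = supNormE 0 g + holderSemiE 0 θ g := by
  have e : ⌊θ⌋₊ = 0 := Nat.floor_eq_zero.2 hθ.2
  simp [CbNorm, e, hθ.1.ne]

lemma floor_two_add {θ : ℝ} (hθ : θ ∈ Ioo (0:ℝ) 1) : ⌊2 + θ⌋₊ = 2 := by
  rw [add_comm, Nat.floor_add_ofNat hθ.1.le, Nat.floor_eq_zero.2 hθ.2]

lemma cbNorm_two_add {θ : ℝ} (hθ : θ ∈ Ioo (0:ℝ) 1) (f : Fn N) :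
    CbNorm (2 + θ) f = supNormE 0 f + supNormE 1 f + supNormE 2 f + holderSemiE 2 θ f := by
  simp [CbNorm, floor_two_add hθ, hθ.1.ne', sum_range_succ]

lemma iteratedFDeriv_two_single (hf : ContDiff ℝ 2 f) (r : Fin 2 → Fin N)
    (x : ES N) : iteratedFDeriv ℝ 2 f x (fun k => EuclideanSpace.single (r k) 1)
    = pd1 (pd1 f (r 1)) (r 0) x := by
  have hd : DifferentiableAt ℝ (fderiv ℝ f) x :=
    (hf.fderiv_right (m := 1) (by norm_num)).differentiable one_ne_zero x
  rw [iteratedFDeriv_two_apply, pd1, show pd1 f (r 1) = fun y => fderiv ℝ f y _ from rfl,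
    fderiv_clm_apply hd (differentiableAt_const _)]
  simp

lemma abs_apply_single_le (L : ContinuousMultilinearMap ℝ (fun _ : Fin 2 => ES N) ℝ)
    (r : Fin 2 → Fin N) : |L fun k => EuclideanSpace.single (r k) 1| ≤ ‖L‖ := by
  simpa using L.le_opNorm fun k => EuclideanSpace.single (r k) (1 : ℝ)

lemma opNorm_le_of_single {L : ContinuousMultilinearMap ℝ (fun _ : Fin 2 => ES N) ℝ} {A : ℝ}
    (hA : 0 ≤ A) (h : ∀ r : Fin 2 → Fin N, |L fun k => EuclideanSpace.single (r k) 1| ≤ A) :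
    ‖L‖ ≤ N ^ 2 * A := by
  refine L.opNorm_le_bound (by positivity) fun m => ?_
  have e : L m = ∑ r : Fin 2 → Fin N, (∏ k, m k (r k)) *
      L fun k => EuclideanSpace.single (r k) 1 := by
    conv_lhs => rw [show m = fun k => ∑ j, m k j • EuclideanSpace.single j (1 : ℝ) from
      funext fun k => by simpa using (sum_single (m k)).symm]
    rw [L.map_sum]
    exact sum_congr rfl fun r _ => L.map_smul_univ _ _
  rw [e, norm_eq_abs]
  refine (abs_sum_le_sum_abs _ _).trans ((sum_le_sum fun r _ => ?_).trans
    (b := ∑ _r : Fin 2 → Fin N, A * ∏ k, ‖m k‖) (by simp [mul_assoc]))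
  rw [abs_mul, mul_comm A, Finset.abs_prod]
  exact mul_le_mul (Finset.prod_le_prod (fun _ _ => abs_nonneg _) fun k _ => abs_apply_le _ _)
    (h r) (abs_nonneg _) (by positivity)

lemma c2h_of_memCb {θ F : ℝ} (hθ : θ ∈ Ioo (0:ℝ) 1) (hF : 0 ≤ F)
    (hf : MemCb (2 + θ) f) (h : CbNorm (2 + θ) f ≤ ENNReal.ofReal F) : C2H θ F f := by
  have hs : ContDiff ℝ 2 f := by simpa [MemCb, floor_two_add hθ] using hf.1
  rw [cbNorm_two_add hθ] at h
  have h3 := le_of_holderSemiE hF (le_add_self.trans h)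
  have h012 := le_self_add.trans h
  have h2 := le_of_supNormE hF (le_add_self.trans h012)
  have h1 := le_of_supNormE hF (le_add_self.trans (le_self_add.trans h012))
  have h0 := le_of_supNormE hF (le_self_add.trans (le_self_add.trans h012))
  refine ⟨hs, fun x => by simpa [norm_iteratedFDeriv_zero] using h0 x, fun i x => ?_,
    fun i j => ⟨fun x => ?_, fun x y => ?_⟩⟩
  · have := h1 x
    rw [norm_iteratedFDeriv_one] at this
    exact ((fderiv ℝ f x).le_opNorm _).trans (by simpa using this)
  · exact iteratedFDeriv_two_single hs ![j, i] x ▸ (abs_apply_single_le _ _).trans (h2 x)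
  · exact iteratedFDeriv_two_single hs ![j, i] x ▸ iteratedFDeriv_two_single hs ![j, i] y ▸
      (abs_apply_single_le (iteratedFDeriv ℝ 2 f x - iteratedFDeriv ℝ 2 f y) _).trans (h3 x y)

lemma hb_of_cbNorm {θ F : ℝ} (hθ : θ ∈ Ioo (0:ℝ) 1) (hF : 0 ≤ F) {g : Fn N}
    (h : CbNorm θ g ≤ ENNReal.ofReal F) : HB θ F g := by
  rw [cbNorm_theta hθ] at h
  refine ⟨fun x => by simpa using le_of_supNormE hF (le_self_add.trans h) x, fun x y => ?_⟩
  have := le_of_holderSemiE hF (le_add_self.trans h) x y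
  simp only [iteratedFDeriv_zero_eq_comp, Function.comp, ← map_sub] at this
  rwa [LinearIsometryEquiv.norm_map] at this

lemma C2H.memCb {θ A : ℝ} (hθ : θ ∈ Ioo (0:ℝ) 1) (h : C2H θ A f) :
    MemCb (2 + θ) f ∧ CbNorm (2 + θ) f ≤ ENNReal.ofReal ((1 + N + 2 * N ^ 2) * A) := by
  have hA := h.nonneg
  have hle : CbNorm (2 + θ) f ≤ ENNReal.ofReal ((1 + N + 2 * N ^ 2) * A) := by
    rw [cbNorm_two_add hθ, show (1 + N + 2 * N ^ 2) * A
      = A + N * A + N ^ 2 * A + N ^ 2 * A by ring,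
      ENNReal.ofReal_add (by positivity) (by positivity),
      ENNReal.ofReal_add (by positivity) (by positivity),
      ENNReal.ofReal_add (by positivity) (by positivity)]
    refine add_le_add (add_le_add (add_le_add (supNormE_le fun x => ?_) (supNormE_le fun x => ?_))
      (supNormE_le fun x => ?_)) (holderSemiE_le fun x y => ?_)
    · simpa using h.b0 x
    · rw [norm_iteratedFDeriv_one]
      refine (norm_fderiv_le_sum f x).trans ?_
      exact (sum_le_sum fun i _ => h.b1 i x).trans (by simp)
    · refine opNorm_le_of_single hA fun r => ?_
      rw [iteratedFDeriv_two_single h.smooth]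
      exact (h.b2 _ _).bd x
    · rw [mul_assoc]
      refine opNorm_le_of_single (by positivity) fun r => ?_
      rw [sub_apply, iteratedFDeriv_two_single h.smooth,
        iteratedFDeriv_two_single h.smooth]
      exact (h.b2 _ _).hol x y
  exact ⟨⟨by simpa [floor_two_add hθ] using h.smooth, ne_top_of_le_ne_top ENNReal.ofReal_ne_top hle⟩,
    hle⟩

end Schauder

/-- Theorem `thm-schauder-cont-2` of the paper. Under Hypotheses (H) with
condition (i) replaced by the weaker `C^{0,δ}`-regularity of the coefficients and of their
spatial derivatives up to order 3 (no Hölder regularity in time), for `θ ∈ (0,1)`,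
`f ∈ C^{2+θ}_b(ℝ^N)` and `g ∈ C^{0,θ}([0,T] × ℝ^N)`, the Cauchy problem `D_t u = 𝒜 u + g`,
`u(0,·) = f` admits a unique bounded classical solution `u`; moreover `u(t,·) ∈ C^{2+θ}_b(ℝ^N)`
for every `t` and `sup_t ‖u(t,·)‖_{C^{2+θ}_b} ≤ C (‖f‖_{C^{2+θ}_b} + sup_t ‖g(t,·)‖_{C^θ_b})`
with `C > 0` independent of `f` and `g`. -/
theorem optimal_schauder_estimates_weak_time_regularity {N : ℕ} {T : ℝ}
    {q : ℝ → ES N → Fin N → Fin N → ℝ} {b : ℝ → ES N → Fin N → ℝ} {c : ℝ → ES N → ℝ}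
    (H : Hyp2 N T q b c) (θ : ℝ) (hθ : θ ∈ Ioo (0:ℝ) 1) :
    ∃ C > (0:ℝ), ∀ (f : ES N → ℝ) (g : ℝ → ES N → ℝ),
      MemCb (2 + θ) f →
      ContinuousOn (fun p : ℝ × ES N => g p.1 p.2) (Icc (0:ℝ) T ×ˢ univ) →
      (∀ t ∈ Icc (0:ℝ) T, MemCb θ (g t)) →
      (⨆ t ∈ Icc (0:ℝ) T, CbNorm θ (g t)) ≠ ⊤ →
      ∃ u : ℝ → ES N → ℝ, IsBCSolInhom q b c T f g u ∧
        (∀ v : ℝ → ES N → ℝ, IsBCSolInhom q b c T f g v →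
          ∀ t ∈ Icc (0:ℝ) T, ∀ x, v t x = u t x) ∧
        (∀ t ∈ Icc (0:ℝ) T, MemCb (2 + θ) (u t)) ∧
        (⨆ t ∈ Icc (0:ℝ) T, CbNorm (2 + θ) (u t)) ≤
          ENNReal.ofReal C * (CbNorm (2 + θ) f + ⨆ t ∈ Icc (0:ℝ) T, CbNorm θ (g t)) := by
  obtain ⟨C, hC, hsol⟩ := H.exists_sol hθ
  refine ⟨(1 + N + 2 * N ^ 2) * C + 1, by positivity, fun f g hf hgc _ hgT => ?_⟩
  have hS : CbNorm (2 + θ) f + ⨆ t ∈ Icc (0:ℝ) T, CbNorm θ (g t) ≠ ⊤ :=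
    ENNReal.add_ne_top.2 ⟨hf.2, hgT⟩
  set S := CbNorm (2 + θ) f + ⨆ t ∈ Icc (0:ℝ) T, CbNorm θ (g t)
  have hSF : ENNReal.ofReal S.toReal = S := ENNReal.ofReal_toReal hS
  have hfS : Schauder.C2H θ S.toReal f :=
    Schauder.c2h_of_memCb hθ ENNReal.toReal_nonneg hf (hSF.ge.trans' le_self_add)
  have hgS : ∀ t ∈ Icc (0:ℝ) T, Schauder.HB θ S.toReal (g t) := fun t ht =>
    Schauder.hb_of_cbNorm hθ ENNReal.toReal_nonneg
      (hSF.ge.trans' ((le_iSup₂ (f := fun t (_ : t ∈ Icc (0:ℝ) T) => CbNorm θ (g t)) t ht).trans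
        le_add_self))
  obtain ⟨u, hu, huS⟩ := hsol S.toReal f g hfS hgc hgS
  refine ⟨u, hu, fun v hv t ht x => le_antisymm (H.le_of_sol hu hv t ht x)
    (H.le_of_sol hv hu t ht x), fun t ht => ((huS t ht).memCb hθ).1, iSup₂_le fun t ht => ?_⟩
  refine ((huS t ht).memCb hθ).2.trans ?_
  rw [← hSF, ← ENNReal.ofReal_mul (by positivity), hSF, ← mul_assoc]
  exact ENNReal.ofReal_le_ofReal
    (mul_le_mul_of_nonneg_right (by linarith) ENNReal.toReal_nonneg)
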